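/- Let d be a squarefree integer with d ∉ {0,1} and let ε > 0. There exists C > 0, depending only on d and ε, such that for every number field M with [M:ℚ] = 4 containing an element c with c² = d, with L := ℚ(c) and K ⊆ M a subfield with [K:ℚ] = 2, K ≠ L, and K and L generating M, and for every real X ≥ 1: the number of nonzero ideals 𝔞 of O_M with Ideal.absNorm 𝔞 ≤ X is at most C·( X·κ_M + X^{1/2}·|Δ_K|^{1/3+ε} ), where Δ_K := NumberField.discr K. -/

import Mathlib

/-!
Statement 7: a uniform Landau-type upper bound for the ideal counting function of the
biquadratic field `M = K·ℚ(√d)` (Lemma `lem:landau`).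
-/

open NumberField

/-- The residue `κ_M = 2^{r_M}·(2π)^{s_M}·h_M·R_M/(w_M·√|Δ_M|)`. -/
noncomputable def kappa (M : Type*) [Field M] [NumberField M] : ℝ :=
  2 ^ (InfinitePlace.nrRealPlaces M) * (2 * Real.pi) ^ (InfinitePlace.nrComplexPlaces M) *
    (classNumber M) * Units.regulator M /
    ((Units.torsionOrder M : ℕ) * Real.sqrt |(discr M : ℝ)|)

section part_A1
open Finset Filter Topology

namespace BQ

/-- real character-like: completely multiplicative with values in `{0,1,-1}` -/
def RC (χ : ℕ →*₀ ℝ) : Prop := ∀ n, χ n = 0 ∨ χ n = 1 ∨ χ n = -1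

/-- partial sums bounded by `B` -/
def PS (χ : ℕ → ℝ) (B : ℝ) : Prop := ∀ N : ℕ, |∑ n ∈ Ioc 0 N, χ n| ≤ B

lemma RC.abs_le {χ : ℕ →*₀ ℝ} (h : RC χ) (n : ℕ) : |χ n| ≤ 1 := by
  rcases h n with h | h | h <;> rw [h] <;> norm_num

lemma RC.le_one {χ : ℕ →*₀ ℝ} (h : RC χ) (n : ℕ) : χ n ≤ 1 := by
  rcases h n with h | h | h <;> rw [h] <;> norm_num

lemma RC.neg_one_le {χ : ℕ →*₀ ℝ} (h : RC χ) (n : ℕ) : -1 ≤ χ n := by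
  rcases h n with h | h | h <;> rw [h] <;> norm_num

/-- associated arithmetic function -/
def af (f : ℕ →*₀ ℝ) : ArithmeticFunction ℝ := ⟨f, map_zero f⟩

@[simp] lemma af_apply (f : ℕ →*₀ ℝ) (n : ℕ) : af f n = f n := rfl

lemma af_mult (f : ℕ →*₀ ℝ) : (af f).IsMultiplicative := by
  refine ⟨by simp, fun {m n} _ => by simp⟩

/-- the constant function one -/
noncomputable def one1 : ℕ →*₀ ℝ where
  toFun n := if n = 0 then 0 else 1
  map_zero' := by simp
  map_one' := by simp
  map_mul' a b := by by_cases ha : a = 0 <;> by_cases hb : b = 0 <;> simp [ha, hb]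

lemma one1_apply {n : ℕ} (hn : n ≠ 0) : one1 n = 1 := by
  change (if n = 0 then (0:ℝ) else 1) = 1
  simp [hn]

lemma one1_RC : RC one1 := by
  intro n
  by_cases h : n = 0
  · left; simp [h]
  · right; left; exact one1_apply h

/-- Hyperbola split. -/
lemma hyperbola (f g : ArithmeticFunction ℝ) (N y : ℕ) :
    ∑ n ∈ Ioc 0 N, (f * g) n =
      ∑ b ∈ Ioc 0 y, g b * ∑ a ∈ Ioc 0 (N / b), f a +
      ∑ a ∈ Ioc 0 (N / (y + 1)), f a * ∑ b ∈ Ioc y (N / a), g b := by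
  have h0 : ∑ n ∈ Ioc 0 N, (f * g) n = ∑ b ∈ Ioc 0 N, g b * ∑ a ∈ Ioc 0 (N / b), f a := by
    rw [mul_comm f g, ArithmeticFunction.sum_Ioc_mul_eq_sum_sum]
  have h1 : ∑ b ∈ Ioc y N, g b * ∑ a ∈ Ioc 0 (N / b), f a =
      ∑ a ∈ Ioc 0 (N / (y + 1)), f a * ∑ b ∈ Ioc y (N / a), g b := by
    simp_rw [mul_sum]
    rw [Finset.sum_comm' (t' := Ioc 0 (N / (y + 1))) (s' := fun a => Ioc y (N / a))]
    · exact sum_congr rfl fun _ _ => sum_congr rfl fun _ _ => mul_comm _ _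
    · intro b a
      simp only [mem_Ioc]
      constructor
      · rintro ⟨⟨h1, h2⟩, h3, h4⟩
        have hb : 0 < b := by omega
        rw [Nat.le_div_iff_mul_le hb] at h4
        refine ⟨⟨h1, ?_⟩, h3, ?_⟩
        · rw [Nat.le_div_iff_mul_le h3]; linarith [mul_comm a b]
        · rw [Nat.le_div_iff_mul_le (by omega)]
          exact le_trans (Nat.mul_le_mul_left a h1) h4
      · rintro ⟨⟨h1, h2⟩, h3, h4⟩
        have hb : 0 < b := by omega
        rw [Nat.le_div_iff_mul_le h3] at h2
        refine ⟨⟨h1, ?_⟩, h3, ?_⟩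
        · exact le_trans (Nat.le_mul_of_pos_right b h3) h2
        · rw [Nat.le_div_iff_mul_le hb]; linarith [mul_comm a b]
  rw [h0, ← h1]
  rcases le_total y N with h | h
  · rw [← Finset.sum_Ioc_consecutive _ (Nat.zero_le y) h]
  · rw [Finset.Ioc_eq_empty_of_le h, sum_empty, add_zero]
    rw [← Finset.sum_Ioc_consecutive _ (Nat.zero_le N) h]
    rw [left_eq_add]
    apply sum_eq_zero
    intro b hb
    rw [mem_Ioc] at hb
    rw [Nat.div_eq_of_lt hb.1]; simp

lemma sum_Ioc_sub (f : ℕ → ℝ) {M N : ℕ} (h : M ≤ N) :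
    ∑ n ∈ Ioc M N, f n = ∑ n ∈ Ioc 0 N, f n - ∑ n ∈ Ioc 0 M, f n := by
  rw [← Finset.sum_Ioc_consecutive _ (Nat.zero_le M) h]; ring

lemma PS.nonneg {χ : ℕ → ℝ} {B : ℝ} (h : PS χ B) : 0 ≤ B := le_trans (abs_nonneg _) (h 0)

lemma PS.Ioc_le {χ : ℕ → ℝ} {B : ℝ} (h : PS χ B) (M N : ℕ) : |∑ n ∈ Ioc M N, χ n| ≤ 2 * B := by
  rcases le_total M N with h1 | h1
  · rw [sum_Ioc_sub _ h1]
    have := abs_sub (∑ n ∈ Ioc 0 N, χ n) (∑ n ∈ Ioc 0 M, χ n)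
    linarith [h N, h M]
  · rw [Finset.Ioc_eq_empty_of_le h1]; simpa using h.nonneg

/-- Abel summation bound -/
lemma abel_bound {χ : ℕ → ℝ} {B : ℝ} {a : ℕ → ℝ} (M N : ℕ) (h : ∀ k, |∑ n ∈ Ioc M k, χ n| ≤ B)
    (ha : ∀ n, M < n → a (n + 1) ≤ a n) (ha0 : ∀ n, M < n → 0 ≤ a n) :
    |∑ n ∈ Ioc M N, χ n * a n| ≤ B * a (M + 1) := by
  have hB : 0 ≤ B := le_trans (abs_nonneg _) (h 0)
  have key : ∀ k : ℕ, |∑ n ∈ Ioc M (M + 1 + k), χ n * a n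
      - (∑ n ∈ Ioc M (M + 1 + k), χ n) * a (M + 1 + k)| ≤ B * (a (M + 1) - a (M + 1 + k)) := by
    intro k
    induction k with
    | zero => simp
    | succ k ih =>
      rw [← add_assoc, Finset.sum_Ioc_succ_top (by omega), Finset.sum_Ioc_succ_top (by omega)]
      set T := ∑ n ∈ Ioc M (M + 1 + k), χ n * a n
      have hD := h (M + 1 + k)
      set D := ∑ n ∈ Ioc M (M + 1 + k), χ n
      have h1 := ha (M + 1 + k) (by omega)
      have e : T + χ (M + 1 + k + 1) * a (M + 1 + k + 1)
          - (D + χ (M + 1 + k + 1)) * a (M + 1 + k + 1)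
          = (T - D * a (M + 1 + k)) + D * (a (M + 1 + k) - a (M + 1 + k + 1)) := by ring
      rw [e]
      refine (abs_add_le _ _).trans ?_
      rw [abs_mul, abs_of_nonneg (sub_nonneg.2 h1)]
      have := mul_le_mul_of_nonneg_right hD (sub_nonneg.2 h1)
      linarith
  rcases Nat.lt_or_ge M N with h1 | h1
  · obtain ⟨k, rfl⟩ := Nat.exists_eq_add_of_le (show M + 1 ≤ N from h1)
    have h2 := key k
    have h3 := h (M + 1 + k)
    have h4 := ha0 (M + 1 + k) (by omega)
    set T := ∑ n ∈ Ioc M (M + 1 + k), χ n * a n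
    set D := ∑ n ∈ Ioc M (M + 1 + k), χ n
    have e : T = (T - D * a (M + 1 + k)) + D * a (M + 1 + k) := by ring
    rw [e]
    refine (abs_add_le _ _).trans ?_
    rw [abs_mul D, abs_of_nonneg h4]
    have := mul_le_mul_of_nonneg_right h3 h4
    linarith
  · rw [Finset.Ioc_eq_empty_of_le h1]; simp; exact mul_nonneg hB (ha0 _ (by omega))

/-- L-value by conditionally convergent series. -/
noncomputable def Lv (χ : ℕ → ℝ) (s : ℝ) : ℝ :=
  limUnder atTop (fun N : ℕ => ∑ n ∈ Ioc 0 N, χ n * (n : ℝ) ^ (-s))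

lemma rpow_anti {s : ℝ} (hs : 0 ≤ s) {n m : ℕ} (hn : 0 < n) (h : n ≤ m) :
    (m : ℝ) ^ (-s) ≤ (n : ℝ) ^ (-s) := by
  apply Real.rpow_le_rpow_of_nonpos (by exact_mod_cast hn) (by exact_mod_cast h) (by linarith)

lemma PS.tail {χ : ℕ → ℝ} {B s : ℝ} (h : PS χ B) (hs : 0 ≤ s) (M N : ℕ) :
    |∑ n ∈ Ioc M N, χ n * (n : ℝ) ^ (-s)| ≤ 2 * B * ((M + 1 : ℕ) : ℝ) ^ (-s) := by
  apply abel_bound (a := fun n : ℕ => (n : ℝ) ^ (-s)) M N (h.Ioc_le M)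
  · intro n hn; exact rpow_anti hs (by omega) (by omega)
  · intro n hn; positivity

lemma tendsto_nat_rpow_neg {s : ℝ} (hs : 0 < s) :
    Tendsto (fun M : ℕ => ((M + 1 : ℕ) : ℝ) ^ (-s)) atTop (𝓝 0) :=
  (tendsto_rpow_neg_atTop hs).comp
    ((tendsto_natCast_atTop_atTop (R := ℝ)).comp (tendsto_add_atTop_nat 1))

lemma PS.tendsto {χ : ℕ → ℝ} {B s : ℝ} (h : PS χ B) (hs : 0 < s) :
    Tendsto (fun N : ℕ => ∑ n ∈ Ioc 0 N, χ n * (n : ℝ) ^ (-s)) atTop (𝓝 (Lv χ s)) := by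
  apply CauchySeq.tendsto_limUnder
  have ht := (tendsto_nat_rpow_neg hs).const_mul (2 * B)
  rw [mul_zero] at ht
  apply cauchySeq_of_le_tendsto_0' _ _ ht
  intro n m hnm
  rw [dist_comm, Real.dist_eq, ← sum_Ioc_sub _ hnm]
  exact h.tail hs.le n m

lemma PS.Lv_sub {χ : ℕ → ℝ} {B s : ℝ} (h : PS χ B) (hs : 0 < s) (M : ℕ) :
    |Lv χ s - ∑ n ∈ Ioc 0 M, χ n * (n : ℝ) ^ (-s)| ≤ 2 * B * ((M + 1 : ℕ) : ℝ) ^ (-s) := by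
  have h1 := ((h.tendsto hs).sub_const (∑ n ∈ Ioc 0 M, χ n * (n : ℝ) ^ (-s))).abs
  apply le_of_tendsto h1
  filter_upwards [eventually_ge_atTop M] with N hN
  rw [← sum_Ioc_sub _ hN]
  exact h.tail hs.le M N

lemma PS.Lv_one_abs {χ : ℕ → ℝ} {B : ℝ} (h : PS χ B) : |Lv χ 1| ≤ 2 * B := by
  simpa using h.Lv_sub one_pos 0

lemma sum_one1 (N : ℕ) : ∑ a ∈ Ioc 0 N, af one1 a = N := by
  rw [sum_congr rfl (g := fun _ => (1:ℝ))]
  · simp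
  · intro a ha; rw [af_apply, one1_apply]; simp at ha; omega

/-- `g = 1 * χ` -/
noncomputable def gg (χ : ℕ →*₀ ℝ) : ArithmeticFunction ℝ := af one1 * af χ

/-- main estimate for the summatory function of `1 * χ` -/
lemma sum_gg {χ : ℕ →*₀ ℝ} {B : ℝ} (hc : RC χ) (h : PS χ B) (hB : 1 ≤ B) {t : ℝ} (ht : 0 ≤ t) :
    |∑ n ∈ Ioc 0 ⌊t⌋₊, gg χ n - t * Lv χ 1| ≤ 5 * Real.sqrt B * Real.sqrt t := by
  have hsq : Real.sqrt B * Real.sqrt t = Real.sqrt (t * B) := by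
    rw [← Real.sqrt_mul (by linarith), mul_comm]
  rcases lt_or_ge (t * B) 1 with h1 | h1
  · have ht1 : t < 1 := by nlinarith
    rw [Nat.floor_eq_zero.2 ht1]
    simp only [Ioc_self, sum_empty, zero_sub, abs_neg, abs_mul, abs_of_nonneg ht]
    have h2 := h.Lv_one_abs
    have h3 : t * B ≤ Real.sqrt (t * B) := by
      apply Real.le_sqrt_of_sq_le; nlinarith [mul_nonneg ht (by linarith : 0 ≤ B)]
    rw [mul_assoc, hsq]
    nlinarith [mul_le_mul_of_nonneg_left h2 ht, Real.sqrt_nonneg (t * B)]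
  · set q := Real.sqrt (t * B) with hq
    have hq1 : 1 ≤ q := by rw [hq]; exact Real.one_le_sqrt.2 h1
    have hqq : q * q = t * B := Real.mul_self_sqrt (by linarith)
    set y := ⌊q⌋₊
    have hy1 : (y : ℝ) ≤ q := Nat.floor_le (by linarith)
    have hy2 : q < (y : ℝ) + 1 := Nat.lt_floor_add_one q
    have hdiv : ∀ b : ℕ, ⌊t⌋₊ / b = ⌊t / b⌋₊ := fun b => (Nat.floor_div_natCast t b).symm
    have e : ∑ n ∈ Ioc 0 ⌊t⌋₊, gg χ n - t * Lv χ 1 =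
        ∑ b ∈ Ioc 0 y, χ b * ((⌊t / b⌋₊ : ℝ) - t / b)
        + t * (∑ b ∈ Ioc 0 y, χ b * (b : ℝ) ^ (-1 : ℝ) - Lv χ 1)
        + ∑ a ∈ Ioc 0 (⌊t⌋₊ / (y + 1)), af one1 a * ∑ b ∈ Ioc y (⌊t⌋₊ / a), χ b := by
      rw [gg, hyperbola _ _ _ y]
      simp_rw [sum_one1, hdiv, mul_sub, sum_sub_distrib, af_apply]
      have : ∑ b ∈ Ioc 0 y, χ b * (t / b) = t * ∑ b ∈ Ioc 0 y, χ b * (b : ℝ) ^ (-1 : ℝ) := by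
        rw [mul_sum]; apply sum_congr rfl; intro b _; rw [Real.rpow_neg_one]; ring
      rw [this]; ring
    have b1 : |∑ b ∈ Ioc 0 y, χ b * ((⌊t / b⌋₊ : ℝ) - t / b)| ≤ q := by
      refine (abs_sum_le_sum_abs _ _).trans ?_
      refine (sum_le_card_nsmul _ _ 1 ?_).trans ?_
      · intro b _
        rw [abs_mul]
        have h2 : 0 ≤ t / (b : ℝ) := by positivity
        have h3 : |(⌊t / b⌋₊ : ℝ) - t / b| ≤ 1 := by
          rw [abs_le]; constructor <;> linarith [Nat.floor_le h2, Nat.lt_floor_add_one (t / (b:ℝ))]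
        calc _ ≤ (1:ℝ) * 1 := mul_le_mul (hc.abs_le b) h3 (abs_nonneg _) (by norm_num)
          _ = 1 := by norm_num
      · simpa using hy1
    have b2 : |t * (∑ b ∈ Ioc 0 y, χ b * (b : ℝ) ^ (-1 : ℝ) - Lv χ 1)| ≤ 2 * q := by
      rw [abs_mul, abs_of_nonneg ht, abs_sub_comm]
      have h2 := h.Lv_sub one_pos y
      rw [Real.rpow_neg_one] at h2
      have h4 : 2 * B * ((y + 1 : ℕ) : ℝ)⁻¹ * t ≤ 2 * q := by
        rw [← div_eq_mul_inv, div_mul_eq_mul_div, div_le_iff₀ (by positivity)]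
        push_cast
        nlinarith
      calc _ ≤ t * (2 * B * ((y + 1 : ℕ) : ℝ)⁻¹) := mul_le_mul_of_nonneg_left h2 ht
        _ ≤ _ := by linarith
    have b3 : |∑ a ∈ Ioc 0 (⌊t⌋₊ / (y + 1)), af one1 a * ∑ b ∈ Ioc y (⌊t⌋₊ / a), χ b| ≤ 2 * q := by
      refine (abs_sum_le_sum_abs _ _).trans ?_
      refine (sum_le_card_nsmul _ _ (2 * B) ?_).trans ?_
      · intro a _
        rw [abs_mul]
        calc _ ≤ 1 * (2 * B) := mul_le_mul (one1_RC.abs_le a) (h.Ioc_le _ _) (abs_nonneg _) (by norm_num)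
          _ = _ := one_mul _
      · rw [Nat.card_Ioc, nsmul_eq_mul, Nat.sub_zero]
        have h2 : ((⌊t⌋₊ / (y + 1) : ℕ) : ℝ) ≤ t / (y + 1) := by
          refine Nat.cast_div_le.trans ?_
          push_cast
          gcongr
          exact Nat.floor_le ht
        have h3 : t / (y + 1) * (2 * B) ≤ 2 * q := by
          rw [div_mul_eq_mul_div, div_le_iff₀ (by positivity)]
          nlinarith
        exact (mul_le_mul_of_nonneg_right h2 (by linarith)).trans h3
    rw [e, mul_assoc, hsq]
    refine (abs_add_le _ _).trans ?_
    have := abs_add_le (∑ b ∈ Ioc 0 y, χ b * ((⌊t / b⌋₊ : ℝ) - t / b))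
      (t * (∑ b ∈ Ioc 0 y, χ b * (b : ℝ) ^ (-1 : ℝ) - Lv χ 1))
    linarith

end BQ
end part_A1

section part_A2
open Finset Filter Topology

namespace BQ
open BoundingSieve ArithmeticFunction

lemma sum_moebius_between {P l m : ℕ} (hP : P ≠ 0) (hm : m ∣ P) :
    ∑ d ∈ P.divisors, (if l ∣ d ∧ d ∣ m then (ArithmeticFunction.moebius (m / d) : ℝ) else 0)
      = if l = m then 1 else 0 := by
  have hm0 : m ≠ 0 := fun h => hP (by rw [h] at hm; exact zero_dvd_iff.1 hm)
  by_cases hl : l ∣ m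
  · have hl0 : l ≠ 0 := fun h => hm0 (by rw [h] at hl; exact zero_dvd_iff.1 hl)
    rw [← sum_filter]
    have : ∑ d ∈ P.divisors with l ∣ d ∧ d ∣ m, (ArithmeticFunction.moebius (m / d) : ℝ)
        = ∑ k ∈ (m / l).divisors, (ArithmeticFunction.moebius k : ℝ) := by
      apply sum_nbij' (fun d => m / d) (fun k => m / k)
      · intro d hd
        simp only [mem_filter, Nat.mem_divisors] at hd ⊢
        obtain ⟨⟨_, _⟩, h1, h2⟩ := hd
        refine ⟨Nat.div_dvd_div_left h2 h1, ?_⟩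
        exact (Nat.div_pos (Nat.le_of_dvd (by omega) hl) (by omega)).ne'
      · intro k hk
        simp only [mem_filter, Nat.mem_divisors] at hk ⊢
        have hkm : k ∣ m := hk.1.trans (Nat.div_dvd_of_dvd hl)
        refine ⟨⟨(Nat.div_dvd_of_dvd hkm).trans hm, hP⟩, ?_, Nat.div_dvd_of_dvd hkm⟩
        have := Nat.div_dvd_div_left (Nat.div_dvd_of_dvd hl) hk.1
        rwa [Nat.div_div_self hl hm0] at this
      · intro d hd
        simp only [mem_filter] at hd
        exact Nat.div_div_self hd.2.2 hm0
      · intro k hk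
        simp only [Nat.mem_divisors] at hk
        exact Nat.div_div_self (hk.1.trans (Nat.div_dvd_of_dvd hl)) hm0
      · intro d hd; rfl
    rw [this]
    have h2 := congrArg (fun f => f (m / l)) ArithmeticFunction.coe_zeta_mul_moebius
    simp only [ArithmeticFunction.coe_zeta_mul_apply, ArithmeticFunction.one_apply] at h2
    have h3 : (∑ k ∈ (m / l).divisors, (ArithmeticFunction.moebius k : ℝ)) = ((∑ k ∈ (m / l).divisors, ArithmeticFunction.moebius k : ℤ) : ℝ) := by
      push_cast; rfl
    rw [h3, h2]
    by_cases h4 : l = m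
    · subst h4; simp [Nat.div_self (Nat.pos_of_ne_zero hl0)]
    · have : m / l ≠ 1 := by
        intro h5
        apply h4
        have := Nat.div_mul_cancel hl
        rw [h5] at this; omega
      simp [this, h4]
  · rw [if_neg (fun h : l = m => hl (by rw [h]))]
    apply sum_eq_zero
    intro d _
    rw [if_neg]
    rintro ⟨h1, h2⟩
    exact hl (h1.trans h2)

/-- Selberg upper bound sieve. -/
theorem selberg (s : BoundingSieve) (R : ℕ) (hR : 1 ≤ R) (W T : ℝ) (hW : 0 ≤ W) (hT : 0 ≤ T)
    (hν : ∀ d, d ∣ s.prodPrimes → d ≤ R → (s.nu d)⁻¹ ≤ W)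
    (hrem : ∀ e, e ∣ s.prodPrimes → e ≤ R ^ 2 → |s.rem e| ≤ T) :
    s.siftedSum ≤ s.totalMass *
      (∑ l ∈ s.prodPrimes.divisors with l ≤ R, s.selbergTerms l)⁻¹ + (R : ℝ) ^ 2 * W ^ 2 * T := by
  classical
  set P := s.prodPrimes with hPdef
  have hP0 : P ≠ 0 := s.prodPrimes_squarefree.ne_zero
  set h := s.selbergTerms with hh
  set H := ∑ l ∈ P.divisors with l ≤ R, h l with hH
  have hpos : ∀ l ∈ P.divisors, 0 < h l := fun l hl => selbergTerms_pos (Nat.dvd_of_mem_divisors hl)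
  have hHpos : 0 < H := by
    apply sum_pos
    · intro l hl; exact hpos l (mem_filter.1 hl).1
    · exact ⟨1, by simp [hP0, hR]⟩
  set y : ℕ → ℝ := fun l => if l ≤ R then (moebius l : ℝ) * h l / H else 0 with hy
  set w : ℕ → ℝ := fun d => if d ∣ P then
    (s.nu d)⁻¹ * ∑ l ∈ P.divisors, (if d ∣ l then (moebius (l / d) : ℝ) * y l else 0) else 0 with hw
  have hsqP : ∀ l ∈ P.divisors, (moebius l : ℝ) * moebius l = 1 := by
    intro l hl
    have h1 : Squarefree l := s.prodPrimes_squarefree.squarefree_of_dvd (Nat.dvd_of_mem_divisors hl)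
    rw [← sq]
    exact_mod_cast ArithmeticFunction.moebius_sq_eq_one_of_squarefree h1
  have habsmu : ∀ k : ℕ, |(moebius k : ℝ)| ≤ 1 := by
    intro k
    exact_mod_cast ArithmeticFunction.abs_moebius_le_one (n := k)
  have hysum : ∑ l ∈ P.divisors, |y l| ≤ 1 := by
    have : ∑ l ∈ P.divisors, |y l| ≤ ∑ l ∈ P.divisors, if l ≤ R then h l / H else 0 := by
      apply sum_le_sum
      intro l hl
      simp only [hy]
      split_ifs
      · rw [abs_div, abs_mul, abs_of_pos hHpos, abs_of_pos (hpos l hl)]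
        gcongr
        have := mul_le_mul_of_nonneg_right (habsmu l) (hpos l hl).le
        linarith
      · simp
    refine this.trans ?_
    rw [← sum_filter, ← sum_div, div_self hHpos.ne']
  have hw1 : w 1 = 1 := by
    simp only [hw, one_dvd, if_true, Nat.div_one, s.nu_mult.map_one, inv_one, one_mul]
    have : ∑ l ∈ P.divisors, (moebius l : ℝ) * y l = ∑ l ∈ P.divisors, if l ≤ R then h l / H else 0 := by
      apply sum_congr rfl
      intro l hl
      simp only [hy]
      split_ifs
      · rw [← mul_div_assoc, ← mul_assoc, hsqP l hl, one_mul]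
      · simp
    rw [this, ← sum_filter, ← sum_div, div_self hHpos.ne']
  have hwR : ∀ d, R < d → w d = 0 := by
    intro d hd
    simp only [hw]
    split_ifs with hdP
    · rw [sum_eq_zero, mul_zero]
      intro l hl
      split_ifs with hdl
      · have : d ≤ l := Nat.le_of_dvd (Nat.pos_of_mem_divisors hl) hdl
        simp only [hy]
        rw [if_neg (by omega), mul_zero]
      · rfl
    · rfl
  have hwW : ∀ d, |w d| ≤ W := by
    intro d
    rcases Nat.lt_or_ge R d with hd | hd
    · rw [hwR d hd]; simpa using hW
    simp only [hw]
    split_ifs with hdP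
    · have hn : 0 < s.nu d := nu_pos_of_dvd_prodPrimes hdP
      rw [abs_mul, abs_of_pos (inv_pos.2 hn)]
      have h1 : |∑ l ∈ P.divisors, (if d ∣ l then (moebius (l / d) : ℝ) * y l else 0)| ≤ 1 := by
        refine (abs_sum_le_sum_abs _ _).trans (le_trans (sum_le_sum ?_) hysum)
        intro l hl
        split_ifs
        · rw [abs_mul]
          have := mul_le_mul_of_nonneg_right (habsmu (l/d)) (abs_nonneg (y l))
          linarith
        · simp
      calc _ ≤ W * 1 := mul_le_mul (hν d hdP hd) h1 (abs_nonneg _) hW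
        _ = W := mul_one W
    · simpa using hW
  have hdual : ∀ l ∈ P.divisors, ∑ d ∈ P.divisors, (if l ∣ d then s.nu d * w d else 0) = y l := by
    intro l hl
    have h1 : ∀ d ∈ P.divisors, (if l ∣ d then s.nu d * w d else 0) =
        ∑ m ∈ P.divisors, y m * (if l ∣ d ∧ d ∣ m then (moebius (m / d) : ℝ) else 0) := by
      intro d hd
      have hdP := Nat.dvd_of_mem_divisors hd
      have hn : s.nu d ≠ 0 := (nu_pos_of_dvd_prodPrimes hdP).ne'
      by_cases hld : l ∣ d
      · simp only [hw, if_pos hdP, hld, true_and, if_true]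
        rw [← mul_assoc, mul_inv_cancel₀ hn, one_mul]
        apply sum_congr rfl
        intro m _
        split_ifs <;> ring
      · simp [hld]
    rw [sum_congr rfl h1, sum_comm]
    simp_rw [← mul_sum]
    rw [sum_congr rfl (fun m hm => by rw [sum_moebius_between hP0 (Nat.dvd_of_mem_divisors hm)])]
    simp only [mul_ite, mul_one, mul_zero]
    rw [sum_ite_eq, if_pos hl]
  have hmain : s.mainSum (lambdaSquared w) = H⁻¹ := by
    rw [mainSum_lambdaSquared_eq_sum_mul_sum_sq]
    have : ∀ l ∈ P.divisors, (s.selbergTerms l)⁻¹ *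
        (∑ d ∈ P.divisors, if l ∣ d then s.nu d * w d else 0) ^ 2 =
        if l ≤ R then h l / H ^ 2 else 0 := by
      intro l hl
      rw [hdual l hl, ← hh]
      simp only [hy]
      have := (hpos l hl).ne'
      split_ifs
      · rw [div_pow, mul_pow, sq (moebius l : ℝ), hsqP l hl]
        field_simp
      · simp
    rw [sum_congr rfl this, ← sum_filter, ← sum_div, ← hH]
    field_simp
  have herr : s.errSum (lambdaSquared w) ≤ (R : ℝ) ^ 2 * W ^ 2 * T := by
    rw [errSum]
    have h1 : ∀ d ∈ P.divisors, |lambdaSquared w d| * |s.rem d| ≤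
        ∑ d1 ∈ Ioc 0 R, ∑ d2 ∈ Ioc 0 R, if d = Nat.lcm d1 d2 then W ^ 2 * T else 0 := by
      intro d hd
      have hdP := Nat.dvd_of_mem_divisors hd
      have hd0 : d ≠ 0 := (Nat.pos_of_mem_divisors hd).ne'
      have h2 : ∀ d1 ∈ d.divisors, ∀ d2 ∈ d.divisors,
          |if d = Nat.lcm d1 d2 then w d1 * w d2 else 0| * |s.rem d| ≤
          if d1 ≤ R ∧ d2 ≤ R ∧ d = Nat.lcm d1 d2 then W ^ 2 * T else 0 := by
        intro d1 hd1 d2 hd2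
        by_cases hl : d = Nat.lcm d1 d2
        · by_cases h3 : d1 ≤ R
          · by_cases h4 : d2 ≤ R
            · rw [if_pos hl, if_pos ⟨h3, h4, hl⟩, abs_mul, sq]
              have h5 : d ≤ R ^ 2 := by
                rw [hl, sq]
                exact (Nat.le_of_dvd (Nat.mul_pos (Nat.pos_of_mem_divisors hd1) (Nat.pos_of_mem_divisors hd2)) (Nat.lcm_dvd_mul d1 d2)).trans
                  (Nat.mul_le_mul h3 h4)
              exact mul_le_mul (mul_le_mul (hwW _) (hwW _) (abs_nonneg _) hW) (hrem d hdP h5)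
                (abs_nonneg _) (by positivity)
            · rw [hwR d2 (by omega)]; simp [h4]
          · rw [hwR d1 (by omega)]; simp [h3]
        · simp [hl]
      calc |lambdaSquared w d| * |s.rem d|
          ≤ (∑ d1 ∈ d.divisors, ∑ d2 ∈ d.divisors,
              |if d = Nat.lcm d1 d2 then w d1 * w d2 else 0|) * |s.rem d| := by
            gcongr
            refine (abs_sum_le_sum_abs _ _).trans (sum_le_sum fun d1 _ => abs_sum_le_sum_abs _ _)
        _ ≤ ∑ d1 ∈ d.divisors, ∑ d2 ∈ d.divisors,
            if d1 ≤ R ∧ d2 ≤ R ∧ d = Nat.lcm d1 d2 then W ^ 2 * T else 0 := by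
            simp_rw [sum_mul]
            exact sum_le_sum fun d1 hd1 => sum_le_sum fun d2 hd2 => h2 d1 hd1 d2 hd2
        _ = ∑ x ∈ (d.divisors ×ˢ d.divisors) with (x.1 ≤ R ∧ x.2 ≤ R ∧ d = Nat.lcm x.1 x.2), W ^ 2 * T := by
            rw [sum_filter, sum_product]
        _ ≤ ∑ x ∈ (Ioc 0 R ×ˢ Ioc 0 R) with (d = Nat.lcm x.1 x.2), W ^ 2 * T := by
            apply sum_le_sum_of_subset_of_nonneg
            · intro x hx
              simp only [mem_filter, mem_product, mem_Ioc, Nat.mem_divisors] at hx ⊢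
              refine ⟨⟨⟨Nat.pos_of_dvd_of_pos hx.1.1.1 (by omega), hx.2.1⟩, Nat.pos_of_dvd_of_pos hx.1.2.1 (by omega), hx.2.2.1⟩, hx.2.2.2⟩
            · intros; positivity
        _ = _ := by rw [sum_filter, sum_product]
    refine (sum_le_sum h1).trans ?_
    rw [sum_comm]
    have h3 : ∀ d1 ∈ Ioc 0 R, ∑ d ∈ P.divisors, ∑ d2 ∈ Ioc 0 R,
        (if d = Nat.lcm d1 d2 then W ^ 2 * T else 0) ≤ R * (W ^ 2 * T) := by
      intro d1 _
      rw [sum_comm]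
      refine (sum_le_card_nsmul _ _ (W ^ 2 * T) ?_).trans (by simp)
      intro d2 _
      rw [sum_ite_eq']
      split_ifs
      · rfl
      · positivity
    refine (sum_le_card_nsmul _ _ _ h3).trans (le_of_eq ?_)
    simp; ring
  have := siftedSum_le_mainSum_errSum_of_upperMoebius (s := s) _ (upperMoebius_lambdaSquared w hw1)
  rw [hmain] at this
  linarith

end BQ
end part_A2

section part_A3
open Finset Filter Topology

namespace BQ
open ArithmeticFunction
open scoped ArithmeticFunction.zeta

lemma sum_log_eq (N : ℕ) : ∑ n ∈ Ioc 0 N, Real.log n = ∑ b ∈ Ioc 0 N, Λ b * (N / b : ℕ) := by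
  have h := ArithmeticFunction.sum_Ioc_mul_eq_sum_sum Λ (ζ : ArithmeticFunction ℝ) N
  rw [vonMangoldt_mul_zeta] at h
  simp only [log_apply] at h
  rw [h]
  apply sum_congr rfl
  intro b _
  congr 1
  rw [sum_congr rfl (g := fun _ => (1:ℝ))]
  · simp
  · intro a ha; simp only [mem_Ioc] at ha; rw [natCoe_apply, zeta_apply_ne (by omega)]; simp

lemma sum_log_le (N : ℕ) : ∑ n ∈ Ioc 0 N, Real.log n ≤ N * Real.log N := by
  refine (sum_le_card_nsmul _ _ (Real.log N) ?_).trans (by simp)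
  intro n hn
  simp only [mem_Ioc] at hn
  exact Real.log_le_log (by exact_mod_cast hn.1) (by exact_mod_cast hn.2)

lemma le_sum_log (N : ℕ) : N * Real.log N - N ≤ ∑ n ∈ Ioc 0 N, Real.log n := by
  induction N with
  | zero => simp
  | succ N ih =>
    rw [Finset.sum_Ioc_succ_top (by omega)]
    rcases Nat.eq_zero_or_pos N with h | h
    · subst h; simp
    have hN : (0:ℝ) < N := by exact_mod_cast h
    have h1 : Real.log ((N + 1 : ℕ) : ℝ) - Real.log N ≤ 1 / N := by
      rw [← Real.log_div (by positivity) hN.ne']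
      refine (Real.log_le_sub_one_of_pos (by positivity)).trans (le_of_eq ?_)
      push_cast; field_simp; ring
    have h2 : N * (Real.log ((N + 1 : ℕ) : ℝ) - Real.log N) ≤ 1 := by
      calc _ ≤ (N:ℝ) * (1 / N) := by gcongr
        _ = 1 := by field_simp
    push_cast at *
    linarith

/-- Chebyshev constant -/
lemma cheb : ∃ c : ℝ, 0 < c ∧ ∀ N : ℕ, ∑ n ∈ Ioc 0 N, Λ n ≤ c * N := by
  refine ⟨Real.log 4 + 4, by positivity, fun N => ?_⟩
  have := Chebyshev.psi_le_const_mul_self (x := (N : ℝ)) (by positivity)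
  rwa [Chebyshev.psi, Nat.floor_natCast] at this

lemma mertens_upper : ∃ C : ℝ, 0 < C ∧ ∀ N : ℕ, 1 ≤ N →
    ∑ n ∈ Ioc 0 N, Λ n / n ≤ Real.log N + C := by
  obtain ⟨c, hc, h⟩ := cheb
  refine ⟨c, hc, fun N hN => ?_⟩
  have hN0 : (0:ℝ) < N := by exact_mod_cast hN
  have h1 := sum_log_eq N
  have h2 := sum_log_le N
  have h3 : ∑ b ∈ Ioc 0 N, Λ b * ((N:ℝ) / b - 1) ≤ ∑ b ∈ Ioc 0 N, Λ b * (N / b : ℕ) := by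
    apply sum_le_sum
    intro b hb
    apply mul_le_mul_of_nonneg_left _ vonMangoldt_nonneg
    have := Nat.lt_floor_add_one ((N:ℝ) / b)
    rw [Nat.floor_div_natCast, Nat.floor_natCast] at this
    linarith
  have h4 : ∑ b ∈ Ioc 0 N, Λ b * ((N:ℝ) / b - 1) = N * ∑ n ∈ Ioc 0 N, Λ n / n - ∑ n ∈ Ioc 0 N, Λ n := by
    rw [mul_sum, ← sum_sub_distrib]
    apply sum_congr rfl; intro b _; ring
  have h5 := h N
  have : N * ∑ n ∈ Ioc 0 N, Λ n / n ≤ N * (Real.log N + c) := by linarith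
  exact le_of_mul_le_mul_left this hN0

lemma mertens_lower (N : ℕ) (hN : 1 ≤ N) : Real.log N - 1 ≤ ∑ n ∈ Ioc 0 N, Λ n / n := by
  have hN0 : (0:ℝ) < N := by exact_mod_cast hN
  have h1 := sum_log_eq N
  have h2 := le_sum_log N
  have h3 : ∑ b ∈ Ioc 0 N, Λ b * (N / b : ℕ) ≤ N * ∑ n ∈ Ioc 0 N, Λ n / n := by
    rw [mul_sum]
    apply sum_le_sum
    intro b hb
    have := mul_le_mul_of_nonneg_left (Nat.cast_div_le (α := ℝ) (m := N) (n := b)) (vonMangoldt_nonneg (n := b))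
    refine this.trans (le_of_eq (by ring))
  have : N * (Real.log N - 1) ≤ N * ∑ n ∈ Ioc 0 N, Λ n / n := by linarith
  exact le_of_mul_le_mul_left this hN0

lemma mertens_primes : ∃ C : ℝ, 0 < C ∧ ∀ z : ℕ, 2 ≤ z →
    ∑ p ∈ z.primesBelow, Real.log p / p ≤ Real.log z + C := by
  obtain ⟨C, hC, h⟩ := mertens_upper
  refine ⟨C, hC, fun z hz => (le_trans ?_ (h z (by omega)))⟩
  have : ∑ p ∈ z.primesBelow, Real.log p / p = ∑ p ∈ z.primesBelow, Λ p / p := by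
    apply sum_congr rfl
    intro p hp
    rw [vonMangoldt_apply_prime (Nat.prime_of_mem_primesBelow hp)]
  rw [this]
  apply sum_le_sum_of_subset_of_nonneg
  · intro p hp
    have h1 := Nat.prime_of_mem_primesBelow hp
    have h2 := Nat.lt_of_mem_primesBelow hp
    simp [h1.pos, h2.le]
  · intro n _ _; exact div_nonneg vonMangoldt_nonneg (by positivity)

/-- twist by `n^{-s}` -/
noncomputable def tw (χ : ℕ →*₀ ℝ) (s : ℝ) : ℕ →*₀ ℝ where
  toFun n := χ n * (n : ℝ) ^ (-s)
  map_zero' := by simp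
  map_one' := by simp
  map_mul' a b := by
    rw [map_mul, Nat.cast_mul, Real.mul_rpow (by positivity) (by positivity)]; ring

lemma tw_apply (χ : ℕ →*₀ ℝ) (s : ℝ) (n : ℕ) : tw χ s n = χ n * (n : ℝ) ^ (-s) := rfl

lemma tw_one_apply (χ : ℕ →*₀ ℝ) (n : ℕ) : tw χ 1 n = χ n / n := by
  rw [tw_apply, Real.rpow_neg_one, div_eq_mul_inv]

lemma pmul_cm (f : ℕ →*₀ ℝ) (a b : ArithmeticFunction ℝ) :
    (af f).pmul (a * b) = (af f).pmul a * (af f).pmul b := by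
  ext n
  simp only [pmul_apply, mul_apply, af_apply, mul_sum]
  apply sum_congr rfl
  rintro ⟨x, y⟩ h
  rw [Nat.mem_divisorsAntidiagonal] at h
  simp only
  rw [← h.1, map_mul]; ring

lemma pmul_af (f g : ℕ →*₀ ℝ) : (af f).pmul (af g) = af (f * g) := by
  ext n; simp; rfl

/-- twisted Mertens -/
lemma mertens_twist {ψ : ℕ →*₀ ℝ} {B : ℝ} (hc : RC ψ) (h : PS ψ B) (hL : Lv ψ 1 ≠ 0) :
    ∃ C : ℝ, 0 < C ∧ ∀ N : ℕ, 1 ≤ N → |∑ n ∈ Ioc 0 N, ψ n * (Λ n / n)| ≤ C := by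
  obtain ⟨c, hcp, hch⟩ := cheb
  have hB := h.nonneg
  set L := Lv ψ 1
  refine ⟨(|∑ n ∈ Ioc 0 2, ψ n * (Real.log n / n)| + 2 * B * (Real.log 3 / 3) + 2 * B * c + 1) / |L|, by positivity, fun N hN => ?_⟩
  have hN0 : (0:ℝ) < N := by exact_mod_cast hN
  rw [le_div_iff₀ (abs_pos.2 hL)]
  have e1 : ∑ n ∈ Ioc 0 N, ψ n * (Real.log n / n) =
      ∑ d ∈ Ioc 0 N, ψ d * (Λ d / d) * ∑ k ∈ Ioc 0 (N / d), ψ k * (k:ℝ) ^ (-1 : ℝ) := by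
    have h1 := ArithmeticFunction.sum_Ioc_mul_eq_sum_sum ((af (tw ψ 1)).pmul Λ) ((af (tw ψ 1)).pmul (ζ : ArithmeticFunction ℝ)) N
    rw [← pmul_cm, vonMangoldt_mul_zeta] at h1
    simp only [pmul_apply, af_apply, tw_one_apply, log_apply] at h1
    rw [sum_congr rfl (g := fun n => ψ n / n * Real.log n) (fun n _ => by ring), h1]
    apply sum_congr rfl
    intro d _
    congr 1
    · ring
    · apply sum_congr rfl
      intro k hk
      simp only [mem_Ioc] at hk
      rw [natCoe_apply, zeta_apply_ne (by omega), Real.rpow_neg_one]; simp [div_eq_mul_inv]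
  have b1 : |∑ n ∈ Ioc 0 N, ψ n * (Real.log n / n)| ≤ |∑ n ∈ Ioc 0 2, ψ n * (Real.log n / n)| + 2 * B * (Real.log 3 / 3) + 1 := by
    rcases Nat.lt_or_ge N 2 with h2 | h2
    · have : N = 1 := by omega
      subst this
      simp; positivity
    · rw [← Finset.sum_Ioc_consecutive _ (Nat.zero_le 2) h2]
      refine (abs_add_le _ _).trans ?_
      have := abel_bound (a := fun n : ℕ => Real.log n / n) 2 N (h.Ioc_le 2) ?_ ?_
      · push_cast at this; norm_num at this ⊢; linarith
      · intro n hn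
        have he := Real.exp_one_lt_d9
        have hn3 : (3:ℝ) ≤ n := by exact_mod_cast hn
        apply Real.log_div_self_antitoneOn
        · simp; linarith
        · simp; linarith
        · push_cast; linarith
      · intro n hn; exact div_nonneg (Real.log_natCast_nonneg n) (by positivity)
  have b2 : |∑ n ∈ Ioc 0 N, ψ n * (Real.log n / n) - L * ∑ n ∈ Ioc 0 N, ψ n * (Λ n / n)| ≤ 2 * B * c := by
    rw [e1, mul_sum, ← sum_sub_distrib]
    refine (abs_sum_le_sum_abs _ _).trans ?_
    have : ∀ d ∈ Ioc 0 N, |ψ d * (Λ d / d) * ∑ k ∈ Ioc 0 (N / d), ψ k * (k:ℝ) ^ (-1 : ℝ) - L * (ψ d * (Λ d / d))| ≤ 2 * B / N * Λ d := by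
      intro d hd
      simp only [mem_Ioc] at hd
      have hd0 : (0:ℝ) < d := by exact_mod_cast hd.1
      have h2 := h.Lv_sub one_pos (N / d)
      rw [Real.rpow_neg_one] at h2
      have e : ψ d * (Λ d / d) * ∑ k ∈ Ioc 0 (N / d), ψ k * (k:ℝ) ^ (-1 : ℝ) - L * (ψ d * (Λ d / d))
         = - (ψ d * (Λ d / d) * (L - ∑ k ∈ Ioc 0 (N / d), ψ k * (k:ℝ) ^ (-1 : ℝ))) := by ring
      rw [e, abs_neg, abs_mul, abs_mul, abs_of_nonneg (div_nonneg (vonMangoldt_nonneg (n := d)) hd0.le)]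
      have h3 : ((N / d + 1 : ℕ) : ℝ)⁻¹ ≤ d / N := by
        rw [inv_le_comm₀ (by positivity) (by positivity), inv_div]
        have := Nat.lt_floor_add_one ((N:ℝ) / d)
        rw [Nat.floor_div_natCast, Nat.floor_natCast] at this
        push_cast; linarith
      have h0 : 0 ≤ Λ d / d := div_nonneg (vonMangoldt_nonneg (n := d)) hd0.le
      calc |ψ d| * (Λ d / d) * |L - ∑ k ∈ Ioc 0 (N / d), ψ k * (k:ℝ) ^ (-1 : ℝ)|
          ≤ 1 * (Λ d / d) * (2 * B * (d / N)) := by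
            apply mul_le_mul (mul_le_mul_of_nonneg_right (hc.abs_le d) h0) _ (abs_nonneg _) (by linarith)
            exact h2.trans (by gcongr)
        _ = _ := by field_simp
    refine (sum_le_sum this).trans ?_
    rw [← mul_sum]
    calc _ ≤ 2 * B / N * (c * N) := by gcongr; exact hch N
      _ = _ := by field_simp
  have b3 : |L * ∑ n ∈ Ioc 0 N, ψ n * (Λ n / n)| ≤ |∑ n ∈ Ioc 0 N, ψ n * (Real.log n / n)| + 2 * B * c := by
    have := abs_sub_abs_le_abs_sub (L * ∑ n ∈ Ioc 0 N, ψ n * (Λ n / n)) (∑ n ∈ Ioc 0 N, ψ n * (Real.log n / n))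
    rw [abs_sub_comm] at this
    linarith
  rw [mul_comm, ← abs_mul]
  linarith

end BQ
end part_A3

section part_A4
set_option linter.unusedVariables false
open Finset Filter Topology

namespace BQ
open ArithmeticFunction
open scoped ArithmeticFunction.zeta

lemma af_one1 : af one1 = (ζ : ArithmeticFunction ℝ) := by
  ext n
  by_cases h : n = 0
  · simp [h]
  · rw [af_apply, one1_apply h, natCoe_apply, zeta_apply_ne h]; simp

lemma mult_nonneg {f : ArithmeticFunction ℝ} (hf : f.IsMultiplicative)
    (h : ∀ p k : ℕ, p.Prime → 0 ≤ f (p ^ k)) (n : ℕ) : 0 ≤ f n := by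
  by_cases hn : n = 0
  · simp [hn]
  rw [hf.multiplicative_factorization f hn]
  exact Finset.prod_nonneg fun p hp => h _ _ (Nat.prime_of_mem_primeFactors hp)

lemma gg_mult (χ : ℕ →*₀ ℝ) : (gg χ).IsMultiplicative := (af_mult _).mul (af_mult _)

lemma gg_prime_pow (χ : ℕ →*₀ ℝ) {p : ℕ} (hp : p.Prime) (k : ℕ) :
    gg χ (p ^ k) = ∑ j ∈ range (k + 1), χ p ^ j := by
  rw [gg, af_one1, coe_zeta_mul_apply, Nat.sum_divisors_prime_pow hp]
  simp

lemma gg_pp_cases {χ : ℕ →*₀ ℝ} (hc : RC χ) {p : ℕ} (hp : p.Prime) (k : ℕ) :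
    (χ p = 1 → gg χ (p ^ k) = k + 1) ∧ (χ p = 0 → gg χ (p ^ k) = 1) ∧
    (χ p = -1 → gg χ (p ^ k) = if Even k then 1 else 0) := by
  rw [gg_prime_pow χ hp]
  refine ⟨fun h => by simp [h], fun h => ?_, fun h => ?_⟩
  · rw [h, sum_range_succ']; simp
  · rw [h, neg_one_geom_sum]
    by_cases hk : Even k
    · rw [if_neg, if_pos hk]; simpa [Nat.even_add_one] using hk
    · rw [if_pos, if_neg hk]; simpa [Nat.even_add_one] using hk

lemma gg_nonneg {χ : ℕ →*₀ ℝ} (hc : RC χ) (n : ℕ) : 0 ≤ gg χ n := by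
  apply mult_nonneg (gg_mult χ)
  intro p k hp
  obtain ⟨h1, h2, h3⟩ := gg_pp_cases hc hp k
  rcases hc p with h | h | h
  · rw [h2 h]; norm_num
  · rw [h1 h]; positivity
  · rw [h3 h]; split_ifs <;> norm_num

lemma RC.mul {χ ψ : ℕ →*₀ ℝ} (h1 : RC χ) (h2 : RC ψ) : RC (χ * ψ) := by
  intro n
  change χ n * ψ n = 0 ∨ χ n * ψ n = 1 ∨ χ n * ψ n = -1
  rcases h1 n with h | h | h <;> rcases h2 n with h' | h' | h' <;> rw [h, h'] <;> norm_num

/-- `r = 1 * ψ * χ * ψχ` -/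
noncomputable def rr (ψ χ : ℕ →*₀ ℝ) : ArithmeticFunction ℝ :=
  (af one1 * af ψ) * (af χ * af (ψ * χ))

lemma one1_mul (χ : ℕ →*₀ ℝ) : χ * one1 = χ := by
  ext n
  change χ n * one1 n = χ n
  by_cases h : n = 0
  · simp [h]
  · rw [one1_apply h, mul_one]

lemma pmul_gg (ψ χ : ℕ →*₀ ℝ) : (af ψ).pmul (gg χ) = af ψ * af (ψ * χ) := by
  rw [gg, pmul_cm, pmul_af, pmul_af, one1_mul]

lemma rr_eq (ψ χ : ℕ →*₀ ℝ) : rr ψ χ = gg χ * (af ψ).pmul (gg χ) := by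
  rw [pmul_gg, gg, rr]; ring

lemma rr_comm (ψ χ : ℕ →*₀ ℝ) : rr ψ χ = rr χ ψ := by
  have h : ψ * χ = χ * ψ := by
    ext n
    change ψ n * χ n = χ n * ψ n
    exact mul_comm _ _
  rw [rr, rr, h]; ring

lemma rr_mult (ψ χ : ℕ →*₀ ℝ) : (rr ψ χ).IsMultiplicative :=
  ((af_mult _).mul (af_mult _)).mul ((af_mult _).mul (af_mult _))

lemma rr_pp_nonneg {ψ χ : ℕ →*₀ ℝ} (hψ : RC ψ) (hχ : RC χ) {p : ℕ} (hp : p.Prime) (k : ℕ) 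
    (h : 0 ≤ ψ p ∨ χ p = -1) :
    0 ≤ rr ψ χ (p ^ k) := by
  rw [rr_eq, mul_apply]
  apply sum_nonneg
  rintro ⟨i, j⟩ hij
  rw [Nat.mem_divisorsAntidiagonal] at hij
  simp only [pmul_apply, af_apply]
  apply mul_nonneg (gg_nonneg hχ i)
  obtain ⟨b, -, hb⟩ := (Nat.dvd_prime_pow hp).1 (Dvd.intro_left i hij.1)
  simp only at hb
  rw [hb, map_pow]
  rcases h with h | h
  · exact mul_nonneg (pow_nonneg h b) (gg_nonneg hχ _)
  · rw [(gg_pp_cases hχ hp b).2.2 h]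
    split_ifs with he
    · simpa using he.pow_nonneg _
    · simp

lemma rr_nonneg {ψ χ : ℕ →*₀ ℝ} (hψ : RC ψ) (hχ : RC χ) (n : ℕ) : 0 ≤ rr ψ χ n := by
  apply mult_nonneg (rr_mult ψ χ)
  intro p k hp
  rcases hψ p with h | h | h
  · exact rr_pp_nonneg hψ hχ hp k (Or.inl (by rw [h]))
  · exact rr_pp_nonneg hψ hχ hp k (Or.inl (by rw [h]; norm_num))
  · rw [rr_comm]
    exact rr_pp_nonneg hχ hψ hp k (Or.inr h)

lemma succ_sq_le (k : ℕ) : ((k:ℝ) + 1) * (k + 1) ≤ 4 ^ k := by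
  have h : k + 1 ≤ 2 ^ k := k.lt_two_pow_self
  have h2 : ((k:ℝ) + 1) ≤ 2 ^ k := by exact_mod_cast h
  calc ((k:ℝ) + 1) * (k + 1) ≤ 2 ^ k * 2 ^ k := by gcongr
    _ = 4 ^ k := by rw [← mul_pow]; norm_num

lemma rr_pp_le {ψ χ : ℕ →*₀ ℝ} (hψ : RC ψ) (hχ : RC χ) {p : ℕ} (hp : p.Prime) (k : ℕ) :
    rr ψ χ (p ^ k) ≤ 4 ^ k * gg χ (p ^ k) := by
  rw [rr_eq, mul_apply]
  have hk := succ_sq_le k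
  have hk0 : (0:ℝ) ≤ k := by positivity
  have key : ∀ D : ℝ, (∀ a b : ℕ, a + b = k → gg χ (p ^ a) * gg χ (p ^ b) ≤ D) → (k + 1) * D ≤ 4 ^ k * gg χ (p ^ k) →
      ∑ x ∈ (p ^ k).divisorsAntidiagonal, gg χ x.1 * ((af ψ).pmul (gg χ)) x.2 ≤ 4 ^ k * gg χ (p ^ k) := by
    intro D h1 h2
    refine le_trans (sum_le_card_nsmul _ _ D ?_) ?_
    · rintro ⟨i, j⟩ hij
      rw [Nat.mem_divisorsAntidiagonal] at hij
      obtain ⟨b, -, hb⟩ := (Nat.dvd_prime_pow hp).1 (Dvd.intro_left i hij.1)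
      obtain ⟨a, -, ha⟩ := (Nat.dvd_prime_pow hp).1 (Dvd.intro j hij.1)
      have hab : a + b = k := by
        have := hij.1
        simp only at this ha hb
        rw [ha, hb, ← pow_add] at this
        exact Nat.pow_right_injective hp.two_le this
      refine le_trans ?_ (h1 a b hab)
      simp only [pmul_apply, af_apply] at *
      rw [ha, hb]
      apply mul_le_mul_of_nonneg_left _ (gg_nonneg hχ _)
      have := mul_le_mul_of_nonneg_right (hψ.le_one (p ^ b)) (gg_nonneg hχ (p ^ b))
      linarith
    · rw [← Nat.map_div_right_divisors, card_map, Nat.divisors_prime_pow hp, card_map, card_range]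
      simpa using h2
  rcases hχ p with h | h | h
  · apply key 1
    · intro a b _
      rw [(gg_pp_cases hχ hp a).2.1 h, (gg_pp_cases hχ hp b).2.1 h]; norm_num
    · rw [(gg_pp_cases hχ hp k).2.1 h]; nlinarith
  · apply key ((k + 1) * (k + 1))
    · intro a b hab
      rw [(gg_pp_cases hχ hp a).1 h, (gg_pp_cases hχ hp b).1 h, ← hab]
      push_cast
      gcongr <;> simp
    · rw [(gg_pp_cases hχ hp k).1 h]; nlinarith
  · by_cases he : Even k
    · apply key 1
      · intro a b _
        rw [(gg_pp_cases hχ hp a).2.2 h, (gg_pp_cases hχ hp b).2.2 h]; split_ifs <;> norm_num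
      · rw [(gg_pp_cases hχ hp k).2.2 h, if_pos he]; nlinarith
    · apply key 0
      · intro a b hab
        rw [(gg_pp_cases hχ hp a).2.2 h, (gg_pp_cases hχ hp b).2.2 h]
        rw [← hab, Nat.even_add] at he
        split_ifs <;> simp_all
      · rw [mul_zero]; exact mul_nonneg (by positivity) (gg_nonneg hχ _)

lemma rr_le {ψ χ : ℕ →*₀ ℝ} (hψ : RC ψ) (hχ : RC χ) {n : ℕ} (hn : n ≠ 0) :
    rr ψ χ n ≤ 4 ^ (cardFactors n) * gg χ n := by
  rw [(rr_mult ψ χ).multiplicative_factorization _ hn, (gg_mult χ).multiplicative_factorization _ hn,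
    cardFactors_eq_sum_factorization]
  rw [Finsupp.sum, ← Finset.prod_pow_eq_pow_sum, Finsupp.prod, Finsupp.prod, ← Finset.prod_mul_distrib]
  apply Finset.prod_le_prod
  · intro p _; exact rr_nonneg hψ hχ _
  · intro p hp; exact rr_pp_le hψ hχ (Nat.prime_of_mem_primeFactors hp) _

/-! Smooth sums -/

/-- Finite Euler product -/
noncomputable def EP (f : ℕ → ℝ) (z : ℕ) : ℝ := ∏ p ∈ z.primesBelow, (1 - f p)⁻¹

open Classical in
/-- restriction to smooth numbers -/
noncomputable def smi (f : ℕ →*₀ ℝ) (z : ℕ) : ℕ →*₀ ℝ where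
  toFun n := if n ∈ z.smoothNumbers then f n else 0
  map_zero' := by simp
  map_one' := by simp [Nat.mem_smoothNumbers]
  map_mul' a b := by
    by_cases ha : a ∈ z.smoothNumbers
    · by_cases hb : b ∈ z.smoothNumbers
      · simp [ha, hb, Nat.mul_mem_smoothNumbers ha hb]
      · rw [if_neg hb, mul_zero]
        by_cases hab : a * b ∈ z.smoothNumbers
        · exact absurd (Nat.mem_smoothNumbers_of_dvd hab (Dvd.intro_left _ rfl)) hb
        · rw [if_neg hab]
    · rw [if_neg ha, zero_mul]
      by_cases hab : a * b ∈ z.smoothNumbers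
      · exact absurd (Nat.mem_smoothNumbers_of_dvd hab (Dvd.intro _ rfl)) ha
      · rw [if_neg hab]

open Classical in
lemma smi_apply (f : ℕ →*₀ ℝ) (z n : ℕ) : smi f z n = if n ∈ z.smoothNumbers then f n else 0 := rfl

lemma smi_sum {f : ℕ →*₀ ℝ} (hf : ∀ p : ℕ, p.Prime → |f p| < 1) (z : ℕ) :
    Summable (fun n => |smi f z n|) ∧ ∑' n, smi f z n = EP f z := by
  obtain ⟨h1, h2⟩ := EulerProduct.summable_and_hasSum_smoothNumbers_prod_primesBelow_geometric
    (f := (f : ℕ →* ℝ)) (fun {p} hp => by simpa using hf p hp) z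
  have e1 : (fun n => |smi f z n|) = (z.smoothNumbers).indicator (fun n => |f n|) := by
    ext n; simp only [smi_apply, Set.indicator]; split_ifs <;> simp
  have e2 : (fun n => smi f z n) = (z.smoothNumbers).indicator (fun n => f n) := by
    ext n; simp only [smi_apply, Set.indicator]
  constructor
  · rw [e1, ← summable_subtype_iff_indicator]; exact h1
  · rw [e2, ← _root_.tsum_subtype]; exact h2.tsum_eq

/-- convolution of summable arithmetic functions -/
lemma hasSum_conv (a b : ArithmeticFunction ℝ) (ha : Summable fun n => |a n|)
    (hb : Summable fun n => |b n|) :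
    HasSum (fun n => (a * b) n) ((∑' n, a n) * ∑' n, b n) := by
  have ha' : Summable fun n => ‖a n‖ := ha
  have hb' : Summable fun n => ‖b n‖ := hb
  have h1 : HasSum (fun x : ℕ × ℕ => a x.1 * b x.2) ((∑' n, a n) * ∑' n, b n) := by
    have e := tsum_mul_tsum_of_summable_norm (f := fun n => a n) (g := fun n => b n) ha' hb'
    rw [e]
    exact (summable_mul_of_summable_norm (f := fun n => a n) (g := fun n => b n) ha' hb').hasSum
  have h2 := HasSum.tsum_fiberwise h1 (fun x : ℕ × ℕ => x.1 * x.2)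
  have key : ∀ n : ℕ, ∑' (x : ↑((fun x : ℕ × ℕ => x.1 * x.2) ⁻¹' {n})), a (x : ℕ × ℕ).1 * b (x : ℕ × ℕ).2 = (a * b) n := by
    intro n
    rw [_root_.tsum_subtype ((fun x : ℕ × ℕ => x.1 * x.2) ⁻¹' {n}) (fun x : ℕ × ℕ => a x.1 * b x.2)]
    symm
    by_cases hn : n = 0
    · subst hn
      rw [ArithmeticFunction.map_zero, ← tsum_zero (β := ℕ × ℕ) (α := ℝ)]
      congr 1
      ext x
      symm
      classical
      rw [Set.indicator_apply]
      split_ifs with hx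
      · simp only [Set.mem_preimage, Set.mem_singleton_iff, mul_eq_zero] at hx
        rcases hx with hx | hx <;> simp [hx]
      · rfl
    · rw [tsum_eq_sum (s := n.divisorsAntidiagonal)]
      · rw [mul_apply]
        apply sum_congr rfl
        intro x hx
        rw [Nat.mem_divisorsAntidiagonal] at hx
        rw [Set.indicator_of_mem]; exact hx.1
      · intro x hx
        rw [Nat.mem_divisorsAntidiagonal] at hx
        rw [Set.indicator_of_notMem]
        intro hx2; exact hx ⟨hx2, hn⟩
  have e : (fun n => (a * b) n) = _ := (funext key).symm
  rw [e]
  exact h2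

lemma summable_conv (a b : ArithmeticFunction ℝ) (ha : Summable fun n => |a n|)
    (hb : Summable fun n => |b n|) : Summable (fun n => |(a * b) n|) := by
  set a' : ArithmeticFunction ℝ := ⟨fun n => |a n|, by simp⟩
  set b' : ArithmeticFunction ℝ := ⟨fun n => |b n|, by simp⟩
  have h := (hasSum_conv a' b' (by simpa [a'] using ha) (by simpa [b'] using hb)).summable
  refine Summable.of_nonneg_of_le (fun n => abs_nonneg _) (fun n => ?_) h
  rw [mul_apply, mul_apply]
  refine (abs_sum_le_sum_abs _ _).trans (le_of_eq ?_)
  apply sum_congr rfl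
  intro x _
  simp [a', b', abs_mul]

end BQ
end part_A4

section part_A5
set_option linter.unusedVariables false
open Finset Filter Topology

namespace BQ
open ArithmeticFunction
open scoped ArithmeticFunction.zeta

/-- Finite Euler product of `χ` at `s`. -/
noncomputable def E (χ : ℕ →*₀ ℝ) (s : ℝ) (z : ℕ) : ℝ := EP (tw χ s) z

lemma tw_abs_lt {χ : ℕ →*₀ ℝ} (hc : RC χ) {s : ℝ} (hs : 0 < s) {p : ℕ} (hp : p.Prime) :
    |tw χ s p| < 1 := by
  rw [tw_apply, abs_mul]
  have h1 := hc.abs_le p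
  have hp1 : (1:ℝ) < p := by exact_mod_cast hp.one_lt
  have h2 : (p:ℝ) ^ (-s) < 1 := Real.rpow_lt_one_of_one_lt_of_neg hp1 (by linarith)
  have h3 : 0 ≤ (p:ℝ) ^ (-s) := by positivity
  rw [abs_of_nonneg h3]
  nlinarith [abs_nonneg (χ p)]

lemma E_pos {χ : ℕ →*₀ ℝ} (hc : RC χ) {s : ℝ} (hs : 0 < s) (z : ℕ) : 0 < E χ s z := by
  unfold E EP
  apply Finset.prod_pos
  intro p hp
  have := abs_lt.1 (tw_abs_lt hc hs (Nat.prime_of_mem_primesBelow hp))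
  apply inv_pos.2; linarith

/-- smooth twist -/
noncomputable def st (χ : ℕ →*₀ ℝ) (s : ℝ) (z : ℕ) : ArithmeticFunction ℝ := af (smi (tw χ s) z)

lemma st_sum {χ : ℕ →*₀ ℝ} (hc : RC χ) {s : ℝ} (hs : 0 < s) (z : ℕ) :
    Summable (fun n => |st χ s z n|) ∧ ∑' n, st χ s z n = E χ s z :=
  smi_sum (fun p hp => tw_abs_lt hc hs hp) z

lemma st_pmul (χ : ℕ →*₀ ℝ) (s : ℝ) (z : ℕ) :
    (af (smi (tw one1 s) z)).pmul (af χ) = st χ s z := by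
  ext n
  simp only [pmul_apply, af_apply, st, smi_apply, tw_apply]
  by_cases hn : n = 0
  · simp [hn]
  · rw [one1_apply hn]; split_ifs <;> ring

/-- the smooth restricted, twisted arithmetic function -/
lemma st_one_mul (a : ArithmeticFunction ℝ) (s : ℝ) (z n : ℕ) (hn : n ∈ z.smoothNumbers) :
    (af (smi (tw one1 s) z)).pmul a n = a n * (n:ℝ) ^ (-s) := by
  have h0 := Nat.ne_zero_of_mem_smoothNumbers hn
  simp only [pmul_apply, af_apply, smi_apply, if_pos hn, tw_apply, one1_apply h0]; ring

lemma st_one_mul' (a : ArithmeticFunction ℝ) (s : ℝ) (z n : ℕ) (hn : n ∉ z.smoothNumbers) :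
    (af (smi (tw one1 s) z)).pmul a n = 0 := by
  simp only [pmul_apply, af_apply, smi_apply, if_neg hn, zero_mul]

lemma hasSum_gg {χ : ℕ →*₀ ℝ} (hc : RC χ) {s : ℝ} (hs : 0 < s) (z : ℕ) :
    HasSum (fun n => (af (smi (tw one1 s) z)).pmul (gg χ) n) (E one1 s z * E χ s z) := by
  rw [gg, pmul_cm, st_pmul, st_pmul, ← (st_sum one1_RC hs z).2, ← (st_sum hc hs z).2]
  exact hasSum_conv _ _ (st_sum one1_RC hs z).1 (st_sum hc hs z).1

lemma hasSum_one {s : ℝ} (hs : 0 < s) (z : ℕ) :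
    HasSum (fun n => (af (smi (tw one1 s) z)).pmul (af one1) n) (E one1 s z) := by
  rw [st_pmul, ← (st_sum one1_RC hs z).2]
  exact (st_sum one1_RC hs z).1.of_abs.hasSum

lemma hasSum_rr {ψ χ : ℕ →*₀ ℝ} (hψ : RC ψ) (hχ : RC χ) {s : ℝ} (hs : 0 < s) (z : ℕ) :
    HasSum (fun n => (af (smi (tw one1 s) z)).pmul (rr ψ χ) n)
      ((E one1 s z * E ψ s z) * (E χ s z * E (ψ * χ) s z)) := by
  have h3 := hψ.mul hχ
  rw [rr, pmul_cm, pmul_cm, pmul_cm, st_pmul, st_pmul, st_pmul, st_pmul]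
  have k1 := hasSum_conv _ _ (st_sum one1_RC hs z).1 (st_sum hψ hs z).1
  have k2 := hasSum_conv _ _ (st_sum hχ hs z).1 (st_sum h3 hs z).1
  have k3 := hasSum_conv _ _ (summable_conv _ _ (st_sum one1_RC hs z).1 (st_sum hψ hs z).1)
    (summable_conv _ _ (st_sum hχ hs z).1 (st_sum h3 hs z).1)
  rw [k1.tsum_eq, k2.tsum_eq, (st_sum one1_RC hs z).2, (st_sum hψ hs z).2, (st_sum hχ hs z).2,
    (st_sum h3 hs z).2] at k3
  exact k3

/-- Rankin's trick -/
lemma rankin_tail {a : ArithmeticFunction ℝ} (ha : ∀ n, 0 ≤ a n) {σ T M0 : ℝ} (hσ : 0 ≤ σ) (hM : 0 < M0)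
    {z : ℕ} (h : HasSum (fun n => (af (smi (tw one1 (1 - σ)) z)).pmul a n) T) (F : Finset ℕ)
    (hF : ∀ n ∈ F, n ∈ z.smoothNumbers ∧ M0 ≤ n) :
    ∑ n ∈ F, a n / n ≤ M0 ^ (-σ) * T := by
  have hnn : ∀ n, 0 ≤ (af (smi (tw one1 (1 - σ)) z)).pmul a n := by
    intro n
    by_cases hn : n ∈ z.smoothNumbers
    · rw [st_one_mul _ _ _ _ hn]; have := ha n; positivity
    · rw [st_one_mul' _ _ _ _ hn]
  have h1 := sum_le_hasSum F (fun n _ => hnn n) h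
  have h2 : ∑ n ∈ F, a n / n ≤ M0 ^ (-σ) * ∑ n ∈ F, (af (smi (tw one1 (1 - σ)) z)).pmul a n := by
    rw [mul_sum]
    apply sum_le_sum
    intro n hn
    obtain ⟨hs, hm⟩ := hF n hn
    have hn0 : (0:ℝ) < n := lt_of_lt_of_le hM hm
    rw [st_one_mul _ _ _ _ hs]
    have e : (n:ℝ) ^ (-(1 - σ)) = (n:ℝ) ^ σ / n := by
      rw [neg_sub, Real.rpow_sub hn0, Real.rpow_one]
    have e2 : 1 ≤ M0 ^ (-σ) * (n:ℝ) ^ σ := by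
      rw [Real.rpow_neg hM.le, inv_mul_eq_div, one_le_div (by positivity)]
      exact Real.rpow_le_rpow hM.le hm hσ
    rw [e]
    have := div_nonneg (ha n) hn0.le
    calc a n / n = 1 * (a n / n) := by ring
      _ ≤ (M0 ^ (-σ) * (n:ℝ) ^ σ) * (a n / n) := by gcongr
      _ = _ := by ring
  refine h2.trans ?_
  gcongr

lemma rank_factor {f : ℝ} (hf : f = 0 ∨ f = 1 ∨ f = -1) {p σ K : ℝ} (hp : 2 ≤ p) (h0 : 0 ≤ σ) (h1 : σ ≤ 1 / 4)
    (hK : σ * Real.log p ≤ K) :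
    (1 - f * p ^ (-(1 - σ)))⁻¹ ≤ Real.exp (5 / 2 * Real.exp K * σ * (Real.log p / p)) * (1 - f * p ^ (-1:ℝ))⁻¹ := by
  have hp0 : 0 < p := by linarith
  have hl : 0 ≤ Real.log p := Real.log_nonneg (by linarith)
  have hexp : 1 ≤ Real.exp (5 / 2 * Real.exp K * σ * (Real.log p / p)) := by
    apply Real.one_le_exp; positivity
  have e1 : p ^ (-(1 - σ)) = p ^ σ / p := by rw [neg_sub, Real.rpow_sub hp0, Real.rpow_one]
  have e2 : p ^ (-1:ℝ) = 1 / p := by rw [Real.rpow_neg_one, one_div]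
  have hps : 1 ≤ p ^ σ := Real.one_le_rpow (by linarith) h0
  rcases hf with hf | hf | hf
  · rw [hf]; simpa using hexp
  · rw [hf, one_mul, one_mul, e1, e2]
    -- upper bound on p^σ/p
    have b1 : p ^ σ / p ≤ 3 / 5 := by
      rw [← e1]
      calc p ^ (-(1 - σ)) ≤ p ^ (-(3/4):ℝ) := Real.rpow_le_rpow_of_exponent_le (by linarith) (by linarith)
        _ ≤ 2 ^ (-(3/4):ℝ) := Real.rpow_le_rpow_of_nonpos (by norm_num) hp (by norm_num)
        _ ≤ 3/5 := by
          rw [← Real.rpow_le_rpow_iff (by positivity) (by norm_num) (z := 4) (by norm_num), ← Real.rpow_mul (by norm_num)]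
          norm_num
    have b2 : p ^ σ - 1 ≤ Real.exp K * σ * Real.log p := by
      have : p ^ σ = Real.exp (σ * Real.log p) := by rw [Real.rpow_def_of_pos hp0, mul_comm]
      rw [this]
      set x := σ * Real.log p
      have hx : 0 ≤ x := by positivity
      have h3 : Real.exp x - 1 ≤ x * Real.exp x := by
        have := Real.add_one_le_exp (-x)
        have h4 : Real.exp x * Real.exp (-x) = 1 := by rw [← Real.exp_add]; simp
        nlinarith [Real.exp_pos x]
      have h5 : Real.exp x ≤ Real.exp K := Real.exp_le_exp.2 hK
      calc Real.exp x - 1 ≤ x * Real.exp x := h3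
        _ ≤ x * Real.exp K := by gcongr
        _ = _ := by simp only [x]; ring
    have b3 : 0 < 1 - p ^ σ / p := by linarith
    have b4 : 0 < 1 - 1 / p := by
      have : 1 / p ≤ 1 / 2 := one_div_le_one_div_of_le (by norm_num) hp
      linarith
    rw [← div_eq_mul_inv, le_div_iff₀ b4, inv_mul_le_iff₀ b3]
    have b5 := Real.add_one_le_exp (5 / 2 * Real.exp K * σ * (Real.log p / p))
    have b6 : (p ^ σ - 1) / p ≤ Real.exp K * σ * (Real.log p / p) := by
      rw [← mul_div_assoc]; gcongr
    have b7 : (p ^ σ - 1) / p = p ^ σ / p - 1 / p := by ring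
    have b8 : 0 ≤ (p ^ σ - 1) / p := div_nonneg (by linarith) hp0.le
    nlinarith
  · rw [hf, e1, e2]
    have b1 : 1 / p ≤ p ^ σ / p := by gcongr
    have b2 : 0 < 1 / p := by positivity
    calc (1 - -1 * (p ^ σ / p))⁻¹ ≤ (1 - -1 * (1 / p))⁻¹ := by
          apply inv_anti₀ <;> linarith
      _ = 1 * (1 - -1 * (1 / p))⁻¹ := by ring
      _ ≤ _ := by
          apply mul_le_mul_of_nonneg_right hexp
          apply inv_nonneg.2; linarith

lemma rank_ratio (K : ℝ) : ∃ C : ℝ, 1 ≤ C ∧ ∀ χ : ℕ →*₀ ℝ, RC χ → ∀ z : ℕ, 2 ≤ z → ∀ σ : ℝ, 0 ≤ σ → σ ≤ 1 / 4 →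
    σ * Real.log z ≤ K → E χ (1 - σ) z ≤ C * E χ 1 z := by
  obtain ⟨C0, hC0, hm⟩ := mertens_primes
  by_cases hK0 : 0 ≤ K
  swap
  · refine ⟨1, le_rfl, fun χ hχ z hz σ h0 h1 h2 => absurd ?_ hK0⟩
    refine le_trans ?_ h2
    have : 0 ≤ Real.log z := Real.log_natCast_nonneg z
    positivity
  refine ⟨Real.exp (5 / 2 * Real.exp K * (K + C0)), Real.one_le_exp (by positivity), ?_⟩
  intro χ hχ z hz σ h0 h1 hK
  have hz1 : (1:ℝ) < z := by exact_mod_cast hz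
  have step : E χ (1 - σ) z ≤ ∏ p ∈ z.primesBelow, (Real.exp (5 / 2 * Real.exp K * σ * (Real.log p / p)) * (1 - tw χ 1 p)⁻¹) := by
    unfold E EP
    apply Finset.prod_le_prod
    · intro p hp
      have := abs_lt.1 (tw_abs_lt hχ (s := 1 - σ) (by linarith) (Nat.prime_of_mem_primesBelow hp))
      apply inv_nonneg.2; linarith
    · intro p hp
      have hpp := Nat.prime_of_mem_primesBelow hp
      rw [tw_apply, tw_apply]
      apply rank_factor (hχ p) (by exact_mod_cast hpp.two_le) h0 h1
      refine le_trans ?_ hK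
      gcongr
      · exact_mod_cast hpp.pos
      · exact (Nat.lt_of_mem_primesBelow hp).le
  refine step.trans ?_
  rw [Finset.prod_mul_distrib]
  apply mul_le_mul_of_nonneg_right _ (E_pos hχ one_pos z).le
  rw [← Real.exp_sum, Real.exp_le_exp, ← mul_sum]
  have := hm z hz
  calc 5 / 2 * Real.exp K * σ * ∑ p ∈ z.primesBelow, Real.log p / p ≤ 5 / 2 * Real.exp K * σ * (Real.log z + C0) := by
        gcongr
    _ = 5 / 2 * Real.exp K * (σ * Real.log z + σ * C0) := by ring
    _ ≤ _ := by
        gcongr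
        nlinarith

end BQ
end part_A5

section part_A6
set_option linter.unusedVariables false
open Finset Filter Topology

namespace BQ
open ArithmeticFunction
open scoped ArithmeticFunction.zeta

/-- finite Euler product at 1 -/
noncomputable def V (χ : ℕ →*₀ ℝ) (z : ℕ) : ℝ := E χ 1 z

lemma V_pos {χ : ℕ →*₀ ℝ} (hc : RC χ) (z : ℕ) : 0 < V χ z := E_pos hc one_pos z

lemma V_split (χ : ℕ →*₀ ℝ) {z z' : ℕ} (h : z ≤ z') :
    V χ z' = V χ z * ∏ p ∈ z'.primesBelow \ z.primesBelow, (1 - χ p / p)⁻¹ := by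
  unfold V E EP
  have hs : z.primesBelow ⊆ z'.primesBelow := by
    intro p hp
    rw [Nat.mem_primesBelow] at *
    exact ⟨hp.1.trans_le h, hp.2⟩
  rw [← Finset.prod_sdiff hs, mul_comm]
  simp only [tw_one_apply]

lemma V_ratio_up {χ : ℕ →*₀ ℝ} (hc : RC χ) {z z' : ℕ} (h : z ≤ z') :
    V χ z' * V one1 z ≤ V χ z * V one1 z' := by
  rw [V_split χ h, V_split one1 h]
  have h1 := V_pos hc z
  have h2 := V_pos one1_RC z
  have : ∏ p ∈ z'.primesBelow \ z.primesBelow, (1 - χ p / p)⁻¹ ≤ ∏ p ∈ z'.primesBelow \ z.primesBelow, (1 - one1 p / p)⁻¹ := by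
    apply Finset.prod_le_prod
    · intro p hp
      have hpp := Nat.prime_of_mem_primesBelow (mem_sdiff.1 hp).1
      have := abs_lt.1 (tw_abs_lt hc one_pos hpp)
      rw [tw_one_apply] at this
      apply inv_nonneg.2; linarith
    · intro p hp
      have hpp := Nat.prime_of_mem_primesBelow (mem_sdiff.1 hp).1
      have := abs_lt.1 (tw_abs_lt one1_RC one_pos hpp)
      rw [tw_one_apply] at this
      apply inv_anti₀ (by linarith)
      rw [one1_apply hpp.ne_zero]
      gcongr
      exact hc.le_one p
  nlinarith [mul_pos h1 h2]

lemma V_ratio_dn {χ : ℕ →*₀ ℝ} (hc : RC χ) {z z' : ℕ} (h : z ≤ z') :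
    V χ z * V one1 z ≤ V χ z' * V one1 z' := by
  rw [V_split χ h, V_split one1 h]
  have h1 := V_pos hc z
  have h2 := V_pos one1_RC z
  have : 1 ≤ (∏ p ∈ z'.primesBelow \ z.primesBelow, (1 - χ p / p)⁻¹) * ∏ p ∈ z'.primesBelow \ z.primesBelow, (1 - one1 p / p)⁻¹ := by
    rw [← Finset.prod_mul_distrib]
    refine le_trans (le_of_eq (Finset.prod_const_one (s := z'.primesBelow \ z.primesBelow)).symm) ?_
    apply Finset.prod_le_prod (fun _ _ => zero_le_one)
    intro p hp
    have hpp := Nat.prime_of_mem_primesBelow (mem_sdiff.1 hp).1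
    have t1 := abs_lt.1 (tw_abs_lt one1_RC one_pos hpp)
    have t2 := abs_lt.1 (tw_abs_lt hc one_pos hpp)
    rw [tw_one_apply] at t1 t2
    rw [one1_apply hpp.ne_zero] at *
    rw [← mul_inv]
    have hp0 : (0:ℝ) < p := by exact_mod_cast hpp.pos
    apply one_le_inv_iff₀.2
    refine ⟨mul_pos (by linarith) (by linarith), ?_⟩
    have : -(1 / (p:ℝ)) ≤ χ p / p := by
      rw [← neg_div]; gcongr; exact hc.neg_one_le p
    nlinarith [mul_nonneg (show 0 ≤ χ p / p + 1 / p by linarith) (show 0 ≤ 1 - 1 / (p:ℝ) by linarith), sq_nonneg (1 / (p:ℝ))]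
  nlinarith [mul_pos h1 h2]

lemma V_one_ge {z : ℕ} (hz : 2 ≤ z) : Real.log z ≤ V one1 z := by
  have h := hasSum_one one_pos z
  have hnn : ∀ n, 0 ≤ (af (smi (tw one1 1) z)).pmul (af one1) n := by
    intro n
    by_cases hn : n ∈ z.smoothNumbers
    · rw [st_one_mul _ _ _ _ hn]
      have : 0 ≤ af one1 n := by
        rw [af_apply]; rcases eq_or_ne n 0 with h | h
        · simp [h]
        · rw [one1_apply h]; norm_num
      positivity
    · rw [st_one_mul' _ _ _ _ hn]
  have h1 := sum_le_hasSum (Icc 1 (z-1)) (fun n _ => hnn n) h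
  refine le_trans ?_ h1
  have h2 := log_add_one_le_harmonic (z - 1)
  rw [harmonic_eq_sum_Icc] at h2
  push_cast at h2
  have e : ((z - 1 : ℕ) : ℝ) + 1 = z := by
    rw [Nat.cast_sub (by omega)]; simp
  rw [e] at h2
  refine h2.trans (le_of_eq ?_)
  apply sum_congr rfl
  intro n hn
  rw [mem_Icc] at hn
  rw [st_one_mul]
  · rw [af_apply, one1_apply (by omega), Real.rpow_neg_one, one_mul]
  · rw [Nat.mem_smoothNumbers]
    refine ⟨by omega, fun p hp => ?_⟩
    have := Nat.le_of_mem_primeFactorsList hp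
    omega

open Classical in
/-- truncation of smooth sums -/
lemma smooth_trunc (Q : ℝ) (hQ : 0 < Q) : ∃ A : ℕ, 1 ≤ A ∧ ∀ (a : ArithmeticFunction ℝ) (z : ℕ) (T T1 : ℝ), (∀ n, 0 ≤ a n) → 2 ≤ z →
    0 ≤ T →
    HasSum (fun n => (af (smi (tw one1 1) z)).pmul a n) T → 
    HasSum (fun n => (af (smi (tw one1 (1 - 1 / (6 * Real.log z))) z)).pmul a n) T1 → T1 ≤ Q * T →
    T ≤ 2 * ∑ n ∈ (Ioc 0 (z ^ A)).filter (· ∈ z.smoothNumbers), a n / n := by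
  obtain ⟨A, hA⟩ := exists_nat_gt (6 * Real.log (2 * Q))
  refine ⟨A + 1, by omega, ?_⟩
  intro a z T T1 ha hz hT h1 h2 h3
  have hz1 : (1:ℝ) < z := by exact_mod_cast hz
  have hl : 0 < Real.log z := Real.log_pos hz1
  have hnn : ∀ n, 0 ≤ (af (smi (tw one1 1) z)).pmul a n := by
    intro n
    by_cases hn : n ∈ z.smoothNumbers
    · rw [st_one_mul _ _ _ _ hn]; have := ha n; positivity
    · rw [st_one_mul' _ _ _ _ hn]
  have conv : ∀ n ∈ z.smoothNumbers, (af (smi (tw one1 1) z)).pmul a n = a n / n := by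
    intro n hn
    rw [st_one_mul _ _ _ _ hn, Real.rpow_neg_one]; rfl
  have key : ∀ F : Finset ℕ, ∑ n ∈ F, (af (smi (tw one1 1) z)).pmul a n ≤
      ∑ n ∈ (Ioc 0 (z ^ (A+1))).filter (· ∈ z.smoothNumbers), a n / n + 1 / 2 * T := by
    intro F
    rw [← sum_filter_add_sum_filter_not F (fun n => n ∈ z.smoothNumbers)]
    have e0 : ∑ n ∈ F.filter (fun n => ¬ n ∈ z.smoothNumbers), (af (smi (tw one1 1) z)).pmul a n = 0 := by
      apply sum_eq_zero
      intro n hn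
      rw [mem_filter] at hn
      exact st_one_mul' _ _ _ _ hn.2
    rw [e0, add_zero, ← sum_filter_add_sum_filter_not _ (fun n => n ≤ z ^ (A+1))]
    apply add_le_add
    · refine le_trans (le_of_eq (sum_congr rfl ?_)) (sum_le_sum_of_subset_of_nonneg (f := fun n => a n / n) ?_ ?_)
      · intro n hn
        simp only [mem_filter] at hn
        exact conv n hn.1.2
      · intro n hn
        simp only [mem_filter, mem_Ioc] at *
        exact ⟨⟨Nat.pos_of_ne_zero (Nat.ne_zero_of_mem_smoothNumbers hn.1.2), hn.2⟩, hn.1.2⟩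
      · intro n _ _; have := ha n; positivity
    · have hz0 : (0:ℝ) < (z:ℝ)^(A+1) := by positivity
      have := rankin_tail ha (σ := 1 / (6 * Real.log z)) (by positivity) hz0 h2
        (filter (fun n => ¬n ≤ z ^ (A + 1)) (filter (fun n => n ∈ z.smoothNumbers) F)) (by
          intro n hn
          simp only [mem_filter] at hn
          refine ⟨hn.1.2, ?_⟩
          have := hn.2
          push Not at this
          exact_mod_cast this.le)
      rw [sum_congr rfl (fun n hn => conv n (by simp only [mem_filter] at hn; exact hn.1.2))]
      refine this.trans ?_
      have e1 : ((z:ℝ) ^ (A+1)) ^ (-(1 / (6 * Real.log z))) = Real.exp (-((A+1)/6)) := by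
        rw [Real.rpow_def_of_pos hz0, Real.log_pow]
        congr 1
        push_cast
        field_simp
      rw [e1]
      have e2 : Real.exp (-((A+1)/6)) * (2 * Q) ≤ 1 := by
        rw [← Real.exp_log (show 0 < 2 * Q by positivity), ← Real.exp_add, Real.exp_le_one_iff]
        linarith
      have := Real.exp_pos (-((A+1)/6))
      nlinarith
  have := h1.summable.tsum_le_of_sum_le key
  rw [h1.tsum_eq] at this
  linarith

lemma sigma_ok {z : ℕ} (hz : 2 ≤ z) : 0 ≤ 1 / (6 * Real.log z) ∧ 1 / (6 * Real.log z) ≤ 1 / 4 ∧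
    1 / (6 * Real.log z) * Real.log z ≤ 1 := by
  have hz2 : (2:ℝ) ≤ z := by exact_mod_cast hz
  have h1 : Real.log 2 ≤ Real.log z := Real.log_le_log (by norm_num) hz2
  have h2 := Real.log_two_gt_d9
  have hl : 0 < Real.log z := by linarith
  refine ⟨by positivity, ?_, ?_⟩
  · apply one_div_le_one_div_of_le <;> linarith
  · field_simp; norm_num

lemma sum_inv_le (N : ℕ) : ∑ n ∈ Ioc 0 N, (1:ℝ) / n ≤ 1 + Real.log N := by
  have h2 := harmonic_le_one_add_log N
  rw [harmonic_eq_sum_Icc] at h2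
  push_cast at h2
  refine le_trans (le_of_eq ?_) h2
  simp only [one_div]; rfl

lemma one1_nonneg (n : ℕ) : 0 ≤ af one1 n := by
  rw [af_apply]
  rcases eq_or_ne n 0 with h | h
  · simp [h]
  · rw [one1_apply h]; norm_num

lemma V_one_le : ∃ C : ℝ, 0 < C ∧ ∀ z : ℕ, 2 ≤ z → V one1 z ≤ C * Real.log z := by
  obtain ⟨Q, hQ, hq⟩ := rank_ratio 1
  obtain ⟨A, hA1, hA⟩ := smooth_trunc Q (by linarith)
  refine ⟨2 * (2 + A), by positivity, fun z hz => ?_⟩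
  obtain ⟨s1, s2, s3⟩ := sigma_ok hz
  have h := hA (af one1) z _ _ one1_nonneg hz (V_pos one1_RC z).le (hasSum_one one_pos z)
    (hasSum_one (s := 1 - 1 / (6 * Real.log z)) (by linarith) z) (hq one1 one1_RC z hz _ s1 s2 s3)
  refine h.trans ?_
  have h1 : ∑ n ∈ (Ioc 0 (z ^ A)).filter (· ∈ z.smoothNumbers), af one1 n / n ≤ ∑ n ∈ Ioc 0 (z ^ A), (1:ℝ) / n := by
    refine le_trans (sum_le_sum_of_subset_of_nonneg (filter_subset _ _) (fun n _ _ => ?_)) (sum_le_sum fun n hn => ?_)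
    · have := one1_nonneg n; positivity
    · rw [af_apply]; gcongr; exact one1_RC.le_one n
  have h2 := sum_inv_le (z ^ A)
  push_cast at h2
  rw [Real.log_pow] at h2
  have hz2 : (2:ℝ) ≤ z := by exact_mod_cast hz
  have h3 : Real.log 2 ≤ Real.log z := Real.log_le_log (by norm_num) hz2
  have h4 := Real.log_two_gt_d9
  nlinarith

lemma sum_gg_div {χ : ℕ →*₀ ℝ} {B : ℝ} (h : PS χ B) (N : ℕ) :
    ∑ n ∈ Ioc 0 N, gg χ n / n ≤ 2 * B * (1 + Real.log N) := by
  have e : ∑ n ∈ Ioc 0 N, gg χ n / n = ∑ a ∈ Ioc 0 N, (1:ℝ) / a * ∑ b ∈ Ioc 0 (N / a), χ b * (b:ℝ)^(-1:ℝ) := by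
    have e1 : ∀ n, gg χ n / n = (af (tw one1 1) * af (tw χ 1)) n := by
      intro n
      have e2 : (af (tw one1 1)).pmul (gg χ) = af (tw one1 1) * af (tw χ 1) := by
        rw [gg, pmul_cm, pmul_af, pmul_af]
        congr 2
        · ext n; change tw one1 1 n * one1 n = tw one1 1 n
          by_cases hn : n = 0
          · simp [hn]
          · rw [one1_apply hn, mul_one]
        · ext n; change tw one1 1 n * χ n = tw χ 1 n
          rw [tw_apply, tw_apply]
          by_cases hn : n = 0
          · simp [hn]
          · rw [one1_apply hn]; ring
      rw [← e2, pmul_apply, af_apply, tw_one_apply]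
      by_cases hn : n = 0
      · simp [hn]
      · rw [one1_apply hn]; ring
    simp only [e1]
    rw [ArithmeticFunction.sum_Ioc_mul_eq_sum_sum]
    apply sum_congr rfl
    intro a ha
    rw [mem_Ioc] at ha
    rw [af_apply, tw_one_apply, one1_apply (by omega)]
    congr 1
  rw [e]
  have h0 := h.nonneg
  calc _ ≤ ∑ a ∈ Ioc 0 N, (1:ℝ) / a * (2 * B) := by
        apply sum_le_sum
        intro a ha
        gcongr
        have := h.tail (s := 1) zero_le_one 0 (N / a)
        have h2 := le_of_abs_le this
        simpa using h2
    _ ≤ _ := by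
        rw [← sum_mul]
        have := sum_inv_le N
        nlinarith

lemma V_psi_le {ψ : ℕ →*₀ ℝ} {B : ℝ} (hc : RC ψ) (h : PS ψ B) : ∃ C : ℝ, 0 < C ∧ ∀ z : ℕ, 2 ≤ z → V ψ z ≤ C := by
  obtain ⟨Q, hQ, hq⟩ := rank_ratio 1
  obtain ⟨A, hA1, hA⟩ := smooth_trunc (Q * Q) (by nlinarith)
  have hB := h.nonneg
  refine ⟨2 * (2 * B) * (2 + A) + 1, by positivity, fun z hz => ?_⟩
  obtain ⟨s1, s2, s3⟩ := sigma_ok hz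
  have p1 := V_pos one1_RC z
  have p2 := V_pos hc z
  have hs : 0 < 1 - 1 / (6 * Real.log z) := by linarith
  have h' := hA (gg ψ) z _ _ (gg_nonneg hc) hz (mul_pos p1 p2).le (hasSum_gg hc one_pos z)
    (hasSum_gg hc hs z) (by
      have a1 := hq one1 one1_RC z hz _ s1 s2 s3
      have a2 := hq ψ hc z hz _ s1 s2 s3
      have a3 := E_pos one1_RC hs z
      have a4 := E_pos hc hs z
      calc _ ≤ (Q * E one1 1 z) * (Q * E ψ 1 z) := by gcongr
        _ = Q * Q * (V one1 z * V ψ z) := by rw [V, V]; ring)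
  have h1 : ∑ n ∈ (Ioc 0 (z ^ A)).filter (· ∈ z.smoothNumbers), gg ψ n / n ≤ ∑ n ∈ Ioc 0 (z ^ A), gg ψ n / n := by
    refine (sum_le_sum_of_subset_of_nonneg (filter_subset _ _) (fun n _ _ => ?_))
    have := gg_nonneg hc n; positivity
  have h2 := sum_gg_div h (z ^ A)
  push_cast at h2
  rw [Real.log_pow] at h2
  have hz2 : (2:ℝ) ≤ z := by exact_mod_cast hz
  have h3 : Real.log 2 ≤ Real.log z := Real.log_le_log (by norm_num) hz2
  have h4 := Real.log_two_gt_d9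
  have h5 := V_one_ge hz
  have h6 : V one1 z * V ψ z ≤ 2 * (2 * B) * (2 + A) * Real.log z := by
    have : (1 + A * Real.log z) ≤ (2 + A) * Real.log z := by nlinarith
    have := mul_le_mul_of_nonneg_left this (show 0 ≤ 2 * B by positivity)
    nlinarith
  have h7 : V ψ z * Real.log z ≤ 2 * (2 * B) * (2 + A) * Real.log z := by nlinarith
  have h8 : V ψ z ≤ 2 * (2 * B) * (2 + A) := le_of_mul_le_mul_right h7 (by linarith)
  linarith

end BQ
end part_A6

section part_A7
set_option linter.unusedVariables false
open Finset Filter Topology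

namespace BQ
open ArithmeticFunction
open scoped ArithmeticFunction.zeta

lemma gg_hecke (χ : ℕ →*₀ ℝ) {p : ℕ} (hp : p.Prime) {k : ℕ} (hk : k ≠ 0) :
    gg χ (p * k) = (1 + χ p) * gg χ k - χ p * (if p ∣ k then gg χ (k / p) else 0) := by
  obtain ⟨a, m, hm, rfl⟩ := Nat.exists_eq_pow_mul_and_not_dvd hk p hp.ne_one
  have hc : ∀ i, Nat.Coprime (p ^ i) m := fun i => ((Nat.Prime.coprime_iff_not_dvd hp).2 hm).pow_left i
  have hg : ∀ i, gg χ (p ^ i * m) = (∑ j ∈ range (i + 1), χ p ^ j) * gg χ m := by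
    intro i
    rw [(gg_mult χ).map_mul_of_coprime (hc i), gg_prime_pow χ hp]
  rw [← mul_assoc, ← pow_succ', hg, hg]
  rcases a with _ | b
  · rw [if_neg (by simpa using hm)]
    simp [sum_range_succ]
  · rw [if_pos (Dvd.dvd.mul_right (dvd_pow_self p (Nat.succ_ne_zero b)) m)]
    have : p ^ (b + 1) * m / p = p ^ b * m := by
      rw [pow_succ', mul_assoc, Nat.mul_div_cancel_left _ hp.pos]
    rw [this, hg, sum_range_succ _ (b + 1 + 1), sum_range_succ _ (b + 1)]
    ring

/-- weights of multiples of `e` -/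
noncomputable def AA (χ : ℕ →*₀ ℝ) (e N : ℕ) : ℝ := ∑ n ∈ Ioc 0 N with e ∣ n, gg χ n

lemma sum_mul_dvd (f : ℕ → ℝ) {p : ℕ} (hp : 0 < p) (N : ℕ) :
    ∑ n ∈ Ioc 0 N with p ∣ n, f n = ∑ k ∈ Ioc 0 (N / p), f (p * k) := by
  symm
  apply sum_bij (fun k _ => p * k)
  · intro k hk
    simp only [mem_filter, mem_Ioc] at *
    refine ⟨⟨by have := hk.1; positivity, ?_⟩, dvd_mul_right p k⟩
    calc p * k ≤ p * (N / p) := by gcongr; exact hk.2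
      _ ≤ N := Nat.mul_div_le N p
  · intro a _ b _ h; exact Nat.eq_of_mul_eq_mul_left hp h
  · intro n hn
    simp only [mem_filter, mem_Ioc] at hn
    obtain ⟨⟨h0, h1⟩, k, rfl⟩ := hn
    refine ⟨k, ?_, rfl⟩
    rw [mem_Ioc]
    exact ⟨Nat.pos_of_mul_pos_left h0, (Nat.le_div_iff_mul_le hp).2 (by linarith)⟩
  · intro _ _; rfl

lemma AA_rec (χ : ℕ →*₀ ℝ) {p e : ℕ} (hp : p.Prime) (hpe : p.Coprime e) (N : ℕ) :
    AA χ (p * e) N = (1 + χ p) * AA χ e (N / p) - χ p * AA χ e (N / p / p) := by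
  unfold AA
  have e1 : ∑ n ∈ Ioc 0 N with p * e ∣ n, gg χ n = ∑ n ∈ Ioc 0 N with p ∣ n, (if e ∣ n then gg χ n else 0) := by
    rw [← sum_filter, filter_filter]
    apply sum_congr _ (fun _ _ => rfl)
    ext n
    simp only [mem_filter]
    constructor
    · rintro ⟨h1, h2⟩; exact ⟨h1, dvd_of_mul_right_dvd h2, dvd_of_mul_left_dvd h2⟩
    · rintro ⟨h1, h2, h3⟩; exact ⟨h1, hpe.mul_dvd_of_dvd_of_dvd h2 h3⟩
  rw [e1, sum_mul_dvd _ hp.pos]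
  have e2 : ∑ k ∈ Ioc 0 (N / p), (if e ∣ p * k then gg χ (p * k) else 0) =
      ∑ k ∈ Ioc 0 (N / p), ((1 + χ p) * (if e ∣ k then gg χ k else 0) -
        χ p * (if p ∣ k then (if e ∣ k then gg χ (k / p) else 0) else 0)) := by
    apply sum_congr rfl
    intro k hk
    rw [mem_Ioc] at hk
    have : e ∣ p * k ↔ e ∣ k := hpe.symm.dvd_mul_left
    by_cases h : e ∣ k
    · rw [if_pos (this.2 h), if_pos h, gg_hecke χ hp (by omega), if_pos h]
    · rw [if_neg (fun h' => h (this.1 h')), if_neg h, if_neg h]; simp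
  rw [e2, sum_sub_distrib, ← mul_sum, ← mul_sum, ← sum_filter]
  congr 2
  rw [← sum_filter, sum_mul_dvd _ hp.pos, sum_filter]
  apply sum_congr rfl
  intro k hk
  have : e ∣ p * k ↔ e ∣ k := hpe.symm.dvd_mul_left
  simp only [this, Nat.mul_div_cancel_left _ hp.pos]

noncomputable def nup (χ : ℕ →*₀ ℝ) (p : ℕ) : ℝ := (1 + χ p) / p - χ p / p ^ 2

noncomputable def nuf (χ : ℕ →*₀ ℝ) : ArithmeticFunction ℝ := prodPrimeFactors (nup χ)

lemma nuf_mult (χ : ℕ →*₀ ℝ) : (nuf χ).IsMultiplicative := IsMultiplicative.prodPrimeFactors _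

lemma nuf_prime (χ : ℕ →*₀ ℝ) {p : ℕ} (hp : p.Prime) : nuf χ p = nup χ p := by
  rw [nuf, prodPrimeFactors_apply hp.ne_zero, hp.primeFactors, prod_singleton]

lemma AA_approx {χ : ℕ →*₀ ℝ} {B : ℝ} (hc : RC χ) (h : PS χ B) (hB : 1 ≤ B) (e : ℕ) :
    Squarefree e → ∀ t : ℝ, 0 ≤ t → |AA χ e ⌊t⌋₊ - nuf χ e * t * Lv χ 1| ≤ (e:ℝ) ^ 2 * (5 * √B * √t) := by
  induction e using induction_on_primes with
  | zero => intro h; exact absurd rfl h.ne_zero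
  | one =>
    intro _ t ht
    have := sum_gg hc h hB ht
    simpa [AA, (nuf_mult χ).map_one] using this
  | prime_mul p a hp ih =>
    intro hsq t ht
    have hpa : p.Coprime a := Nat.coprime_of_squarefree_mul hsq
    have hsa : Squarefree a := hsq.squarefree_of_dvd (dvd_mul_left a p)
    have hp0 : (0:ℝ) < p := by exact_mod_cast hp.pos
    have hp2 : (2:ℝ) ≤ p := by exact_mod_cast hp.two_le
    have i1 := ih hsa (t / p) (by positivity)
    have i2 := ih hsa (t / p / p) (by positivity)
    rw [Nat.floor_div_natCast] at i1 i2
    rw [Nat.floor_div_natCast] at i2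
    rw [AA_rec χ hp hpa, (nuf_mult χ).map_mul_of_coprime hpa, nuf_prime χ hp, nup]
    set E0 := 5 * √B with hE0
    have hE : 0 ≤ E0 := by positivity
    have s1 : √(t / p) ≤ √t := Real.sqrt_le_sqrt (div_le_self ht (by linarith))
    have s2 : √(t / p / p) ≤ √t := Real.sqrt_le_sqrt ((div_le_self (by positivity) (by linarith)).trans (div_le_self ht (by linarith)))
    set x1 := AA χ a (⌊t⌋₊ / p) - nuf χ a * (t / p) * Lv χ 1
    set x2 := AA χ a (⌊t⌋₊ / p / p) - nuf χ a * (t / p / p) * Lv χ 1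
    have e : (1 + χ p) * AA χ a (⌊t⌋₊ / p) - χ p * AA χ a (⌊t⌋₊ / p / p) - ((1 + χ p) / p - χ p / p ^ 2) * nuf χ a * t * Lv χ 1
        = (1 + χ p) * x1 - χ p * x2 := by
      simp only [x1, x2]; field_simp; ring
    rw [e]
    have b1 : |x1| ≤ (a:ℝ)^2 * (E0 * √t) := i1.trans (by gcongr)
    have b2 : |x2| ≤ (a:ℝ)^2 * (E0 * √t) := i2.trans (by gcongr)
    set Q := (a:ℝ)^2 * (E0 * √t)
    have hQ : 0 ≤ Q := by positivity
    have b3 : |(1 + χ p) * x1 - χ p * x2| ≤ 3 * Q := by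
      calc _ ≤ |(1 + χ p) * x1| + |χ p * x2| := abs_sub _ _
        _ = |1 + χ p| * |x1| + |χ p| * |x2| := by rw [abs_mul, abs_mul]
        _ ≤ 2 * Q + 1 * Q := by
          gcongr
          · rw [abs_le]; have := hc.le_one p; have := hc.neg_one_le p; constructor <;> linarith
          · exact hc.abs_le p
        _ = 3 * Q := by ring
    refine b3.trans ?_
    push_cast
    have : (p * (a:ℝ)) ^ 2 * (E0 * √t) = p ^ 2 * Q := by simp only [Q]; ring
    rw [this]
    apply mul_le_mul_of_nonneg_right _ hQ
    nlinarith

lemma one_sub_nup (χ : ℕ →*₀ ℝ) {p : ℕ} (hp : p.Prime) : 1 - nup χ p = (1 - 1 / p) * (1 - χ p / p) := by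
  have hp0 : (p:ℝ) ≠ 0 := by exact_mod_cast hp.ne_zero
  rw [nup]; field_simp; ring

lemma nup_bounds {χ : ℕ →*₀ ℝ} (hc : RC χ) {p : ℕ} (hp : p.Prime) :
    1 / (p:ℝ) ^ 2 ≤ nup χ p ∧ nup χ p < 1 ∧ nup χ p * (1 - nup χ p)⁻¹ ≤ 6 / p := by
  have hp2 : (2:ℝ) ≤ p := by exact_mod_cast hp.two_le
  have hp0 : (0:ℝ) < p := by linarith
  set P : ℝ := (p:ℝ) with hPdef
  have hlt : nup χ p < 1 := by
    have := one_sub_nup χ hp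
    have t1 : 1 / P < 1 := by rw [div_lt_one hp0]; linarith
    have t2 := abs_lt.1 (tw_abs_lt hc one_pos hp)
    rw [tw_one_apply] at t2
    have := mul_pos (show 0 < 1 - 1 / P by linarith) (show 0 < 1 - χ p / P by linarith)
    linarith
  refine ⟨?_, hlt, ?_⟩
  · rw [nup]
    change 1 / P ^ 2 ≤ (1 + χ p) / P - χ p / P ^ 2
    rcases hc p with h | h | h <;> rw [h]
    · rw [div_le_iff₀ (by positivity)]; field_simp; linarith
    · rw [div_le_iff₀ (by positivity)]; field_simp; linarith
    · apply le_of_eq; field_simp; ring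
  · rw [← div_eq_mul_inv, div_le_div_iff₀ (by linarith) hp0]
    rw [nup]
    change ((1 + χ p) / P - χ p / P ^ 2) * P ≤ 6 * (1 - ((1 + χ p) / P - χ p / P ^ 2))
    rcases hc p with h | h | h <;> rw [h]
    · field_simp; nlinarith
    · field_simp; nlinarith
    · field_simp; nlinarith

end BQ
end part_A7

section part_A8
set_option linter.unusedVariables false
open Finset Filter Topology

namespace BQ
open ArithmeticFunction
open scoped ArithmeticFunction.zeta

/-- product of primes below z -/
def PP (z : ℕ) : ℕ := ∏ p ∈ z.primesBelow, p

lemma PP_primeFactors (z : ℕ) : (PP z).primeFactors = z.primesBelow :=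
  Nat.primeFactors_prod fun p hp => Nat.prime_of_mem_primesBelow hp

lemma PP_squarefree (z : ℕ) : Squarefree (PP z) := by
  unfold PP
  apply Finset.squarefree_prod_of_pairwise_isCoprime
  · intro p hp q hq hne
    have := (Nat.coprime_primes (Nat.prime_of_mem_primesBelow hp) (Nat.prime_of_mem_primesBelow hq)).2 hne
    exact Nat.coprime_iff_isRelPrime.1 this
  · intro p hp
    exact (Nat.prime_of_mem_primesBelow hp).prime.squarefree

lemma coprime_PP {z n : ℕ} : (PP z).Coprime n ↔ ∀ p : ℕ, p.Prime → p ∣ n → z ≤ p := by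
  unfold PP
  rw [Nat.coprime_prod_left_iff]
  constructor
  · intro h p hp hpn
    by_contra hz
    push Not at hz
    have := h p (Nat.mem_primesBelow.2 ⟨hz, hp⟩)
    rw [Nat.Prime.coprime_iff_not_dvd hp] at this
    exact this hpn
  · intro h p hp
    rw [Nat.mem_primesBelow] at hp
    rw [Nat.Prime.coprime_iff_not_dvd hp.2]
    intro hpn
    have := h p hp.2 hpn
    omega

noncomputable def sv (χ : ℕ →*₀ ℝ) (hc : RC χ) (z N : ℕ) (X : ℝ) : BoundingSieve where
  support := Ioc 0 N
  prodPrimes := PP z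
  prodPrimes_squarefree := PP_squarefree z
  weights := gg χ
  weights_nonneg := gg_nonneg hc
  totalMass := X
  nu := nuf χ
  nu_mult := nuf_mult χ
  nu_pos_of_prime := fun p hp _ => by
    rw [nuf_prime χ hp]
    have := (nup_bounds hc hp).1
    have hp0 : (0:ℝ) < p := by exact_mod_cast hp.pos
    exact lt_of_lt_of_le (by positivity) this
  nu_lt_one_of_prime := fun p hp _ => by
    rw [nuf_prime χ hp]; exact (nup_bounds hc hp).2.1

lemma hsum (χ : ℕ →*₀ ℝ) (hc : RC χ) (z N : ℕ) (X : ℝ) :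
    ∑ l ∈ (PP z).divisors, (sv χ hc z N X).selbergTerms l = V one1 z * V χ z := by
  rw [← IsMultiplicative.prodPrimeFactors_one_add_of_squarefree
    ((sv χ hc z N X).selbergTerms_isMultiplicative) (PP_squarefree z), PP_primeFactors, V, V, E, E, EP, EP, ← Finset.prod_mul_distrib]
  apply Finset.prod_congr rfl
  intro p hp
  have hpp := Nat.prime_of_mem_primesBelow hp
  rw [BoundingSieve.selbergTerms_apply, hpp.primeFactors, prod_singleton]
  change 1 + nuf χ p * (1 - nuf χ p)⁻¹ = _
  rw [nuf_prime χ hpp, ← mul_inv, tw_one_apply, tw_one_apply, one1_apply hpp.ne_zero, ← one_sub_nup χ hpp]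
  have := (nup_bounds hc hpp).2.1
  have : 1 - nup χ p ≠ 0 := by linarith
  field_simp; ring

/-- Rankin for the Selberg sum -/
lemma hsum_trunc : ∃ A : ℕ, 1 ≤ A ∧ ∀ (χ : ℕ →*₀ ℝ) (hc : RC χ) (z N : ℕ) (X : ℝ) (R : ℕ), 2 ≤ z → z ^ A ≤ R →
    V one1 z * V χ z ≤ 2 * ∑ l ∈ (PP z).divisors with l ≤ R, (sv χ hc z N X).selbergTerms l := by
  obtain ⟨C0, hC0, hm⟩ := mertens_primes
  obtain ⟨A, hA⟩ := exists_nat_gt (6 * Real.exp 1 * (1 + 2 * C0) + 1)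
  refine ⟨A, ?_, ?_⟩
  · have : (1:ℝ) < A := lt_of_le_of_lt (by have := Real.exp_pos 1; have : 0 ≤ 6 * Real.exp 1 * (1 + 2 * C0) := by positivity
                                           linarith) hA
    exact_mod_cast this.le
  intro χ hc z N X R hz hR
  set s := sv χ hc z N X
  have hz2 : (2:ℝ) ≤ z := by exact_mod_cast hz
  have hl2 : Real.log 2 ≤ Real.log z := Real.log_le_log (by norm_num) hz2
  have hlog2 := Real.log_two_gt_d9
  have hl : 0 < Real.log z := by linarith
  set σ := 1 / Real.log z with hσ
  have hσ0 : 0 < σ := by positivity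
  have hpos : ∀ l ∈ (PP z).divisors, 0 < s.selbergTerms l := by
    intro l hl
    exact BoundingSieve.selbergTerms_pos (Nat.dvd_of_mem_divisors hl)
  have hR0 : (0:ℝ) < R := by
    have : 0 < z ^ A := by positivity
    exact_mod_cast this.trans_le hR
  -- twisted
  set tt : ArithmeticFunction ℝ := s.selbergTerms.pmul (af (tw one1 (-σ)))
  have ttm : tt.IsMultiplicative := (s.selbergTerms_isMultiplicative).pmul (af_mult _)
  have htt : ∀ l ≠ 0, tt l = s.selbergTerms l * (l:ℝ) ^ σ := by
    intro l hl
    simp only [tt, pmul_apply, af_apply, tw_apply, one1_apply hl, neg_neg, one_mul]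
  have tail : ∑ l ∈ (PP z).divisors with ¬ l ≤ R, s.selbergTerms l ≤ (R:ℝ) ^ (-σ) * ∑ l ∈ (PP z).divisors, tt l := by
    rw [mul_sum]
    refine le_trans (sum_le_sum (g := fun l => (R:ℝ) ^ (-σ) * tt l) ?_) (sum_le_sum_of_subset_of_nonneg (filter_subset _ _) ?_)
    · intro l hl
      rw [mem_filter] at hl
      have hl0 := (Nat.pos_of_mem_divisors hl.1).ne'
      rw [htt l hl0]
      have h1 : 1 ≤ (R:ℝ) ^ (-σ) * (l:ℝ) ^ σ := by
        rw [Real.rpow_neg hR0.le, inv_mul_eq_div, one_le_div (by positivity)]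
        apply Real.rpow_le_rpow hR0.le _ hσ0.le
        have := hl.2
        push Not at this
        exact_mod_cast this.le
      have := hpos l hl.1
      nlinarith
    · intro l hl _
      have hl0 := (Nat.pos_of_mem_divisors hl).ne'
      rw [htt l hl0]
      have := hpos l hl
      positivity
  have euler : ∑ l ∈ (PP z).divisors, tt l ≤ Real.exp (6 * Real.exp 1 * (1 + 2 * C0)) * (V one1 z * V χ z) := by
    rw [← hsum χ hc z N X, ← IsMultiplicative.prodPrimeFactors_one_add_of_squarefree ttm (PP_squarefree z),
      ← IsMultiplicative.prodPrimeFactors_one_add_of_squarefree (s.selbergTerms_isMultiplicative) (PP_squarefree z), PP_primeFactors]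
    have h1 : ∀ p ∈ z.primesBelow, 1 + tt p ≤ Real.exp (6 * Real.exp 1 * σ * (Real.log p / p)) * (1 + s.selbergTerms p) := by
      intro p hp
      have hpp := Nat.prime_of_mem_primesBelow hp
      have hp0 : (0:ℝ) < p := by exact_mod_cast hpp.pos
      have hp1 : (1:ℝ) ≤ p := by exact_mod_cast hpp.one_le
      rw [htt p hpp.ne_zero]
      have hh0 : 0 < s.selbergTerms p := by
        apply hpos; rw [Nat.mem_divisors]
        refine ⟨?_, (PP_squarefree z).ne_zero⟩
        exact Finset.dvd_prod_of_mem _ hp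
      have hh : s.selbergTerms p ≤ 6 / p := by
        rw [BoundingSieve.selbergTerms_apply, hpp.primeFactors, prod_singleton]
        change nuf χ p * (1 - nuf χ p)⁻¹ ≤ _
        rw [nuf_prime χ hpp]
        exact (nup_bounds hc hpp).2.2
      have hlp : 0 ≤ Real.log p := Real.log_nonneg hp1
      have b2 : (p:ℝ) ^ σ - 1 ≤ Real.exp 1 * σ * Real.log p := by
        have : (p:ℝ) ^ σ = Real.exp (σ * Real.log p) := by rw [Real.rpow_def_of_pos hp0, mul_comm]
        rw [this]
        set x := σ * Real.log p
        have hx : 0 ≤ x := by positivity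
        have hx1 : x ≤ 1 := by
          simp only [x, hσ]
          rw [one_div, inv_mul_le_iff₀ hl, mul_one]
          apply Real.log_le_log hp0
          exact_mod_cast (Nat.lt_of_mem_primesBelow hp).le
        have h3 : Real.exp x - 1 ≤ x * Real.exp x := by
          have := Real.add_one_le_exp (-x)
          have h4 : Real.exp x * Real.exp (-x) = 1 := by rw [← Real.exp_add]; simp
          nlinarith [Real.exp_pos x]
        have h5 : Real.exp x ≤ Real.exp 1 := Real.exp_le_exp.2 hx1
        calc Real.exp x - 1 ≤ x * Real.exp x := h3
          _ ≤ x * Real.exp 1 := by gcongr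
          _ = _ := by simp only [x]; ring
      set hv := s.selbergTerms p
      have h7 : hv * ((p:ℝ) ^ σ - 1) ≤ 6 * Real.exp 1 * σ * (Real.log p / p) := by
        have : 0 ≤ (p:ℝ) ^ σ - 1 := by have := Real.one_le_rpow hp1 hσ0.le; linarith
        calc hv * ((p:ℝ) ^ σ - 1) ≤ 6 / p * (Real.exp 1 * σ * Real.log p) := by gcongr
          _ = _ := by ring
      have h8 := Real.add_one_le_exp (6 * Real.exp 1 * σ * (Real.log p / p))
      have h9 : 0 ≤ 6 * Real.exp 1 * σ * (Real.log p / p) := by positivity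
      nlinarith
    calc _ ≤ ∏ p ∈ z.primesBelow, (Real.exp (6 * Real.exp 1 * σ * (Real.log p / p)) * (1 + s.selbergTerms p)) := by
          apply Finset.prod_le_prod _ h1
          intro p hp
          have hpp := Nat.prime_of_mem_primesBelow hp
          rw [htt p hpp.ne_zero]
          have : 0 < s.selbergTerms p := by
            apply hpos; rw [Nat.mem_divisors]
            exact ⟨Finset.dvd_prod_of_mem _ hp, (PP_squarefree z).ne_zero⟩
          positivity
      _ ≤ _ := by
          rw [Finset.prod_mul_distrib]
          have hnn : 0 ≤ ∏ p ∈ z.primesBelow, (1 + s.selbergTerms p) := by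
            apply Finset.prod_nonneg
            intro p hp
            have : 0 < s.selbergTerms p := by
              apply hpos; rw [Nat.mem_divisors]
              exact ⟨Finset.dvd_prod_of_mem _ hp, (PP_squarefree z).ne_zero⟩
            positivity
          apply mul_le_mul_of_nonneg_right _ hnn
          rw [← Real.exp_sum, Real.exp_le_exp, ← mul_sum]
          calc 6 * Real.exp 1 * σ * ∑ p ∈ z.primesBelow, Real.log p / p ≤ 6 * Real.exp 1 * σ * (Real.log z + C0) := by
                gcongr; exact hm z hz
            _ = 6 * Real.exp 1 * (1 + σ * C0) := by rw [hσ]; field_simp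
            _ ≤ _ := by
                gcongr
                rw [hσ, div_le_iff₀ hl]; linarith
  have hRs : (R:ℝ) ^ (-σ) ≤ Real.exp (-A) := by
    have h1 : ((z:ℝ) ^ A) ^ (-σ) = Real.exp (-A) := by
      rw [Real.rpow_def_of_pos (by positivity), Real.log_pow, hσ]
      congr 1; field_simp
    rw [← h1]
    apply Real.rpow_le_rpow_of_nonpos (by positivity) (by exact_mod_cast hR) (by linarith)
  have hV : 0 < V one1 z * V χ z := mul_pos (V_pos one1_RC z) (V_pos hc z)
  have split := sum_filter_add_sum_filter_not (PP z).divisors (fun l => l ≤ R) (fun l => s.selbergTerms l)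
  rw [hsum] at split
  have final : ∑ l ∈ (PP z).divisors with ¬ l ≤ R, s.selbergTerms l ≤ 1 / 2 * (V one1 z * V χ z) := by
    refine tail.trans ?_
    calc (R:ℝ) ^ (-σ) * ∑ l ∈ (PP z).divisors, tt l ≤ Real.exp (-A) * (Real.exp (6 * Real.exp 1 * (1 + 2 * C0)) * (V one1 z * V χ z)) := by
          gcongr
          apply sum_nonneg
          intro l hl
          rw [htt l (Nat.pos_of_mem_divisors hl).ne']
          have := hpos l hl
          positivity
      _ = Real.exp (6 * Real.exp 1 * (1 + 2 * C0) - A) * (V one1 z * V χ z) := by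
          rw [← mul_assoc, ← Real.exp_add]; congr 2; ring
      _ ≤ Real.exp (-1) * (V one1 z * V χ z) := by
          gcongr; linarith
      _ ≤ _ := by
          gcongr
          rw [Real.exp_neg, inv_eq_one_div]
          apply one_div_le_one_div_of_le (by norm_num)
          have := Real.add_one_le_exp (1:ℝ); linarith
  linarith

lemma sieve_raw : ∃ A : ℕ, 1 ≤ A ∧ ∀ (χ : ℕ →*₀ ℝ) (B : ℝ) (z : ℕ) (Y : ℝ), RC χ → PS χ B → 1 ≤ B → 0 ≤ Lv χ 1 → 2 ≤ z → 0 ≤ Y →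
    ∑ n ∈ Ioc 0 ⌊Y⌋₊ with (PP z).Coprime n, gg χ n ≤
      2 * (Y * Lv χ 1 / (V one1 z * V χ z)) + (z:ℝ) ^ (10 * A) * (5 * √B * √Y) := by
  obtain ⟨A, hA1, hA⟩ := hsum_trunc
  refine ⟨A, hA1, fun χ B z Y hc h hB hL hz hY => ?_⟩
  set s := sv χ hc z ⌊Y⌋₊ (Y * Lv χ 1) with hs
  have hR : 1 ≤ z ^ A := Nat.one_le_pow _ _ (by omega)
  have hz0 : (0:ℝ) < z := by exact_mod_cast (by omega : 0 < z)
  have := selberg s (z ^ A) hR (((z:ℝ) ^ A) ^ 2) (((z:ℝ) ^ A) ^ 4 * (5 * √B * √Y)) (by positivity) (by positivity) ?_ ?_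
  · have e : s.siftedSum = ∑ n ∈ Ioc 0 ⌊Y⌋₊ with (PP z).Coprime n, gg χ n := by
      rw [sum_filter]; rfl
    rw [e] at this
    refine this.trans ?_
    apply add_le_add
    · have h1 := hA χ hc z ⌊Y⌋₊ (Y * Lv χ 1) (z ^ A) hz le_rfl
      have hV : 0 < V one1 z * V χ z := mul_pos (V_pos one1_RC z) (V_pos hc z)
      set T := ∑ l ∈ (PP z).divisors with l ≤ z ^ A, s.selbergTerms l
      change Y * Lv χ 1 * T⁻¹ ≤ _
      have hT : (V one1 z * V χ z) / 2 ≤ T := by linarith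
      have : T⁻¹ ≤ ((V one1 z * V χ z) / 2)⁻¹ := inv_anti₀ (by positivity) hT
      calc Y * Lv χ 1 * T⁻¹ ≤ Y * Lv χ 1 * ((V one1 z * V χ z) / 2)⁻¹ := by gcongr
        _ = _ := by rw [inv_div]; ring
    · apply le_of_eq; push_cast; ring
  · intro d hd hdR
    change (nuf χ d)⁻¹ ≤ _
    have hd' : d ∣ PP z := hd
    have hd0 : d ≠ 0 := ne_zero_of_dvd_ne_zero (PP_squarefree z).ne_zero hd'
    have hsd : Squarefree d := (PP_squarefree z).squarefree_of_dvd hd'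
    have h1 : 1 / (d:ℝ) ^ 2 ≤ nuf χ d := by
      rw [nuf, prodPrimeFactors_apply hd0]
      have : (1 / (d:ℝ) ^ 2) = ∏ p ∈ d.primeFactors, 1 / (p:ℝ) ^ 2 := by
        conv_lhs => rw [← Nat.prod_primeFactors_of_squarefree hsd]
        push_cast
        rw [← Finset.prod_pow, one_div, ← Finset.prod_inv_distrib]
        simp
      rw [this]
      apply Finset.prod_le_prod
      · intro p hp; positivity
      · intro p hp; exact (nup_bounds hc (Nat.prime_of_mem_primeFactors hp)).1
    have hdp : (0:ℝ) < d := by exact_mod_cast Nat.pos_of_ne_zero hd0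
    calc (nuf χ d)⁻¹ ≤ (1 / (d:ℝ) ^ 2)⁻¹ := inv_anti₀ (by positivity) h1
      _ = (d:ℝ) ^ 2 := by simp
      _ ≤ _ := by gcongr; exact_mod_cast hdR
  · intro e he heR
    have he' : e ∣ PP z := he
    have hse : Squarefree e := (PP_squarefree z).squarefree_of_dvd he'
    have h1 := AA_approx hc h hB e hse Y hY
    have e2 : s.rem e = AA χ e ⌊Y⌋₊ - nuf χ e * Y * Lv χ 1 := by
      rw [BoundingSieve.rem, BoundingSieve.multSum, AA, sum_filter]
      change _ - nuf χ e * (Y * Lv χ 1) = _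
      rw [mul_assoc]; rfl
    rw [e2]
    refine h1.trans ?_
    gcongr
    calc (e:ℝ) ^ 2 ≤ (((z:ℝ) ^ A) ^ 2) ^ 2 := by gcongr; exact_mod_cast heR
      _ = _ := by ring

lemma V_le_V_one {χ : ℕ →*₀ ℝ} (hc : RC χ) (z : ℕ) : V χ z ≤ V one1 z := by
  have := V_ratio_up hc (Nat.zero_le z)
  simpa [V, E, EP] using this

/-- Sieve in usable form -/
lemma sieve_app : ∃ A : ℕ, ∃ C : ℝ, 0 < C ∧ ∀ (χ : ℕ →*₀ ℝ) (B : ℝ) (z : ℕ) (Y : ℝ), RC χ → PS χ B → 1 ≤ B → 0 ≤ Lv χ 1 → 2 ≤ z → 0 ≤ Y →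
    (z:ℝ) ^ A * √B ≤ Lv χ 1 * √Y →
    ∑ n ∈ Ioc 0 ⌊Y⌋₊ with (PP z).Coprime n, gg χ n ≤ C * (Y * Lv χ 1 / (V one1 z * V χ z)) := by
  obtain ⟨A, hA1, hA⟩ := sieve_raw
  obtain ⟨C1, hC1, hV1⟩ := V_one_le
  refine ⟨10 * A + 2, 2 + 5 * C1 ^ 2, by positivity, ?_⟩
  intro χ B z Y hc h hB hL hz hY hcond
  refine (hA χ B z Y hc h hB hL hz hY).trans ?_
  have hV : 0 < V one1 z * V χ z := mul_pos (V_pos one1_RC z) (V_pos hc z)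
  have hz1 : (1:ℝ) ≤ z := by exact_mod_cast (by omega : 1 ≤ z)
  have hlog : Real.log z ≤ z := (Real.log_le_sub_one_of_pos (by linarith)).trans (by linarith)
  have hV2 : V one1 z * V χ z ≤ C1 ^ 2 * (z:ℝ) ^ 2 := by
    have a1 : V one1 z ≤ C1 * z := (hV1 z hz).trans (by gcongr)
    have a2 := V_le_V_one hc z
    have a3 := V_pos hc z
    have a4 := V_pos one1_RC z
    calc V one1 z * V χ z ≤ (C1 * z) * (C1 * z) := by gcongr; linarith
      _ = _ := by ring
  have key : (z:ℝ) ^ (10 * A) * (5 * √B * √Y) ≤ 5 * C1 ^ 2 * (Y * Lv χ 1 / (V one1 z * V χ z)) := by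
    rw [← mul_div_assoc, le_div_iff₀ hV]
    calc (z:ℝ) ^ (10 * A) * (5 * √B * √Y) * (V one1 z * V χ z) ≤ (z:ℝ) ^ (10 * A) * (5 * √B * √Y) * (C1 ^ 2 * (z:ℝ) ^ 2) := by gcongr
      _ = 5 * C1 ^ 2 * √Y * ((z:ℝ) ^ (10 * A + 2) * √B) := by rw [pow_add]; ring
      _ ≤ 5 * C1 ^ 2 * √Y * (Lv χ 1 * √Y) := by gcongr
      _ = 5 * C1 ^ 2 * ((√Y * √Y) * Lv χ 1) := by ring
      _ = _ := by rw [Real.mul_self_sqrt hY]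
  linarith

end BQ
end part_A8

section part_A9
set_option linter.unusedVariables false
open Finset Filter Topology

namespace BQ
open ArithmeticFunction
open scoped ArithmeticFunction.zeta

lemma abel_div {a : ℕ → ℝ} {D : ℝ} (ha : ∀ n, 0 ≤ a n) {N0 N : ℕ} (h0 : 1 ≤ N0) (hN : N0 ≤ N)
    (hD : ∀ n, N0 ≤ n → n ≤ N → ∑ k ∈ Ioc 0 n, a k ≤ D * n) :
    ∑ n ∈ Ioc N0 N, a n / n ≤ D * (2 + Real.log N) := by
  have key : ∑ n ∈ Ioc N0 N, a n / n ≤ (∑ k ∈ Ioc 0 N, a k) / N + D * ∑ n ∈ Ioc N0 N, (1:ℝ) / n := by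
    induction N, hN using Nat.le_induction with
    | base =>
      simp only [Ioc_self, sum_empty, mul_zero, add_zero]
      exact div_nonneg (sum_nonneg fun k _ => ha k) (by positivity)
    | succ N hN ih =>
      have ih := ih (fun n h1 h2 => hD n h1 (by omega))
      have hG := hD N hN (by omega)
      rw [sum_Ioc_succ_top hN, sum_Ioc_succ_top hN, sum_Ioc_succ_top (Nat.zero_le N)]
      set G := ∑ k ∈ Ioc 0 N, a k
      have hNp : (0:ℝ) < N := by exact_mod_cast (by omega : 0 < N)
      push_cast
      have h1 : G / N ≤ G / (N + 1) + D * (1 / (N + 1)) := by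
        rw [div_add' _ _ _ (by positivity), div_le_div_iff₀ hNp (by positivity)]
        field_simp
        nlinarith
      have : (G + a (N+1)) / ((N:ℝ) + 1) = G / (N+1) + a (N+1) / (N+1) := by ring
      rw [this]
      linarith
  have hNp : (0:ℝ) < N := by exact_mod_cast (by omega : 0 < N)
  have hG := hD N hN le_rfl
  have hG0 : 0 ≤ ∑ k ∈ Ioc 0 N, a k := sum_nonneg fun k _ => ha k
  have hD0 : 0 ≤ D := by
    by_contra hneg
    push Not at hneg
    nlinarith
  have h1 : (∑ k ∈ Ioc 0 N, a k) / N ≤ D := by rwa [div_le_iff₀ hNp]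
  have h2 : ∑ n ∈ Ioc N0 N, (1:ℝ) / n ≤ 1 + Real.log N := by
    refine le_trans (sum_le_sum_of_subset_of_nonneg (Ioc_subset_Ioc_left (Nat.zero_le _)) (fun _ _ _ => by positivity)) (sum_inv_le N)
  nlinarith

lemma sqrt_log_le (η : ℝ) (hη : 0 < η) : ∃ n0 : ℕ, 1 ≤ n0 ∧ ∀ n : ℕ, n0 ≤ n → 2 * √(n:ℝ) * Real.log n ≤ η * n := by
  have h := (isLittleO_log_rpow_atTop (show (0:ℝ) < 1/2 by norm_num)).def (show 0 < η / 2 by positivity)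
  have h2 := tendsto_natCast_atTop_atTop (R := ℝ) |>.eventually h
  obtain ⟨n0, hn0⟩ := eventually_atTop.1 h2
  refine ⟨max n0 1, le_max_right _ _, fun n hn => ?_⟩
  have hn1 : 1 ≤ n := (le_max_right _ _).trans hn
  have := hn0 n ((le_max_left _ _).trans hn)
  rw [Real.norm_eq_abs, Real.norm_eq_abs, ← Real.sqrt_eq_rpow, abs_of_nonneg (Real.sqrt_nonneg _)] at this
  have h3 := (le_abs_self _).trans this
  have h4 : √(n:ℝ) * √n = n := Real.mul_self_sqrt (by positivity)
  nlinarith [Real.sqrt_nonneg (n:ℝ)]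

lemma nonprime_small (η : ℝ) (hη : 0 < η) : ∃ n0 : ℕ, 1 ≤ n0 ∧ ∀ N0 N : ℕ, n0 ≤ N0 → N0 ≤ N →
    ∑ n ∈ Ioc N0 N, (if n.Prime then 0 else Λ n) / n ≤ η * (2 + Real.log N) := by
  obtain ⟨n0, h1, h2⟩ := sqrt_log_le η hη
  refine ⟨n0, h1, fun N0 N h3 h4 => ?_⟩
  apply abel_div (fun n => by split_ifs; exact le_rfl; exact vonMangoldt_nonneg) (by omega) h4
  intro n hn _
  refine le_trans ?_ (h2 n (by omega))
  have h5 := Chebyshev.psi_sub_theta_le (x := n) (by exact_mod_cast (by omega : 1 ≤ n))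
  refine le_trans (le_of_eq ?_) h5
  rw [Chebyshev.psi_sub_theta_eq_sum_not_prime, Nat.floor_natCast, sum_filter]
  apply sum_congr rfl
  intro k _
  split_ifs <;> simp_all

lemma eta1 {ψ : ℕ →*₀ ℝ} {B : ℝ} (hψ : RC ψ) (h : PS ψ B) (hL : Lv ψ 1 ≠ 0) :
    ∃ n0 : ℕ, 1 ≤ n0 ∧ ∀ N0 N : ℕ, n0 ≤ N0 → N0 ≤ N → 5 * Real.log N0 ≤ 4 * Real.log N → ∀ χ : ℕ →*₀ ℝ, RC χ →
      1 / 20 * Real.log N ≤ ∑ p ∈ Ioc N0 N with p.Prime, (gg χ p + gg (ψ * χ) p) * (Real.log p / p) := by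
  obtain ⟨C1, hC1, m1⟩ := mertens_upper
  obtain ⟨C2, hC2, m2⟩ := mertens_twist hψ h hL
  obtain ⟨n1, hn1, np⟩ := nonprime_small (1/40) (by norm_num)
  obtain ⟨n2, hn2⟩ := exists_nat_gt (Real.exp (10 * (2 + C1 + 2 * C2)))
  refine ⟨max n1 n2, hn1.trans (le_max_left _ _), ?_⟩
  intro N0 N h0 hN hlog χ hχ
  have hN01 : 1 ≤ N0 := hn1.trans ((le_max_left _ _).trans h0)
  have hN1 : 1 ≤ N := hN01.trans hN
  have hbig : 10 * (2 + C1 + 2 * C2) ≤ Real.log N := by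
    rw [Real.le_log_iff_exp_le (by exact_mod_cast hN1)]
    refine hn2.le.trans ?_
    exact_mod_cast ((le_max_right _ _).trans h0).trans hN
  have a1 := mertens_lower N hN1
  have a2 := m1 N0 hN01
  have a3 := abs_le.1 (m2 N hN1)
  have a4 := abs_le.1 (m2 N0 hN01)
  have a5 := np N0 N ((le_max_left _ _).trans h0) hN
  have s1 := sum_Ioc_sub (fun n => Λ n / n) hN
  have s2 := sum_Ioc_sub (fun n => ψ n * (Λ n / n)) hN
  have main : ∑ n ∈ Ioc N0 N, (1 - ψ n) * (Λ n / n) ≤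
      ∑ p ∈ Ioc N0 N with p.Prime, (gg χ p + gg (ψ * χ) p) * (Real.log p / p) + 2 * ∑ n ∈ Ioc N0 N, (if n.Prime then 0 else Λ n) / n := by
    rw [sum_filter, mul_sum, ← sum_add_distrib]
    apply sum_le_sum
    intro n hn
    have hn0 : 0 ≤ (Λ n / n : ℝ) := div_nonneg vonMangoldt_nonneg (by positivity)
    by_cases hp : n.Prime
    · rw [if_pos hp, if_pos hp, vonMangoldt_apply_prime hp, zero_div, mul_zero, add_zero]
      have g1 := gg_prime_pow χ hp 1
      have g2 := gg_prime_pow (ψ * χ) hp 1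
      rw [pow_one] at g1 g2
      rw [g1, g2]
      have e : (ψ * χ) n = ψ n * χ n := rfl
      simp only [sum_range_succ, range_zero, sum_empty, pow_zero, pow_one, zero_add, e]
      rw [vonMangoldt_apply_prime hp] at hn0
      apply mul_le_mul_of_nonneg_right _ hn0
      have := hψ.neg_one_le n
      have := hχ.neg_one_le n
      nlinarith
    · rw [if_neg hp, if_neg hp, zero_add]
      apply mul_le_mul_of_nonneg_right _ hn0
      have := hψ.neg_one_le n
      linarith
  have e : ∑ n ∈ Ioc N0 N, (1 - ψ n) * (Λ n / n) = ∑ n ∈ Ioc N0 N, Λ n / n - ∑ n ∈ Ioc N0 N, ψ n * (Λ n / n) := by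
    rw [← sum_sub_distrib]; apply sum_congr rfl; intro n _; ring
  rw [e] at main
  have hl : 0 ≤ Real.log N := Real.log_natCast_nonneg N
  linarith

lemma eta2 {χ : ℕ →*₀ ℝ} (hχ : RC χ) {D : ℝ} {z N0 N : ℕ} (h0 : 1 ≤ N0) (hN : N0 ≤ N) (hz : z ≤ N0)
    (hD : ∀ n, N0 ≤ n → n ≤ N → ∑ k ∈ Ioc 0 n with (PP z).Coprime k, gg χ k ≤ D * n) :
    ∑ p ∈ Ioc N0 N with p.Prime, gg χ p * (Real.log p / p) ≤ Real.log N * (D * (2 + Real.log N)) := by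
  have h1 := abel_div (a := fun k => if (PP z).Coprime k then gg χ k else 0) (D := D)
    (fun n => by split_ifs; exact gg_nonneg hχ n; exact le_rfl) h0 hN
    (fun n a b => by rw [← sum_filter]; exact hD n a b)
  have hl : 0 ≤ Real.log N := Real.log_natCast_nonneg N
  refine le_trans ?_ (mul_le_mul_of_nonneg_left h1 hl)
  rw [mul_sum, sum_filter]
  apply sum_le_sum
  intro n hn
  rw [mem_Ioc] at hn
  have hg := gg_nonneg hχ n
  split_ifs with hp hc hc
  · have : Real.log n ≤ Real.log N := Real.log_le_log (by exact_mod_cast (by omega : 0 < n)) (by exact_mod_cast hn.2)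
    calc gg χ n * (Real.log n / n) = Real.log n * (gg χ n / n) := by ring
      _ ≤ _ := by gcongr
  · exfalso
    apply hc
    rw [coprime_PP]
    intro q hq hqn
    rw [(Nat.prime_dvd_prime_iff_eq hq hp).1 hqn]
    omega
  · positivity
  · simp

end BQ
end part_A9

section part_B1
set_option linter.unusedVariables false
open Finset Filter Topology

namespace BQ
open ArithmeticFunction
open scoped ArithmeticFunction.zeta

lemma div_bound (ε : ℝ) (hε : 0 < ε) : ∃ C : ℝ, 1 ≤ C ∧ ∀ n : ℕ, n ≠ 0 → ((n.divisors.card : ℕ) : ℝ) ≤ C * (n:ℝ) ^ ε := by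
  -- (k+1) ≤ C1 * 2^(ε k)
  obtain ⟨C1, hC1, h1⟩ : ∃ C1 : ℝ, 1 ≤ C1 ∧ ∀ k : ℕ, (k:ℝ) + 1 ≤ C1 * ((2:ℝ) ^ ε) ^ k := by
    set q := (2:ℝ) ^ ε with hq
    have hq1 : 1 < q := Real.one_lt_rpow (by norm_num) hε
    refine ⟨1 + 1 / (q - 1), ?_, ?_⟩
    · have : 0 < 1 / (q - 1) := by apply div_pos <;> linarith
      linarith
    intro k
    have hb : 1 + (k:ℝ) * (q - 1) ≤ q ^ k := by
      have := one_add_mul_le_pow (a := q - 1) (by linarith) k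
      simpa using this
    have hk1 : 1 ≤ q ^ k := one_le_pow₀ hq1.le
    have : (k:ℝ) ≤ 1 / (q - 1) * q ^ k := by
      rw [div_mul_eq_mul_div, le_div_iff₀ (by linarith)]; linarith
    linarith
  obtain ⟨P0, hP0⟩ := exists_nat_gt ((2:ℝ) ^ (1 / ε))
  refine ⟨C1 ^ P0, one_le_pow₀ hC1, ?_⟩
  intro n hn
  rw [Nat.card_divisors hn]
  push_cast
  have hprod : ∏ p ∈ n.primeFactors, ((p:ℝ) ^ ε) ^ (n.factorization p) = (n:ℝ) ^ ε := by
    conv_rhs => rw [← Nat.prod_factorization_pow_eq_self hn]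
    rw [Finsupp.prod, Nat.support_factorization, Nat.cast_prod, ← Real.finsetProd_rpow]
    · apply Finset.prod_congr rfl
      intro p hp
      push_cast
      rw [← Real.rpow_natCast, ← Real.rpow_natCast, ← Real.rpow_mul (by positivity), ← Real.rpow_mul (by positivity), mul_comm]
    · intros; positivity
  calc ∏ x ∈ n.primeFactors, ((n.factorization x : ℝ) + 1)
      ≤ ∏ p ∈ n.primeFactors, ((if p < P0 then C1 else 1) * ((p:ℝ) ^ ε) ^ (n.factorization p)) := by
        apply Finset.prod_le_prod
        · intros; positivity
        intro p hp
        have hp2 : 2 ≤ p := (Nat.prime_of_mem_primeFactors hp).two_le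
        split_ifs with h
        · refine (h1 _).trans ?_
          gcongr
          exact_mod_cast hp2
        · rw [one_mul]
          have h2 : (2:ℝ) ≤ (p:ℝ) ^ ε := by
            have : (2:ℝ) ^ (1/ε) ≤ p := hP0.le.trans (by exact_mod_cast not_lt.mp h)
            calc (2:ℝ) = ((2:ℝ) ^ (1/ε)) ^ ε := by
                  rw [← Real.rpow_mul (by norm_num), one_div, inv_mul_cancel₀ hε.ne', Real.rpow_one]
              _ ≤ _ := by gcongr
          have h3 : (n.factorization p : ℝ) + 1 ≤ 2 ^ (n.factorization p) := by
            exact_mod_cast Nat.lt_two_pow_self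
          exact h3.trans (by gcongr)
    _ = (∏ p ∈ n.primeFactors, (if p < P0 then C1 else 1)) * (n:ℝ) ^ ε := by
        rw [Finset.prod_mul_distrib, hprod]
    _ ≤ _ := by
        gcongr
        rw [← Finset.prod_filter, Finset.prod_const]
        apply pow_le_pow_right₀ hC1
        calc _ ≤ (range P0).card := by
              apply Finset.card_le_card
              intro p; simp
          _ = P0 := by simp

lemma gg_le_div {χ : ℕ →*₀ ℝ} (hχ : RC χ) (n : ℕ) : |gg χ n| ≤ (n.divisors.card : ℝ) := by
  rw [gg, ArithmeticFunction.mul_apply]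
  refine (Finset.abs_sum_le_sum_abs _ _).trans ?_
  calc _ ≤ ∑ x ∈ n.divisorsAntidiagonal, (1:ℝ) := by
        apply Finset.sum_le_sum
        intro x hx
        rw [abs_mul, af_apply, af_apply]
        have := one1_RC.abs_le x.1
        have := hχ.abs_le x.2
        exact mul_le_one₀ ‹_› (abs_nonneg _) ‹_›
    _ = _ := by
        rw [Finset.sum_const, nsmul_eq_mul, mul_one, ← Nat.map_div_right_divisors, Finset.card_map]

lemma rr_le_div {ψ χ : ℕ →*₀ ℝ} (hψ : RC ψ) (hχ : RC χ) {n : ℕ} (hn : n ≠ 0) :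
    rr ψ χ n ≤ (n.divisors.card : ℝ) ^ 3 := by
  rw [rr_eq, ArithmeticFunction.mul_apply]
  refine (le_abs_self _).trans ((Finset.abs_sum_le_sum_abs _ _).trans ?_)
  calc _ ≤ ∑ x ∈ n.divisorsAntidiagonal, (n.divisors.card : ℝ) ^ 2 := by
        apply Finset.sum_le_sum
        intro x hx
        have hx' := Nat.mem_divisorsAntidiagonal.mp hx
        have a1 : |gg χ x.1| ≤ (n.divisors.card : ℝ) := (gg_le_div hχ _).trans (by
          exact_mod_cast Finset.card_le_card (Nat.divisors_subset_of_dvd hn ⟨x.2, hx'.1.symm⟩))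
        have a2 : |gg χ x.2| ≤ (n.divisors.card : ℝ) := (gg_le_div hχ _).trans (by
          exact_mod_cast Finset.card_le_card (Nat.divisors_subset_of_dvd hn ⟨x.1, by rw [mul_comm]; exact hx'.1.symm⟩))
        rw [abs_mul, ArithmeticFunction.pmul_apply, abs_mul, af_apply, sq]
        have a3 : |ψ x.2| * |gg χ x.2| ≤ (n.divisors.card : ℝ) := by
          have := hψ.abs_le x.2
          nlinarith [abs_nonneg (gg χ x.2)]
        exact mul_le_mul a1 a3 (by positivity) (by positivity)
    _ = _ := by
        rw [Finset.sum_const, nsmul_eq_mul, ← Nat.map_div_right_divisors, Finset.card_map]; ring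

lemma rr_bound (ε : ℝ) (hε : 0 < ε) : ∃ C : ℝ, 1 ≤ C ∧ ∀ ψ χ : ℕ →*₀ ℝ, RC ψ → RC χ → ∀ N n : ℕ, n ≠ 0 → n ≤ N →
    rr ψ χ n ≤ C * (N:ℝ) ^ ε := by
  obtain ⟨C, hC, h⟩ := div_bound (ε/3) (by positivity)
  refine ⟨C ^ 3, one_le_pow₀ hC, ?_⟩
  intro ψ χ hψ hχ N n hn hnN
  refine (rr_le_div hψ hχ hn).trans ?_
  calc _ ≤ (C * (n:ℝ) ^ (ε/3)) ^ 3 := by gcongr; exact h n hn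
    _ = C ^ 3 * (n:ℝ) ^ ε := by
      rw [mul_pow, ← Real.rpow_natCast, ← Real.rpow_natCast ((n:ℝ)^(ε/3)), ← Real.rpow_mul (by positivity)]; congr 2; push_cast; ring
    _ ≤ _ := by gcongr

/-- the part of n supported on the primes of S -/
noncomputable def Q (n : ℕ) (S : Finset ℕ) : ℕ := ∏ p ∈ S, p ^ n.factorization p

lemma Q_all {n : ℕ} (hn : n ≠ 0) : Q n n.primeFactors = n := by
  conv_rhs => rw [← Nat.prod_factorization_pow_eq_self hn]
  rfl

lemma Q_mul (n : ℕ) {S T : Finset ℕ} (h : S ⊆ T) : Q n (T \ S) * Q n S = Q n T := Finset.prod_sdiff h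

lemma Q_pos {n : ℕ} {S : Finset ℕ} (h : S ⊆ n.primeFactors) : 0 < Q n S :=
  Finset.prod_pos fun p hp => pow_pos (Nat.prime_of_mem_primeFactors (h hp)).pos _

lemma Q_prime_dvd {n : ℕ} {S : Finset ℕ} (h : S ⊆ n.primeFactors) {p : ℕ} (hp : p.Prime) (hd : p ∣ Q n S) : p ∈ S := by
  rw [Q, hp.prime.dvd_finsetProd_iff] at hd
  obtain ⟨q, hq, hd⟩ := hd
  have := (Nat.prime_dvd_prime_iff_eq hp (Nat.prime_of_mem_primeFactors (h hq))).mp (hp.dvd_of_dvd_pow hd)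
  rwa [this]

lemma Q_coprime {n : ℕ} {S T : Finset ℕ} (h : S ⊆ n.primeFactors) (hT : T ⊆ n.primeFactors) (hd : Disjoint S T) :
    (Q n S).Coprime (Q n T) := by
  apply Nat.coprime_of_dvd
  intro p hp h1 h2
  exact Finset.disjoint_left.mp hd (Q_prime_dvd h hp h1) (Q_prime_dvd hT hp h2)

lemma Q_choose {n : ℕ} {Y T : ℝ} (S0 : Finset ℕ) (hY : (Q n S0 : ℝ) < Y) (R : Finset ℕ) (hdis : Disjoint S0 R)
    (hT : ∀ p ∈ R, ((p ^ n.factorization p : ℕ) : ℝ) ≤ T) (h1 : Y ≤ (Q n (S0 ∪ R) : ℝ)) :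
    ∃ S, S0 ⊆ S ∧ S ⊆ S0 ∪ R ∧ Y ≤ (Q n S : ℝ) ∧ (Q n S : ℝ) ≤ Y * T := by
  induction R using Finset.induction_on with
  | empty => simp at h1; linarith
  | insert p R hp ih =>
    by_cases h : Y ≤ (Q n (S0 ∪ R) : ℝ)
    · obtain ⟨S, a, b, c⟩ := ih (Finset.disjoint_of_subset_right (Finset.subset_insert _ _) hdis)
        (fun q hq => hT q (Finset.mem_insert_of_mem hq)) h
      exact ⟨S, a, b.trans (by gcongr; exact Finset.subset_insert _ _), c⟩
    · push Not at h
      refine ⟨_, Finset.subset_union_left, subset_rfl, h1, ?_⟩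
      have hp' : p ∉ S0 ∪ R := by
        rw [Finset.mem_union]; rintro (h' | h')
        · exact Finset.disjoint_left.mp hdis h' (Finset.mem_insert_self _ _)
        · exact hp h'
      rw [Finset.union_insert, Q, Finset.prod_insert hp', Nat.cast_mul, mul_comm]
      have := hT p (Finset.mem_insert_self _ _)
      have h0 : (0:ℝ) < Y := lt_of_le_of_lt (by positivity) hY
      exact mul_le_mul h.le this (by positivity) h0.le

/-- union bound -/
lemma sum_le_pairs {f : ℕ → ℝ} (hf : ∀ n, 0 ≤ f n) (A : Finset ℕ) (P : Finset (ℕ × ℕ))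
    (h : ∀ n ∈ A, ∃ x ∈ P, x.1 * x.2 = n) : ∑ n ∈ A, f n ≤ ∑ x ∈ P, f (x.1 * x.2) := by
  classical
  calc ∑ n ∈ A, f n ≤ ∑ n ∈ P.image (fun x => x.1 * x.2), f n := by
        apply Finset.sum_le_sum_of_subset_of_nonneg
        · intro n hn
          obtain ⟨x, hx, rfl⟩ := h n hn
          exact Finset.mem_image_of_mem _ hx
        · intros; exact hf _
    _ ≤ _ := Finset.sum_image_le_of_nonneg (fun _ _ => hf _)

lemma count_mult (N q : ℕ) : (((Ioc 0 N).filter (q ∣ ·)).card : ℝ) ≤ (N:ℝ) / q := by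
  rw [Nat.Ioc_filter_dvd_card_eq_div]
  exact Nat.cast_div_le

open Classical in
/-- D1 -/
lemma D1_count (N z : ℕ) {T : ℝ} (hT : 0 < T) :
    (((Ioc 0 N).filter (fun n => ∃ p < z, p.Prime ∧ T < ((p ^ n.factorization p : ℕ) : ℝ))).card : ℝ) ≤
      z * (1 + Nat.log 2 N) * (N / T) := by

  have hsub : (Ioc 0 N).filter (fun n => ∃ p < z, p.Prime ∧ T < ((p ^ n.factorization p : ℕ) : ℝ)) ⊆
      ((range z ×ˢ range (1 + Nat.log 2 N)).filter (fun x => T < ((x.1 ^ x.2 : ℕ) : ℝ))).biUnion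
        (fun x => (Ioc 0 N).filter (x.1 ^ x.2 ∣ ·)) := by
    intro n hn
    simp only [Finset.mem_filter, Finset.mem_Ioc] at hn
    obtain ⟨⟨h0, h1⟩, p, hp, hpp, hpT⟩ := hn
    simp only [Finset.mem_biUnion, Finset.mem_filter, Finset.mem_product, Finset.mem_range, Finset.mem_Ioc]
    refine ⟨(p, n.factorization p), ⟨⟨hp, ?_⟩, hpT⟩, ⟨h0, h1⟩, Nat.ordProj_dvd n p⟩
    have h2 : 2 ^ n.factorization p ≤ N :=
      (Nat.pow_le_pow_left hpp.two_le _).trans ((Nat.le_of_dvd h0 (Nat.ordProj_dvd n p)).trans h1)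
    have := Nat.le_log_of_pow_le (by norm_num) h2
    simp only; omega
  calc _ ≤ ((((range z ×ˢ range (1 + Nat.log 2 N)).filter (fun x => T < ((x.1 ^ x.2 : ℕ) : ℝ))).biUnion
        (fun x => (Ioc 0 N).filter (x.1 ^ x.2 ∣ ·))).card : ℝ) := by exact_mod_cast Finset.card_le_card hsub
    _ ≤ ∑ x ∈ (range z ×ˢ range (1 + Nat.log 2 N)).filter (fun x => T < ((x.1 ^ x.2 : ℕ) : ℝ)),
        (((Ioc 0 N).filter (x.1 ^ x.2 ∣ ·)).card : ℝ) := by exact_mod_cast Finset.card_biUnion_le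
    _ ≤ ∑ x ∈ (range z ×ˢ range (1 + Nat.log 2 N)).filter (fun x => T < ((x.1 ^ x.2 : ℕ) : ℝ)), (N / T : ℝ) := by
        apply Finset.sum_le_sum
        intro x hx
        have := (Finset.mem_filter.mp hx).2
        refine (count_mult N _).trans ?_
        gcongr
    _ ≤ ∑ x ∈ (range z ×ˢ range (1 + Nat.log 2 N)), (N / T : ℝ) := by
        apply Finset.sum_le_sum_of_subset_of_nonneg (Finset.filter_subset _ _)
        intros; positivity
    _ = _ := by
        rw [Finset.sum_const, Finset.card_product, Finset.card_range, Finset.card_range]; push_cast [nsmul_eq_mul]; ring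

open Classical in
/-- D2 -/
lemma D2_count (N z : ℕ) {T : ℝ} (hT : 0 < T) :
    (((Ioc 0 N).filter (fun n => ∃ m ∈ z.smoothNumbers, T ≤ m ∧ m ∣ n)).card : ℝ) ≤
      N * (T ^ (-(1/2 : ℝ)) * E one1 (1/2) z) := by

  set F := (Ioc 0 N).filter (fun m => m ∈ z.smoothNumbers ∧ T ≤ (m:ℝ)) with hF
  have hsub : (Ioc 0 N).filter (fun n => ∃ m ∈ z.smoothNumbers, T ≤ m ∧ m ∣ n) ⊆
      F.biUnion (fun m => (Ioc 0 N).filter (m ∣ ·)) := by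
    intro n hn
    simp only [Finset.mem_filter, Finset.mem_Ioc] at hn
    obtain ⟨⟨h0, h1⟩, m, hm, hmT, hd⟩ := hn
    simp only [Finset.mem_biUnion, Finset.mem_filter, Finset.mem_Ioc, hF]
    exact ⟨m, ⟨⟨Nat.pos_of_dvd_of_pos hd h0, (Nat.le_of_dvd h0 hd).trans h1⟩, hm, hmT⟩, ⟨h0, h1⟩, hd⟩
  have h1 := rankin_tail (a := af one1) one1_nonneg (σ := 1/2) (by norm_num) hT (z := z)
    (hasSum_one (by norm_num) z) F (fun n hn => (Finset.mem_filter.mp hn).2)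
  calc _ ≤ ((F.biUnion (fun m => (Ioc 0 N).filter (m ∣ ·))).card : ℝ) := by exact_mod_cast Finset.card_le_card hsub
    _ ≤ ∑ m ∈ F, (((Ioc 0 N).filter (m ∣ ·)).card : ℝ) := by exact_mod_cast Finset.card_biUnion_le
    _ ≤ ∑ m ∈ F, (N : ℝ) * (af one1 m / m) := by
        apply Finset.sum_le_sum
        intro m hm
        have : m ≠ 0 := by have := (Finset.mem_filter.mp hm).1; rw [Finset.mem_Ioc] at this; omega
        refine (count_mult N _).trans ?_
        rw [af_apply, one1_apply this]
        apply le_of_eq; ring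
    _ = N * ∑ m ∈ F, af one1 m / m := by rw [Finset.mul_sum]
    _ ≤ _ := by
        have h2 : (1 - 1/2 : ℝ) = 1/2 := by norm_num
        rw [h2] at h1
        gcongr

end BQ
end part_B1

section part_B2
set_option linter.unusedVariables false
open Finset Filter Topology

namespace BQ
open ArithmeticFunction
open scoped ArithmeticFunction.zeta

lemma rough_omega {w k N : ℕ} (hw : 2 ≤ w) (hk : 0 < k) (hkN : k ≤ N) (h : (PP w).Coprime k) :
    (4:ℝ) ^ (cardFactors k) ≤ (4:ℝ) ^ (Real.log N / Real.log w) := by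
  rw [coprime_PP] at h
  have h1 : w ^ cardFactors k ≤ k := by
    rw [cardFactors_apply]
    conv_rhs => rw [← Nat.prod_primeFactorsList hk.ne']
    apply List.pow_card_le_prod
    intro p hp
    exact h p (Nat.prime_of_mem_primeFactorsList hp) (Nat.dvd_of_mem_primeFactorsList hp)
  rw [← Real.rpow_natCast]
  apply Real.rpow_le_rpow_of_exponent_le (by norm_num)
  have hlw : 0 < Real.log w := Real.log_pos (by exact_mod_cast hw)
  rw [le_div_iff₀ hlw, ← Real.log_pow]
  apply Real.log_le_log (by positivity)
  exact_mod_cast h1.trans hkN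

open Classical in
noncomputable def pairs (N w w' : ℕ) (M0 Y0 : ℝ) : Finset (ℕ × ℕ) :=
  (Ioc 0 N ×ˢ Ioc 0 N).filter fun x => x.1 * x.2 ≤ N ∧ x.1.Coprime x.2 ∧ x.1 ∈ w'.smoothNumbers ∧ M0 ≤ x.1 ∧
    (PP w).Coprime x.2 ∧ Y0 ≤ x.2

lemma pair_sum {ψ χ : ℕ →*₀ ℝ} (hψ : RC ψ) (hχ : RC χ) {N w w' : ℕ} {M0 Y0 D σ T : ℝ} (hw : 2 ≤ w)
    (hM : 0 < M0) (hσ : 0 ≤ σ) (hD0 : 0 ≤ D)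
    (hT : HasSum (fun n => (af (smi (tw one1 (1 - σ)) w')).pmul (rr ψ χ) n) T)
    (hs : ∀ Y : ℝ, Y0 ≤ Y → Y ≤ N → 0 ≤ Y → ∑ n ∈ Ioc 0 ⌊Y⌋₊ with (PP w).Coprime n, gg χ n ≤ D * Y) :
    ∑ x ∈ pairs N w w' M0 Y0, rr ψ χ (x.1 * x.2) ≤ (4:ℝ) ^ (Real.log N / Real.log w) * D * N * (M0 ^ (-σ) * T) := by
  classical
  set U := (4:ℝ) ^ (Real.log N / Real.log w) with hU
  have hU0 : 0 ≤ U := by positivity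
  set F := (Ioc 0 N).filter (fun m => m ∈ w'.smoothNumbers ∧ M0 ≤ (m:ℝ) ∧ Y0 ≤ (N:ℝ) / m) with hF
  have step : ∑ x ∈ pairs N w w' M0 Y0, rr ψ χ (x.1 * x.2) ≤
      ∑ x ∈ F.sigma (fun m => (Ioc 0 ⌊(N:ℝ)/m⌋₊).filter (fun n => (PP w).Coprime n)), rr ψ χ x.1 * (U * gg χ x.2) := by
    rw [← Finset.sum_image (s := pairs N w w' M0 Y0) (g := fun x : ℕ × ℕ => (⟨x.1, x.2⟩ : (_ : ℕ) × ℕ))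
      (f := fun x => rr ψ χ (x.1 * x.2)) (by
        intro a _ b _ hab
        simp only [Sigma.mk.injEq, heq_eq_eq] at hab
        exact Prod.ext hab.1 hab.2)]
    refine (Finset.sum_le_sum (g := fun x => rr ψ χ x.1 * (U * gg χ x.2)) ?_).trans ?_
    · intro x hx
      obtain ⟨y, hy, rfl⟩ := Finset.mem_image.mp hx
      simp only [pairs, Finset.mem_filter, Finset.mem_product, Finset.mem_Ioc] at hy
      obtain ⟨⟨⟨a1, a2⟩, b1, b2⟩, c1, c2, c3, c4, c5, c6⟩ := hy
      dsimp only
      rw [(rr_mult ψ χ).map_mul_of_coprime c2]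
      apply mul_le_mul_of_nonneg_left _ (rr_nonneg hψ hχ _)
      refine (rr_le hψ hχ b1.ne').trans ?_
      exact mul_le_mul_of_nonneg_right (rough_omega hw b1 b2 c5) (gg_nonneg hχ _)
    · apply Finset.sum_le_sum_of_subset_of_nonneg
      · intro x hx
        obtain ⟨y, hy, rfl⟩ := Finset.mem_image.mp hx
        simp only [pairs, Finset.mem_filter, Finset.mem_product, Finset.mem_Ioc] at hy
        obtain ⟨⟨⟨a1, a2⟩, b1, b2⟩, c1, c2, c3, c4, c5, c6⟩ := hy
        have hle : (y.2 : ℝ) ≤ (N:ℝ) / y.1 := by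
          rw [le_div_iff₀ (by exact_mod_cast a1), mul_comm]; exact_mod_cast c1
        simp only [Finset.mem_sigma, hF, Finset.mem_filter, Finset.mem_Ioc]
        exact ⟨⟨⟨a1, a2⟩, c3, c4, c6.trans hle⟩, ⟨b1, Nat.le_floor hle⟩, c5⟩
      · intro x _ _
        exact mul_nonneg (rr_nonneg hψ hχ _) (mul_nonneg hU0 (gg_nonneg hχ _))
  refine step.trans ?_
  rw [Finset.sum_sigma]
  have h1 := rankin_tail (a := rr ψ χ) (rr_nonneg hψ hχ) hσ hM (z := w') hT F
    (fun n hn => ⟨(Finset.mem_filter.mp hn).2.1, (Finset.mem_filter.mp hn).2.2.1⟩)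
  calc _ ≤ ∑ m ∈ F, U * D * N * (rr ψ χ m / m) := by
        apply Finset.sum_le_sum
        intro m hm
        simp only [hF, Finset.mem_filter, Finset.mem_Ioc] at hm
        dsimp only
        rw [← Finset.mul_sum, ← Finset.mul_sum]
        have hm1 : (1:ℝ) ≤ m := by exact_mod_cast hm.1.1
        have hb := hs ((N:ℝ)/m) hm.2.2.2 (div_le_self (by positivity) hm1) (by positivity)
        calc _ ≤ rr ψ χ m * (U * (D * ((N:ℝ)/m))) := by
              apply mul_le_mul_of_nonneg_left _ (rr_nonneg hψ hχ _)
              apply mul_le_mul_of_nonneg_left hb hU0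
          _ = _ := by ring
    _ = U * D * N * ∑ m ∈ F, rr ψ χ m / m := by rw [Finset.mul_sum]
    _ ≤ _ := by gcongr

end BQ
end part_B2

section part_B3
set_option linter.unusedVariables false
open Finset Filter Topology

namespace BQ
open ArithmeticFunction
open scoped ArithmeticFunction.zeta

def yy (j : ℕ) : ℕ := 2 ^ (2 ^ j)

lemma yy_two (j : ℕ) : 2 ≤ yy j := by
  unfold yy
  exact Nat.le_self_pow (by positivity) 2

lemma log_yy (j : ℕ) : Real.log (yy j) = 2 ^ j * Real.log 2 := by
  unfold yy; push_cast; rw [Real.log_pow]; push_cast; ring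

lemma yy_mono {i j : ℕ} (h : i ≤ j) : yy i ≤ yy j := by
  unfold yy
  exact Nat.pow_le_pow_right (by norm_num) (Nat.pow_le_pow_right (by norm_num) h)

lemma exp_aux {u : ℝ} (hu : 0 < u) : Real.exp (4 * Real.log 2 * u) * Real.exp (-(4 * u)) ≤ 2 / u ^ 2 := by
  rw [← Real.exp_add]
  have h2 := Real.log_two_lt_d9
  have h1 : 4 * Real.log 2 * u + -(4 * u) ≤ -u := by nlinarith
  have h3 : u ^ 2 / 2 ≤ Real.exp u := by
    have := Real.quadratic_le_exp_of_nonneg hu.le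
    nlinarith
  calc _ ≤ Real.exp (-u) := Real.exp_le_exp.mpr h1
    _ = (Real.exp u)⁻¹ := Real.exp_neg u
    _ ≤ (u ^ 2 / 2)⁻¹ := by gcongr
    _ = _ := by rw [inv_div]

set_option maxHeartbeats 1000000 in
lemma level {ψ : ℕ →*₀ ℝ} {B : ℝ} (hψ : RC ψ) (hP : PS ψ B) : ∃ C : ℝ, 0 < C ∧ ∀ (χ : ℕ →*₀ ℝ), RC χ → 
    ∀ (N j J : ℕ) (Y0 L Cs : ℝ), 7 ≤ j → j + 1 ≤ J → yy J ≤ N → 0 ≤ L → 0 ≤ Cs →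
    (∀ Y : ℝ, Y0 ≤ Y → Y ≤ N → 0 ≤ Y → ∑ n ∈ Ioc 0 ⌊Y⌋₊ with (PP (yy j)).Coprime n, gg χ n ≤ 
      Cs * (Y * L / (V one1 (yy j) * V χ (yy j)))) →
    ∑ x ∈ pairs N (yy j) (yy (j+1)) ((N:ℝ) ^ (1/8 : ℝ)) Y0, rr ψ χ (x.1 * x.2) ≤
      C * Cs * N * L * V (ψ * χ) (yy J) * (Real.log (yy (j+1)) / Real.log N) := by
  obtain ⟨Cr, hCr, hr⟩ := rank_ratio 32
  obtain ⟨C1, hC1, h1⟩ := V_one_le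
  obtain ⟨Cp, hCp, hp⟩ := V_psi_le hψ hP
  refine ⟨2 * (Cr ^ 4 * (2 * C1) ^ 2 * Cp * C1), by positivity, ?_⟩
  intro χ hχ N j J Y0 L Cs hj hjJ hJN hL hCs hs
  have hχ' : RC (ψ * χ) := hψ.mul hχ
  set w := yy j with hw
  set w' := yy (j+1) with hw'
  set z0 := yy J with hz0
  have hl2 : 0 < Real.log 2 := Real.log_pos (by norm_num)
  have hlw : 0 < Real.log w := by rw [hw, log_yy]; positivity
  have hlw' : Real.log w' = 2 * Real.log w := by rw [hw, hw', log_yy, log_yy]; ring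
  have hz2 : (2:ℝ) ≤ z0 := by exact_mod_cast yy_two J
  have hlz : Real.log z0 ≤ Real.log N := Real.log_le_log (by linarith) (by exact_mod_cast hJN)
  have hlz0 : 0 < Real.log z0 := Real.log_pos (by linarith)
  have hlN : 0 < Real.log N := by linarith
  have hNpos : (0:ℝ) < N := by have : (z0:ℝ) ≤ N := by exact_mod_cast hJN
                               linarith
  have hbig : 128 ≤ Real.log w' := by
    rw [hw', log_yy]
    have : (2:ℝ) ^ 8 ≤ 2 ^ (j+1) := pow_le_pow_right₀ (by norm_num) (by omega)
    have := Real.log_two_gt_d9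
    nlinarith
  set σ := 32 / Real.log w' with hσ
  have hσ0 : 0 ≤ σ := by positivity
  have hσ1 : σ ≤ 1/4 := by rw [hσ, div_le_iff₀ (by linarith)]; linarith
  have hσ2 : σ * Real.log w' ≤ 32 := by rw [hσ, div_mul_cancel₀ _ (by linarith)]
  have hT := hasSum_rr hψ hχ (s := 1 - σ) (by linarith) w'
  set D := Cs * (L / (V one1 w * V χ w)) with hD
  have v1 : 0 < V one1 w := V_pos one1_RC w
  have v2 : 0 < V χ w := V_pos hχ w
  have v3 : 0 < V one1 w' := V_pos one1_RC w'
  have v4 : 0 < V χ w' := V_pos hχ w'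
  have v5 : 0 < V (ψ * χ) w' := V_pos hχ' w'
  have v6 : 0 < V (ψ * χ) z0 := V_pos hχ' z0
  have v7 : 0 < V ψ w' := V_pos hψ w'
  have hD0 : 0 ≤ D := by positivity
  have main := pair_sum hψ hχ (N := N) (w := w) (w' := w') (M0 := (N:ℝ) ^ (1/8:ℝ)) (Y0 := Y0) (D := D) (yy_two j) (by positivity) hσ0 hD0 hT (by
    intro Y a b c
    refine (hs Y a b c).trans (le_of_eq ?_)
    rw [hD]; ring)
  refine main.trans ?_
  set T := E one1 (1 - σ) w' * E ψ (1 - σ) w' * (E χ (1 - σ) w' * E (ψ * χ) (1 - σ) w') with hTdef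
  have hT1 : T ≤ Cr ^ 4 * (V one1 w' * V ψ w' * (V χ w' * V (ψ * χ) w')) := by
    have e1 := hr one1 one1_RC w' (yy_two _) σ hσ0 hσ1 hσ2
    have e2 := hr ψ hψ w' (yy_two _) σ hσ0 hσ1 hσ2
    have e3 := hr χ hχ w' (yy_two _) σ hσ0 hσ1 hσ2
    have e4 := hr _ hχ' w' (yy_two _) σ hσ0 hσ1 hσ2
    have p1 := (E_pos one1_RC (s := 1 - σ) (by linarith) w').le
    have p2 := (E_pos hψ (s := 1 - σ) (by linarith) w').le
    have p3 := (E_pos hχ (s := 1 - σ) (by linarith) w').le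
    have p4 := (E_pos hχ' (s := 1 - σ) (by linarith) w').le
    change _ ≤ Cr * V one1 w' at e1
    change _ ≤ Cr * V ψ w' at e2
    change _ ≤ Cr * V χ w' at e3
    change _ ≤ Cr * V (ψ * χ) w' at e4
    calc T ≤ (Cr * V one1 w') * (Cr * V ψ w') * ((Cr * V χ w') * (Cr * V (ψ * χ) w')) := by
          rw [hTdef]; gcongr
      _ = _ := by ring
  -- ratios
  have r1 : V one1 w' ≤ 2 * C1 * V one1 w := by
    calc _ ≤ C1 * Real.log w' := h1 w' (yy_two _)
      _ = 2 * C1 * Real.log w := by rw [hlw']; ring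
      _ ≤ _ := by gcongr; exact V_one_ge (yy_two _)
  have r2 : V χ w' ≤ 2 * C1 * V χ w := by
    have := V_ratio_up hχ (yy_mono (Nat.le_succ j))
    have h' : V χ w' * V one1 w ≤ (2 * C1 * V χ w) * V one1 w := by
      calc _ ≤ _ := this
        _ ≤ V χ w * (2 * C1 * V one1 w) := by gcongr
        _ = _ := by ring
    exact le_of_mul_le_mul_right h' v1
  have r3 : V (ψ * χ) w' ≤ V (ψ * χ) z0 * C1 * (Real.log z0 / Real.log w') := by
    have := V_ratio_dn hχ' (yy_mono hjJ)
    have h3 : V (ψ * χ) w' * Real.log w' ≤ V (ψ * χ) z0 * (C1 * Real.log z0) := by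
      calc _ ≤ V (ψ * χ) w' * V one1 w' := by gcongr; exact V_one_ge (yy_two _)
        _ ≤ _ := this
        _ ≤ _ := by gcongr; exact h1 _ (yy_two _)
    rw [mul_div_assoc', le_div_iff₀ (by linarith)]
    linarith
  have hDT : D * T ≤ Cs * L * (Cr ^ 4 * (2 * C1) ^ 2 * Cp * C1) * V (ψ * χ) z0 * (Real.log z0 / Real.log w') := by
    calc D * T ≤ D * (Cr ^ 4 * ((2 * C1 * V one1 w) * Cp * ((2 * C1 * V χ w) * (V (ψ * χ) z0 * C1 * (Real.log z0 / Real.log w'))))) := by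
          apply mul_le_mul_of_nonneg_left _ hD0
          refine hT1.trans ?_
          have := hp w' (yy_two _)
          gcongr
      _ = _ := by
          rw [hD]; field_simp
  set u := Real.log N / Real.log w' with hu
  have hu0 : 0 < u := by rw [hu]; apply div_pos hlN; linarith
  have hexp := exp_aux hu0
  have e1 : (4:ℝ) ^ (Real.log N / Real.log w) = Real.exp (4 * Real.log 2 * u) := by
    rw [Real.rpow_def_of_pos (by norm_num), show (4:ℝ) = 2 ^ 2 by norm_num, Real.log_pow, hu, hlw']
    congr 1; push_cast; field_simp
  have e2 : ((N:ℝ) ^ (1/8:ℝ)) ^ (-σ) = Real.exp (-(4 * u)) := by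
    rw [← Real.rpow_mul hNpos.le, Real.rpow_def_of_pos hNpos, hu, hσ]
    congr 1; field_simp; ring
  rw [e1, e2]
  calc _ = (Real.exp (4 * Real.log 2 * u) * Real.exp (-(4 * u))) * N * (D * T) := by ring
    _ ≤ (2 / u ^ 2) * N * (Cs * L * (Cr ^ 4 * (2 * C1) ^ 2 * Cp * C1) * V (ψ * χ) z0 * (Real.log z0 / Real.log w')) := by
        have : 0 ≤ D * T := by
          apply mul_nonneg hD0
          rw [hTdef]
          have p1 := (E_pos one1_RC (s := 1 - σ) (by linarith) w').le
          have p2 := (E_pos hψ (s := 1 - σ) (by linarith) w').le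
          have p3 := (E_pos hχ (s := 1 - σ) (by linarith) w').le
          have p4 := (E_pos hχ' (s := 1 - σ) (by linarith) w').le
          positivity
        gcongr
    _ = 2 * (Cr ^ 4 * (2 * C1) ^ 2 * Cp * C1) * Cs * N * L * V (ψ * χ) z0 * (Real.log w' / Real.log N) * (Real.log z0 / Real.log N) := by
        have : Real.log w' ≠ 0 := by linarith
        rw [hu]; field_simp
    _ ≤ 2 * (Cr ^ 4 * (2 * C1) ^ 2 * Cp * C1) * Cs * N * L * V (ψ * χ) z0 * (Real.log w' / Real.log N) * 1 := by
        apply mul_le_mul_of_nonneg_left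
        · rw [div_le_one hlN]; exact hlz
        · have : 0 ≤ Real.log w' := by linarith
          positivity
    _ = _ := by ring

lemma level0 {ψ : ℕ →*₀ ℝ} {B : ℝ} (hψ : RC ψ) (hP : PS ψ B) : ∃ C : ℝ, 0 < C ∧ ∀ (χ : ℕ →*₀ ℝ), RC χ → 
    ∀ (N J : ℕ) (Y0 L Cs : ℝ), 0 ≤ L → 0 ≤ Cs →
    (∀ Y : ℝ, Y0 ≤ Y → Y ≤ N → 0 ≤ Y → ∑ n ∈ Ioc 0 ⌊Y⌋₊ with (PP (yy J)).Coprime n, gg χ n ≤ 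
      Cs * (Y * L / (V one1 (yy J) * V χ (yy J)))) →
    ∑ x ∈ pairs N (yy J) (yy J) 1 Y0, rr ψ χ (x.1 * x.2) ≤
      C * Cs * N * L * V (ψ * χ) (yy J) * (4:ℝ) ^ (Real.log N / Real.log (yy J)) := by
  obtain ⟨Cp, hCp, hp⟩ := V_psi_le hψ hP
  refine ⟨Cp, hCp, ?_⟩
  intro χ hχ N J Y0 L Cs hL hCs hs
  have hχ' : RC (ψ * χ) := hψ.mul hχ
  set w := yy J with hw
  have v1 : 0 < V one1 w := V_pos one1_RC w
  have v2 : 0 < V χ w := V_pos hχ w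
  have v6 : 0 < V (ψ * χ) w := V_pos hχ' w
  have v7 : 0 < V ψ w := V_pos hψ w
  set D := Cs * (L / (V one1 w * V χ w)) with hD
  have hD0 : 0 ≤ D := by positivity
  have hT := hasSum_rr hψ hχ (s := 1 - 0) (by norm_num) w
  have main := pair_sum hψ hχ (N := N) (w := w) (w' := w) (M0 := 1) (Y0 := Y0) (D := D) (yy_two J) (by positivity) le_rfl hD0 hT (by
    intro Y a b c
    refine (hs Y a b c).trans (le_of_eq ?_)
    rw [hD]; ring)
  refine main.trans ?_
  rw [sub_zero, Real.one_rpow]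
  change _ * (1 * (V one1 w * V ψ w * (V χ w * V (ψ * χ) w))) ≤ _
  calc _ ≤ (4:ℝ) ^ (Real.log N / Real.log w) * D * N * (1 * (V one1 w * Cp * (V χ w * V (ψ * χ) w))) := by
        gcongr; exact hp w (yy_two _)
    _ = _ := by rw [hD]; field_simp

end BQ
end part_B3

section part_B4
set_option linter.unusedVariables false
open Finset Filter Topology

namespace BQ
open ArithmeticFunction
open scoped ArithmeticFunction.zeta

lemma mem_smooth_of {z n : ℕ} (hn : n ≠ 0) (h : ∀ p : ℕ, p.Prime → p ∣ n → p < z) : n ∈ z.smoothNumbers := by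
  rw [Nat.mem_smoothNumbers]
  exact ⟨hn, fun p hp => h p (Nat.prime_of_mem_primeFactorsList hp) (Nat.dvd_of_mem_primeFactorsList hp)⟩

lemma mem_pairs_of {N w w' n : ℕ} {M0 Y0 : ℝ} (hn : n ∈ Ioc 0 N) {S : Finset ℕ} (hS : S ⊆ n.primeFactors)
    (h1 : ∀ p ∈ n.primeFactors, p ∉ S → p < w') (h2 : ∀ p ∈ S, w ≤ p) (h3 : M0 ≤ (Q n (n.primeFactors \ S) : ℝ))
    (h4 : Y0 ≤ (Q n S : ℝ)) : ∃ x ∈ pairs N w w' M0 Y0, x.1 * x.2 = n := by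
  rw [Finset.mem_Ioc] at hn
  have hn0 : n ≠ 0 := by omega
  have hprod : Q n (n.primeFactors \ S) * Q n S = n := by rw [Q_mul n hS, Q_all hn0]
  have p1 := Q_pos (n := n) (S := n.primeFactors \ S) Finset.sdiff_subset
  have p2 := Q_pos hS
  refine ⟨(Q n (n.primeFactors \ S), Q n S), ?_, hprod⟩
  have l1 : Q n (n.primeFactors \ S) ≤ n := Nat.le_of_dvd hn.1 ⟨_, hprod.symm⟩
  have l2 : Q n S ≤ n := Nat.le_of_dvd hn.1 ⟨_, by rw [mul_comm]; exact hprod.symm⟩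
  simp only [pairs, Finset.mem_filter, Finset.mem_product, Finset.mem_Ioc]
  refine ⟨⟨⟨p1, by omega⟩, p2, by omega⟩, by rw [hprod]; exact hn.2, Q_coprime Finset.sdiff_subset hS Finset.sdiff_disjoint, ?_, h3, ?_, h4⟩
  · apply mem_smooth_of p1.ne'
    intro p hp hd
    have := Q_prime_dvd Finset.sdiff_subset hp hd
    rw [Finset.mem_sdiff] at this
    exact h1 p this.1 this.2
  · rw [coprime_PP]
    intro p hp hd
    exact h2 p (Q_prime_dvd hS hp hd)

lemma decomp {N J n : ℕ} {T Y0 : ℝ} (hT : 1 ≤ T) (hY : 0 < Y0) (hJ : 7 ≤ J) (hn : n ∈ Ioc 0 N) (hlow : Y0 * T * T ≤ n)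
    (hD1 : ¬ ∃ p < yy J, p.Prime ∧ T < ((p ^ n.factorization p : ℕ) : ℝ))
    (hD2 : ¬ ∃ m ∈ (yy 7).smoothNumbers, T ≤ m ∧ m ∣ n) :
    (∃ x ∈ pairs N (yy J) (yy J) 1 Y0, x.1 * x.2 = n) ∨
    ∃ j ∈ Ico 7 J, ∃ x ∈ pairs N (yy j) (yy (j+1)) T Y0, x.1 * x.2 = n := by
  classical
  have hn' := Finset.mem_Ioc.mp hn
  have hn0 : n ≠ 0 := by omega
  set f : ℕ → Finset ℕ := fun j => n.primeFactors.filter (yy j ≤ ·) with hf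
  have hfs : ∀ j, f j ⊆ n.primeFactors := fun j => Finset.filter_subset _ _
  have hprod : ∀ S, S ⊆ n.primeFactors → (Q n (n.primeFactors \ S) : ℝ) * Q n S = n := by
    intro S hS
    have : Q n (n.primeFactors \ S) * Q n S = n := by rw [Q_mul n hS, Q_all hn0]
    exact_mod_cast this
  have h7 : Y0 ≤ (Q n (f 7) : ℝ) := by
    by_contra hc
    push Not at hc
    apply hD2
    refine ⟨Q n (n.primeFactors \ f 7), ?_, ?_, ?_⟩
    · apply mem_smooth_of (Q_pos Finset.sdiff_subset).ne'
      intro p hp hd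
      have := Q_prime_dvd Finset.sdiff_subset hp hd
      rw [Finset.mem_sdiff, hf, Finset.mem_filter] at this
      by_contra h
      exact this.2 ⟨this.1, not_lt.mp h⟩
    · by_contra h
      push Not at h
      have := hprod _ (hfs 7)
      have h0 : (0:ℝ) ≤ Q n (f 7) := by positivity
      have h1 : (0:ℝ) ≤ Q n (n.primeFactors \ f 7) := by positivity
      have : (n:ℝ) < T * Y0 := by rw [← this]; nlinarith
      nlinarith [mul_pos hY (by linarith : 0 < T)]
    · exact ⟨Q n (f 7), by rw [Q_mul n (hfs 7), Q_all hn0]⟩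
  by_cases hJc : Y0 ≤ (Q n (f J) : ℝ)
  · left
    apply mem_pairs_of hn (hfs J) _ _ _ hJc
    · intro p hp hpS
      by_contra h
      exact hpS (Finset.mem_filter.mpr ⟨hp, not_lt.mp h⟩)
    · intro p hp; exact (Finset.mem_filter.mp hp).2
    · exact_mod_cast Q_pos Finset.sdiff_subset
  · right
    obtain ⟨j, hj, hj1, hj2⟩ : ∃ j ∈ Ico 7 J, Y0 ≤ (Q n (f j) : ℝ) ∧ (Q n (f (j+1)) : ℝ) < Y0 := by
      by_contra hcon
      push Not at hcon
      apply hJc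
      have : ∀ k, 7 ≤ k → k ≤ J → Y0 ≤ (Q n (f k) : ℝ) := by
        intro k hk
        induction k, hk using Nat.le_induction with
        | base => intro _; exact h7
        | succ k hk ih =>
          intro hkJ
          exact hcon k (Finset.mem_Ico.mpr ⟨hk, by omega⟩) (ih (by omega))
      exact this J hJ le_rfl
    refine ⟨j, hj, ?_⟩
    rw [Finset.mem_Ico] at hj
    set R := n.primeFactors.filter (fun p => yy j ≤ p ∧ p < yy (j+1)) with hR
    have hun : f (j+1) ∪ R = f j := by
      ext p
      have := yy_mono (Nat.le_succ j)
      simp only [hf, hR, Finset.mem_union, Finset.mem_filter, Nat.succ_eq_add_one] at this ⊢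
      constructor
      · rintro (⟨a, b⟩ | ⟨a, b, c⟩)
        · exact ⟨a, by omega⟩
        · exact ⟨a, b⟩
      · rintro ⟨a, b⟩
        by_cases h : p < yy (j+1)
        · right; exact ⟨a, b, h⟩
        · left; exact ⟨a, not_lt.mp h⟩
    have hdis : Disjoint (f (j+1)) R := by
      rw [Finset.disjoint_left]
      intro p hp hp'
      have a := (Finset.mem_filter.mp hp).2
      have b := (Finset.mem_filter.mp hp').2.2
      omega
    obtain ⟨S, a, b, c, e⟩ := Q_choose (n := n) (Y := Y0) (T := T) (f (j+1)) hj2 R hdis (by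
      intro p hp
      have hp' := Finset.mem_filter.mp hp
      by_contra h
      push Not at h
      exact hD1 ⟨p, lt_of_lt_of_le hp'.2.2 (yy_mono (by omega)), Nat.prime_of_mem_primeFactors hp'.1, h⟩) (by rw [hun]; exact hj1)
    rw [hun] at b
    have hS := b.trans (hfs j)
    apply mem_pairs_of hn hS _ _ _ c
    · intro p hp hpS
      by_contra h
      exact hpS (a (Finset.mem_filter.mpr ⟨hp, not_lt.mp h⟩))
    · intro p hp; exact (Finset.mem_filter.mp (b hp)).2
    · by_contra h
      push Not at h
      have h1 := hprod _ hS
      have h0 : (0:ℝ) < Q n S := by exact_mod_cast Q_pos hS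
      have : (n:ℝ) < T * (Y0 * T) := by
        rw [← h1]; nlinarith
      nlinarith

open Classical in
lemma sum_decomp {ψ χ : ℕ →*₀ ℝ} (hψ : RC ψ) (hχ : RC χ) {N J : ℕ} {T Y0 R : ℝ} (hT : 1 ≤ T) (hY : 0 < Y0) (hJ : 7 ≤ J)
    (hR : ∀ n, n ≠ 0 → n ≤ N → rr ψ χ n ≤ R) (hR0 : 0 ≤ R) :
    ∑ n ∈ Ioc 0 N, rr ψ χ n ≤ R * (Y0 * T * T + yy J * (1 + Nat.log 2 N) * (N / T) + N * (T ^ (-(1/2 : ℝ)) * E one1 (1/2) (yy 7)))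
      + (∑ x ∈ pairs N (yy J) (yy J) 1 Y0, rr ψ χ (x.1 * x.2) +
       ∑ j ∈ Ico 7 J, ∑ x ∈ pairs N (yy j) (yy (j+1)) T Y0, rr ψ χ (x.1 * x.2)) := by
  set f : ℕ → ℝ := fun n => rr ψ χ n with hf
  have hf0 : ∀ n, 0 ≤ f n := rr_nonneg hψ hχ
  set A1 : Finset ℕ := (Ioc 0 N).filter (fun n : ℕ => (n:ℝ) < Y0 * T * T) with hA1
  set A2 := (Ioc 0 N).filter (fun n => ∃ p < yy J, p.Prime ∧ T < ((p ^ n.factorization p : ℕ) : ℝ)) with hA2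
  set A3 := (Ioc 0 N).filter (fun n => ∃ m ∈ (yy 7).smoothNumbers, T ≤ m ∧ m ∣ n) with hA3
  set A4 := (Ioc 0 N).filter (fun n => ∃ x ∈ pairs N (yy J) (yy J) 1 Y0, x.1 * x.2 = n) with hA4
  set A5 : ℕ → Finset ℕ := fun j => (pairs N (yy j) (yy (j+1)) T Y0).image (fun x => x.1 * x.2) with hA5
  have hcov : Ioc 0 N ⊆ A1 ∪ (A2 ∪ (A3 ∪ (A4 ∪ (Ico 7 J).biUnion A5))) := by
    intro n hn
    simp only [Finset.mem_union, Finset.mem_biUnion]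
    by_cases h1 : (n:ℝ) < Y0 * T * T
    · left; exact Finset.mem_filter.mpr ⟨hn, h1⟩
    right
    by_cases h2 : ∃ p < yy J, p.Prime ∧ T < ((p ^ n.factorization p : ℕ) : ℝ)
    · left; exact Finset.mem_filter.mpr ⟨hn, h2⟩
    right
    by_cases h3 : ∃ m ∈ (yy 7).smoothNumbers, T ≤ m ∧ m ∣ n
    · left; exact Finset.mem_filter.mpr ⟨hn, h3⟩
    right
    rcases decomp hT hY hJ hn (not_lt.mp h1) h2 h3 with h | ⟨j, hj, h⟩
    · left; exact Finset.mem_filter.mpr ⟨hn, h⟩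
    · right; refine ⟨j, hj, ?_⟩; exact Finset.mem_image.mpr h
  have hun : ∀ U W : Finset ℕ, ∑ n ∈ U ∪ W, f n ≤ ∑ n ∈ U, f n + ∑ n ∈ W, f n := by
    intro U W
    rw [← Finset.sum_union_inter]
    have : 0 ≤ ∑ n ∈ U ∩ W, f n := Finset.sum_nonneg fun _ _ => hf0 _
    linarith
  have hbU : ∑ n ∈ (Ico 7 J).biUnion A5, f n ≤ ∑ j ∈ Ico 7 J, ∑ n ∈ A5 j, f n := by
    generalize Ico 7 J = I
    induction I using Finset.induction_on with
    | empty => simp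
    | insert a s ha ih =>
      rw [Finset.biUnion_insert, Finset.sum_insert ha]
      exact (hun _ _).trans (by gcongr)
  have hsmall : ∀ A : Finset ℕ, A ⊆ Ioc 0 N → ∑ n ∈ A, f n ≤ R * A.card := by
    intro A hA
    rw [mul_comm, ← nsmul_eq_mul]
    apply Finset.sum_le_card_nsmul
    intro n hn
    have := Finset.mem_Ioc.mp (hA hn)
    exact hR n (by omega) this.2
  have c1 : (A1.card : ℝ) ≤ Y0 * T * T := by
    have hs : A1 ⊆ Ioc 0 ⌊Y0 * T * T⌋₊ := by
      intro n hn
      have hn' := Finset.mem_filter.mp hn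
      rw [Finset.mem_Ioc] at hn' ⊢
      exact ⟨hn'.1.1, Nat.le_floor hn'.2.le⟩
    have := Finset.card_le_card hs
    rw [Nat.card_Ioc, Nat.sub_zero] at this
    calc (A1.card : ℝ) ≤ (⌊Y0 * T * T⌋₊ : ℝ) := by exact_mod_cast this
      _ ≤ _ := Nat.floor_le (by positivity)
  have c2 := D1_count N (yy J) (T := T) (by linarith)
  have c3 := D2_count N (yy 7) (T := T) (by linarith)
  have s1 := hsmall A1 (Finset.filter_subset _ _)
  have s2 := hsmall A2 (Finset.filter_subset _ _)
  have s3 := hsmall A3 (Finset.filter_subset _ _)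
  have s4 : ∑ n ∈ A4, f n ≤ ∑ x ∈ pairs N (yy J) (yy J) 1 Y0, f (x.1 * x.2) :=
    sum_le_pairs hf0 A4 _ fun n hn => (Finset.mem_filter.mp hn).2
  have s5 : ∑ j ∈ Ico 7 J, ∑ n ∈ A5 j, f n ≤ ∑ j ∈ Ico 7 J, ∑ x ∈ pairs N (yy j) (yy (j+1)) T Y0, f (x.1 * x.2) :=
    Finset.sum_le_sum fun j hj => sum_le_pairs hf0 (A5 j) _ fun n hn => Finset.mem_image.mp hn
  have t0 : ∑ n ∈ Ioc 0 N, f n ≤ ∑ n ∈ A1, f n + (∑ n ∈ A2, f n + (∑ n ∈ A3, f n + (∑ n ∈ A4, f n + ∑ j ∈ Ico 7 J, ∑ n ∈ A5 j, f n))) := by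
    refine (Finset.sum_le_sum_of_subset_of_nonneg hcov fun _ _ _ => hf0 _).trans ?_
    refine (hun _ _).trans (by gcongr; refine (hun _ _).trans (by gcongr; refine (hun _ _).trans (by gcongr; refine (hun _ _).trans (by gcongr))))
  have d1 := mul_le_mul_of_nonneg_left c1 hR0
  have d2 := mul_le_mul_of_nonneg_left c2 hR0
  have d3 := mul_le_mul_of_nonneg_left c3 hR0
  change R * (A2.card : ℝ) ≤ _ at d2
  change R * (A3.card : ℝ) ≤ _ at d3
  linarith

end BQ
end part_B4

section part_B5
set_option linter.unusedVariables false
open Finset Filter Topology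

namespace BQ
open ArithmeticFunction
open scoped ArithmeticFunction.zeta

lemma exists_J (c : ℝ) (hc : 0 < c) : ∃ n0 : ℕ, 2 ≤ n0 ∧ ∀ N : ℕ, n0 ≤ N → ∃ J : ℕ, 7 ≤ J ∧
    Real.log (yy J) ≤ c * Real.log N ∧ c * Real.log N ≤ 2 * Real.log (yy J) := by
  have hl2 : 0 < Real.log 2 := Real.log_pos (by norm_num)
  have ht : Tendsto (fun N : ℕ => c * Real.log N / Real.log 2) atTop atTop := by
    apply Tendsto.atTop_div_const hl2
    apply Tendsto.const_mul_atTop hc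
    exact Real.tendsto_log_atTop.comp tendsto_natCast_atTop_atTop
  obtain ⟨n0, hn0⟩ := eventually_atTop.mp (ht.eventually_ge_atTop ((2:ℝ)^7))
  refine ⟨max n0 2, le_max_right _ _, ?_⟩
  intro N hN
  have hx := hn0 N ((le_max_left _ _).trans hN)
  set x := c * Real.log N / Real.log 2 with hxd
  have hxe : c * Real.log N = x * Real.log 2 := by rw [hxd, div_mul_cancel₀ _ hl2.ne']
  have hf : 2 ^ 7 ≤ ⌊x⌋₊ := Nat.le_floor (by norm_num; linarith)
  have hx0 : 0 ≤ x := le_trans (by positivity) hx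
  refine ⟨Nat.log 2 ⌊x⌋₊, Nat.le_log_of_pow_le (by norm_num) hf, ?_, ?_⟩
  · rw [log_yy, hxe]
    gcongr
    have h1 : 2 ^ (Nat.log 2 ⌊x⌋₊) ≤ ⌊x⌋₊ := Nat.pow_log_le_self 2 (by omega)
    calc (2:ℝ) ^ (Nat.log 2 ⌊x⌋₊) ≤ (⌊x⌋₊ : ℝ) := by exact_mod_cast h1
      _ ≤ x := Nat.floor_le hx0
  · rw [log_yy, hxe, ← mul_assoc]
    gcongr
    have h1 : ⌊x⌋₊ < 2 ^ (Nat.log 2 ⌊x⌋₊ + 1) := Nat.lt_pow_succ_log_self (by norm_num) _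
    have h2 : x < ⌊x⌋₊ + 1 := Nat.lt_floor_add_one x
    have h3 : ((⌊x⌋₊ : ℝ)) + 1 ≤ 2 ^ (Nat.log 2 ⌊x⌋₊ + 1) := by exact_mod_cast h1
    rw [pow_succ] at h3
    linarith

/-- the sieve hypothesis for all levels -/
def SV (χ : ℕ →*₀ ℝ) (Cs : ℝ) (N J : ℕ) (Y0 : ℝ) : Prop :=
  ∀ j ≤ J, ∀ Y : ℝ, Y0 ≤ Y → Y ≤ N → 0 ≤ Y → ∑ n ∈ Ioc 0 ⌊Y⌋₊ with (PP (yy j)).Coprime n, gg χ n ≤ 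
      Cs * (Y * Lv χ 1 / (V one1 (yy j) * V χ (yy j)))

lemma log_yy_sum (J : ℕ) : ∑ j ∈ Ico 7 J, Real.log (yy (j+1)) ≤ 2 * Real.log (yy J) := by
  have hl2 : 0 < Real.log 2 := Real.log_pos (by norm_num)
  calc _ ≤ ∑ j ∈ range J, Real.log (yy (j+1)) := by
        apply Finset.sum_le_sum_of_subset_of_nonneg
        · intro j; simp
        · intro j _ _; rw [log_yy]; positivity
    _ = ((∑ j ∈ range J, (2:ℝ) ^ j) * 2) * Real.log 2 := by
        rw [Finset.sum_mul, Finset.sum_mul]; apply Finset.sum_congr rfl; intro j _; rw [log_yy, pow_succ]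
    _ ≤ _ := by
        rw [log_yy, geom_sum_eq (by norm_num)]
        norm_num
        nlinarith

lemma half_main {ψ : ℕ →*₀ ℝ} {B0 : ℝ} (hψ : RC ψ) (hP : PS ψ B0) : ∃ C : ℝ, 0 < C ∧ ∀ (χ : ℕ →*₀ ℝ), RC χ → 
    ∀ (N J : ℕ) (Y0 Cs c C2 : ℝ), 7 ≤ J → yy J ≤ N → 0 ≤ Lv χ 1 → 0 ≤ Lv (ψ * χ) 1 → 0 ≤ Cs → 0 < c → 0 ≤ C2 → 
    c * Real.log N ≤ 2 * Real.log (yy J) → SV χ Cs N J Y0 → V (ψ * χ) (yy J) ≤ C2 * Lv (ψ * χ) 1 →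
    (∑ x ∈ pairs N (yy J) (yy J) 1 Y0, rr ψ χ (x.1 * x.2) +
       ∑ j ∈ Ico 7 J, ∑ x ∈ pairs N (yy j) (yy (j+1)) ((N:ℝ) ^ (1/8:ℝ)) Y0, rr ψ χ (x.1 * x.2)) ≤
      C * Cs * C2 * (1 + (4:ℝ) ^ (2/c)) * (N * (Lv χ 1 * Lv (ψ * χ) 1)) := by
  obtain ⟨K0, hK0, k0⟩ := level0 hψ hP
  obtain ⟨K1, hK1, k1⟩ := level hψ hP
  refine ⟨K0 + 2 * K1, by positivity, ?_⟩
  intro χ hχ N J Y0 Cs c C2 hJ hJN hL hL' hCs hc hC2 hlog hSV hV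
  set L := Lv χ 1
  set L' := Lv (ψ * χ) 1
  have hz2 : (2:ℝ) ≤ yy J := by exact_mod_cast yy_two J
  have hlz0 : 0 < Real.log (yy J) := Real.log_pos (by linarith)
  have hlz : Real.log (yy J) ≤ Real.log N := Real.log_le_log (by linarith) (by exact_mod_cast hJN)
  have hlN : 0 < Real.log N := by linarith
  have v0 := V_pos (hψ.mul hχ) (yy J)
  have a0 := k0 χ hχ N J Y0 L Cs hL hCs (hSV J le_rfl)
  have a1 : ∑ j ∈ Ico 7 J, ∑ x ∈ pairs N (yy j) (yy (j+1)) ((N:ℝ) ^ (1/8:ℝ)) Y0, rr ψ χ (x.1 * x.2) ≤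
      ∑ j ∈ Ico 7 J, K1 * Cs * N * L * V (ψ * χ) (yy J) * (Real.log (yy (j+1)) / Real.log N) := by
    apply Finset.sum_le_sum
    intro j hj
    rw [Finset.mem_Ico] at hj
    exact k1 χ hχ N j J Y0 L Cs hj.1 hj.2 hJN hL hCs (hSV j hj.2.le)
  rw [← Finset.mul_sum, ← Finset.sum_div] at a1
  have a2 : (∑ j ∈ Ico 7 J, Real.log (yy (j+1))) / Real.log N ≤ 2 := by
    rw [div_le_iff₀ hlN]; have := log_yy_sum J; linarith
  have a3 : (4:ℝ) ^ (Real.log N / Real.log (yy J)) ≤ (4:ℝ) ^ (2/c) := by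
    apply Real.rpow_le_rpow_of_exponent_le (by norm_num)
    rw [div_le_div_iff₀ hlz0 hc]; linarith
  set F := (4:ℝ) ^ (2/c)
  have hF : 0 < F := by positivity
  calc _ ≤ K0 * Cs * N * L * (C2 * L') * F + K1 * Cs * N * L * (C2 * L') * 2 := by
        apply add_le_add
        · refine a0.trans ?_
          gcongr
        · refine a1.trans ?_
          gcongr
    _ ≤ _ := by
        have : 0 ≤ Cs * N * L * (C2 * L') := by positivity
        have e : (K0 + 2 * K1) * Cs * C2 * (1 + F) * (N * (L * L')) - (K0 * Cs * N * L * (C2 * L') * F + K1 * Cs * N * L * (C2 * L') * 2) = 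
          (K0 + 2 * K1 * F) * (Cs * N * L * (C2 * L')) := by ring
        have : 0 ≤ (K0 + 2 * K1 * F) * (Cs * N * L * (C2 * L')) := by positivity
        linarith

/-- dichotomy -/
lemma dichotomy {ψ : ℕ →*₀ ℝ} {B0 : ℝ} (hψ : RC ψ) (hP : PS ψ B0) (hLψ : Lv ψ 1 ≠ 0) (Cs c : ℝ) (hCs : 0 < Cs) (hc : 0 < c) :
    ∃ n1 : ℕ, ∀ N J : ℕ, n1 ≤ N → c * Real.log N ≤ 2 * Real.log (yy J) → (yy J : ℝ) ≤ (N:ℝ) ^ (3/4 : ℝ) →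
    ∀ (χ : ℕ →*₀ ℝ) (Y0 : ℝ), RC χ → 0 < Lv χ 1 → 0 < Lv (ψ * χ) 1 → Y0 ≤ (N:ℝ) ^ (3/4 : ℝ) → 
    SV χ Cs N J Y0 → SV (ψ * χ) Cs N J Y0 → 
    V χ (yy J) ≤ 160 * Cs / c * Lv χ 1 ∨ V (ψ * χ) (yy J) ≤ 160 * Cs / c * Lv (ψ * χ) 1 := by
  obtain ⟨n0, hn0, h0⟩ := eta1 hψ hP hLψ
  have tp : ∀ a : ℝ, 0 < a → Tendsto (fun N : ℕ => (N:ℝ) ^ a) atTop atTop := fun a ha =>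
    (tendsto_rpow_atTop ha).comp tendsto_natCast_atTop_atTop
  have tl : Tendsto (fun N : ℕ => Real.log N) atTop atTop := Real.tendsto_log_atTop.comp tendsto_natCast_atTop_atTop
  have ev : ∀ᶠ N : ℕ in atTop, (n0:ℝ) ≤ (N:ℝ) ^ (3/4:ℝ) ∧ 2 ≤ (N:ℝ) ^ (1/20:ℝ) ∧ 2 ≤ Real.log N ∧ 2 ≤ N :=
    ((tp _ (by norm_num)).eventually_ge_atTop _).and (((tp _ (by norm_num)).eventually_ge_atTop _).and
      ((tl.eventually_ge_atTop _).and (eventually_ge_atTop 2)))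
  obtain ⟨n1, hn1⟩ := eventually_atTop.mp ev
  refine ⟨n1, ?_⟩
  intro N J hN hlog hJ χ Y0 hχ hL hL' hY0 hS hS'
  obtain ⟨e1, e2, e3, e4⟩ := hn1 N hN
  have hNpos : (0:ℝ) < N := by positivity
  have hχ' := hψ.mul hχ
  set N0 := ⌈(N:ℝ) ^ (3/4:ℝ)⌉₊ with hN0
  have hge : (N:ℝ) ^ (3/4:ℝ) ≤ N0 := Nat.le_ceil _
  have hn0N : n0 ≤ N0 := by exact_mod_cast e1.trans hge
  have h34 : 1 ≤ (N:ℝ) ^ (3/4:ℝ) := Real.one_le_rpow (by exact_mod_cast (by omega : 1 ≤ N)) (by norm_num)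
  have hle : (N0:ℝ) ≤ (N:ℝ) ^ (4/5:ℝ) := by
    have h1 : (N0:ℝ) < (N:ℝ) ^ (3/4:ℝ) + 1 := Nat.ceil_lt_add_one (by positivity)
    have h2 : (N:ℝ) ^ (4/5:ℝ) = (N:ℝ) ^ (3/4:ℝ) * (N:ℝ) ^ (1/20:ℝ) := by rw [← Real.rpow_add hNpos]; norm_num
    rw [h2]; nlinarith
  have hN0N : N0 ≤ N := by
    have : (N:ℝ) ^ (4/5:ℝ) ≤ N := by
      conv_rhs => rw [← Real.rpow_one (N:ℝ)]
      exact Real.rpow_le_rpow_of_exponent_le (by exact_mod_cast (by omega : 1 ≤ N)) (by norm_num)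
    exact_mod_cast hle.trans this
  have hN0pos : (0:ℝ) < N0 := by linarith
  have hlogs : 5 * Real.log N0 ≤ 4 * Real.log N := by
    have := Real.log_le_log hN0pos hle
    rw [Real.log_rpow hNpos] at this
    linarith
  have key := h0 N0 N hn0N hN0N hlogs χ hχ
  have hz : yy J ≤ N0 := by exact_mod_cast hJ.trans hge
  have gen : ∀ η : ℕ →*₀ ℝ, RC η → SV η Cs N J Y0 → ∑ p ∈ Ioc N0 N with p.Prime, gg η p * (Real.log p / p) ≤
      Real.log N * (Cs * (Lv η 1 / (V one1 (yy J) * V η (yy J))) * (2 + Real.log N)) := by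
    intro η hη hSη
    apply eta2 hη (by omega) hN0N hz
    intro n h1 h2
    have := hSη J le_rfl n (by
      have : (N0:ℝ) ≤ n := by exact_mod_cast h1
      linarith) (by exact_mod_cast h2) (by positivity)
    rw [Nat.floor_natCast] at this
    refine this.trans (le_of_eq (by ring))
  have g1 := gen χ hχ hS
  have g2 := gen _ hχ' hS'
  simp only [add_mul, Finset.sum_add_distrib] at key
  by_contra hcon
  push Not at hcon
  have v1 := V_pos one1_RC (yy J)
  have bound : ∀ η : ℕ →*₀ ℝ, RC η → 0 < Lv η 1 → 160 * Cs / c * Lv η 1 < V η (yy J) →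
      Real.log N * (Cs * (Lv η 1 / (V one1 (yy J) * V η (yy J))) * (2 + Real.log N)) < Real.log N * (1/40) := by
    intro η hη hLη hV
    have hv := V_pos hη (yy J)
    apply mul_lt_mul_of_pos_left _ (by linarith)
    have b1 : Lv η 1 / V η (yy J) < c / (160 * Cs) := by
      rw [div_lt_div_iff₀ hv (by positivity)]
      rw [div_mul_eq_mul_div, div_lt_iff₀ hc] at hV
      linarith
    have b2 : (2 + Real.log N) / V one1 (yy J) ≤ 4 / c := by
      rw [div_le_div_iff₀ v1 hc]
      have := V_one_ge (yy_two J)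
      nlinarith
    have b3 : 0 < (2 + Real.log N) / V one1 (yy J) := by apply div_pos _ v1; linarith
    calc _ = Cs * ((Lv η 1 / V η (yy J)) * ((2 + Real.log N) / V one1 (yy J))) := by field_simp
      _ < Cs * ((c / (160 * Cs)) * (4 / c)) := by
          apply mul_lt_mul_of_pos_left _ hCs
          apply mul_lt_mul b1 b2 b3 (by positivity)
      _ = 1/40 := by field_simp; norm_num
  have b1 := bound χ hχ hL hcon.1
  have b2 := bound _ hχ' hL' hcon.2
  linarith

end BQ
end part_B5

section part_B6
set_option linter.unusedVariables false
open Finset Filter Topology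

namespace BQ
open ArithmeticFunction
open scoped ArithmeticFunction.zeta

lemma log2_le {N : ℕ} (hN : 2 ≤ N) : (1:ℝ) + Nat.log 2 N ≤ 100 * (N:ℝ) ^ (1/32:ℝ) := by
  have hNpos : (1:ℝ) ≤ N := by exact_mod_cast (by omega : 1 ≤ N)
  have h1 := Real.log_le_rpow_div (x := (N:ℝ)) (by positivity) (show (0:ℝ) < 1/32 by norm_num)
  have h2 : (Nat.log 2 N : ℝ) * Real.log 2 ≤ Real.log N := by
    rw [← Real.log_pow]
    apply Real.log_le_log (by positivity)
    exact_mod_cast Nat.pow_log_le_self 2 (by omega)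
  have h3 := Real.log_two_gt_d9
  have h4 : 1 ≤ (N:ℝ) ^ (1/32:ℝ) := Real.one_le_rpow hNpos (by norm_num)
  have h5 : (0:ℝ) ≤ Nat.log 2 N := by positivity
  rw [div_div_eq_mul_div, div_one] at h1
  nlinarith

theorem thmB {ψ : ℕ →*₀ ℝ} {B0 : ℝ} (hψ : RC ψ) (hP : PS ψ B0) (hLψ : Lv ψ 1 ≠ 0) (δ : ℝ) (hδ : 0 < δ) (hδ1 : δ ≤ 1/16) :
    ∃ C : ℝ, 0 < C ∧ ∃ X0 : ℕ, ∀ N : ℕ, X0 ≤ N → ∀ (χ : ℕ →*₀ ℝ) (B : ℝ), RC χ → ψ * (ψ * χ) = χ → 1 ≤ B → 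
      B ≤ (N:ℝ) ^ (3/4 - δ) → PS χ B → PS (ψ * χ) B → (N:ℝ) ^ (-(δ/8)) ≤ Lv χ 1 → (N:ℝ) ^ (-(δ/8)) ≤ Lv (ψ * χ) 1 →
      ∑ n ∈ Ioc 0 N, rr ψ χ n ≤ C * (N * (Lv χ 1 * Lv (ψ * χ) 1)) := by
  obtain ⟨A, Cs, hCs, hsv⟩ := sieve_app
  set c := δ / (8 * (A + 1)) with hc
  have hc0 : 0 < c := by positivity
  have hcA : c * A ≤ δ/8 := by
    rw [hc, div_mul_eq_mul_div, div_le_div_iff₀ (by positivity) (by norm_num)]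
    nlinarith
  have hc1 : c ≤ 1/32 := by
    rw [hc, div_le_iff₀ (by positivity)]
    have : (0:ℝ) ≤ A := by positivity
    nlinarith
  obtain ⟨n0, hn02, hn0⟩ := exists_J c hc0
  obtain ⟨n1, hn1⟩ := dichotomy hψ hP hLψ Cs c hCs hc0
  obtain ⟨K, hK, hmain⟩ := half_main hψ hP
  obtain ⟨Cr, hCr, hrb⟩ := rr_bound (δ/8) (by positivity)
  set C2 := 160 * Cs / c with hC2
  obtain ⟨E0, hE0', hE0⟩ : ∃ x : ℝ, 0 < x ∧ ∀ u : Unit, x = E one1 (1/2) (yy 7) := ⟨_, E_pos one1_RC (by norm_num) _, fun _ => rfl⟩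
  refine ⟨Cr * (101 + E0) + K * Cs * C2 * (1 + (4:ℝ) ^ (2/c)), by positivity, max n0 n1, ?_⟩
  intro N hN χ B hχ hinv hB hBN hPχ hPχ' hL hL'
  have hN2 : 2 ≤ N := hn02.trans ((le_max_left _ _).trans hN)
  have hN1 : (1:ℝ) ≤ N := by exact_mod_cast (by omega : 1 ≤ N)
  have hN0 : (0:ℝ) < N := by linarith
  obtain ⟨J, hJ, hJ1, hJ2⟩ := hn0 N ((le_max_left _ _).trans hN)
  have hχ' := hψ.mul hχ
  have hp : ∀ a : ℝ, 0 < (N:ℝ) ^ a := fun a => Real.rpow_pos_of_pos hN0 a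
  have hmono : ∀ a b : ℝ, a ≤ b → (N:ℝ) ^ a ≤ (N:ℝ) ^ b := fun a b h => Real.rpow_le_rpow_of_exponent_le hN1 h
  have hz : (yy J : ℝ) ≤ (N:ℝ) ^ c := by
    have h2 : (0:ℝ) < yy J := by have := yy_two J; positivity
    rw [Real.le_rpow_iff_log_le h2 hN0]; exact hJ1
  have hzN : yy J ≤ N := by
    have : (N:ℝ) ^ c ≤ (N:ℝ) ^ (1:ℝ) := hmono _ _ (by linarith)
    rw [Real.rpow_one] at this
    exact_mod_cast hz.trans this
  set Y0 := (N:ℝ) ^ (3/4 - δ/2) with hY0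
  have hSV : ∀ η : ℕ →*₀ ℝ, RC η → PS η B → (N:ℝ) ^ (-(δ/8)) ≤ Lv η 1 → SV η Cs N J Y0 := by
    intro η hη hPη hLη j hj Y hY1 hY2 hY3
    apply hsv η B (yy j) Y hη hPη hB ((hp _).le.trans hLη) (yy_two j) hY3
    have a1 : ((yy j : ℕ):ℝ) ^ A ≤ (N:ℝ) ^ (δ/8) := by
      calc ((yy j : ℕ):ℝ) ^ A ≤ ((N:ℝ) ^ c) ^ A := by
            gcongr
            exact le_trans (by exact_mod_cast yy_mono hj) hz
        _ = (N:ℝ) ^ (c * A) := by rw [Real.rpow_mul hN0.le, Real.rpow_natCast]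
        _ ≤ _ := hmono _ _ hcA
    have a2 : √B ≤ (N:ℝ) ^ (3/8 - δ/2) := by
      calc √B ≤ √((N:ℝ) ^ (3/4 - δ)) := Real.sqrt_le_sqrt hBN
        _ = _ := by rw [Real.sqrt_eq_rpow, ← Real.rpow_mul hN0.le]; congr 1; ring
    have a3 : (N:ℝ) ^ (3/8 - δ/4) ≤ √Y := by
      calc _ = √Y0 := by rw [hY0, Real.sqrt_eq_rpow, ← Real.rpow_mul hN0.le]; congr 1; ring
        _ ≤ _ := Real.sqrt_le_sqrt hY1
    calc ((yy j : ℕ):ℝ) ^ A * √B ≤ (N:ℝ) ^ (δ/8) * (N:ℝ) ^ (3/8 - δ/2) := by gcongr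
      _ = (N:ℝ) ^ (-(δ/8)) * (N:ℝ) ^ (3/8 - δ/4) := by
          rw [← Real.rpow_add hN0, ← Real.rpow_add hN0]; congr 1; ring
      _ ≤ _ := mul_le_mul hLη a3 (hp _).le ((hp _).le.trans hLη)
  have hS1 := hSV χ hχ hPχ hL
  have hS2 := hSV _ hχ' hPχ' hL'
  have hLp : 0 < Lv χ 1 := (hp _).trans_le hL
  have hLp' : 0 < Lv (ψ * χ) 1 := (hp _).trans_le hL'
  have hdich := hn1 N J ((le_max_right _ _).trans hN) hJ2 (hz.trans (hmono _ _ (by linarith))) χ Y0 hχ hLp hLp'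
    (hmono _ _ (by linarith)) hS1 hS2
  set T := (N:ℝ) ^ (1/8:ℝ) with hT
  have hT1 : 1 ≤ T := Real.one_le_rpow hN1 (by norm_num)
  have hdec := sum_decomp hψ hχ (N := N) (J := J) (T := T) (Y0 := Y0) (R := Cr * (N:ℝ) ^ (δ/8)) hT1 (hp _) hJ
    (fun n h1 h2 => hrb ψ χ hψ hχ N n h1 h2) (by positivity)
  rw [← hE0 ()] at hdec
  have hdisc : Cr * (N:ℝ) ^ (δ/8) * (Y0 * T * T + yy J * (1 + Nat.log 2 N) * (N / T) + N * (T ^ (-(1/2 : ℝ)) * E0)) ≤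
      Cr * (101 + E0) * (N * (Lv χ 1 * Lv (ψ * χ) 1)) := by
    have d1 : Y0 * T * T = (N:ℝ) ^ (1 - δ/2) := by
      rw [hY0, hT, ← Real.rpow_add hN0, ← Real.rpow_add hN0]; congr 1; ring
    have d2 : yy J * (1 + Nat.log 2 N) * (N / T) ≤ 100 * (N:ℝ) ^ (1 - δ/2) := by
      calc _ ≤ (N:ℝ) ^ c * (100 * (N:ℝ) ^ (1/32:ℝ)) * (N / T) := by
            gcongr; exact log2_le hN2
        _ = 100 * (N:ℝ) ^ (c + 1/32 + (1 - 1/8)) := by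
            rw [Real.rpow_add hN0, Real.rpow_add hN0, Real.rpow_sub hN0, Real.rpow_one]; ring
        _ ≤ _ := by
            gcongr
            linarith
    have d3 : N * (T ^ (-(1/2 : ℝ)) * E0) ≤ E0 * (N:ℝ) ^ (1 - δ/2) := by
      have : N * T ^ (-(1/2 : ℝ)) = (N:ℝ) ^ (1 - 1/16 : ℝ) := by
        rw [hT, ← Real.rpow_mul hN0.le]
        nth_rewrite 1 [← Real.rpow_one (N:ℝ)]
        rw [← Real.rpow_add hN0]; congr 1; norm_num
      calc _ = E0 * (N * T ^ (-(1/2 : ℝ))) := by ring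
        _ = E0 * (N:ℝ) ^ (1 - 1/16 : ℝ) := by rw [this]
        _ ≤ _ := mul_le_mul_of_nonneg_left (hmono _ _ (by linarith)) hE0'.le
    have d4 : (N:ℝ) ^ (δ/8) * (N:ℝ) ^ (1 - δ/2) ≤ N * (Lv χ 1 * Lv (ψ * χ) 1) := by
      calc _ = (N:ℝ) ^ (1 + (-(3*δ/8))) := by rw [← Real.rpow_add hN0]; congr 1; ring
        _ ≤ (N:ℝ) ^ (1 + (-(δ/8) + -(δ/8))) := hmono _ _ (by linarith)
        _ = N * ((N:ℝ) ^ (-(δ/8)) * (N:ℝ) ^ (-(δ/8))) := by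
            rw [Real.rpow_add hN0, Real.rpow_add hN0, Real.rpow_one]
        _ ≤ _ := by gcongr
    rw [d1]
    calc _ ≤ Cr * (N:ℝ) ^ (δ/8) * ((N:ℝ) ^ (1 - δ/2) + 100 * (N:ℝ) ^ (1 - δ/2) + E0 * (N:ℝ) ^ (1 - δ/2)) := by
          gcongr
      _ = Cr * (101 + E0) * ((N:ℝ) ^ (δ/8) * (N:ℝ) ^ (1 - δ/2)) := by ring
      _ ≤ _ := by gcongr
  rcases hdich with hd | hd
  · -- swap
    have hinv' : (⇑ψ * ⇑(ψ * χ) : ℕ → ℝ) = ⇑χ := by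
      conv_rhs => rw [← hinv]
      rfl
    have e : rr ψ χ = rr ψ (ψ * χ) := by
      unfold rr
      rw [hinv]; ring
    rw [e] at hdec ⊢
    have := hmain (ψ * χ) hχ' N J Y0 Cs c C2 hJ hzN hLp'.le (by rw [hinv']; exact hLp.le) hCs.le hc0 (by positivity) hJ2 hS2 (by rw [hinv, hinv']; exact hd)
    rw [hinv'] at this
    have e2 : Lv (⇑(ψ * χ)) 1 * Lv (⇑χ) 1 = Lv (⇑χ) 1 * Lv (⇑ψ * ⇑χ) 1 := mul_comm _ _
    rw [e2] at this
    refine hdec.trans ((add_le_add hdisc this).trans (le_of_eq (by ring)))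
  · have := hmain χ hχ N J Y0 Cs c C2 hJ hzN hLp.le hLp'.le hCs.le hc0 (by positivity) hJ2 hS1 hd
    refine hdec.trans ((add_le_add hdisc this).trans (le_of_eq (by ring)))

end BQ
end part_B6

section part_C1
set_option linter.unusedVariables false
open Finset Filter Topology
namespace BQ
open ArithmeticFunction
open scoped ArithmeticFunction.zeta

/-- quantitative convergence of partial sums, with a bound for absolute partial sums -/
def Cv (f : ArithmeticFunction ℝ) (F E θ A ν : ℝ) : Prop :=
  (∀ N : ℕ, 1 ≤ N → |∑ n ∈ Ioc 0 N, f n - F| ≤ E * (N:ℝ) ^ (-θ)) ∧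
  (∀ N : ℕ, 1 ≤ N → ∑ n ∈ Ioc 0 N, |f n| ≤ A * (N:ℝ) ^ ν)

lemma Cv.mono {f : ArithmeticFunction ℝ} {F E θ A ν E' θ' A' ν' : ℝ} (h : Cv f F E θ A ν) (hE0 : 0 ≤ E) (hA0 : 0 ≤ A)
    (hE : E ≤ E') (hθ : θ' ≤ θ) (hA : A ≤ A') (hν : ν ≤ ν') : Cv f F E' θ' A' ν' := by
  refine ⟨fun N hN => (h.1 N hN).trans ?_, fun N hN => (h.2 N hN).trans ?_⟩
  · have : (1:ℝ) ≤ N := by exact_mod_cast hN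
    exact mul_le_mul hE (Real.rpow_le_rpow_of_exponent_le this (by linarith)) (by positivity) (hE0.trans hE)
  · have : (1:ℝ) ≤ N := by exact_mod_cast hN
    exact mul_le_mul hA (Real.rpow_le_rpow_of_exponent_le this (by linarith)) (by positivity) (hA0.trans hA)

lemma Cv.F_le {f : ArithmeticFunction ℝ} {F E θ A ν : ℝ} (h : Cv f F E θ A ν) : |F| ≤ A + E := by
  have h1 := h.1 1 le_rfl
  have h2 := h.2 1 le_rfl
  simp at h1 h2
  have : |F| ≤ |f 1| + |f 1 - F| := by
    have := abs_sub_abs_le_abs_sub F (f 1)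
    rw [abs_sub_comm] at this; linarith
  linarith

lemma abs_sum_mul_le (f g : ArithmeticFunction ℝ) (N : ℕ) :
    ∑ n ∈ Ioc 0 N, |(f * g) n| ≤ (∑ n ∈ Ioc 0 N, |f n|) * ∑ n ∈ Ioc 0 N, |g n| := by
  set f' : ArithmeticFunction ℝ := ⟨fun n => |f n|, by simp⟩
  set g' : ArithmeticFunction ℝ := ⟨fun n => |g n|, by simp⟩
  have h1 : ∀ n, |(f * g) n| ≤ (f' * g') n := by
    intro n
    rw [mul_apply, mul_apply]
    refine (abs_sum_le_sum_abs _ _).trans (sum_le_sum fun x _ => ?_)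
    rw [abs_mul]; rfl
  calc _ ≤ ∑ n ∈ Ioc 0 N, (f' * g') n := sum_le_sum fun n _ => h1 n
    _ = ∑ a ∈ Ioc 0 N, f' a * ∑ b ∈ Ioc 0 (N / a), g' b := sum_Ioc_mul_eq_sum_sum _ _ _
    _ ≤ ∑ a ∈ Ioc 0 N, f' a * ∑ b ∈ Ioc 0 N, g' b := by
        refine sum_le_sum fun a _ => mul_le_mul_of_nonneg_left ?_ (abs_nonneg (f a))
        exact sum_le_sum_of_subset_of_nonneg (Ioc_subset_Ioc_right (Nat.div_le_self _ _)) fun b _ _ => abs_nonneg (g b)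
    _ = _ := by rw [sum_mul]; rfl

lemma Cv.mul {f g : ArithmeticFunction ℝ} {F G E θ A ν : ℝ} (hf : Cv f F E θ A ν) (hg : Cv g G E θ A ν)
    (hE : 1 ≤ E) (hA : 1 ≤ A) (hν : 0 ≤ ν) (hνθ : ν ≤ θ) (hθ : θ ≤ 1) :
    Cv (f * g) (F * G) (10 * A * E ^ 2) ((θ - ν) / 2) (A ^ 2) (2 * ν) := by
  refine ⟨fun N hN => ?_, fun N hN => ?_⟩
  · set y := Nat.sqrt N with hy
    have hN1 : (1:ℝ) ≤ N := by exact_mod_cast hN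
    have hN0 : (0:ℝ) < N := by linarith
    have hy1 : 1 ≤ y := Nat.sqrt_pos.2 hN
    have hy1' : (1:ℝ) ≤ y := by exact_mod_cast hy1
    have hy0 : (0:ℝ) < y := by linarith
    have hyy : y * y ≤ N := Nat.sqrt_le N
    have hyN : N < (y + 1) * (y + 1) := Nat.lt_succ_sqrt N
    have hdiv : N / (y + 1) ≤ y := by
      have : N / (y + 1) < y + 1 := Nat.div_lt_of_lt_mul hyN
      omega
    have hA0 : 0 < A := by linarith
    have hE0 : 0 < E := by linarith
    rw [hyperbola f g N y]
    have p1 : |∑ b ∈ Ioc 0 y, g b * ∑ a ∈ Ioc 0 (N / b), f a - F * ∑ b ∈ Ioc 0 y, g b| ≤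
        A * (y:ℝ) ^ ν * (E * (y:ℝ) ^ (-θ)) := by
      rw [mul_sum, ← sum_sub_distrib]
      refine (abs_sum_le_sum_abs _ _).trans ?_
      calc _ ≤ ∑ b ∈ Ioc 0 y, |g b| * (E * (y:ℝ) ^ (-θ)) := by
            refine sum_le_sum fun b hb => ?_
            rw [mem_Ioc] at hb
            have e : g b * ∑ a ∈ Ioc 0 (N / b), f a - F * g b = g b * (∑ a ∈ Ioc 0 (N / b), f a - F) := by ring
            rw [e, abs_mul]
            refine mul_le_mul_of_nonneg_left ?_ (abs_nonneg _)
            have h2 : y ≤ N / b := by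
              rw [Nat.le_div_iff_mul_le hb.1]
              exact (Nat.mul_le_mul_left y hb.2).trans hyy
            refine (hf.1 _ (hy1.trans h2)).trans ?_
            exact mul_le_mul_of_nonneg_left (rpow_anti (hν.trans hνθ) hy1 h2) hE0.le
        _ ≤ _ := by
            rw [← sum_mul]
            exact mul_le_mul_of_nonneg_right (hg.2 y hy1) (by positivity)
    have p2 : |∑ a ∈ Ioc 0 (N / (y + 1)), f a * ∑ b ∈ Ioc y (N / a), g b| ≤
        A * (y:ℝ) ^ ν * (2 * E * (y:ℝ) ^ (-θ)) := by
      refine (abs_sum_le_sum_abs _ _).trans ?_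
      calc _ ≤ ∑ a ∈ Ioc 0 (N / (y + 1)), |f a| * (2 * E * (y:ℝ) ^ (-θ)) := by
            refine sum_le_sum fun a ha => ?_
            rw [mem_Ioc] at ha
            rw [abs_mul]
            refine mul_le_mul_of_nonneg_left ?_ (abs_nonneg _)
            have h2 : y ≤ N / a := by
              rw [Nat.le_div_iff_mul_le ha.1]
              exact (Nat.mul_le_mul_left y (ha.2.trans hdiv)).trans hyy
            rw [sum_Ioc_sub _ h2]
            have h3 := hg.1 _ hy1
            have h4 : |∑ n ∈ Ioc 0 (N / a), g n - G| ≤ E * (y:ℝ) ^ (-θ) := by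
              refine (hg.1 _ (hy1.trans h2)).trans ?_
              exact mul_le_mul_of_nonneg_left (rpow_anti (hν.trans hνθ) hy1 h2) hE0.le
            rw [abs_le] at h3 h4 ⊢
            constructor <;> linarith
        _ ≤ _ := by
            rw [← sum_mul]
            refine mul_le_mul_of_nonneg_right ?_ (by positivity)
            exact (sum_le_sum_of_subset_of_nonneg (Ioc_subset_Ioc_right hdiv) fun b _ _ => abs_nonneg (f b)).trans (hf.2 y hy1)
    have p3 : |F * ∑ b ∈ Ioc 0 y, g b - F * G| ≤ (A + E) * (E * (y:ℝ) ^ (-θ)) := by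
      rw [← mul_sub, abs_mul]
      exact mul_le_mul hf.F_le (hg.1 y hy1) (abs_nonneg _) (by positivity)
    have e1 : (y:ℝ) ^ (-θ) ≤ (y:ℝ) ^ ν * (y:ℝ) ^ (-θ) :=
      le_mul_of_one_le_left (by positivity) (Real.one_le_rpow hy1' hν)
    have e2 : (y:ℝ) ^ ν * (y:ℝ) ^ (-θ) ≤ 2 * (N:ℝ) ^ (-((θ - ν)/2)) := by
      rw [← Real.rpow_add hy0]
      have h4 : (N:ℝ) ≤ (2 * y) ^ 2 := by
        have : N ≤ (2 * y) ^ 2 := by nlinarith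
        exact_mod_cast this
      have h5 : ((2 * (y:ℝ)) ^ 2) ^ (-((θ - ν)/2)) ≤ (N:ℝ) ^ (-((θ - ν)/2)) :=
        Real.rpow_le_rpow_of_nonpos hN0 h4 (by linarith)
      have h6 : ((2 * (y:ℝ)) ^ 2) ^ (-((θ - ν)/2)) = 2 ^ (-(θ - ν)) * (y:ℝ) ^ (-(θ - ν)) := by
        rw [← Real.rpow_natCast, ← Real.rpow_mul (by positivity), ← Real.mul_rpow (by norm_num) (by positivity)]
        congr 1; push_cast; ring
      have h7 : (1:ℝ)/2 ≤ 2 ^ (-(θ - ν)) := by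
        rw [one_div, ← Real.rpow_neg_one]
        exact Real.rpow_le_rpow_of_exponent_le (by norm_num) (by linarith)
      have h8 : ν + -θ = -(θ - ν) := by ring
      rw [h8]
      have h9 : (0:ℝ) ≤ (y:ℝ) ^ (-(θ - ν)) := by positivity
      nlinarith
    set T := (y:ℝ) ^ ν * (y:ℝ) ^ (-θ) with hT
    have hT0 : 0 < T := by positivity
    have q3 : (A + E) * (E * (y:ℝ) ^ (-θ)) ≤ (A + E) * (E * T) := by gcongr
    have q1 : A * (y:ℝ) ^ ν * (E * (y:ℝ) ^ (-θ)) = A * E * T := by rw [hT]; ring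
    have q2 : A * (y:ℝ) ^ ν * (2 * E * (y:ℝ) ^ (-θ)) = 2 * A * E * T := by rw [hT]; ring
    rw [q1] at p1
    rw [q2] at p2
    have q4 : A * E * T + 2 * A * E * T + (A + E) * (E * T) ≤ 5 * A * E ^ 2 * T := by
      have : A * E + 2 * A * E + (A + E) * E ≤ 5 * A * E ^ 2 := by
        have a1 : A * E ≤ A * E * E := le_mul_of_one_le_right (by positivity) hE
        have a2 : E * E ≤ A * (E * E) := le_mul_of_one_le_left (by positivity) hA
        nlinarith
      nlinarith
    have q5 : 5 * A * E ^ 2 * T ≤ 10 * A * E ^ 2 * (N:ℝ) ^ (-((θ - ν)/2)) := by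
      have : 0 < 5 * A * E ^ 2 := by positivity
      nlinarith
    have q6 := abs_add_le (∑ b ∈ Ioc 0 y, g b * ∑ a ∈ Ioc 0 (N / b), f a - F * ∑ b ∈ Ioc 0 y, g b)
      (∑ a ∈ Ioc 0 (N / (y + 1)), f a * ∑ b ∈ Ioc y (N / a), g b)
    have q7 := abs_add_le ((∑ b ∈ Ioc 0 y, g b * ∑ a ∈ Ioc 0 (N / b), f a - F * ∑ b ∈ Ioc 0 y, g b) +
      (∑ a ∈ Ioc 0 (N / (y + 1)), f a * ∑ b ∈ Ioc y (N / a), g b)) (F * ∑ b ∈ Ioc 0 y, g b - F * G)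
    have q8 : ((∑ b ∈ Ioc 0 y, g b * ∑ a ∈ Ioc 0 (N / b), f a - F * ∑ b ∈ Ioc 0 y, g b) +
      (∑ a ∈ Ioc 0 (N / (y + 1)), f a * ∑ b ∈ Ioc y (N / a), g b)) + (F * ∑ b ∈ Ioc 0 y, g b - F * G) =
      (∑ b ∈ Ioc 0 y, g b * ∑ a ∈ Ioc 0 (N / b), f a) +
      (∑ a ∈ Ioc 0 (N / (y + 1)), f a * ∑ b ∈ Ioc y (N / a), g b) - F * G := by ring
    rw [q8] at q7
    linarith
  · refine (abs_sum_mul_le f g N).trans ?_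
    have hN0 : (0:ℝ) < N := by exact_mod_cast hN
    calc _ ≤ (A * (N:ℝ) ^ ν) * (A * (N:ℝ) ^ ν) :=
          mul_le_mul (hf.2 N hN) (hg.2 N hN) (sum_nonneg fun _ _ => abs_nonneg _) (by positivity)
      _ = _ := by
          have : (N:ℝ) ^ (2 * ν) = (N:ℝ) ^ ν * (N:ℝ) ^ ν := by rw [← Real.rpow_add hN0]; ring_nf
          rw [this]; ring

/-- `N^(1-s)/(1-s)` comparison: one step -/
lemma step_rpow {s a b : ℝ} (hs : 0 < s) (hs1 : s < 1) (ha : 0 < a) (hab : a ≤ b) :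
    (b - a) * b ^ (-s) ≤ b ^ (1 - s) / (1 - s) - a ^ (1 - s) / (1 - s) ∧
    b ^ (1 - s) / (1 - s) - a ^ (1 - s) / (1 - s) ≤ (b - a) * a ^ (-s) := by
  rcases hab.eq_or_lt with rfl | hlt
  · simp
  have hd : ∀ x ∈ Set.Ioo a b, HasDerivAt (fun x : ℝ => x ^ (1 - s) / (1 - s)) (x ^ (-s)) x := by
    intro x hx
    have hx0 : x ≠ 0 := (ha.trans hx.1).ne'
    have h1 := (Real.hasDerivAt_rpow_const (x := x) (p := 1 - s) (Or.inl hx0)).div_const (1 - s)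
    have : (1 - s) ≠ 0 := by linarith
    rw [mul_div_right_comm, div_self this, one_mul, show 1 - s - 1 = -s by ring] at h1
    exact h1
  have hc : ContinuousOn (fun x : ℝ => x ^ (1 - s) / (1 - s)) (Set.Icc a b) := by
    refine ContinuousOn.div_const (ContinuousOn.rpow_const continuousOn_id fun x hx => Or.inr (by linarith)) _
  obtain ⟨c, hc1, hc2⟩ := exists_hasDerivAt_eq_slope _ _ hlt hc hd
  have hba : 0 < b - a := by linarith
  have e : b ^ (1 - s) / (1 - s) - a ^ (1 - s) / (1 - s) = (b - a) * c ^ (-s) := by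
    rw [hc2]; field_simp
  rw [e]
  have hc0 : 0 < c := ha.trans hc1.1
  constructor
  · exact mul_le_mul_of_nonneg_left (Real.rpow_le_rpow_of_nonpos hc0 hc1.2.le (by linarith)) hba.le
  · exact mul_le_mul_of_nonneg_left (Real.rpow_le_rpow_of_nonpos ha hc1.1.le (by linarith)) hba.le

lemma sum_rpow_le {s : ℝ} (hs : 0 < s) (hs1 : s < 1) (N : ℕ) :
    ∑ n ∈ Ioc 0 N, (n:ℝ) ^ (-s) ≤ (N:ℝ) ^ (1 - s) / (1 - s) := by
  induction N with
  | zero => simp; rw [Real.zero_rpow (by linarith)]; simp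
  | succ N ih =>
    rw [Finset.sum_Ioc_succ_top (by omega)]
    rcases Nat.eq_zero_or_pos N with rfl | hN
    · simp
      rw [le_inv_comm₀] <;> simp <;> linarith
    have hN0 : (0:ℝ) < N := by exact_mod_cast hN
    have := (step_rpow hs hs1 hN0 (b := ((N + 1 : ℕ) : ℝ)) (by push_cast; linarith)).1
    have e : (((N + 1 : ℕ) : ℝ) - N) = 1 := by push_cast; ring
    rw [e, one_mul] at this
    linarith

lemma exists_Z {s : ℝ} (hs : 0 < s) (hs1 : s < 1) : ∃ Z : ℝ, Z ≤ 0 ∧ -(1/(1-s)) ≤ Z ∧ ∀ t : ℝ, 1 ≤ t →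
    |∑ n ∈ Ioc 0 ⌊t⌋₊, (n:ℝ) ^ (-s) - t ^ (1 - s) / (1 - s) - Z| ≤ 2 * t ^ (-s) := by
  set a : ℕ → ℝ := fun N => ∑ n ∈ Ioc 0 (N+1), (n:ℝ) ^ (-s) - ((N+1:ℕ):ℝ) ^ (1 - s) / (1 - s) with ha
  set b : ℕ → ℝ := fun N => ∑ n ∈ Ioc 0 N, (n:ℝ) ^ (-s) - ((N+1:ℕ):ℝ) ^ (1 - s) / (1 - s) with hb
  have key := fun N : ℕ => step_rpow hs hs1 (a := ((N+1:ℕ):ℝ)) (b := ((N+1+1:ℕ):ℝ)) (by positivity) (by push_cast; linarith)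
  have e : ∀ N : ℕ, (((N + 1 + 1 : ℕ) : ℝ) - ((N + 1 : ℕ) : ℝ)) = 1 := fun N => by push_cast; ring
  have hanti : Antitone a := by
    refine antitone_nat_of_succ_le fun N => ?_
    have := (key N).1
    rw [e, one_mul] at this
    simp only [ha]
    rw [Finset.sum_Ioc_succ_top (by omega : 0 ≤ N + 1)]
    linarith
  have hmono : Monotone b := by
    refine monotone_nat_of_le_succ fun N => ?_
    have := (key N).2
    rw [e, one_mul] at this
    simp only [hb]
    rw [Finset.sum_Ioc_succ_top (by omega : 0 ≤ N)]
    linarith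
  have hab : ∀ N, a N = b N + ((N+1:ℕ):ℝ) ^ (-s) := by
    intro N; simp only [ha, hb]; rw [Finset.sum_Ioc_succ_top (by omega : 0 ≤ N)]; ring
  have hba : ∀ N, b N ≤ a N := fun N => by rw [hab]; have : (0:ℝ) ≤ ((N+1:ℕ):ℝ) ^ (-s) := by positivity
                                           linarith
  have hbdd : BddAbove (Set.range b) := by
    refine ⟨a 0, ?_⟩
    rintro _ ⟨N, rfl⟩
    exact (hba N).trans (hanti (Nat.zero_le N))
  have hbZ : ∀ N, b N ≤ ⨆ i, b i := fun N => le_ciSup hbdd N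
  have hZa : ∀ N, ⨆ i, b i ≤ a N := by
    intro N
    refine ciSup_le fun i => ?_
    exact (hmono (le_max_left i N)).trans ((hba _).trans (hanti (le_max_right i N)))
  refine ⟨⨆ i, b i, (hZa 0).trans ?_, le_trans ?_ (hbZ 0), ?_⟩
  · simp only [ha]
    simp
    rw [le_inv_comm₀] <;> simp <;> linarith
  · simp [hb]
  · intro t ht
    obtain ⟨N, hN⟩ : ∃ N, ⌊t⌋₊ = N + 1 := ⟨⌊t⌋₊ - 1, by have := Nat.floor_pos.2 ht; omega⟩
    have h1 : ((N + 1 : ℕ) : ℝ) ≤ t := hN ▸ Nat.floor_le (by linarith)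
    have h2 : t < ((N + 1 : ℕ) : ℝ) + 1 := hN ▸ Nat.lt_floor_add_one t
    have hp : (1:ℝ) ≤ ((N + 1 : ℕ) : ℝ) := by push_cast; linarith [Nat.cast_nonneg (α := ℝ) N]
    rw [hN]
    have k := step_rpow hs hs1 (a := ((N+1:ℕ):ℝ)) (b := t) (by linarith) h1
    have hh : ((N+1:ℕ):ℝ) ^ (-s) ≤ 2 * t ^ (-s) := by
      have h3 : (2 * ((N+1:ℕ):ℝ)) ^ (-s) ≤ t ^ (-s) := Real.rpow_le_rpow_of_nonpos (by linarith) (by linarith) (by linarith)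
      rw [Real.mul_rpow (by norm_num) (by linarith)] at h3
      have h7 : (1:ℝ)/2 ≤ 2 ^ (-s) := by
        rw [one_div, ← Real.rpow_neg_one]
        exact Real.rpow_le_rpow_of_exponent_le (by norm_num) (by linarith)
      have h9 : (0:ℝ) ≤ ((N+1:ℕ):ℝ) ^ (-s) := by positivity
      nlinarith
    have h4 := hbZ N
    have h5 := hZa N
    have h6 := hab N
    have h8 : (t - ((N+1:ℕ):ℝ)) * ((N+1:ℕ):ℝ) ^ (-s) ≤ ((N+1:ℕ):ℝ) ^ (-s) :=
      mul_le_of_le_one_left (by positivity) (by linarith)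
    have h10 : 0 ≤ (t - ((N+1:ℕ):ℝ)) * t ^ (-s) := mul_nonneg (by linarith) (by positivity)
    simp only [ha] at h5 h6
    rw [abs_le]
    constructor <;> linarith [k.1, k.2]

end BQ
end part_C1

section part_C2
set_option linter.unusedVariables false
open Finset Filter Topology
namespace BQ
open ArithmeticFunction
open scoped ArithmeticFunction.zeta

/-- twist by `n^(-s)` -/
noncomputable def twf (s : ℝ) (g : ArithmeticFunction ℝ) : ArithmeticFunction ℝ := (af (tw one1 s)).pmul g

lemma twf_apply (s : ℝ) (g : ArithmeticFunction ℝ) {n : ℕ} (hn : n ≠ 0) : twf s g n = (n:ℝ) ^ (-s) * g n := by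
  rw [twf, pmul_apply, af_apply, tw_apply, one1_apply hn, one_mul]

lemma twf_mul (s : ℝ) (f g : ArithmeticFunction ℝ) : twf s (f * g) = twf s f * twf s g := pmul_cm _ _ _

lemma core {g : ArithmeticFunction ℝ} {s Gs G1 E A : ℝ} (hs : 31/32 ≤ s) (hs1 : s < 1) (hE : 1 ≤ E) (hA : 1 ≤ A)
    (h1 : Cv (twf s g) Gs E (1/8) A (1/8)) (h2 : Cv (twf 1 g) G1 E (1/8) A (1/8))
    (hpos : ∀ n, 0 ≤ (af one1 * g) n) (hg1 : g 1 = 1) (hGs : 0 ≤ Gs) (y : ℕ) (hy : 1 ≤ y) :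
    1 ≤ (y:ℝ) ^ (2 * (1 - s)) / (1 - s) * G1 + 6 * A * E / (1 - s) * (y:ℝ) ^ (-(1/16) : ℝ) := by
  obtain ⟨Z, hZ0, hZ1, hZ⟩ := exists_Z (by linarith : 0 < s) hs1
  have hy1 : (1:ℝ) ≤ y := by exact_mod_cast hy
  have hy0 : (0:ℝ) < y := by linarith
  have h1s : 0 < 1 - s := by linarith
  set N := y * y with hN
  have hNy : (N:ℝ) = (y:ℝ) ^ (2:ℝ) := by rw [hN]; push_cast; rw [Real.rpow_two]; ring
  have hN0 : (0:ℝ) < N := by rw [hNy]; positivity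
  have lower : 1 ≤ ∑ n ∈ Ioc 0 N, (twf s (af one1) * twf s g) n := by
    rw [← twf_mul]
    have : (twf s (af one1 * g)) 1 = 1 := by
      rw [twf_apply _ _ one_ne_zero]; simp [hg1, mul_apply]
    rw [← this]
    refine single_le_sum (f := fun n => twf s (af one1 * g) n) (fun n hn => ?_) ?_
    · rw [mem_Ioc] at hn
      rw [twf_apply _ _ (by omega)]
      exact mul_nonneg (by positivity) (hpos n)
    · rw [mem_Ioc]; exact ⟨one_pos, by nlinarith⟩
  have hone : ∀ M, ∑ a ∈ Ioc 0 M, twf s (af one1) a = ∑ a ∈ Ioc 0 M, (a:ℝ) ^ (-s) := by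
    intro M
    refine sum_congr rfl fun a ha => ?_
    rw [mem_Ioc] at ha
    rw [twf_apply _ _ (by omega), af_apply, one1_apply (by omega), mul_one]
  rw [hyperbola _ _ N y] at lower
  have hdiv : N / (y + 1) ≤ y := by
    have : N / (y + 1) < y + 1 := Nat.div_lt_of_lt_mul (by nlinarith)
    omega
  set P := (y:ℝ) ^ (-(1/16) : ℝ) with hP
  have hP0 : 0 < P := by positivity
  have hym : ∀ u v : ℝ, u ≤ v → (y:ℝ) ^ u ≤ (y:ℝ) ^ v := fun u v h => Real.rpow_le_rpow_of_exponent_le hy1 h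
  -- second part
  have p2 : ∑ a ∈ Ioc 0 (N / (y + 1)), twf s (af one1) a * ∑ b ∈ Ioc y (N / a), twf s g b ≤ 2 * E / (1 - s) * P := by
    calc _ ≤ ∑ a ∈ Ioc 0 (N / (y + 1)), twf s (af one1) a * (2 * E * (y:ℝ) ^ (-(1/8):ℝ)) := by
          refine sum_le_sum fun a ha => ?_
          rw [mem_Ioc] at ha
          have : 0 ≤ twf s (af one1) a := by
            rw [twf_apply _ _ (by omega), af_apply, one1_apply (by omega)]; positivity
          refine mul_le_mul_of_nonneg_left ?_ this
          have h2 : y ≤ N / a := by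
            rw [Nat.le_div_iff_mul_le ha.1]
            exact (Nat.mul_le_mul_left y (ha.2.trans hdiv))
          rw [sum_Ioc_sub _ h2]
          have h3 := h1.1 _ hy
          have h4 : |∑ n ∈ Ioc 0 (N / a), twf s g n - Gs| ≤ E * (y:ℝ) ^ (-(1/8):ℝ) := by
            refine (h1.1 _ (hy.trans h2)).trans ?_
            exact mul_le_mul_of_nonneg_left (rpow_anti (by norm_num) hy h2) (by linarith)
          rw [abs_le] at h3 h4
          linarith
      _ ≤ (y:ℝ) ^ (1 - s) / (1 - s) * (2 * E * (y:ℝ) ^ (-(1/8):ℝ)) := by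
          rw [← sum_mul]
          refine mul_le_mul_of_nonneg_right ?_ (by positivity)
          rw [hone]
          refine (sum_le_sum_of_subset_of_nonneg (Ioc_subset_Ioc_right hdiv) fun b _ _ => ?_).trans
            (sum_rpow_le (by linarith) hs1 y)
          positivity
      _ = 2 * E / (1 - s) * (y:ℝ) ^ (1 - s - 1/8) := by
          rw [show (1 - s - 1/8 : ℝ) = (1 - s) + (-(1/8)) by ring, Real.rpow_add hy0]; ring
      _ ≤ _ := mul_le_mul_of_nonneg_left (hym _ _ (by linarith)) (by positivity)
  have p1 : ∑ b ∈ Ioc 0 y, twf s g b * ∑ a ∈ Ioc 0 (N / b), twf s (af one1) a ≤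
      (N:ℝ) ^ (1 - s) / (1 - s) * ∑ b ∈ Ioc 0 y, twf 1 g b + Z * ∑ b ∈ Ioc 0 y, twf s g b + 2 * A * P := by
    have hb : ∀ b ∈ Ioc 0 y, twf s g b * ∑ a ∈ Ioc 0 (N / b), twf s (af one1) a ≤
        (N:ℝ) ^ (1 - s) / (1 - s) * twf 1 g b + Z * twf s g b + 2 * (N:ℝ) ^ (-s) * y * |twf 1 g b| := by
      intro b hb
      rw [mem_Ioc] at hb
      have hb0 : (0:ℝ) < b := by exact_mod_cast hb.1
      have hby : (b:ℝ) ≤ y := by exact_mod_cast hb.2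
      have ht : 1 ≤ (N:ℝ) / b := by
        rw [le_div_iff₀ hb0, one_mul]
        have : b ≤ N := hb.2.trans (Nat.le_mul_self y)
        exact_mod_cast this
      have hz := hZ _ ht
      rw [Nat.floor_div_eq_div] at hz
      rw [hone, twf_apply _ _ (by omega), twf_apply _ _ (by omega)]
      set S := ∑ n ∈ Ioc 0 (N / b), (n:ℝ) ^ (-s)
      have e1 : ((N:ℝ) / b) ^ (1 - s) = (N:ℝ) ^ (1-s) * (b:ℝ) ^ (-1:ℝ) * (b:ℝ) ^ s := by
        rw [Real.div_rpow hN0.le hb0.le, div_eq_mul_inv, ← Real.rpow_neg hb0.le, mul_assoc, ← Real.rpow_add hb0]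
        congr 2; ring
      have e2 : ((N:ℝ) / b) ^ (-s) = (N:ℝ) ^ (-s) * (b:ℝ) ^ s := by
        rw [Real.div_rpow hN0.le hb0.le, div_eq_mul_inv, ← Real.rpow_neg hb0.le, neg_neg]
      have e3 : (b:ℝ) ^ (-s) * (b:ℝ) ^ s = 1 := by rw [← Real.rpow_add hb0]; simp
      have e4 : (b:ℝ) * (b:ℝ) ^ (-1:ℝ) = 1 := by rw [Real.rpow_neg_one]; field_simp
      rw [e1, e2] at hz
      have h5 : (b:ℝ) ^ (-s) * g b * (S - (N:ℝ) ^ (1-s) * (b:ℝ) ^ (-1:ℝ) * (b:ℝ) ^ s / (1 - s) - Z) ≤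
          2 * (N:ℝ) ^ (-s) * |g b| := by
        refine (le_abs_self _).trans ?_
        rw [abs_mul]
        refine (mul_le_mul_of_nonneg_left hz (abs_nonneg _)).trans ?_
        rw [abs_mul, abs_of_nonneg (by positivity : 0 ≤ (b:ℝ) ^ (-s))]
        apply le_of_eq
        calc _ = 2 * (N:ℝ) ^ (-s) * |g b| * ((b:ℝ) ^ (-s) * (b:ℝ) ^ s) := by ring
          _ = _ := by rw [e3, mul_one]
      have h6 : (b:ℝ) ^ (-s) * g b * ((N:ℝ) ^ (1-s) * (b:ℝ) ^ (-1:ℝ) * (b:ℝ) ^ s / (1 - s)) =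
          (N:ℝ) ^ (1 - s) / (1 - s) * ((b:ℝ) ^ (-1:ℝ) * g b) := by
        calc _ = (N:ℝ) ^ (1 - s) / (1 - s) * ((b:ℝ) ^ (-1:ℝ) * g b) * ((b:ℝ) ^ (-s) * (b:ℝ) ^ s) := by ring
          _ = _ := by rw [e3, mul_one]
      have h7 : |g b| ≤ y * |(b:ℝ) ^ (-1:ℝ) * g b| := by
        rw [abs_mul, abs_of_nonneg (by positivity : 0 ≤ (b:ℝ) ^ (-1:ℝ))]
        calc |g b| = (b * (b:ℝ) ^ (-1:ℝ)) * |g b| := by rw [e4, one_mul]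
          _ = b * ((b:ℝ) ^ (-1:ℝ) * |g b|) := by ring
          _ ≤ _ := by gcongr
      have h8 : 2 * (N:ℝ) ^ (-s) * |g b| ≤ 2 * (N:ℝ) ^ (-s) * (y * |(b:ℝ) ^ (-1:ℝ) * g b|) := by gcongr
      have h9 : (b:ℝ) ^ (-s) * g b * S = (b:ℝ) ^ (-s) * g b * (S - (N:ℝ) ^ (1-s) * (b:ℝ) ^ (-1:ℝ) * (b:ℝ) ^ s / (1 - s) - Z)
        + (b:ℝ) ^ (-s) * g b * ((N:ℝ) ^ (1-s) * (b:ℝ) ^ (-1:ℝ) * (b:ℝ) ^ s / (1 - s)) + Z * ((b:ℝ) ^ (-s) * g b) := by ring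
      rw [h9, h6]
      linarith
    refine (sum_le_sum hb).trans ?_
    rw [sum_add_distrib, sum_add_distrib, ← mul_sum, ← mul_sum, ← mul_sum]
    have : 2 * (N:ℝ) ^ (-s) * y * ∑ b ∈ Ioc 0 y, |twf 1 g b| ≤ 2 * A * P := by
      calc _ ≤ 2 * (N:ℝ) ^ (-s) * y * (A * (y:ℝ) ^ (1/8:ℝ)) := by gcongr; exact h2.2 y hy
        _ = 2 * A * (y:ℝ) ^ (-2 * s + 1 + 1/8) := by
            rw [Real.rpow_add hy0, Real.rpow_add hy0, Real.rpow_one, hNy, ← Real.rpow_mul hy0.le,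
              show 2 * -s = -2 * s by ring]; ring
        _ ≤ _ := mul_le_mul_of_nonneg_left (hym _ _ (by linarith)) (by positivity)
    linarith
  have hNs : (N:ℝ) ^ (1 - s) = (y:ℝ) ^ (2 * (1 - s)) := by rw [hNy, ← Real.rpow_mul hy0.le]
  have p3 : (N:ℝ) ^ (1 - s) / (1 - s) * ∑ b ∈ Ioc 0 y, twf 1 g b ≤
      (y:ℝ) ^ (2 * (1 - s)) / (1 - s) * G1 + E / (1 - s) * P := by
    have h3 := (abs_le.1 (h2.1 y hy)).2
    calc _ ≤ (N:ℝ) ^ (1 - s) / (1 - s) * (G1 + E * (y:ℝ) ^ (-(1/8):ℝ)) := by gcongr; linarith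
      _ = (y:ℝ) ^ (2 * (1 - s)) / (1 - s) * G1 + E / (1 - s) * (y:ℝ) ^ (2 * (1 - s) + -(1/8)) := by
          rw [Real.rpow_add hy0, hNs]; ring
      _ ≤ _ := by
          have := mul_le_mul_of_nonneg_left (hym (2 * (1 - s) + -(1/8)) (-(1/16)) (by linarith)) (by positivity : 0 ≤ E / (1 - s))
          linarith
  have p4 : Z * ∑ b ∈ Ioc 0 y, twf s g b ≤ E / (1 - s) * P := by
    have h3 := (abs_le.1 (h1.1 y hy)).1
    calc _ ≤ Z * (-(E * (y:ℝ) ^ (-(1/8):ℝ))) := mul_le_mul_of_nonpos_left (by linarith) hZ0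
      _ = (-Z) * (E * (y:ℝ) ^ (-(1/8):ℝ)) := by ring
      _ ≤ (1/(1-s)) * (E * P) := by
          refine mul_le_mul (by linarith) ?_ (by positivity) (by positivity)
          exact mul_le_mul_of_nonneg_left (hym _ _ (by norm_num)) (by linarith)
      _ = _ := by ring
  have p5 : 2 * A * P + 2 * E / (1 - s) * P + E / (1 - s) * P + E / (1 - s) * P ≤ 6 * A * E / (1 - s) * P := by
    have a1 : A ≤ A * E / (1 - s) := by
      rw [le_div_iff₀ h1s]
      nlinarith
    have a2 : E / (1 - s) ≤ A * E / (1 - s) := by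
      gcongr; nlinarith
    have : 2 * A + 2 * E / (1 - s) + E / (1 - s) + E / (1 - s) ≤ 6 * A * E / (1 - s) := by
      have e1 : 2 * E / (1 - s) = 2 * (E / (1 - s)) := by ring
      have e2 : 6 * A * E / (1 - s) = 6 * (A * E / (1 - s)) := by ring
      rw [e1, e2]; linarith
    have := mul_le_mul_of_nonneg_right this hP0.le
    linarith
  linarith

lemma core2 {g : ArithmeticFunction ℝ} {s Gs G1 E A : ℝ} (hs : 31/32 ≤ s) (hs1 : s < 1) (hE : 1 ≤ E) (hA : 1 ≤ A)
    (h1 : Cv (twf s g) Gs E (1/8) A (1/8)) (h2 : Cv (twf 1 g) G1 E (1/8) A (1/8))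
    (hpos : ∀ n, 0 ≤ (af one1 * g) n) (hg1 : g 1 = 1) (hGs : 0 ≤ Gs) {K q : ℝ} (hK : 1 ≤ K) (hq : 1 ≤ q)
    (hKq : 12 * A * E / (1 - s) ≤ K * q ^ 4) :
    (1 - s) / 2 * (2 * K ^ 16) ^ (-2 : ℝ) * q ^ (-(128 * (1 - s))) ≤ G1 := by
  have h1s : 0 < 1 - s := by linarith
  set T := (K * q ^ 4) ^ 16 with hT
  have hq4 : 1 ≤ q ^ 4 := one_le_pow₀ hq
  have hKq1 : 1 ≤ K * q ^ 4 := by nlinarith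
  have hT1 : 1 ≤ T := one_le_pow₀ hKq1
  set y := ⌈T⌉₊ with hy
  have hyT : T ≤ y := Nat.le_ceil T
  have hyT2 : (y:ℝ) ≤ 2 * T := by
    have := Nat.ceil_lt_add_one (by linarith : 0 ≤ T)
    linarith
  have hy1 : 1 ≤ y := by
    have : (1:ℝ) ≤ y := hT1.trans hyT
    exact_mod_cast this
  have hy0 : (0:ℝ) < y := by exact_mod_cast hy1
  have hc := core hs hs1 hE hA h1 h2 hpos hg1 hGs y hy1
  have e1 : (y:ℝ) ^ (-(1/16):ℝ) ≤ (K * q ^ 4)⁻¹ := by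
    calc _ ≤ T ^ (-(1/16):ℝ) := Real.rpow_le_rpow_of_nonpos (by linarith) hyT (by norm_num)
      _ = _ := by
          rw [hT, ← Real.rpow_natCast, ← Real.rpow_mul (by positivity), ← Real.rpow_neg_one]
          congr 1; norm_num
  have e2 : 6 * A * E / (1 - s) * (y:ℝ) ^ (-(1/16):ℝ) ≤ 1/2 := by
    calc _ ≤ (K * q ^ 4 / 2) * (K * q ^ 4)⁻¹ := by
          refine mul_le_mul ?_ e1 (by positivity) (by positivity)
          have : 6 * A * E / (1 - s) = (12 * A * E / (1 - s)) / 2 := by ring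
          rw [this]; linarith
      _ = 1/2 := by field_simp
  have e3 : 1/2 ≤ (y:ℝ) ^ (2 * (1 - s)) / (1 - s) * G1 := by linarith
  have hG : 0 < G1 := by
    by_contra h
    push Not at h
    have : (y:ℝ) ^ (2 * (1 - s)) / (1 - s) * G1 ≤ 0 := mul_nonpos_of_nonneg_of_nonpos (by positivity) h
    linarith
  have e4 : (1 - s) / 2 * (y:ℝ) ^ (-(2 * (1 - s))) ≤ G1 := by
    rw [Real.rpow_neg hy0.le, ← div_eq_mul_inv, div_le_iff₀ (by positivity)]
    rw [div_mul_eq_mul_div, le_div_iff₀ h1s] at e3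
    linarith
  refine le_trans ?_ e4
  rw [mul_assoc]
  refine mul_le_mul_of_nonneg_left ?_ (by linarith)
  have e5 : (2 * T) ^ (-(2 * (1 - s))) ≤ (y:ℝ) ^ (-(2 * (1 - s))) :=
    Real.rpow_le_rpow_of_nonpos hy0 hyT2 (by linarith)
  refine le_trans ?_ e5
  have e6 : 2 * T = (2 * K ^ 16) * q ^ (64:ℝ) := by
    rw [hT, show (64:ℝ) = ((64:ℕ):ℝ) by norm_num, Real.rpow_natCast]; ring
  rw [e6, Real.mul_rpow (x := 2 * K ^ 16) (y := q ^ (64:ℝ)) (by positivity) (by positivity), ← Real.rpow_mul (by linarith)]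
  have e7 : (64:ℝ) * -(2 * (1 - s)) = -(128 * (1 - s)) := by ring
  rw [e7]
  refine mul_le_mul_of_nonneg_right ?_ (by positivity)
  have : 1 ≤ K ^ 16 := one_le_pow₀ hK
  exact Real.rpow_le_rpow_of_exponent_le (by linarith) (by linarith)

lemma twf_char (s : ℝ) (χ : ℕ →*₀ ℝ) (n : ℕ) : twf s (af χ) n = χ n * (n:ℝ) ^ (-s) := by
  rcases eq_or_ne n 0 with rfl | hn
  · simp
  · rw [twf_apply _ _ hn, af_apply, mul_comm]

lemma Cv_char {χ : ℕ →*₀ ℝ} {B s : ℝ} (hc : RC χ) (h : PS χ B) (hs : 31/32 ≤ s) (hs1 : s ≤ 1) :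
    Cv (twf s (af χ)) (Lv χ s) (2 * B) (7/8) 32 (1/32) := by
  refine ⟨fun N hN => ?_, fun N hN => ?_⟩
  · simp_rw [twf_char]
    rw [abs_sub_comm]
    refine (h.Lv_sub (by linarith) N).trans ?_
    refine mul_le_mul_of_nonneg_left ?_ (by linarith [h.nonneg])
    refine (rpow_anti (by linarith) hN (Nat.le_succ N)).trans ?_
    exact Real.rpow_le_rpow_of_exponent_le (by exact_mod_cast hN) (by linarith)
  · have := sum_rpow_le (s := 31/32) (by norm_num) (by norm_num) N
    have e : (N:ℝ) ^ (1 - 31/32 : ℝ) / (1 - 31/32) = 32 * (N:ℝ) ^ (1/32:ℝ) := by norm_num; ring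
    rw [e] at this
    refine le_trans (sum_le_sum fun n hn => ?_) this
    rw [mem_Ioc] at hn
    rw [twf_char, abs_mul, abs_of_nonneg (by positivity : 0 ≤ (n:ℝ) ^ (-s))]
    calc _ ≤ 1 * (n:ℝ) ^ (-s) := by gcongr; exact hc.abs_le n
      _ = (n:ℝ) ^ (-s) := one_mul _
      _ ≤ _ := Real.rpow_le_rpow_of_exponent_le (by exact_mod_cast hn.1) (by linarith)

lemma Cv_triple {χ₁ χ χ₂ : ℕ →*₀ ℝ} {B s : ℝ} (hB : 1 ≤ B) (hc₁ : RC χ₁) (h₁ : PS χ₁ B) (hc : RC χ) (h : PS χ B)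
    (hc₂ : RC χ₂) (h₂ : PS χ₂ B) (hs : 31/32 ≤ s) (hs1 : s ≤ 1) :
    Cv (twf s (af χ₁ * af χ * af χ₂)) (Lv χ₁ s * Lv χ s * Lv χ₂ s) (10 * 1024 * (1280 * B ^ 2) ^ 2) (1/8) (1024 ^ 2) (1/8) := by
  rw [twf_mul, twf_mul]
  have a := (Cv_char hc₁ h₁ hs hs1).mul (Cv_char hc h hs hs1) (by linarith) (by norm_num) (by norm_num) (by norm_num) (by norm_num)
  have hB2 : B ≤ B ^ 2 := by nlinarith
  have a' : Cv (twf s (af χ₁) * twf s (af χ)) (Lv χ₁ s * Lv χ s) (1280 * B ^ 2) (27/64) 1024 (1/16) :=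
    a.mono (by positivity) (by positivity) (by nlinarith) (by norm_num) (by norm_num) (by norm_num)
  have b' : Cv (twf s (af χ₂)) (Lv χ₂ s) (1280 * B ^ 2) (27/64) 1024 (1/16) :=
    (Cv_char hc₂ h₂ hs hs1).mono (by linarith) (by norm_num) (by nlinarith) (by norm_num) (by norm_num) (by norm_num)
  have c := a'.mul b' (by nlinarith) (by norm_num) (by norm_num) (by norm_num) (by norm_num)
  exact c.mono (by positivity) (by positivity) le_rfl (by norm_num) le_rfl (by norm_num)

lemma Lv_cont {χ : ℕ → ℝ} {B : ℝ} (h : PS χ B) {a b : ℝ} (ha : 0 < a) : ContinuousOn (Lv χ) (Set.Icc a b) := by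
  have hu : TendstoUniformlyOn (fun (N : ℕ) (s : ℝ) => ∑ n ∈ Ioc 0 N, χ n * (n : ℝ) ^ (-s)) (Lv χ) atTop (Set.Icc a b) := by
    rw [Metric.tendstoUniformlyOn_iff]
    intro e he
    have h1 := (tendsto_nat_rpow_neg ha).const_mul (2 * B)
    rw [mul_zero] at h1
    filter_upwards [h1.eventually (gt_mem_nhds he)] with N hN s hs
    rw [Real.dist_eq]
    refine ((h.Lv_sub (ha.trans_le hs.1) N).trans ?_).trans_lt hN
    refine mul_le_mul_of_nonneg_left ?_ (by linarith [h.nonneg])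
    refine Real.rpow_le_rpow_of_exponent_le ?_ (by linarith [hs.1])
    push_cast; linarith [Nat.cast_nonneg (α := ℝ) N]
  refine hu.continuousOn (Eventually.of_forall fun N => ?_).frequently
  refine continuousOn_finsetSum _ fun n hn => ?_
  rw [mem_Ioc] at hn
  have : (n:ℝ) ≠ 0 := by exact_mod_cast (by omega : n ≠ 0)
  refine ContinuousOn.mul continuousOn_const ?_
  exact (continuous_const.rpow continuous_neg fun _ => Or.inl this).continuousOn

lemma Lv_one_log {χ : ℕ →*₀ ℝ} {B : ℝ} (hc : RC χ) (h : PS χ B) (hB : 1 ≤ B) : Lv χ 1 ≤ 4 + Real.log B := by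
  have h1 := h.Lv_sub (one_pos) ⌊B⌋₊
  have h2 : (B:ℝ) < ((⌊B⌋₊ + 1 : ℕ) : ℝ) := by push_cast; exact Nat.lt_floor_add_one B
  have hB0 : 0 < B := by linarith
  have h3 : 2 * B * ((⌊B⌋₊ + 1 : ℕ) : ℝ) ^ (-1:ℝ) ≤ 2 := by
    rw [Real.rpow_neg_one, ← div_eq_mul_inv, div_le_iff₀ (by linarith)]; linarith
  have h4 : ∑ n ∈ Ioc 0 ⌊B⌋₊, χ n * (n:ℝ) ^ (-1:ℝ) ≤ 1 + Real.log B := by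
    calc _ ≤ ∑ n ∈ Ioc 0 ⌊B⌋₊, ((n:ℝ))⁻¹ := by
          refine sum_le_sum fun n hn => ?_
          rw [Real.rpow_neg_one]
          exact mul_le_of_le_one_left (by positivity) (hc.le_one n)
      _ = (harmonic ⌊B⌋₊ : ℝ) := by
          rw [harmonic_eq_sum_Icc]; push_cast; rfl
      _ ≤ _ := harmonic_floor_le_one_add_log B hB
  have := (abs_le.1 h1).2
  linarith

theorem siegel {ι : Type*} (X : ι → ℕ →*₀ ℝ) (q : ι → ℝ) (A0 : ℝ) (hA0 : 1 ≤ A0) (hq : ∀ i, 1 ≤ q i)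
    (hRC : ∀ i, RC (X i)) (hPS : ∀ i, PS (X i) (A0 * q i))
    (hPS2 : ∀ i j, i ≠ j → PS (⇑(X i * X j)) (A0 * (q i * q j)))
    (hL : ∀ i, 0 < Lv (X i) 1) (ε : ℝ) (hε : 0 < ε) :
    ∃ c : ℝ, 0 < c ∧ ∀ i, c * (q i) ^ (-ε) ≤ Lv (X i) 1 := by
  set η := min (1/32) (ε / 256) with hη
  have hη0 : 0 < η := lt_min (by norm_num) (by positivity)
  have hη1 : η ≤ 1/32 := min_le_left _ _
  have hη2 : η ≤ ε / 256 := min_le_right _ _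
  by_cases hB : ∀ i, 0 ≤ Lv (X i) (1 - η)
  · set K := 12 * 32 * (2 * A0) / η with hK
    have hK1 : 1 ≤ K := by rw [hK, le_div_iff₀ hη0]; linarith
    refine ⟨η / 2 * (2 * K ^ 16) ^ (-2 : ℝ), by positivity, fun i => ?_⟩
    have hqi := hq i
    have hAq : 1 ≤ A0 * q i := by nlinarith
    have c1 := (Cv_char (hRC i) (hPS i) (s := 1 - η) (by linarith) (by linarith)).mono (by linarith) (by norm_num) le_rfl
      (by norm_num : (1/8:ℝ) ≤ 7/8) le_rfl (by norm_num : (1/32:ℝ) ≤ 1/8)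
    have c2 := (Cv_char (hRC i) (hPS i) (s := 1) (by linarith) (by linarith)).mono (by linarith) (by norm_num) le_rfl
      (by norm_num : (1/8:ℝ) ≤ 7/8) le_rfl (by norm_num : (1/32:ℝ) ≤ 1/8)
    have := core2 (K := K) (q := q i) (by linarith) (by linarith) (by linarith) (by norm_num) c1 c2 (fun n => gg_nonneg (hRC i) n)
      (by simp) (hB i) hK1 hqi (by
        have e : 12 * 32 * (2 * (A0 * q i)) / (1 - (1 - η)) = K * q i := by rw [hK]; ring
        rw [e]
        refine mul_le_mul_of_nonneg_left ?_ (by linarith)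
        exact le_self_pow₀ hqi (by norm_num))
    rw [show 1 - (1 - η) = η by ring] at this
    refine le_trans ?_ this
    refine mul_le_mul_of_nonneg_left ?_ (by positivity)
    exact Real.rpow_le_rpow_of_exponent_le hqi (by linarith)
  · push Not at hB
    obtain ⟨i₁, hi₁⟩ := hB
    obtain ⟨β, hβ, hβ0⟩ : ∃ β ∈ Set.Icc (1 - η) 1, Lv (X i₁) β = 0 := by
      have := intermediate_value_Icc (by linarith : 1 - η ≤ 1) (Lv_cont (hPS i₁) (a := 1 - η) (b := 1) (by linarith))
      exact this ⟨hi₁.le, (hL i₁).le⟩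
    have hβ1 : β < 1 := lt_of_le_of_ne hβ.2 fun h => by rw [h] at hβ0; linarith [hL i₁]
    have h1β : 0 < 1 - β := by linarith
    have hβη : 1 - β ≤ η := by linarith [hβ.1]
    set q1 := q i₁ with hq1
    have hq11 : 1 ≤ q1 := hq i₁
    set D := A0 * q1 with hD
    have hD1 : 1 ≤ D := by nlinarith
    set K := 12 * 1024 ^ 2 * (10 * 1024 * (1280 * D ^ 2) ^ 2) / (1 - β) with hK
    have hK1 : 1 ≤ K := by
      rw [hK, le_div_iff₀ h1β]
      have : 1 ≤ D ^ 2 := one_le_pow₀ hD1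
      have : 1 ≤ (1280 * D ^ 2) ^ 2 := one_le_pow₀ (by linarith)
      linarith
    set L1 := Lv (X i₁) 1 with hL1
    have hL10 : 0 < L1 := hL i₁
    set c0 := (1 - β) / 2 * (2 * K ^ 16) ^ (-2 : ℝ) with hc0
    have hc00 : 0 < c0 := by positivity
    set W := 4 + Real.log D + 1 / (ε/2) with hW
    have hlogD : 0 ≤ Real.log D := Real.log_nonneg hD1
    have hW0 : 0 < W := by positivity
    refine ⟨min L1 (c0 / (L1 * W)), lt_min hL10 (by positivity), fun i => ?_⟩
    have hqi := hq i
    have hqi0 : 0 < q i := by linarith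
    by_cases hi : i = i₁
    · rw [hi, ← hL1, ← hq1]
      calc _ ≤ L1 * 1 := by
            refine mul_le_mul (min_le_left _ _) ?_ (by positivity) hL10.le
            exact Real.rpow_le_one_of_one_le_of_nonpos hq11 (by linarith)
        _ = L1 := mul_one _
    set B := D * q i with hBdef
    have hB1 : 1 ≤ B := by nlinarith
    have m1 : PS (X i₁) B := fun N => (hPS i₁ N).trans (by rw [← hq1, ← hD]; nlinarith)
    have m2 : PS (X i) B := fun N => (hPS i N).trans (by rw [hBdef, hD]; nlinarith [mul_nonneg (mul_nonneg (by linarith) hqi0.le : 0 ≤ A0 * q i) (by linarith : 0 ≤ q1 - 1)])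
    have m3 : PS (⇑(X i₁ * X i)) B := fun N => (hPS2 i₁ i (Ne.symm hi) N).trans (by rw [hBdef, hD, ← hq1]; linarith)
    have c1 := Cv_triple hB1 (hRC i₁) m1 (hRC i) m2 ((hRC i₁).mul (hRC i)) m3 (s := β) (by linarith) (by linarith)
    have c2 := Cv_triple hB1 (hRC i₁) m1 (hRC i) m2 ((hRC i₁).mul (hRC i)) m3 (s := 1) (by linarith) (by linarith)
    have hB2 : 1 ≤ B ^ 2 := one_le_pow₀ hB1
    have hB3 : 1 ≤ (1280 * B ^ 2) ^ 2 := one_le_pow₀ (by linarith)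
    have key := core2 (K := K) (q := q i) (by linarith) hβ1 (by linarith) (by norm_num) c1 c2
      (fun n => by
        have : af one1 * (af (X i₁) * af (X i) * af (X i₁ * X i)) = rr (X i₁) (X i) := by
          rw [rr]; simp only [mul_assoc]
        rw [this]
        exact rr_nonneg (hRC i₁) (hRC i) n)
      (by simp [mul_apply]) (by rw [hβ0]; simp) hK1 hqi (by
        have e : 12 * 1024 ^ 2 * (10 * 1024 * (1280 * B ^ 2) ^ 2) / (1 - β) = K * q i ^ 4 := by rw [hK, hBdef]; ring
        rw [e])
    rw [← hc0, ← hL1] at key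
    set L := Lv (X i) 1 with hLd
    have hL0 : 0 < L := hL i
    set L' := Lv (⇑(X i₁ * X i)) 1 with hL'
    have hL'u : L' ≤ W * (q i) ^ (ε / 2) := by
      have h5 := Lv_one_log ((hRC i₁).mul (hRC i)) m3 hB1
      have h6 : Real.log B = Real.log D + Real.log (q i) := Real.log_mul (by linarith) (by linarith)
      have h7 : Real.log (q i) ≤ (q i) ^ (ε/2) / (ε/2) := Real.log_le_rpow_div hqi0.le (by positivity)
      have h8 : 1 ≤ (q i) ^ (ε/2) := Real.one_le_rpow hqi (by positivity)
      rw [hW]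
      have : (4 + Real.log D) * 1 ≤ (4 + Real.log D) * (q i) ^ (ε/2) := by gcongr
      have e : (q i) ^ (ε/2) / (ε/2) = 1 / (ε/2) * (q i) ^ (ε/2) := by ring
      rw [e] at h7
      linarith
    have h9 : c0 * (q i) ^ (-(ε/2)) ≤ c0 * q i ^ (-(128 * (1 - β))) := by
      refine mul_le_mul_of_nonneg_left ?_ hc00.le
      exact Real.rpow_le_rpow_of_exponent_le hqi (by linarith)
    have h10 : L1 * L * L' ≤ L1 * L * (W * (q i) ^ (ε / 2)) := mul_le_mul_of_nonneg_left hL'u (by positivity)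
    have h11 : c0 * (q i) ^ (-(ε/2)) ≤ L1 * L * (W * (q i) ^ (ε / 2)) := (h9.trans key).trans h10
    have hp : 0 < (q i) ^ (ε / 2) := by positivity
    have e12 : (q i) ^ (-(ε/2)) = (q i) ^ (-ε) * (q i) ^ (ε / 2) := by rw [← Real.rpow_add hqi0]; congr 1; ring
    rw [e12] at h11
    have h13 : c0 * (q i) ^ (-ε) ≤ L1 * L * W := by
      have : c0 * (q i) ^ (-ε) * (q i) ^ (ε / 2) ≤ L1 * L * W * (q i) ^ (ε / 2) := by linarith
      exact le_of_mul_le_mul_right this hp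
    calc _ ≤ c0 / (L1 * W) * (q i) ^ (-ε) := by gcongr; exact min_le_right _ _
      _ = c0 * (q i) ^ (-ε) / (L1 * W) := by ring
      _ ≤ L := by rw [div_le_iff₀ (by positivity)]; linarith

end BQ
end part_C2

section part_D1
set_option linter.unusedVariables false
open Finset Filter Topology
namespace BQ
open ArithmeticFunction
open scoped ArithmeticFunction.zeta

lemma geom_norm (w : ℂ) (hw : ‖w‖ = 1) (N : ℕ) : ‖∑ n ∈ Ioc 0 N, w ^ n‖ * ‖w - 1‖ ≤ 2 := by
  have h1 : ∑ n ∈ Ioc 0 N, w ^ n = w * ∑ n ∈ range N, w ^ n := by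
    induction N with
    | zero => simp
    | succ k ih =>
      rw [Finset.sum_Ioc_succ_top (by omega), Finset.sum_range_succ, ih]; ring
  rw [h1, norm_mul, hw, one_mul, ← norm_mul, geom_sum_mul]
  calc _ ≤ ‖w ^ N‖ + ‖(1:ℂ)‖ := norm_sub_le _ _
    _ = 2 := by rw [norm_pow, hw]; norm_num

lemma sin_bound {q j : ℕ} (hj : 0 < j) (hjq : j < q) :
    1 / (2 * Real.sin (Real.pi * j / q)) ≤ q / 4 * (1 / (j:ℝ) + 1 / ((q - j : ℕ):ℝ)) := by
  have hq : (0:ℝ) < q := by exact_mod_cast (by omega : 0 < q)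
  have hj' : (0:ℝ) < j := by exact_mod_cast hj
  have hc : ((q - j : ℕ):ℝ) = q - j := by push_cast [hjq.le]; ring
  have hjq' : (0:ℝ) < q - j := by rw [← hc]; exact_mod_cast (by omega : 0 < q - j)
  rw [hc]
  have key : ∀ t : ℝ, 0 < t → t ≤ q / 2 → 2 * t / q ≤ Real.sin (Real.pi * t / q) := by
    intro t ht ht2
    have := Real.mul_le_sin (x := Real.pi * t / q) (by positivity) (by
      rw [div_le_div_iff₀ hq (by norm_num)]
      have := mul_le_mul_of_nonneg_left ht2 Real.pi_pos.le
      nlinarith [Real.pi_pos])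
    calc 2 * t / q = 2 / Real.pi * (Real.pi * t / q) := by field_simp
      _ ≤ _ := this
  rcases le_total (j:ℝ) (q/2) with h | h
  · have h1 := key j hj' h
    calc _ ≤ 1 / (2 * (2 * (j:ℝ) / q)) := by
          apply one_div_le_one_div_of_le (by positivity); linarith
      _ = q / 4 * (1 / j) := by field_simp; norm_num
      _ ≤ _ := by
        apply mul_le_mul_of_nonneg_left _ (by positivity)
        have : 0 < 1 / ((q:ℝ) - j) := by positivity
        linarith
  · have h1 := key (q - j) hjq' (by linarith)
    have h2 : Real.sin (Real.pi * (q - j) / q) = Real.sin (Real.pi * j / q) := by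
      rw [← Real.sin_pi_sub]; congr 1; field_simp; ring
    rw [h2] at h1
    calc _ ≤ 1 / (2 * (2 * ((q:ℝ) - j) / q)) := by
          apply one_div_le_one_div_of_le (by positivity); linarith
      _ = q / 4 * (1 / (q - j)) := by field_simp; norm_num
      _ ≤ _ := by
        apply mul_le_mul_of_nonneg_left _ (by positivity)
        have : 0 < 1 / (j:ℝ) := by positivity
        linarith

lemma geom_std {q : ℕ} [NeZero q] {j : ZMod q} (hj : j ≠ 0) (N : ℕ) :
    ‖∑ n ∈ Ioc 0 N, ZMod.stdAddChar (-((n : ZMod q) * j))‖ ≤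
      q / 2 * (1 / (j.val:ℝ) + 1 / ((q - j.val : ℕ):ℝ)) := by
  have hv : 0 < j.val := Nat.pos_of_ne_zero (by rwa [Ne, ZMod.val_eq_zero])
  have hlt := ZMod.val_lt j
  set w : ℂ := ZMod.stdAddChar (-j) with hw
  have hpow : ∀ n : ℕ, ZMod.stdAddChar (-((n : ZMod q) * j)) = w ^ n := by
    intro n
    rw [hw, ← AddChar.map_nsmul_eq_pow]; congr 1; simp
  have hwn : ‖w‖ = 1 := by rw [hw]; exact Circle.norm_coe (ZMod.toCircle (-j))
  simp_rw [hpow]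
  have hw1 : ‖w - 1‖ = 2 * Real.sin (Real.pi * j.val / q) := by
    have e1 : w = Complex.exp (Complex.I * ((-(2 * Real.pi * j.val / q) : ℝ))) := by
      rw [hw]
      have : (-j) = ((-(j.val:ℤ) : ℤ) : ZMod q) := by simp
      rw [this, ZMod.stdAddChar_coe]; congr 1; push_cast; ring
    rw [e1, Complex.norm_exp_I_mul_ofReal_sub_one]
    rw [show (-(2 * Real.pi * (j.val:ℝ) / q)) / 2 = -(Real.pi * j.val / q) by ring, Real.sin_neg]
    rw [mul_neg, norm_neg, Real.norm_eq_abs, abs_of_nonneg]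
    apply mul_nonneg (by norm_num)
    apply Real.sin_nonneg_of_nonneg_of_le_pi (by positivity)
    have : (0:ℝ) < q := by exact_mod_cast (by omega : 0 < q)
    rw [div_le_iff₀ this]
    exact mul_le_mul_of_nonneg_left (by exact_mod_cast hlt.le) Real.pi_pos.le
  have hs := sin_bound hv hlt
  have hg := geom_norm w hwn N
  have hpos : 0 < Real.sin (Real.pi * j.val / q) := by
    have : (0:ℝ) < q := by exact_mod_cast (by omega : 0 < q)
    apply Real.sin_pos_of_pos_of_lt_pi
    · have : (0:ℝ) < j.val := by exact_mod_cast hv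
      positivity
    · rw [div_lt_iff₀ this]
      exact mul_lt_mul_of_pos_left (by exact_mod_cast hlt) Real.pi_pos
  rw [hw1] at hg
  calc _ ≤ 2 / (2 * Real.sin (Real.pi * j.val / q)) := by rw [le_div_iff₀ (by positivity)]; exact hg
    _ = 2 * (1 / (2 * Real.sin (Real.pi * j.val / q))) := by ring
    _ ≤ 2 * (q / 4 * (1 / (j.val:ℝ) + 1 / ((q - j.val : ℕ):ℝ))) := by linarith
    _ = _ := by ring

lemma gauss_norm {q : ℕ} [NeZero q] {χ : DirichletCharacter ℂ q} (hχ : χ.IsPrimitive) :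
    ‖gaussSum χ ZMod.stdAddChar‖ = Real.sqrt q := by
  have h1 := congrFun (ZMod.dft_dft (χ : ZMod q → ℂ)) 1
  rw [ZMod.dft_apply] at h1
  simp only [smul_eq_mul, mul_one] at h1
  simp_rw [hχ.fourierTransform_eq_inv_mul_gaussSum] at h1
  have h2 : ∑ x : ZMod q, ZMod.stdAddChar (-x) * (χ⁻¹ (-x) * gaussSum χ ZMod.stdAddChar)
      = gaussSum χ⁻¹ ZMod.stdAddChar * gaussSum χ ZMod.stdAddChar := by
    rw [gaussSum.eq_1 χ⁻¹, sum_mul]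
    rw [← Equiv.sum_comp (Equiv.neg (ZMod q))]
    apply sum_congr rfl; intro x _; simp; ring
  rw [h2] at h1
  have h3 : ‖gaussSum χ⁻¹ ZMod.stdAddChar‖ = ‖gaussSum χ ZMod.stdAddChar‖ := by
    have := star_gaussSum_eq χ ZMod.stdAddChar
    rw [AddChar.inv_mulShift, ← Units.coe_neg_one, gaussSum_mulShift_eq] at this
    have h4 := congrArg norm this
    rw [norm_star, norm_mul] at h4
    have : ‖(χ⁻¹)⁻¹ ((-1 : (ZMod q)ˣ) : ZMod q)‖ = 1 := DirichletCharacter.unit_norm_eq_one _ _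
    rw [this, one_mul] at h4
    exact h4.symm
  have h5 := congrArg norm h1
  rw [norm_mul, h3, norm_mul] at h5
  have : ‖χ (-1)‖ = 1 := by
    have := DirichletCharacter.unit_norm_eq_one χ (-1)
    simpa using this
  rw [this] at h5
  rw [eq_comm, Real.sqrt_eq_iff_mul_self_eq (by positivity) (by positivity)]
  simpa using h5.symm

lemma pv_prim {q : ℕ} [NeZero q] {χ : DirichletCharacter ℂ q} (hχ : χ.IsPrimitive) (h1 : q ≠ 1) (N : ℕ) :
    ‖∑ n ∈ Ioc 0 N, χ (n : ZMod q)‖ ≤ Real.sqrt q * (1 + Real.log q) := by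
  have hq : 0 < q := Nat.pos_of_ne_zero (NeZero.ne q)
  have hqr : (0:ℝ) < q := by exact_mod_cast hq
  have e0 : ∀ n : ℕ, (q:ℂ) * χ (n : ZMod q) =
      χ (-1) * ∑ j : ZMod q, ZMod.stdAddChar (-((n : ZMod q) * j)) * (χ⁻¹ (-j) * gaussSum χ ZMod.stdAddChar) := by
    intro n
    have h1 := congrFun (ZMod.dft_dft (χ : ZMod q → ℂ)) n
    rw [ZMod.dft_apply] at h1
    simp only [smul_eq_mul] at h1
    simp_rw [hχ.fourierTransform_eq_inv_mul_gaussSum] at h1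
    simp_rw [mul_comm ((n:ℕ) : ZMod q)]
    rw [h1]
    have : χ (-(n:ZMod q)) = χ (-1) * χ n := by rw [← map_mul]; simp
    rw [this]
    have h2 : χ (-1) * χ (-1) = 1 := by rw [← map_mul]; simp
    linear_combination (-(q:ℂ) * χ n) * h2
  have e1 : (q:ℂ) * ∑ n ∈ Ioc 0 N, χ (n : ZMod q) =
      χ (-1) * ∑ j : ZMod q, (∑ n ∈ Ioc 0 N, ZMod.stdAddChar (-((n : ZMod q) * j))) *
        (χ⁻¹ (-j) * gaussSum χ ZMod.stdAddChar) := by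
    rw [mul_sum]; simp_rw [e0]; rw [← mul_sum, sum_comm]; simp_rw [sum_mul]
  have hb : ‖∑ j : ZMod q, (∑ n ∈ Ioc 0 N, ZMod.stdAddChar (-((n : ZMod q) * j))) *
        (χ⁻¹ (-j) * gaussSum χ ZMod.stdAddChar)‖ ≤ ∑ j : ZMod q, (if j = 0 then 0 else
          q / 2 * (1 / (j.val:ℝ) + 1 / ((q - j.val : ℕ):ℝ))) * Real.sqrt q := by
    refine (norm_sum_le _ _).trans (sum_le_sum ?_)
    intro j _
    rw [norm_mul, norm_mul, gauss_norm hχ]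
    split_ifs with hj
    · subst hj
      have : χ⁻¹ (-(0:ZMod q)) = 0 := by rw [neg_zero]; exact DirichletCharacter.map_zero' _ h1
      rw [this]; simp
    · gcongr
      · exact geom_std hj N
      · have := DirichletCharacter.norm_le_one (χ⁻¹) (-j)
        nlinarith [Real.sqrt_nonneg (q:ℝ)]
  have hsum : ∑ j : ZMod q, (if j = 0 then 0 else
          q / 2 * (1 / (j.val:ℝ) + 1 / ((q - j.val : ℕ):ℝ))) ≤ q * (1 + Real.log q) := by
    have h0 : ∑ j : ZMod q, (if j = 0 then 0 else
          (q:ℝ) / 2 * (1 / (j.val:ℝ) + 1 / ((q - j.val : ℕ):ℝ))) =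
          ∑ v ∈ range q, (if v = 0 then 0 else (q:ℝ) / 2 * (1 / (v:ℝ) + 1 / ((q - v : ℕ):ℝ))) := by
      apply sum_bij (fun (j : ZMod q) _ => j.val)
      · intro j _; simpa using ZMod.val_lt j
      · intro a _ b _ h; exact ZMod.val_injective q h
      · intro b hb; exact ⟨(b : ZMod q), mem_univ _, ZMod.val_natCast_of_lt (by simpa using hb)⟩
      · intro j _; simp [ZMod.val_eq_zero]
    rw [h0]
    have hh : ∑ v ∈ Ico 1 q, 1 / (v:ℝ) ≤ 1 + Real.log q := by
      have := harmonic_le_one_add_log q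
      refine le_trans ?_ this
      rw [harmonic_eq_sum_Icc]; push_cast
      simp_rw [one_div]
      apply sum_le_sum_of_subset_of_nonneg
      · intro x; simp; omega
      · intro i _ _; positivity
    have h2 : ∑ v ∈ Ico 1 q, 1 / ((q - v : ℕ):ℝ) = ∑ v ∈ Ico 1 q, 1 / (v:ℝ) := by
      apply sum_bij (fun v _ => q - v)
      · intro a ha; simp at *; omega
      · intro a ha b hb h; simp at *; omega
      · intro b hb; simp at hb; exact ⟨q - b, by simp; omega, by omega⟩
      · intro a ha; rfl
    have h3 : ∑ v ∈ range q, (if v = 0 then 0 else (q:ℝ) / 2 * (1 / (v:ℝ) + 1 / ((q - v : ℕ):ℝ)))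
        = ∑ v ∈ Ico 1 q, (q:ℝ) / 2 * (1 / (v:ℝ) + 1 / ((q - v : ℕ):ℝ)) := by
      rw [← sum_filter_add_sum_filter_not (range q) (fun v => v = 0)]
      rw [sum_eq_zero (by intro x hx; rw [if_pos (Finset.mem_filter.mp hx).2]), zero_add]
      apply sum_congr
      · ext x; simp; omega
      · intro x hx; simp at hx; rw [if_neg (by omega)]
    rw [h3, ← mul_sum, sum_add_distrib, h2]
    nlinarith
  have hfin : (q:ℝ) * ‖∑ n ∈ Ioc 0 N, χ (n : ZMod q)‖ ≤ q * (Real.sqrt q * (1 + Real.log q)) := by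
    have := congrArg norm e1
    rw [norm_mul, norm_mul] at this
    simp only [Complex.norm_natCast] at this
    rw [this]
    have h2 := DirichletCharacter.norm_le_one χ (-1)
    refine (mul_le_of_le_one_left (norm_nonneg _) h2).trans ?_
    refine hb.trans ?_
    calc _
      _ = (∑ j : ZMod q, (if j = 0 then 0 else
          q / 2 * (1 / (j.val:ℝ) + 1 / ((q - j.val : ℕ):ℝ)))) * Real.sqrt q := by rw [sum_mul]
      _ ≤ (q * (1 + Real.log q)) * Real.sqrt q := by gcongr
      _ = _ := by ring
  exact le_of_mul_le_mul_left hfin hqr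

lemma coprime_moebius (n Q : ℕ) (hQ : Q ≠ 0) :
    (if n.Coprime Q then (1:ℂ) else 0) = ∑ e ∈ Q.divisors, if e ∣ n then ((moebius e : ℤ) : ℂ) else 0 := by
  have h := congrArg (fun f => f (n.gcd Q)) moebius_mul_coe_zeta
  rw [mul_comm, coe_zeta_mul_apply, one_apply] at h
  have h2 : ∑ e ∈ Q.divisors, (if e ∣ n then ((moebius e : ℤ) : ℂ) else 0) =
      ∑ e ∈ (n.gcd Q).divisors, ((moebius e : ℤ) : ℂ) := by
    rw [← sum_filter]; apply sum_congr _ (fun _ _ => rfl)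
    ext e; simp [Nat.dvd_gcd_iff, hQ]; tauto
  rw [h2, ← Int.cast_sum, h]
  simp [Nat.coprime_iff_gcd_eq_one]

lemma pv_char {Q : ℕ} [NeZero Q] (χ : DirichletCharacter ℂ Q) (h1 : χ ≠ 1) (N : ℕ) :
    ‖∑ n ∈ Ioc 0 N, χ (n : ZMod Q)‖ ≤ Q.divisors.card * (Real.sqrt Q * (1 + Real.log Q)) := by
  have hQ0 : Q ≠ 0 := NeZero.ne Q
  set q := χ.conductor with hq
  have hqd : q ∣ Q := χ.conductor_dvd_level
  have hq0 : q ≠ 0 := χ.conductor_ne_zero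
  have : NeZero q := ⟨hq0⟩
  have hq1 : q ≠ 1 := fun h => h1 ((DirichletCharacter.eq_one_iff_conductor_eq_one).mpr h)
  set θ : DirichletCharacter ℂ q := χ.primitiveCharacter with hθ
  have hprim : θ.IsPrimitive := χ.primitiveCharacter_isPrimitive
  have hval : ∀ n : ℕ, χ (n : ZMod Q) = ∑ e ∈ Q.divisors, if e ∣ n then ((moebius e : ℤ) : ℂ) * θ (n : ZMod q) else 0 := by
    intro n
    have h2 := coprime_moebius n Q hQ0
    have h3 : χ (n : ZMod Q) = (if n.Coprime Q then (1:ℂ) else 0) * θ (n : ZMod q) := by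
      split_ifs with hc
      · have := χ.primitiveCharacter_apply_of_isCoprime (a := n) (Nat.isCoprime_iff_coprime.mpr hc)
        simp at this
        rw [one_mul, ← this]
      · rw [zero_mul]
        have := (χ.apply_eq_zero_iff (n:ℤ)).mpr (by rwa [Nat.isCoprime_iff_coprime])
        simpa using this
    rw [h3, h2, sum_mul]
    apply sum_congr rfl; intro e _; split_ifs <;> simp
  simp_rw [hval]
  rw [sum_comm]
  refine (norm_sum_le _ _).trans ?_
  rw [← nsmul_eq_mul]
  apply sum_le_card_nsmul
  intro e he
  have hepos : 0 < e := Nat.pos_of_mem_divisors he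
  have h4 : ∑ n ∈ Ioc 0 N, (if e ∣ n then ((moebius e : ℤ) : ℂ) * θ (n : ZMod q) else 0) =
      ((moebius e : ℤ) : ℂ) * θ (e : ZMod q) * ∑ k ∈ Ioc 0 (N / e), θ (k : ZMod q) := by
    rw [← sum_filter, mul_sum]
    symm
    apply sum_bij (fun k _ => e * k)
    · intro k hk
      simp only [mem_Ioc, mem_filter] at *
      refine ⟨⟨Nat.mul_pos hepos hk.1, ?_⟩, dvd_mul_right _ _⟩
      · rw [mul_comm]; exact (Nat.le_div_iff_mul_le hepos).mp hk.2
    · intro a _ b _ h; exact Nat.eq_of_mul_eq_mul_left hepos h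
    · intro b hb
      simp only [mem_Ioc, mem_filter] at hb
      obtain ⟨⟨hb1, hb2⟩, k, rfl⟩ := hb
      refine ⟨k, ?_, rfl⟩
      simp only [mem_Ioc]
      exact ⟨by
        rcases Nat.eq_zero_or_pos k with h0 | h0
        · subst h0; simp at hb1
        · exact h0, (Nat.le_div_iff_mul_le hepos).mpr (by rwa [mul_comm])⟩
    · intro a _; push_cast; rw [map_mul]; ring
  rw [h4, norm_mul, norm_mul]
  have b1 : ‖((moebius e : ℤ) : ℂ)‖ ≤ 1 := by
    rw [Complex.norm_intCast]
    exact_mod_cast abs_moebius_le_one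
  have b2 := DirichletCharacter.norm_le_one θ (e : ZMod q)
  have b3 := pv_prim hprim hq1 (N / e)
  have b4 : Real.sqrt q * (1 + Real.log q) ≤ Real.sqrt Q * (1 + Real.log Q) := by
    have hle : (q:ℝ) ≤ Q := by exact_mod_cast Nat.le_of_dvd (Nat.pos_of_ne_zero hQ0) hqd
    have hq1' : (1:ℝ) ≤ q := by exact_mod_cast Nat.pos_of_ne_zero hq0
    have := Real.log_nonneg hq1'
    gcongr
  calc _ ≤ 1 * 1 * ‖∑ k ∈ Ioc 0 (N / e), θ (k : ZMod q)‖ := by gcongr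
    _ ≤ _ := by linarith

/-- generic periodic real character to Dirichlet character -/
noncomputable def mkChar (X : ℕ →*₀ ℝ) (Q : ℕ) [NeZero Q] (hper : ∀ n, X (n % Q) = X n)
    (hcop : ∀ n, ¬ n.Coprime Q → X n = 0) : DirichletCharacter ℂ Q where
  toFun x := ((X x.val : ℝ) : ℂ)
  map_one' := by
    rw [ZMod.val_one_eq_one_mod, hper]; simp
  map_mul' x y := by
    rw [ZMod.val_mul, hper]; simp
  map_nonunit' x hx := by
    have : ¬ x.val.Coprime Q := by
      rwa [← ZMod.isUnit_iff_coprime, ZMod.natCast_zmod_val]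
    rw [hcop _ this]; simp

lemma mkChar_apply (X : ℕ →*₀ ℝ) (Q : ℕ) [NeZero Q] (hper : ∀ n, X (n % Q) = X n)
    (hcop : ∀ n, ¬ n.Coprime Q → X n = 0) (n : ℕ) : mkChar X Q hper hcop (n : ZMod Q) = ((X n : ℝ) : ℂ) := by
  change ((X ((n : ZMod Q).val) : ℝ) : ℂ) = _
  rw [ZMod.val_natCast, hper]

lemma mkChar_ne_one (X : ℕ →*₀ ℝ) (Q : ℕ) [NeZero Q] (hper : ∀ n, X (n % Q) = X n)
    (hcop : ∀ n, ¬ n.Coprime Q → X n = 0) (hn : ∃ n, X n = -1) : mkChar X Q hper hcop ≠ 1 := by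
  obtain ⟨n, hn⟩ := hn
  intro h
  have h2 := mkChar_apply X Q hper hcop n
  have hc : n.Coprime Q := by
    by_contra h3; rw [hcop n h3] at hn; norm_num at hn
  rw [h, hn, MulChar.one_apply ((ZMod.isUnit_iff_coprime n Q).mpr hc)] at h2
  norm_num at h2

lemma pv_real (X : ℕ →*₀ ℝ) (Q : ℕ) (hQ : Q ≠ 0) (hper : ∀ n, X (n % Q) = X n)
    (hcop : ∀ n, ¬ n.Coprime Q → X n = 0) (hn : ∃ n, X n = -1) :
    PS X (Q.divisors.card * (Real.sqrt Q * (1 + Real.log Q))) := by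
  have : NeZero Q := ⟨hQ⟩
  intro N
  have := pv_char (mkChar X Q hper hcop) (mkChar_ne_one X Q hper hcop hn) N
  simp_rw [mkChar_apply] at this
  rw [← Complex.ofReal_sum, Complex.norm_real] at this
  exact this

lemma pv_exp (ε : ℝ) (hε : 0 < ε) : ∃ C : ℝ, 1 ≤ C ∧ ∀ (X : ℕ →*₀ ℝ) (Q : ℕ) (hQ : Q ≠ 0) (hper : ∀ n, X (n % Q) = X n)
    (hcop : ∀ n, ¬ n.Coprime Q → X n = 0) (hn : ∃ n, X n = -1), PS X (C * (Q:ℝ) ^ (1 / 2 + ε)) := by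
  obtain ⟨C, hC1, hC⟩ := div_bound (ε/2) (by positivity)
  refine ⟨C * (1 + 2 / ε), ?_, ?_⟩
  · have : 0 < 2 / ε := by positivity
    nlinarith
  intro X Q hQ hper hcop hn N
  refine (pv_real X Q hQ hper hcop hn N).trans ?_
  have hQ1 : (1:ℝ) ≤ Q := by exact_mod_cast Nat.pos_of_ne_zero hQ
  have hQ0 : (0:ℝ) < Q := by linarith
  have h1 := hC Q hQ
  have h2 : 1 + Real.log Q ≤ (1 + 2 / ε) * (Q:ℝ) ^ (ε/2) := by
    have := Real.log_le_rpow_div hQ0.le (show 0 < ε/2 by positivity)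
    have h3 : (1:ℝ) ≤ (Q:ℝ) ^ (ε/2) := Real.one_le_rpow hQ1 (by positivity)
    calc _ ≤ (Q:ℝ) ^ (ε/2) + (Q:ℝ) ^ (ε/2) / (ε/2) := by linarith
      _ = _ := by field_simp
  have hl := Real.log_nonneg hQ1
  rw [Real.sqrt_eq_rpow]
  calc _ ≤ (C * (Q:ℝ) ^ (ε/2)) * ((Q:ℝ) ^ ((1:ℝ)/2) * ((1 + 2 / ε) * (Q:ℝ) ^ (ε/2))) := by gcongr
    _ = C * (1 + 2/ε) * ((Q:ℝ) ^ ((1:ℝ)/2) * ((Q:ℝ) ^ (ε/2) * (Q:ℝ) ^ (ε/2))) := by ring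
    _ = _ := by rw [← Real.rpow_add hQ0, ← Real.rpow_add hQ0]; congr 2; ring

end BQ
end part_D1

section part_D2
set_option linter.unusedVariables false
open Finset Filter Topology
namespace BQ
open ArithmeticFunction
open scoped ArithmeticFunction.zeta

/-- The quadratic character `(m/n)` restricted to `n` coprime to `2 * a`. -/
noncomputable def chi (a : ℕ) (m : ℤ) : ℕ →*₀ ℝ where
  toFun n := if n.Coprime (2 * a) then ((jacobiSym m n : ℤ) : ℝ) else 0
  map_zero' := by
    rw [if_neg]; simp
  map_one' := by simp
  map_mul' x y := by
    by_cases hx : x.Coprime (2 * a)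
    · by_cases hy : y.Coprime (2 * a)
      · have hx0 : x ≠ 0 := by rintro rfl; simp at hx
        have hy0 : y ≠ 0 := by rintro rfl; simp at hy
        rw [if_pos hx, if_pos hy, if_pos (Nat.Coprime.mul_left hx hy), jacobiSym.mul_right' m hx0 hy0]
        push_cast; ring
      · rw [if_neg hy, if_neg (fun h => hy (Nat.Coprime.coprime_mul_left h)), mul_zero]
    · rw [if_neg hx, if_neg (fun h => hx (Nat.Coprime.coprime_mul_right h)), zero_mul]

lemma chi_apply (a : ℕ) (m : ℤ) (n : ℕ) :
    chi a m n = if n.Coprime (2 * a) then ((jacobiSym m n : ℤ) : ℝ) else 0 := rfl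

lemma chi_RC (a : ℕ) (m : ℤ) : RC (chi a m) := by
  intro n
  rw [chi_apply]
  split_ifs
  · rcases jacobiSym.trichotomy m n with h | h | h <;> simp [h]
  · simp

lemma chi_mul (a : ℕ) (m m' : ℤ) : chi a m * chi a m' = chi a (m * m') := by
  ext n
  change chi a m n * chi a m' n = chi a (m * m') n
  simp only [chi_apply, jacobiSym.mul_left]
  split_ifs <;> push_cast <;> ring

lemma odd_of_cop {a n : ℕ} (h : n.Coprime (2 * a)) : Odd n := by
  have : n.Coprime 2 := Nat.Coprime.coprime_mul_right_right h
  exact (Nat.coprime_two_right).mp this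

lemma chi_per (a : ℕ) (m : ℤ) (n : ℕ) :
    chi a m (n % (8 * a * m.natAbs)) = chi a m n := by
  set Q := 8 * a * m.natAbs with hQ
  have hc : (n % Q).Coprime (2 * a) ↔ n.Coprime (2 * a) := by
    have h1 : 2 * a ∣ Q := ⟨4 * m.natAbs, by rw [hQ]; ring⟩
    have h2 : (n % Q) % (2 * a) = n % (2 * a) := Nat.mod_mod_of_dvd n h1
    rw [Nat.coprime_iff_gcd_eq_one, Nat.coprime_iff_gcd_eq_one, Nat.ModEq.gcd_eq h2]
  simp only [chi_apply, hc]
  split_ifs with h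
  · have h' := hc.mpr h
    rw [jacobiSym.mod_right m (odd_of_cop h'), jacobiSym.mod_right m (odd_of_cop h)]
    rw [Nat.mod_mod_of_dvd n (⟨2 * a, by rw [hQ]; ring⟩ : 4 * m.natAbs ∣ Q)]
  · rfl

lemma chi_cop (a : ℕ) (m : ℤ) (n : ℕ) (hn : ¬ n.Coprime (8 * a * m.natAbs)) : chi a m n = 0 := by
  rw [chi_apply]
  split_ifs with h
  · have hn0 : n ≠ 0 := by rintro rfl; simp at h
    have : NeZero n := ⟨hn0⟩
    have h0 : jacobiSym m n = 0 := by
      rw [jacobiSym.eq_zero_iff_not_coprime]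
      intro hg
      apply hn
      have h2 : n.Coprime 2 := Nat.Coprime.coprime_mul_right_right h
      have ha : n.Coprime a := Nat.Coprime.coprime_mul_left_right h
      have h8 : n.Coprime 8 := by
        have := h2.pow_right 3
        simpa using this
      refine Nat.Coprime.mul_right (Nat.Coprime.mul_right h8 ha) ?_
      rw [Nat.coprime_comm]
      simpa [Int.gcd] using hg
    rw [h0]; simp
  · rfl

lemma jac_one_mod {k : ℤ} {n W : ℕ} (hn : n ≡ 1 [MOD W]) (hW : 4 * k.natAbs ∣ W) (ho : Odd n) :
    jacobiSym k n = 1 := by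
  rw [jacobiSym.mod_right k ho]
  have h : n % (4 * k.natAbs) = 1 % (4 * k.natAbs) := hn.of_dvd hW
  rw [h, ← jacobiSym.mod_right k odd_one]
  simp

lemma jac_sq {b : ℤ} {m : ℤ} {n : ℕ} (h : n.Coprime b.natAbs) : jacobiSym (b ^ 2 * m) n = jacobiSym m n := by
  rw [jacobiSym.mul_left, jacobiSym.pow_left, jacobiSym.sq_one, one_mul]
  rw [Int.gcd, Nat.gcd_comm]; simpa using h

lemma nontriv_odd {a b : ℕ} (ha : a ≠ 0) (hb : b ≠ 0) {p : ℕ} (hp : p.Prime) (hp2 : p ≠ 2) {k : ℤ} (hk : k ≠ 0)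
    (hpk : ¬ (p:ℤ) ∣ k) : ∃ n : ℕ, n.Coprime (2 * a) ∧ n.Coprime b ∧ jacobiSym (p * k) n = -1 := by
  have : Fact p.Prime := ⟨hp⟩
  set W := 8 * a * b * k.natAbs with hW
  have hk' : k.natAbs ≠ 0 := by simpa using hk
  have hW0 : W ≠ 0 := by positivity
  set W' := W / p ^ W.factorization p with hW'
  have hcop : p.Coprime W' := Nat.coprime_ordCompl hp hW0
  have hmul : p ^ W.factorization p * W' = W := Nat.ordProj_mul_ordCompl_eq_self W p
  have hdvd : ∀ t, t ∣ W → t.Coprime p → t ∣ W' := by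
    intro t ht htp
    rw [← hmul] at ht
    exact Nat.Coprime.dvd_of_dvd_mul_left (htp.pow_right _) ht
  obtain ⟨r, hr⟩ := FiniteField.exists_nonsquare (F := ZMod p) (by rw [ZMod.ringChar_zmod_n]; exact hp2)
  obtain ⟨n, hn1, hn2⟩ := Nat.chineseRemainder hcop r.val 1
  have hnr : ((n : ℕ) : ZMod p) = r := by
    have := (ZMod.natCast_eq_natCast_iff _ _ _).mpr hn1
    rw [this]; simp
  have hop : Odd p := hp.odd_of_ne_two hp2
  have h8 : 8 ∣ W' := by
    apply hdvd 8 ⟨a * b * k.natAbs, by rw [hW]; ring⟩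
    have : Nat.Coprime 2 p := by rw [Nat.coprime_two_left]; exact hop
    have := this.pow_left 3
    simpa using this
  have h81 : n % 8 = 1 := hn2.of_dvd h8
  have hodd : Odd n := Nat.odd_iff.mpr (by omega)
  have hnp : n.Coprime p := by
    rw [Nat.coprime_comm, Nat.Prime.coprime_iff_not_dvd hp]
    intro h
    apply hr
    rw [← hnr, (ZMod.natCast_eq_zero_iff _ _).mpr h]
    exact ⟨0, by simp⟩
  have hnW' : n.Coprime W' := by
    rw [Nat.coprime_iff_gcd_eq_one, hn2.gcd_eq]; simp
  have hnW : n.Coprime W := by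
    rw [← hmul]; exact Nat.Coprime.mul_right (hnp.pow_right _) hnW'
  refine ⟨n, hnW.coprime_dvd_right ⟨4 * b * k.natAbs, by rw [hW]; ring⟩,
    hnW.coprime_dvd_right ⟨8 * a * k.natAbs, by rw [hW]; ring⟩, ?_⟩
  rw [jacobiSym.mul_left]
  have hk1 : jacobiSym k n = 1 := by
    apply jac_one_mod hn2 _ hodd
    apply hdvd _ ⟨2 * a * b, by rw [hW]; ring⟩
    apply Nat.Coprime.mul_left
    · have : Nat.Coprime 2 p := by rw [Nat.coprime_two_left]; exact hop
      have := this.pow_left 2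
      simpa using this
    · rw [Nat.coprime_comm, Nat.Prime.coprime_iff_not_dvd hp]
      intro h; exact hpk (Int.natCast_dvd.mpr h)
  rw [hk1, mul_one, jacobiSym.quadratic_reciprocity_one_mod_four' hop (by omega),
    ← jacobiSym.legendreSym.to_jacobiSym, legendreSym.eq_neg_one_iff]
  simpa [hnr] using hr

lemma nontriv_two {a b : ℕ} (ha : a ≠ 0) (hb : b ≠ 0) (r : ℕ) (hr : r = 3 ∨ r = 5) :
    ∃ n : ℕ, n.Coprime (2 * a) ∧ n.Coprime b ∧ n % 8 = r := by
  set W := 2 * a * b with hW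
  have hW0 : W ≠ 0 := by positivity
  set W' := W / 2 ^ W.factorization 2 with hW'
  have hcop : (2:ℕ).Coprime W' := Nat.coprime_ordCompl Nat.prime_two hW0
  have hmul : 2 ^ W.factorization 2 * W' = W := Nat.ordProj_mul_ordCompl_eq_self W 2
  have hc8 : (8:ℕ).Coprime W' := by
    have := hcop.pow_left 3
    simpa using this
  obtain ⟨n, hn1, hn2⟩ := Nat.chineseRemainder hc8 r 1
  have hn8 : n % 8 = r := by
    have : n % 8 = r % 8 := hn1
    rcases hr with rfl | rfl <;> simpa using this
  have hn2' : n.Coprime 2 := by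
    rw [Nat.coprime_two_right, Nat.odd_iff]; rcases hr with rfl | rfl <;> omega
  have hnW' : n.Coprime W' := by
    rw [Nat.coprime_iff_gcd_eq_one, hn2.gcd_eq]; simp
  have hnW : n.Coprime W := by
    rw [← hmul]; exact Nat.Coprime.mul_right (hn2'.pow_right _) hnW'
  exact ⟨n, hnW.coprime_dvd_right ⟨b, by rw [hW]⟩, hnW.coprime_dvd_right ⟨2 * a, by rw [hW]; ring⟩, hn8⟩

lemma chi_nontriv {a : ℕ} (ha : a ≠ 0) {m : ℤ} (hm : ¬ IsSquare m) : ∃ n, chi a m n = -1 := by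
  have hm0 : m ≠ 0 := by rintro rfl; exact hm ⟨0, by simp⟩
  obtain ⟨s, b, hsb, hs⟩ := Nat.sq_mul_squarefree m.natAbs
  have hb : b ≠ 0 := by rintro rfl; simp at hsb; exact hm0 (Int.natAbs_eq_zero.mp hsb.symm)
  have hs0 : s ≠ 0 := hs.ne_zero
  suffices h : ∃ n : ℕ, n.Coprime (2 * a) ∧ n.Coprime b ∧ jacobiSym (m.sign * s) n = -1 by
    obtain ⟨n, h1, h2, h3⟩ := h
    refine ⟨n, ?_⟩
    rw [chi_apply, if_pos h1]
    have hmm : m = (b:ℤ) ^ 2 * (m.sign * s) := by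
      conv_lhs => rw [← Int.sign_mul_natAbs m, ← hsb]
      push_cast; ring
    rw [hmm, jac_sq (by simpa using h2), h3]; simp
  by_cases hodd : ∃ p, p.Prime ∧ p ≠ 2 ∧ p ∣ s
  · obtain ⟨p, hp, hp2, k, rfl⟩ := hodd
    have hpk : ¬ p ∣ k := by
      rintro ⟨j, rfl⟩
      have := hs p ⟨j, by ring⟩
      exact hp.one_lt.ne' (by simpa using this)
    have hsg : m.sign = 1 ∨ m.sign = -1 := by
      rcases lt_trichotomy m 0 with h | h | h
      · right; exact Int.sign_eq_neg_one_of_neg h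
      · exact absurd h hm0
      · left; exact Int.sign_eq_one_of_pos h
    have hk0 : k ≠ 0 := by rintro rfl; simp at hs0
    obtain ⟨n, h1, h2, h3⟩ := nontriv_odd ha hb hp hp2 (k := m.sign * k)
      (mul_ne_zero (by rcases hsg with h | h <;> simp [h]) (by exact_mod_cast hk0))
      (by
        intro h
        apply hpk
        rcases hsg with h' | h' <;> rw [h'] at h <;> simp at h <;> exact_mod_cast h)
    refine ⟨n, h1, h2, ?_⟩
    rw [← h3]; congr 1; push_cast; ring
  · push Not at hodd
    have hs12 : s = 1 ∨ s = 2 := by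
      by_cases h1 : s = 1
      · exact Or.inl h1
      right
      obtain ⟨p, hp, k, hk⟩ := Nat.exists_prime_and_dvd h1
      have hp2 : p = 2 := by
        by_contra h; exact hodd p hp h ⟨k, hk⟩
      subst hp2
      by_cases hk1 : k = 1
      · rw [hk, hk1]
      obtain ⟨q, hq, j, hj⟩ := Nat.exists_prime_and_dvd hk1
      have hq2 : q = 2 := by
        by_contra h; exact hodd q hq h ⟨2 * j, by rw [hk, hj]; ring⟩
      subst hq2
      have := hs 2 ⟨j, by rw [hk, hj]; ring⟩
      norm_num at this
    rcases lt_trichotomy m 0 with h | h | h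
    · have hsg : m.sign = -1 := Int.sign_eq_neg_one_of_neg h
      rcases hs12 with rfl | rfl
      · obtain ⟨n, h1, h2, h3⟩ := nontriv_two ha hb 3 (Or.inl rfl)
        refine ⟨n, h1, h2, ?_⟩
        rw [hsg]; norm_num
        rw [jacobiSym.at_neg_one (odd_of_cop h1), ZMod.χ₄_nat_three_mod_four (by omega)]
      · obtain ⟨n, h1, h2, h3⟩ := nontriv_two ha hb 5 (Or.inr rfl)
        refine ⟨n, h1, h2, ?_⟩
        rw [hsg, jacobiSym.mul_left, jacobiSym.at_neg_one (odd_of_cop h1), ZMod.χ₄_nat_one_mod_four (by omega)]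
        push_cast
        rw [jacobiSym.at_two (odd_of_cop h1), ZMod.χ₈_nat_eq_if_mod_eight]
        simp [h3]; omega
    · exact absurd h hm0
    · have hsg : m.sign = 1 := Int.sign_eq_one_of_pos h
      rcases hs12 with rfl | rfl
      · exfalso; apply hm
        refine ⟨b, ?_⟩
        rw [← Int.sign_mul_natAbs m, hsg, ← hsb]; push_cast; ring
      · obtain ⟨n, h1, h2, h3⟩ := nontriv_two ha hb 5 (Or.inr rfl)
        refine ⟨n, h1, h2, ?_⟩
        rw [hsg, one_mul]
        push_cast
        rw [jacobiSym.at_two (odd_of_cop h1), ZMod.χ₈_nat_eq_if_mod_eight]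
        simp [h3]; omega

lemma Lv_eq_LSeries {X : ℕ →*₀ ℝ} {B : ℝ} (h : PS X B) (Q : ℕ) [NeZero Q] (hper : ∀ n, X (n % Q) = X n)
    (hcop : ∀ n, ¬ n.Coprime Q → X n = 0) {s : ℝ} (hs : 1 < s) :
    DirichletCharacter.LFunction (mkChar X Q hper hcop) s = (Lv X s : ℂ) := by
  have hs' : 1 < (s:ℂ).re := by simpa using hs
  rw [DirichletCharacter.LFunction_eq_LSeries _ hs']
  have hsum := (DirichletCharacter.LSeriesSummable_of_one_lt_re (mkChar X Q hper hcop) hs').hasSum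
  have ht := hsum.tendsto_sum_nat.comp (tendsto_add_atTop_nat 1)
  have ht2 := (Complex.continuous_ofReal.tendsto _).comp (h.tendsto (show 0 < s by linarith))
  refine tendsto_nhds_unique ht ?_
  refine ht2.congr ?_
  intro N
  simp only [Function.comp]
  rw [Finset.sum_range_succ']
  simp only [LSeries.term_zero, add_zero]
  rw [Complex.ofReal_sum]
  rw [Finset.range_eq_Ico, Finset.sum_Ico_add' (fun n => LSeries.term (fun n => (mkChar X Q hper hcop) (n : ZMod Q)) (s:ℂ) n) 0 N 1]
  apply sum_congr
  · ext x; simp; omega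
  intro n hn
  have hn0 : n ≠ 0 := by simp at hn; omega
  rw [LSeries.term_of_ne_zero hn0, mkChar_apply, Complex.ofReal_mul,
    Complex.ofReal_cpow (by positivity)]
  push_cast
  rw [Complex.cpow_neg, div_eq_mul_inv]

lemma Lv_one_nonneg {X : ℕ →*₀ ℝ} {B : ℝ} (hc : RC X) (h : PS X B) : 0 ≤ Lv X 1 := by
  have h' : PS X (max B 1) := fun N => (h N).trans (le_max_left _ _)
  by_contra hneg
  push Not at hneg
  set L := Lv X 1
  set s := 5 * Real.sqrt (max B 1) / (-L) + 1 with hs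
  have hs1 : 0 < s := by
    have : 0 ≤ 5 * Real.sqrt (max B 1) / (-L) := div_nonneg (by positivity) (by linarith)
    linarith
  have h1 := sum_gg hc h' (le_max_right _ _) (t := s ^ 2) (by positivity)
  rw [Real.sqrt_sq hs1.le] at h1
  have h2 : 0 ≤ ∑ n ∈ Ioc 0 ⌊s ^ 2⌋₊, gg X n := sum_nonneg fun n _ => gg_nonneg hc n
  have h3 := (abs_le.mp h1).2
  have h4 : s ^ 2 * (-L) ≤ 5 * Real.sqrt (max B 1) * s := by linarith
  have h5 : s * (-L) = 5 * Real.sqrt (max B 1) + (-L) := by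
    rw [hs, add_mul, div_mul_cancel₀ _ (by linarith : (-L) ≠ 0), one_mul]
  nlinarith

lemma Lv_one_pos {X : ℕ →*₀ ℝ} {B : ℝ} (hc : RC X) (h : PS X B) (Q : ℕ) (hQ : Q ≠ 0) (hper : ∀ n, X (n % Q) = X n)
    (hcop : ∀ n, ¬ n.Coprime Q → X n = 0) (hn : ∃ n, X n = -1) : 0 < Lv X 1 := by
  have : NeZero Q := ⟨hQ⟩
  refine lt_of_le_of_ne (Lv_one_nonneg hc h) ?_
  intro h0
  have hne := mkChar_ne_one X Q hper hcop hn
  have h1 := DirichletCharacter.LFunction_apply_one_ne_zero hne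
  apply h1
  have hcont := (DirichletCharacter.differentiable_LFunction hne).continuous
  have ht1 : Tendsto (fun s : ℝ => DirichletCharacter.LFunction (mkChar X Q hper hcop) (s:ℂ)) (𝓝[>] 1)
      (𝓝 (DirichletCharacter.LFunction (mkChar X Q hper hcop) 1)) := by
    have : Tendsto (fun s : ℝ => DirichletCharacter.LFunction (mkChar X Q hper hcop) (s:ℂ)) (𝓝 1)
      (𝓝 (DirichletCharacter.LFunction (mkChar X Q hper hcop) ((1:ℝ):ℂ))) :=
        (hcont.comp Complex.continuous_ofReal).tendsto 1
    rw [Complex.ofReal_one] at this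
    exact this.mono_left nhdsWithin_le_nhds
  have ht2 : Tendsto (fun s : ℝ => (Lv X s : ℂ)) (𝓝[>] 1) (𝓝 ((Lv X 1 : ℝ) : ℂ)) := by
    have hc := (Lv_cont h (a := 1) (b := 2) (by norm_num)) 1 (by norm_num)
    have hc2 : Tendsto (Lv X) (𝓝[>] 1) (𝓝 (Lv X 1)) := by
      refine hc.mono_left ?_
      rw [← nhdsWithin_Ioo_eq_nhdsGT (show (1:ℝ) < 2 by norm_num)]
      exact nhdsWithin_mono _ Set.Ioo_subset_Icc_self
    exact (Complex.continuous_ofReal.tendsto _).comp hc2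
  have := tendsto_nhds_unique ht1 (ht2.congr' (by
    filter_upwards [self_mem_nhdsWithin] with s hs
    exact (Lv_eq_LSeries h Q hper hcop hs).symm))
  rw [this, ← h0]; simp

end BQ
end part_D2

section part_D3
set_option linter.unusedVariables false
open Finset Filter Topology
namespace BQ
open ArithmeticFunction
open scoped ArithmeticFunction.zeta

lemma not_sq_prod {m m' : ℤ} (hm : Squarefree m) (hm' : Squarefree m') (hne : m ≠ m') : ¬ IsSquare (m * m') := by
  rintro ⟨r, hr⟩
  have h1 : m ∣ r ^ 2 := ⟨m', by rw [hr]; ring⟩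
  rw [hm.dvd_pow_iff_dvd (by norm_num)] at h1
  obtain ⟨k, rfl⟩ := h1
  have h2 : m' = m * (k * k) := by
    apply mul_left_cancel₀ hm.ne_zero
    rw [hr]; ring
  have hk : IsUnit k := hm' k ⟨m, by rw [h2]; ring⟩
  apply hne
  rcases Int.isUnit_iff.mp hk with rfl | rfl <;> simp [h2]

lemma not_sq_mul {t x : ℤ} (ht : t ≠ 0) (hx : ¬ IsSquare x) : ¬ IsSquare (t ^ 2 * x) := by
  rintro ⟨r, hr⟩
  have h1 : t ^ 2 ∣ r ^ 2 := ⟨x, by rw [hr]; ring⟩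
  rw [Int.pow_dvd_pow_iff (by norm_num)] at h1
  obtain ⟨k, rfl⟩ := h1
  apply hx
  refine ⟨k, mul_left_cancel₀ (pow_ne_zero 2 ht) ?_⟩
  rw [hr]; ring

lemma natAbs_pos' {m : ℤ} (hm : ¬ IsSquare m) : m.natAbs ≠ 0 := by
  intro h; apply hm; rw [Int.natAbs_eq_zero.mp h]; exact ⟨0, by simp⟩

lemma fam_PS {a : ℕ} (ha : a ≠ 0) (ε : ℝ) (hε : 0 < ε) :
    ∃ C : ℝ, 1 ≤ C ∧ ∀ m : ℤ, ¬ IsSquare m → PS (chi a m) (C * (m.natAbs : ℝ) ^ (1 / 2 + ε)) := by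
  obtain ⟨C, hC, h⟩ := pv_exp ε hε
  have h8 : (1:ℝ) ≤ ((8 * a : ℕ):ℝ) ^ (1 / 2 + ε) := Real.one_le_rpow (by exact_mod_cast (by omega)) (by positivity)
  refine ⟨C * ((8 * a : ℕ):ℝ) ^ (1 / 2 + ε), by nlinarith, ?_⟩
  intro m hm
  have hm0 := natAbs_pos' hm
  have := h (chi a m) (8 * a * m.natAbs) (by positivity) (chi_per a m) (chi_cop a m) (chi_nontriv ha hm)
  rw [Nat.cast_mul, Real.mul_rpow (by positivity) (by positivity), ← mul_assoc] at this
  exact this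

lemma fam_pos {a : ℕ} (ha : a ≠ 0) {m : ℤ} (hm : ¬ IsSquare m) : 0 < Lv (chi a m) 1 := by
  obtain ⟨C, hC, h⟩ := fam_PS ha 1 one_pos
  have hm0 := natAbs_pos' hm
  exact Lv_one_pos (chi_RC a m) (h m hm) (8 * a * m.natAbs) (by positivity) (chi_per a m) (chi_cop a m) (chi_nontriv ha hm)

lemma fam_siegel {a : ℕ} (ha : a ≠ 0) {t : ℤ} (ht : t ≠ 0) (ε : ℝ) (hε : 0 < ε) :
    ∃ c : ℝ, 0 < c ∧ ∀ m : ℤ, Squarefree m → ¬ IsSquare (t * m) →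
      c * (m.natAbs : ℝ) ^ (-ε) ≤ Lv (chi a (t * m)) 1 := by
  obtain ⟨C, hC, h⟩ := fam_PS ha (1/2) (by norm_num)
  have h' : ∀ m : ℤ, ¬ IsSquare m → PS (chi a m) (C * m.natAbs) := by
    intro m hm
    have := h m hm
    rwa [show (1:ℝ)/2 + 1/2 = 1 by norm_num, Real.rpow_one] at this
  have ht1 : (1:ℝ) ≤ t.natAbs := by exact_mod_cast Int.natAbs_pos.mpr ht
  have hmon : ∀ {χ : ℕ → ℝ} {B B' : ℝ}, PS χ B → B ≤ B' → PS χ B' := fun hp hb N => (hp N).trans hb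
  obtain ⟨c, hc, H⟩ := siegel (ι := {m : ℤ // Squarefree m ∧ ¬ IsSquare (t * m)}) (fun i => chi a (t * i.1))
    (fun i => (i.1.natAbs : ℝ)) (C * (t.natAbs : ℝ) ^ 2) (by nlinarith)
    (fun i => by exact_mod_cast Int.natAbs_pos.mpr i.2.1.ne_zero)
    (fun i => chi_RC _ _)
    (fun i => hmon (h' _ i.2.2) (by
      rw [Int.natAbs_mul]; push_cast
      have : (0:ℝ) ≤ i.1.natAbs := by positivity
      have h2 : (t.natAbs:ℝ) ≤ (t.natAbs:ℝ)^2 := by nlinarith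
      rw [mul_assoc]
      gcongr ?_ * (?_ * ?_)))
    (fun i j hij => by
      rw [chi_mul]
      have e : t * i.1 * (t * j.1) = t ^ 2 * (i.1 * j.1) := by ring
      rw [e]
      refine hmon (h' _ (not_sq_mul ht (not_sq_prod i.2.1 j.2.1 (fun h => hij (Subtype.ext h))))) ?_
      rw [Int.natAbs_mul, Int.natAbs_mul, Int.natAbs_pow]; push_cast
      apply le_of_eq; ring)
    (fun i => fam_pos ha i.2.2) ε hε
  exact ⟨c, hc, fun m h1 h2 => H ⟨m, h1, h2⟩⟩

end BQ
end part_D3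

section part_E1
set_option linter.unusedVariables false
open Finset Filter Topology
namespace BQ
open ArithmeticFunction
open scoped ArithmeticFunction.zeta
open NumberField UniqueFactorizationMonoid

section counts
variable (M : Type) [Field M] [NumberField M]

/-- number of ideals of norm n. -/
noncomputable def cN (n : ℕ) : ℕ := Nat.card {I : Ideal (𝓞 M) // Ideal.absNorm I = n}

/-- primes above p -/
def SP (p : ℕ) : Set (Ideal (𝓞 M)) := (Ideal.span {(p : ℤ)}).primesOver (𝓞 M)

lemma cN_one : cN M 1 = 1 := by
  unfold cN
  rw [Nat.card_eq_one_iff_unique]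
  refine ⟨⟨fun a b => Subtype.ext ?_⟩, ⟨⟨⊤, by simp⟩⟩⟩
  rw [Ideal.absNorm_eq_one_iff.1 a.2, Ideal.absNorm_eq_one_iff.1 b.2]

lemma fin_norm (n : ℕ) : Finite {I : Ideal (𝓞 M) // Ideal.absNorm I = n} :=
  (Ideal.finite_setOfPred_absNorm_eq n).to_subtype

lemma cop_ideal {m n : ℕ} (h : m.Coprime n) {A B : Ideal (𝓞 M)} (hA : (m : 𝓞 M) ∈ A) (hB : (n : 𝓞 M) ∈ B) :
    IsCoprime A B := by
  rw [Ideal.isCoprime_iff_sup_eq, Ideal.eq_top_iff_one]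
  have h1 := Nat.isCoprime_iff_coprime.2 h
  obtain ⟨u, v, huv⟩ := h1
  have : (1 : 𝓞 M) = (u : 𝓞 M) * m + v * n := by exact_mod_cast (congrArg (Int.cast : ℤ → 𝓞 M) huv).symm
  rw [this]
  exact Ideal.add_mem _ (Ideal.mul_mem_left _ _ (Ideal.mem_sup_left hA)) (Ideal.mul_mem_left _ _ (Ideal.mem_sup_right hB))

lemma norm_sup_dvd {m : ℕ} (I : Ideal (𝓞 M)) :
    ∃ r, Ideal.absNorm (I ⊔ Ideal.span {(m : 𝓞 M)}) ∣ m ^ r := by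
  refine ⟨Module.finrank ℤ (𝓞 M), ?_⟩
  have h1 := Ideal.absNorm_dvd_absNorm_of_le (le_sup_right : Ideal.span {(m : 𝓞 M)} ≤ I ⊔ Ideal.span {(m : 𝓞 M)})
  rw [Ideal.absNorm_span_singleton] at h1
  have h2 := Algebra.norm_algebraMap (R := ℤ) (S := 𝓞 M) (m : ℤ)
  simp only [eq_intCast, Int.cast_natCast] at h2
  rw [h2, Int.natAbs_pow, Int.natAbs_natCast] at h1
  exact h1

lemma cN_mul {m n : ℕ} (h : m.Coprime n) (hm : m ≠ 0) (hn : n ≠ 0) : cN M (m * n) = cN M m * cN M n := by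
  unfold cN
  rw [← Nat.card_prod]
  symm
  apply Nat.card_congr
  refine Equiv.ofBijective (fun q => ⟨q.1.1 * q.2.1, by rw [map_mul, q.1.2, q.2.2]⟩) ⟨?_, ?_⟩
  · rintro ⟨⟨A, hA⟩, ⟨B, hB⟩⟩ ⟨⟨A', hA'⟩, ⟨B', hB'⟩⟩ he
    have he' : A * B = A' * B' := congrArg Subtype.val he
    have mA : (m : 𝓞 M) ∈ A := by rw [← hA]; exact Ideal.absNorm_mem A
    have mA' : (m : 𝓞 M) ∈ A' := by rw [← hA']; exact Ideal.absNorm_mem A'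
    have mB : (n : 𝓞 M) ∈ B := by rw [← hB]; exact Ideal.absNorm_mem B
    have mB' : (n : 𝓞 M) ∈ B' := by rw [← hB']; exact Ideal.absNorm_mem B'
    have h1 : A = A' := by
      apply dvd_antisymm
      · exact (cop_ideal M h mA mB').dvd_of_dvd_mul_right (he' ▸ dvd_mul_right A B)
      · exact (cop_ideal M h mA' mB).dvd_of_dvd_mul_right (he' ▸ dvd_mul_right A' B')
    have h2 : B = B' := by
      apply dvd_antisymm
      · exact (cop_ideal M h mA' mB).symm.dvd_of_dvd_mul_left (he' ▸ dvd_mul_left B A)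
      · exact (cop_ideal M h mA mB').symm.dvd_of_dvd_mul_left (he' ▸ dvd_mul_left B' A')
    subst h1; subst h2; rfl
  · rintro ⟨I, hI⟩
    set A := I ⊔ Ideal.span {(m : 𝓞 M)} with hA
    set B := I ⊔ Ideal.span {(n : 𝓞 M)} with hB
    have mA : (m : 𝓞 M) ∈ A := Ideal.mem_sup_right (Ideal.mem_span_singleton_self _)
    have mB : (n : 𝓞 M) ∈ B := Ideal.mem_sup_right (Ideal.mem_span_singleton_self _)
    have hcop := cop_ideal M h mA mB
    have hmn : (m : 𝓞 M) * n ∈ I := by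
      have := Ideal.absNorm_mem I
      rw [hI] at this
      exact_mod_cast this
    have hAB : A * B = I := by
      apply le_antisymm
      · rw [hA, hB, Ideal.sup_mul, Ideal.mul_sup, Ideal.mul_sup]
        refine sup_le (sup_le Ideal.mul_le_left Ideal.mul_le_left) (sup_le Ideal.mul_le_right ?_)
        rw [Ideal.span_singleton_mul_span_singleton, Ideal.span_singleton_le_iff_mem]
        exact hmn
      · rw [Ideal.mul_eq_inf_of_isCoprime hcop]
        exact le_inf le_sup_left le_sup_left
    have hN : Ideal.absNorm A * Ideal.absNorm B = m * n := by rw [← map_mul, hAB, hI]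
    have dA : Ideal.absNorm A ∣ m := by
      obtain ⟨r, hr⟩ := norm_sup_dvd M (m := m) I
      exact (Nat.Coprime.coprime_dvd_left hr (h.pow_left r)).dvd_of_dvd_mul_right (hN ▸ dvd_mul_right _ _)
    have dB : Ideal.absNorm B ∣ n := by
      obtain ⟨r, hr⟩ := norm_sup_dvd M (m := n) I
      exact (Nat.Coprime.coprime_dvd_left hr (h.symm.pow_left r)).dvd_of_dvd_mul_left (hN ▸ dvd_mul_left _ _)
    have lA := Nat.le_of_dvd (Nat.pos_of_ne_zero hm) dA
    have lB := Nat.le_of_dvd (Nat.pos_of_ne_zero hn) dB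
    have pn : 0 < n := Nat.pos_of_ne_zero hn
    have pm : 0 < m := Nat.pos_of_ne_zero hm
    have eA : Ideal.absNorm A = m := by
      rcases lA.lt_or_eq with h | h
      · have := Nat.mul_lt_mul_of_lt_of_le h lB pn
        omega
      · exact h
    have eB : Ideal.absNorm B = n := by
      rw [eA] at hN
      exact Nat.eq_of_mul_eq_mul_left pm hN
    exact ⟨⟨⟨A, eA⟩, ⟨B, eB⟩⟩, Subtype.ext hAB⟩

lemma mem_SP {p : ℕ} (hp : p.Prime) (P : Ideal (𝓞 M)) : P ∈ SP M p ↔ P.IsPrime ∧ (p : 𝓞 M) ∈ P := by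
  unfold SP
  constructor
  · rintro ⟨h1, h2⟩
    refine ⟨h1, ?_⟩
    have : (p : ℤ) ∈ P.under ℤ := h2.over ▸ Ideal.mem_span_singleton_self _
    rw [Ideal.mem_comap] at this
    simpa using this
  · rintro ⟨h1, h2⟩
    refine ⟨h1, ⟨?_⟩⟩
    have hmax : (Ideal.span {(p : ℤ)}).IsMaximal :=
      PrincipalIdealRing.isMaximal_of_irreducible (Nat.prime_iff_prime_int.1 hp).irreducible
    refine hmax.eq_of_le (Ideal.IsPrime.ne_top (Ideal.IsPrime.under ℤ P)) ?_
    rw [Ideal.span_singleton_le_iff_mem, Ideal.mem_comap]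
    simpa using h2

lemma SP_ne_bot {p : ℕ} (hp : p.Prime) {P : Ideal (𝓞 M)} (h : P ∈ SP M p) : P ≠ ⊥ := by
  rintro rfl
  have := ((mem_SP M hp _).1 h).2
  simp [hp.ne_zero] at this

lemma SP_finite {p : ℕ} (hp : p.Prime) : (SP M p).Finite := by
  have hmax : (Ideal.span {(p : ℤ)}).IsMaximal :=
      PrincipalIdealRing.isMaximal_of_irreducible (Nat.prime_iff_prime_int.1 hp).irreducible
  exact IsDedekindDomain.primesOver_finite _ _

lemma nf_mem {p : ℕ} (hp : p.Prime) {k : ℕ} {I : Ideal (𝓞 M)} (hI : Ideal.absNorm I = p ^ k) {P : Ideal (𝓞 M)}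
    (hP : P ∈ normalizedFactors I) : P ∈ SP M p := by
  have h1 := prime_of_normalized_factor P hP
  have h2 : P.IsPrime := Ideal.isPrime_of_prime h1
  rw [mem_SP M hp]
  refine ⟨h2, ?_⟩
  have h3 := Ideal.absNorm_mem I
  rw [hI] at h3
  have h4 := Ideal.dvd_iff_le.1 (dvd_of_mem_normalizedFactors hP) h3
  push_cast at h4
  exact h2.mem_of_pow_mem _ h4

lemma ne_bot_of_norm {p : ℕ} (hp : p.Prime) {k : ℕ} {I : Ideal (𝓞 M)} (hI : Ideal.absNorm I = p ^ k) : I ≠ ⊥ := by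
  rintro rfl
  simp at hI
  exact (pow_ne_zero k hp.ne_zero) hI.symm

lemma prod_nf {I : Ideal (𝓞 M)} (h : I ≠ ⊥) : (normalizedFactors I).prod = I :=
  associated_iff_eq.1 (prod_normalizedFactors h)

lemma prod_norm {q : ℕ} (s : Multiset (Ideal (𝓞 M))) (h : ∀ P ∈ s, Ideal.absNorm P = q) :
    Ideal.absNorm s.prod = q ^ s.card := by
  rw [map_multiset_prod, Multiset.map_congr rfl h]
  simp

lemma cN_pp {p f g : ℕ} (hp : p.Prime) (hf : f ≠ 0) (hN : ∀ P ∈ SP M p, Ideal.absNorm P = p ^ f)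
    (hg : (SP M p).ncard = g) (k : ℕ) : cN M (p ^ k) = if f ∣ k then g.multichoose (k / f) else 0 := by
  have key : ∀ I : Ideal (𝓞 M), Ideal.absNorm I = p ^ k → f * (normalizedFactors I).card = k := by
    intro I hI
    have h1 := prod_norm M (q := p ^ f) (normalizedFactors I) (fun P hP => hN P (nf_mem M hp hI hP))
    rw [prod_nf M (ne_bot_of_norm M hp hI), hI, ← pow_mul] at h1
    exact (Nat.pow_right_injective hp.two_le h1).symm
  split_ifs with hk
  · obtain ⟨j, rfl⟩ := hk
    rw [Nat.mul_div_cancel_left _ (Nat.pos_of_ne_zero hf)]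
    have hfin : Fintype (SP M p) := (SP_finite M hp).fintype
    classical
    have hc : g.multichoose j = Nat.card (Sym (SP M p) j) := by
      rw [Nat.card_eq_fintype_card, Sym.card_sym_eq_multichoose, ← hg, ← Nat.card_coe_set_eq, Nat.card_eq_fintype_card]
    rw [hc]
    symm
    unfold cN
    apply Nat.card_congr
    have hpr : ∀ s : Multiset (SP M p), ∀ P ∈ s.map Subtype.val, Prime P := by
      intro s P hP
      obtain ⟨Q, hQ, rfl⟩ := Multiset.mem_map.1 hP
      have := ((mem_SP M hp _).1 Q.2).1
      exact Ideal.prime_of_isPrime (SP_ne_bot M hp Q.2) this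
    refine Equiv.ofBijective (fun s => ⟨(s.1.map Subtype.val).prod, ?_⟩) ⟨?_, ?_⟩
    · rw [prod_norm M (q := p ^ f), Multiset.card_map, s.2, ← pow_mul]
      intro P hP
      obtain ⟨Q, hQ, rfl⟩ := Multiset.mem_map.1 hP
      exact hN _ Q.2
    · intro s t hst
      have h1 : (s.1.map Subtype.val).prod = (t.1.map Subtype.val).prod := congrArg Subtype.val hst
      have h2 := congrArg normalizedFactors h1
      rw [normalizedFactors_prod_of_prime (hpr _), normalizedFactors_prod_of_prime (hpr _)] at h2
      exact Subtype.ext (Multiset.map_injective Subtype.val_injective h2)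
    · rintro ⟨I, hI⟩
      have h1 : ∀ P ∈ normalizedFactors I, P ∈ SP M p := fun P hP => nf_mem M hp hI hP
      refine ⟨⟨(normalizedFactors I).attach.map (fun P => ⟨P.1, h1 P.1 P.2⟩), ?_⟩, ?_⟩
      · rw [Multiset.card_map, Multiset.card_attach]
        exact Nat.eq_of_mul_eq_mul_left (Nat.pos_of_ne_zero hf) (key I hI)
      · apply Subtype.ext
        simp only [Multiset.map_map, Function.comp_def]
        rw [Multiset.attach_map_val]
        exact prod_nf M (ne_bot_of_norm M hp hI)
  · unfold cN
    rw [Nat.card_eq_zero]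
    left
    refine ⟨fun I => hk ?_⟩
    rw [← key I.1 I.2]
    exact dvd_mul_right _ _

lemma cN_pp_le {p : ℕ} (hp : p.Prime) (hg : (SP M p).ncard ≤ 4) (k : ℕ) : cN M (p ^ k) ≤ (k + 1) ^ 4 := by
  classical
  have hfin : Fintype (SP M p) := (SP_finite M hp).fintype
  have hcard : Fintype.card (SP M p) ≤ 4 := by
    rwa [← Nat.card_coe_set_eq, Nat.card_eq_fintype_card] at hg
  have hb : ∀ I : Ideal (𝓞 M), Ideal.absNorm I = p ^ k → (normalizedFactors I).card ≤ k := by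
    intro I hI
    have h1 : Ideal.absNorm (normalizedFactors I).prod = p ^ k := by
      rw [prod_nf M (ne_bot_of_norm M hp hI), hI]
    rw [map_multiset_prod] at h1
    have h2 : p ^ (normalizedFactors I).card ≤ p ^ k := by
      rw [← h1]
      have := Multiset.pow_card_le_prod (s := (normalizedFactors I).map Ideal.absNorm) (a := p) (by
        intro x hx
        obtain ⟨P, hP, rfl⟩ := Multiset.mem_map.1 hx
        have hP' := nf_mem M hp hI hP
        have h3 := Ideal.absNorm_dvd_absNorm_of_le (Ideal.dvd_iff_le.1 (dvd_of_mem_normalizedFactors hP))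
        rw [hI, Nat.dvd_prime_pow hp] at h3
        obtain ⟨j, hj, h4⟩ := h3
        rw [h4]
        have : j ≠ 0 := by
          rintro rfl
          rw [pow_zero, Ideal.absNorm_eq_one_iff] at h4
          exact ((mem_SP M hp _).1 hP').1.ne_top h4
        exact Nat.le_self_pow this p)
      simpa using this
    exact (Nat.pow_le_pow_iff_right hp.one_lt).1 h2
  unfold cN
  calc _ ≤ Nat.card (SP M p → Fin (k + 1)) := by
        refine Nat.card_le_card_of_injective (fun I P => ⟨(normalizedFactors I.1).count P.1, ?_⟩) ?_
        · exact Nat.lt_succ_of_le ((Multiset.count_le_card _ _).trans (hb _ I.2))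
        · rintro ⟨I, hI⟩ ⟨J, hJ⟩ h
          apply Subtype.ext
          change I = J
          rw [← prod_nf M (ne_bot_of_norm M hp hI), ← prod_nf M (ne_bot_of_norm M hp hJ)]
          congr 1
          ext P
          by_cases hP : P ∈ SP M p
          · have := congrFun h ⟨P, hP⟩
            simpa using this
          · rw [Multiset.count_eq_zero_of_notMem, Multiset.count_eq_zero_of_notMem]
            · exact fun h => hP (nf_mem M hp hJ h)
            · exact fun h => hP (nf_mem M hp hI h)
    _ = (k + 1) ^ Fintype.card (SP M p) := by simp
    _ ≤ _ := Nat.pow_le_pow_right (by omega) hcard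

end counts
end BQ
end part_E1

section part_E2
set_option linter.unusedVariables false
open Finset Filter Topology
namespace BQ
open ArithmeticFunction
open scoped ArithmeticFunction.zeta
open NumberField UniqueFactorizationMonoid
open scoped Pointwise

section split
variable (M : Type) [Field M] [NumberField M]

lemma int_mem_SP {p : ℕ} (hp : p.Prime) {P : Ideal (𝓞 M)} (hP : P ∈ SP M p) (t : ℤ) :
    (t : 𝓞 M) ∈ P ↔ (p : ℤ) ∣ t := by
  have h2 : P.LiesOver (Ideal.span {(p : ℤ)}) := hP.2
  have h3 : t ∈ Ideal.span {(p : ℤ)} ↔ (t : 𝓞 M) ∈ P := by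
    rw [h2.over, Ideal.mem_comap]; simp
  rw [← h3, Ideal.mem_span_singleton]

lemma gal_ef [IsGalois ℚ M] (hM : Module.finrank ℚ M = 4) {p : ℕ} (hp : p.Prime) :
    ∃ e f : ℕ, (SP M p).ncard * (e * f) = 4 ∧ (∀ P ∈ SP M p, Ideal.absNorm P = p ^ f) ∧
      ((∃ P ∈ SP M p, (p : 𝓞 M) ∈ P ^ 2) → e ≠ 1) := by
  have hpi : Prime (p : ℤ) := Nat.prime_iff_prime_int.1 hp
  have hmax : (Ideal.span {(p : ℤ)}).IsMaximal :=
      PrincipalIdealRing.isMaximal_of_irreducible hpi.irreducible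
  have hprime := hmax.isPrime
  have hmain := Ideal.ncard_primesOver_mul_ramificationIdxIn_mul_inertiaDegIn (Ideal.span {(p : ℤ)}) (𝓞 M) (M ≃ₐ[ℚ] M)
  rw [IsGalois.card_aut_eq_finrank, hM] at hmain
  refine ⟨_, _, hmain, ?_, ?_⟩
  · intro P hP
    have h1 : P.IsPrime := hP.1
    have h2 : P.LiesOver (Ideal.span {(p : ℤ)}) := hP.2
    have h3 : P.IsMaximal := h1.isMaximal (SP_ne_bot M hp hP)
    rw [Ideal.absNorm_eq_pow_inertiaDeg' P hp, Ideal.inertiaDegIn_eq_inertiaDeg _ P (M ≃ₐ[ℚ] M), Ideal.inertiaDeg'_eq_inertiaDeg]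
  · rintro ⟨P, hP, hpp⟩
    have h1 : P.IsPrime := hP.1
    have h2 : P.LiesOver (Ideal.span {(p : ℤ)}) := hP.2
    have h3 : P.IsMaximal := h1.isMaximal (SP_ne_bot M hp hP)
    have hne : Ideal.map (algebraMap ℤ (𝓞 M)) (Ideal.span {(p : ℤ)}) ≠ ⊥ :=
      Ideal.map_ne_bot_of_ne_bot (by simpa using hp.ne_zero)
    rw [Ideal.ramificationIdxIn_eq_ramificationIdx _ P (M ≃ₐ[ℚ] M),
      Ideal.IsDedekindDomain.ramificationIdx_eq_multiplicity (Ideal.span {(p : ℤ)}) P hne]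
    have hd : P ^ 2 ∣ Ideal.map (algebraMap ℤ (𝓞 M)) (Ideal.span {(p : ℤ)}) := by
      rw [Ideal.dvd_iff_le, Ideal.map_span, Ideal.span_le]
      simpa using hpp
    have hfm : FiniteMultiplicity P (Ideal.map (algebraMap ℤ (𝓞 M)) (Ideal.span {(p : ℤ)})) :=
      FiniteMultiplicity.of_not_isUnit (Ideal.isUnit_iff.not.mpr h1.ne_top) hne
    have := hfm.le_multiplicity_of_pow_dvd hd
    omega

/-- a prime with a square-root conjugation moves. -/
lemma smul_ne {p : ℕ} (hp : p.Prime) {P : Ideal (𝓞 M)} (hP : P ∈ SP M p) {y : 𝓞 M} {t x : ℤ}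
    (hy : y ^ 2 = (t : 𝓞 M)) (hpt : ¬ (p : ℤ) ∣ 2 * t) (hx : (p : ℤ) ∣ t - x ^ 2) (σ : M ≃ₐ[ℚ] M)
    (hσ : σ • y = - y) : σ • P ≠ P := by
  intro he
  have hpi : Prime (p : ℤ) := Nat.prime_iff_prime_int.1 hp
  have h1 : P.IsPrime := hP.1
  have h2 : (y - x) * (y + x) ∈ P := by
    have : (y - x) * (y + x) = ((t - x ^ 2 : ℤ) : 𝓞 M) := by push_cast; rw [← hy]; ring
    rw [this, int_mem_SP M hp hP]; exact hx
  have hsx : ∀ x : ℤ, σ • (x : 𝓞 M) = x := fun x => map_intCast (MulSemiringAction.toRingHom _ (𝓞 M) σ) x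
  have h3 : ((2 * x : ℤ) : 𝓞 M) ∈ P := by
    rcases h1.mem_or_mem h2 with h | h
    · have h4 : σ • (y - x) ∈ P := by rw [← he]; exact Ideal.smul_mem_pointwise_smul_iff.2 h
      rw [smul_sub, hσ, hsx] at h4
      have := P.neg_mem (P.add_mem h h4)
      have e : -(y - (x : 𝓞 M) + (-y - x)) = ((2 * x : ℤ) : 𝓞 M) := by push_cast; ring
      rwa [e] at this
    · have h4 : σ • (y + x) ∈ P := by rw [← he]; exact Ideal.smul_mem_pointwise_smul_iff.2 h
      rw [smul_add, hσ, hsx] at h4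
      have := (P.add_mem h h4)
      have e : (y + (x : 𝓞 M) + (-y + x)) = ((2 * x : ℤ) : 𝓞 M) := by push_cast; ring
      rwa [e] at this
  rw [int_mem_SP M hp hP] at h3
  apply hpt
  have : 2 * t = 2 * (t - x ^ 2) + (2 * x) * x := by ring
  rw [this]
  exact dvd_add (hx.mul_left _) (h3.mul_right _)

lemma smul_SP {p : ℕ} (hp : p.Prime) {P : Ideal (𝓞 M)} (hP : P ∈ SP M p) (σ : M ≃ₐ[ℚ] M) : σ • P ∈ SP M p := by
  rw [mem_SP M hp] at hP ⊢
  have h1 := hP.1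
  refine ⟨inferInstance, ?_⟩
  have : σ • (p : 𝓞 M) = p := map_natCast (MulSemiringAction.toRingHom _ (𝓞 M) σ) p
  rw [← this]
  exact Ideal.smul_mem_pointwise_smul_iff.2 hP.2

lemma norm_ne {p : ℕ} (hp : p.Prime) {P : Ideal (𝓞 M)} (hP : P ∈ SP M p) {y : 𝓞 M} {t : ℤ}
    (hy : y ^ 2 = (t : 𝓞 M)) (hx : ∀ x : ℤ, ¬ (p : ℤ) ∣ t - x ^ 2) : Ideal.absNorm P ≠ p := by
  intro hN
  rw [Ideal.absNorm_apply, Submodule.cardQuot_apply] at hN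
  have hfin : Finite (𝓞 M ⧸ P) := Nat.finite_of_card_ne_zero (by rw [hN]; exact hp.ne_zero)
  have : Fintype (𝓞 M ⧸ P) := Fintype.ofFinite _
  rw [Nat.card_eq_fintype_card] at hN
  have e := ZMod.ringEquivOfPrime (𝓞 M ⧸ P) hp hN
  have hpf : Fact p.Prime := ⟨hp⟩
  set z := e.symm (Ideal.Quotient.mk P y) with hz
  obtain ⟨x, hx1⟩ := ZMod.intCast_surjective z
  have h1 : Ideal.Quotient.mk P y = Ideal.Quotient.mk P (x : 𝓞 M) := by
    have : e z = Ideal.Quotient.mk P y := by rw [hz]; simp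
    rw [← this, ← hx1]; simp
  apply hx x
  rw [← int_mem_SP M hp hP, ← Ideal.Quotient.eq_zero_iff_mem]
  push_cast
  rw [← hy, map_sub, map_pow, map_pow, h1, sub_self]

lemma p_mem_sq {p : ℕ} (hp : p.Prime) {P : Ideal (𝓞 M)} (hP : P ∈ SP M p) {y : 𝓞 M} {t : ℤ}
    (hy : y ^ 2 = (t : 𝓞 M)) (ht : Squarefree t) (hpt : (p : ℤ) ∣ t) : (p : 𝓞 M) ∈ P ^ 2 := by
  have hpi : Prime (p : ℤ) := Nat.prime_iff_prime_int.1 hp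
  have h1 : P.IsPrime := hP.1
  have hyP : y ∈ P := by
    apply h1.mem_of_pow_mem 2
    rw [hy, int_mem_SP M hp hP]; exact hpt
  have hpP := ((mem_SP M hp P).1 hP).2
  obtain ⟨t', rfl⟩ := hpt
  have hco : IsCoprime (p : ℤ) t' := by
    rw [Prime.coprime_iff_not_dvd hpi]
    intro h
    have := ht p (mul_dvd_mul_left _ h)
    exact hpi.not_isUnit this
  obtain ⟨u, v, huv⟩ := hco
  have h2 : (p : 𝓞 M) = v * y ^ 2 + u * (p : 𝓞 M) ^ 2 := by
    rw [hy]
    have : ((p : ℤ) : ℤ) = v * (p * t') + u * p ^ 2 := by linear_combination (-(p : ℤ)) * huv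
    exact_mod_cast congrArg (Int.cast : ℤ → 𝓞 M) this
  rw [h2]
  exact Ideal.add_mem _ (Ideal.mul_mem_left _ _ (Ideal.pow_mem_pow hyP 2)) (Ideal.mul_mem_left _ _ (Ideal.pow_mem_pow hpP 2))

lemma jac_one {p : ℕ} (hp : p.Prime) {t : ℤ} (h : jacobiSym t p = 1) : ∃ x : ℤ, (p : ℤ) ∣ t - x ^ 2 := by
  have : Fact p.Prime := ⟨hp⟩
  rw [← jacobiSym.legendreSym.to_jacobiSym] at h
  have h0 : (t : ZMod p) ≠ 0 := by
    intro h0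
    rw [(legendreSym.eq_zero_iff p t).2 h0] at h
    norm_num at h
  obtain ⟨z, hz⟩ := (legendreSym.eq_one_iff p h0).1 h
  obtain ⟨x, rfl⟩ := ZMod.intCast_surjective z
  refine ⟨x, ?_⟩
  rw [← ZMod.intCast_zmod_eq_zero_iff_dvd]
  push_cast; rw [hz]; ring

lemma jac_neg {p : ℕ} (hp : p.Prime) {t : ℤ} (h : jacobiSym t p = -1) (x : ℤ) : ¬ (p : ℤ) ∣ t - x ^ 2 := by
  have : Fact p.Prime := ⟨hp⟩
  rw [← jacobiSym.legendreSym.to_jacobiSym, legendreSym.eq_neg_one_iff] at h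
  intro hd
  apply h
  rw [← ZMod.intCast_zmod_eq_zero_iff_dvd] at hd
  push_cast at hd
  exact ⟨x, by linear_combination hd⟩

lemma jac_zero {p : ℕ} (hp : p.Prime) {t : ℤ} : jacobiSym t p = 0 ↔ (p : ℤ) ∣ t := by
  have : Fact p.Prime := ⟨hp⟩
  rw [← jacobiSym.legendreSym.to_jacobiSym, legendreSym.eq_zero_iff, ZMod.intCast_zmod_eq_zero_iff_dvd]

end split
end BQ
end part_E2

section part_E3
set_option linter.unusedVariables false
open Finset Filter Topology
namespace BQ
open ArithmeticFunction
open scoped ArithmeticFunction.zeta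
open NumberField UniqueFactorizationMonoid
open scoped Pointwise

section biq
variable (M : Type) [Field M] [NumberField M]

lemma biq_galois {c b : M} {d m : ℤ} (hd : d ≠ 0) (hm : m ≠ 0) (hc : c ^ 2 = (d : M)) (hb : b ^ 2 = (m : M))
    (htop : IntermediateField.adjoin ℚ {b, c} = ⊤) : IsGalois ℚ M := by
  open Polynomial in
  have hs : IsSplittingField ℚ M ((X ^ 2 - C (d : ℚ)) * (X ^ 2 - C (m : ℚ))) := by
    rw [isSplittingField_iff_intermediateField]
    constructor
    · have : Polynomial.map (algebraMap ℚ M) ((X ^ 2 - C (d : ℚ)) * (X ^ 2 - C (m : ℚ))) =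
          ((X - C c) * (X - C (-c))) * ((X - C b) * (X - C (-b))) := by
        simp only [Polynomial.map_mul, Polynomial.map_sub, Polynomial.map_pow, map_X, map_C]
        have e1 : algebraMap ℚ M (d : ℚ) = c ^ 2 := by simp [hc]
        have e2 : algebraMap ℚ M (m : ℚ) = b ^ 2 := by simp [hb]
        rw [e1, e2]; simp only [map_pow, map_neg]; ring
      rw [this]
      exact (((Splits.X_sub_C _).mul (Splits.X_sub_C _)).mul ((Splits.X_sub_C _).mul (Splits.X_sub_C _)))
    · rw [eq_top_iff, ← htop]
      apply IntermediateField.adjoin.mono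
      have hne : ((X ^ 2 - C (d : ℚ)) * (X ^ 2 - C (m : ℚ))) ≠ 0 :=
        mul_ne_zero (X_pow_sub_C_ne_zero (by norm_num) _) (X_pow_sub_C_ne_zero (by norm_num) _)
      rintro x (rfl | rfl)
      · rw [mem_rootSet]
        refine ⟨hne, ?_⟩
        simp [hb]
      · rw [mem_rootSet]
        refine ⟨hne, ?_⟩
        simp [hc]
  have : Normal ℚ M := Normal.of_isSplittingField ((X ^ 2 - C (d : ℚ)) * (X ^ 2 - C (m : ℚ)) : Polynomial ℚ)
  exact ⟨⟩

lemma sq_pm {x : M} {t : ℤ} (hx : x ^ 2 = (t : M)) (σ : M ≃ₐ[ℚ] M) : σ x = x ∨ σ x = - x := by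
  rw [← sq_eq_sq_iff_eq_or_eq_neg, ← map_pow, hx, map_intCast]

lemma gal_ext {c b : M} (htop : IntermediateField.adjoin ℚ {b, c} = ⊤) {σ τ : M ≃ₐ[ℚ] M}
    (h1 : σ b = τ b) (h2 : σ c = τ c) : σ = τ := by
  have hx : ∀ x ∈ IntermediateField.adjoin ℚ {b, c}, σ x = τ x := by
    intro x hx
    induction hx using IntermediateField.adjoin_induction with
    | mem x hx => rcases hx with rfl | rfl <;> assumption
    | algebraMap x => simp
    | add x y _ _ h h' => rw [map_add, map_add, h, h']
    | inv x _ h => rw [map_inv₀, map_inv₀, h]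
    | mul x y _ _ h h' => rw [map_mul, map_mul, h, h']
  ext x
  exact hx x (htop ▸ IntermediateField.mem_top)

lemma gal_exists [IsGalois ℚ M] (hM : Module.finrank ℚ M = 4) {c b : M} {d m : ℤ} (hd : d ≠ 0) (hm : m ≠ 0) (hc : c ^ 2 = (d : M)) (hb : b ^ 2 = (m : M))
    (htop : IntermediateField.adjoin ℚ {b, c} = ⊤) :
    (∃ σ : M ≃ₐ[ℚ] M, σ c = -c ∧ σ b = b) ∧ (∃ σ : M ≃ₐ[ℚ] M, σ c = c ∧ σ b = -b) := by
  classical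
  have hcard : Nat.card (M ≃ₐ[ℚ] M) = 4 := by rw [IsGalois.card_aut_eq_finrank, hM]
  have : Fintype (M ≃ₐ[ℚ] M) := Fintype.ofFinite _
  rw [Nat.card_eq_fintype_card] at hcard
  let Φ : (M ≃ₐ[ℚ] M) → Bool × Bool := fun σ => (decide (σ c = c), decide (σ b = b))
  have hinj : Function.Injective Φ := by
    intro σ τ h
    have h' := Prod.ext_iff.1 h
    simp only [Φ, decide_eq_decide] at h'
    apply gal_ext M htop
    · rcases sq_pm M hb σ with h1 | h1 <;> rcases sq_pm M hb τ with h2 | h2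
      · rw [h1, h2]
      · rw [h1, h'.2.1 h1]
      · rw [h2, h'.2.2 h2]
      · rw [h1, h2]
    · rcases sq_pm M hc σ with h1 | h1 <;> rcases sq_pm M hc τ with h2 | h2
      · rw [h1, h2]
      · rw [h1, h'.1.1 h1]
      · rw [h2, h'.1.2 h2]
      · rw [h1, h2]
  have hbij := (Fintype.bijective_iff_injective_and_card Φ).2 ⟨hinj, by rw [hcard]; rfl⟩
  constructor
  · obtain ⟨σ, hσ⟩ := hbij.2 (false, true)
    have hpair := Prod.ext_iff.1 hσ
    simp only [Φ, decide_eq_false_iff_not, decide_eq_true_eq] at hpair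
    exact ⟨σ, (sq_pm M hc σ).resolve_left hpair.1, hpair.2⟩
  · obtain ⟨σ, hσ⟩ := hbij.2 (true, false)
    have hpair := Prod.ext_iff.1 hσ
    simp only [Φ, decide_eq_false_iff_not, decide_eq_true_eq] at hpair
    exact ⟨σ, hpair.1, (sq_pm M hb σ).resolve_left hpair.2⟩

/-- lift to the ring of integers. -/
lemma lift_int {x : M} {t : ℤ} (hx : x ^ 2 = (t : M)) : ∃ y : 𝓞 M, (y : M) = x ∧ y ^ 2 = (t : 𝓞 M) := by
  have hi : IsIntegral ℤ x := by
    apply IsIntegral.of_pow (n := 2) (by norm_num)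
    rw [hx]
    exact isIntegral_algebraMap (R := ℤ) (x := t)
  obtain ⟨y, hy⟩ : ∃ y : 𝓞 M, (y : M) = x := ⟨⟨x, hi⟩, rfl⟩
  refine ⟨y, hy, ?_⟩
  apply RingOfIntegers.ext
  change algebraMap (𝓞 M) M (y ^ 2) = algebraMap (𝓞 M) M (t : 𝓞 M)
  rw [map_pow, map_intCast]
  change (y : M) ^ 2 = _
  rw [hy, hx]

lemma smul_lift {y : 𝓞 M} {σ : M ≃ₐ[ℚ] M} (h : σ (y : M) = -(y : M)) : σ • y = - y := by
  apply RingOfIntegers.ext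
  exact h

lemma smul_lift' {y : 𝓞 M} {σ : M ≃ₐ[ℚ] M} (h : σ (y : M) = (y : M)) : σ • y = y := by
  apply RingOfIntegers.ext
  exact h

lemma two_le_SP {p : ℕ} (hp : p.Prime) {P : Ideal (𝓞 M)} (hP : P ∈ SP M p) {σ : M ≃ₐ[ℚ] M} (h : σ • P ≠ P) :
    2 ≤ (SP M p).ncard := by
  have : ({σ • P, P} : Set (Ideal (𝓞 M))).ncard = 2 := Set.ncard_pair h
  rw [← this]
  apply Set.ncard_le_ncard _ (SP_finite M hp)
  rintro x (rfl | rfl)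
  · exact smul_SP M hp hP σ
  · exact hP

lemma four_le_SP [IsGalois ℚ M] (hM : Module.finrank ℚ M = 4) {p : ℕ} (hp : p.Prime) {P : Ideal (𝓞 M)} (hP : P ∈ SP M p) (h : ∀ σ : M ≃ₐ[ℚ] M, σ ≠ 1 → σ • P ≠ P) :
    4 ≤ (SP M p).ncard := by
  have hcard : Nat.card (M ≃ₐ[ℚ] M) = 4 := by rw [IsGalois.card_aut_eq_finrank, hM]
  have hinj : Function.Injective (fun σ : M ≃ₐ[ℚ] M => σ • P) := by
    intro σ τ he
    by_contra hne
    apply h (τ⁻¹ * σ)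
    · intro h1
      exact hne (inv_mul_eq_one.1 h1).symm
    · have he' : σ • P = τ • P := he
      rw [mul_smul, he', inv_smul_smul]
  have : (Set.range (fun σ : M ≃ₐ[ℚ] M => σ • P)).ncard = 4 := by
    rw [← Nat.card_coe_set_eq, Nat.card_range_of_injective hinj, hcard]
  rw [← this]
  apply Set.ncard_le_ncard _ (SP_finite M hp)
  rintro x ⟨σ, rfl⟩
  exact smul_SP M hp hP σ

/-- The splitting type of primes not dividing `2 * d`. -/
lemma split_type (hM : Module.finrank ℚ M = 4) {c b : M} {d m : ℤ} (hd : d ≠ 0) (hm : Squarefree m) (hc : c ^ 2 = (d : M)) (hb : b ^ 2 = (m : M))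
    (htop : IntermediateField.adjoin ℚ {b, c} = ⊤) {p : ℕ} (hp : p.Prime) (hpd : ¬ (p : ℤ) ∣ 2 * d) :
    ∃ f g : ℕ, f ≠ 0 ∧ (∀ P ∈ SP M p, Ideal.absNorm P = p ^ f) ∧ (SP M p).ncard = g ∧
      ((jacobiSym d p = 1 ∧ jacobiSym m p = 1 ∧ g = 4 ∧ f = 1) ∨
       (jacobiSym d p = 1 ∧ jacobiSym m p = 0 ∧ g = 2 ∧ f = 1) ∨
       (jacobiSym d p = -1 ∧ jacobiSym m p = 0 ∧ g = 1 ∧ f = 2) ∨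
       (jacobiSym d p = 1 ∧ jacobiSym m p = -1 ∧ g = 2 ∧ f = 2) ∨
       (jacobiSym d p = -1 ∧ jacobiSym m p = 1 ∧ g = 2 ∧ f = 2) ∨
       (jacobiSym d p = -1 ∧ jacobiSym m p = -1 ∧ g = 2 ∧ f = 2)) := by
  have hpi : Prime (p : ℤ) := Nat.prime_iff_prime_int.1 hp
  have hg := biq_galois M hd hm.ne_zero hc hb htop
  obtain ⟨e, f, hgef, hN, hram⟩ := gal_ef M hM hp
  obtain ⟨⟨s1, s1c, s1b⟩, ⟨s2, s2c, s2b⟩⟩ := gal_exists M hM hd hm.ne_zero hc hb htop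
  obtain ⟨c', hc', hcd⟩ := lift_int M hc
  obtain ⟨b', hb', hbm⟩ := lift_int M hb
  have hd1 : ¬ (p : ℤ) ∣ d := fun h => hpd (h.mul_left _)
  have hp2 : ¬ (p : ℤ) ∣ 2 := fun h => hpd (h.mul_right _)
  have hf0 : f ≠ 0 := by rintro rfl; simp at hgef
  have hne : (SP M p).Nonempty := by
    rw [Set.nonempty_iff_ne_empty]
    intro h
    rw [h] at hgef
    simp at hgef
  obtain ⟨P, hP⟩ := hne
  refine ⟨f, (SP M p).ncard, hf0, hN, rfl, ?_⟩
  have hfn : ∀ {y : 𝓞 M} {t : ℤ}, y ^ 2 = (t : 𝓞 M) → jacobiSym t p = -1 → f ≠ 1 := by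
    intro y t hy ht hf
    have := norm_ne M hp hP hy (jac_neg hp ht)
    rw [hN P hP, hf, pow_one] at this
    exact this rfl
  have hmove : ∀ {y : 𝓞 M} {t : ℤ} {σ : M ≃ₐ[ℚ] M}, y ^ 2 = (t : 𝓞 M) → jacobiSym t p = 1 → σ • y = -y → σ • P ≠ P := by
    intro y t σ hy ht hσ
    obtain ⟨x, hx⟩ := jac_one hp ht
    refine smul_ne M hp hP hy ?_ hx σ hσ
    intro h
    rcases hpi.dvd_or_dvd h with h | h
    · exact hp2 h
    · rw [(jac_zero hp).2 h] at ht
      norm_num at ht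
  have m1c : s1 • c' = -c' := smul_lift M (by rw [hc']; exact s1c)
  have m1b : s1 • b' = b' := smul_lift' M (by rw [hb']; exact s1b)
  have m2b : s2 • b' = -b' := smul_lift M (by rw [hb']; exact s2b)
  have hgle : (SP M p).ncard ∣ 4 := ⟨_, hgef.symm⟩
  have hfle : f ∣ 4 := ⟨(SP M p).ncard * e, by rw [← hgef]; ring⟩
  have hele : e ∣ 4 := ⟨(SP M p).ncard * f, by rw [← hgef]; ring⟩
  have hg4 := Nat.le_of_dvd (by norm_num) hgle
  have hf4 := Nat.le_of_dvd (by norm_num) hfle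
  have he4 := Nat.le_of_dvd (by norm_num) hele
  have hu : jacobiSym d p = 1 ∨ jacobiSym d p = -1 := by
    rcases jacobiSym.trichotomy d p with h | h | h
    · exact absurd ((jac_zero hp).1 h) hd1
    · exact Or.inl h
    · exact Or.inr h
  have arith1 : f ≠ 1 → 2 ≤ (SP M p).ncard → (SP M p).ncard = 2 ∧ f = 2 := by
    intro h1 h2
    generalize (SP M p).ncard = g at *
    interval_cases g <;> interval_cases f <;> interval_cases e <;> omega
  rcases hu with hu | hu <;> rcases jacobiSym.trichotomy m p with hv | hv | hv
  · have h2 := two_le_SP M hp hP (hmove hcd hu m1c)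
    have h3 := hram ⟨P, hP, p_mem_sq M hp hP hbm hm ((jac_zero hp).1 hv)⟩
    have : (SP M p).ncard = 2 ∧ f = 1 := by
      generalize (SP M p).ncard = g at *
      interval_cases g <;> interval_cases f <;> interval_cases e <;> omega
    simp [hu, hv, this]
  · have h4 : 4 ≤ (SP M p).ncard := by
      apply four_le_SP M hM hp hP
      intro σ hσ
      rcases sq_pm M hc σ with h | h
      · rcases sq_pm M hb σ with h' | h'
        · exact absurd (gal_ext M htop (τ := 1) h' h) hσ
        · exact hmove hbm hv (smul_lift M (by rw [hb']; exact h'))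
      · exact hmove hcd hu (smul_lift M (by rw [hc']; exact h))
    have : (SP M p).ncard = 4 ∧ f = 1 := by
      generalize (SP M p).ncard = g at *
      interval_cases g <;> interval_cases f <;> interval_cases e <;> omega
    simp [hu, hv, this]
  · have := arith1 (hfn hbm hv) (two_le_SP M hp hP (hmove hcd hu m1c))
    simp [hu, hv, this]
  · have h2 := hfn hcd hu
    have h3 := hram ⟨P, hP, p_mem_sq M hp hP hbm hm ((jac_zero hp).1 hv)⟩
    have : (SP M p).ncard = 1 ∧ f = 2 := by
      generalize (SP M p).ncard = g at *
      interval_cases g <;> interval_cases f <;> interval_cases e <;> omega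
    simp [hu, hv, this]
  · have := arith1 (hfn hcd hu) (two_le_SP M hp hP (hmove hbm hv m2b))
    simp [hu, hv, this]
  · have hbc : (c' * b') ^ 2 = ((d * m : ℤ) : 𝓞 M) := by rw [mul_pow, hcd, hbm]; push_cast; rfl
    have := arith1 (hfn hcd hu) (two_le_SP M hp hP (hmove (σ := s1) hbc (by rw [jacobiSym.mul_left, hu, hv]; norm_num)
      (by rw [smul_mul', m1c, m1b]; ring)))
    simp [hu, hv, this]

lemma SP_le_four (hM : Module.finrank ℚ M = 4) {c b : M} {d m : ℤ} (hd : d ≠ 0) (hm : m ≠ 0) (hc : c ^ 2 = (d : M)) (hb : b ^ 2 = (m : M))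
    (htop : IntermediateField.adjoin ℚ {b, c} = ⊤) {p : ℕ} (hp : p.Prime) : (SP M p).ncard ≤ 4 := by
  have hg := biq_galois M hd hm hc hb htop
  obtain ⟨e, f, hgef, hN, hram⟩ := gal_ef M hM hp
  exact Nat.le_of_dvd (by norm_num) ⟨_, hgef.symm⟩

end biq
end BQ
end part_E3

section part_E4
set_option linter.unusedVariables false
open Finset Filter Topology
namespace BQ
open ArithmeticFunction
open scoped ArithmeticFunction.zeta
open NumberField UniqueFactorizationMonoid

lemma rr_pp (ψ χ : ℕ →*₀ ℝ) {p : ℕ} (hp : p.Prime) (k : ℕ) :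
    rr ψ χ (p ^ k) = ∑ i ∈ range (k + 1), gg χ (p ^ i) * (ψ p ^ (k - i) * gg χ (p ^ (k - i))) := by
  rw [rr_eq, mul_apply, Nat.sum_divisorsAntidiagonal (fun i j => gg χ i * ((af ψ).pmul (gg χ)) j),
    Nat.sum_divisors_prime_pow hp]
  apply sum_congr rfl
  intro i hi
  have : p ^ k / p ^ i = p ^ (k - i) := Nat.pow_div (by have := mem_range.1 hi; omega) hp.pos
  rw [this, pmul_apply, af_apply, map_pow ψ]

lemma mc3 (k : ℕ) : ((Nat.multichoose 3 k : ℕ) : ℝ) = (k + 1) * (k + 2) / 2 := by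
  induction k with
  | zero => simp
  | succ k ih => rw [Nat.multichoose_succ_succ, Nat.multichoose_two]; push_cast; rw [ih]; ring

lemma mc4 (k : ℕ) : ((Nat.multichoose 4 k : ℕ) : ℝ) = (k + 1) * (k + 2) * (k + 3) / 6 := by
  induction k with
  | zero => simp; norm_num
  | succ k ih => rw [Nat.multichoose_succ_succ]; push_cast; rw [ih, mc3]; push_cast; ring

lemma sum_pp (k : ℕ) : ∑ i ∈ range (k + 1), ((i : ℝ) + 1) * (((k - i : ℕ) : ℝ) + 1) = (k + 1) * (k + 2) * (k + 3) / 6 := by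
  have h : ∀ n : ℕ, ∀ c : ℝ, ∑ i ∈ range n, ((i : ℝ) + 1) * (c - i) = n * (n + 1) / 2 * c - (n - 1) * n * (n + 1) / 3 := by
    intro n c
    induction n with
    | zero => simp
    | succ n ih => rw [sum_range_succ, ih]; push_cast; ring
  have h2 := h (k + 1) (k + 1)
  have e : ∑ i ∈ range (k + 1), ((i : ℝ) + 1) * (((k - i : ℕ) : ℝ) + 1) = ∑ i ∈ range (k + 1), ((i : ℝ) + 1) * ((k + 1 : ℝ) - i) := by
    apply sum_congr rfl
    intro i hi
    rw [Nat.cast_sub (by have := mem_range.1 hi; omega)]; ring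
  rw [e, h2]; push_cast; ring

lemma sum_even (j : ℕ) : ∑ i ∈ range (2 * j + 1), (if Even i then (1:ℝ) else 0) = j + 1 := by
  induction j with
  | zero => rw [show 2 * 0 + 1 = 1 by norm_num, sum_range_one]; simp
  | succ j ih =>
    rw [show 2 * (j + 1) + 1 = (2 * j + 1) + 1 + 1 by ring, sum_range_succ, sum_range_succ, ih]
    have h1 : ¬ Even (2 * j + 1) := by simp [parity_simps]
    have h2 : Even (2 * j + 1 + 1) := by simp [parity_simps]
    rw [if_neg h1, if_pos h2]; push_cast; ring

lemma sum_even2 (k : ℕ) : ∑ i ∈ range (k + 1), (if Even i then (1:ℝ) else 0) * (if Even (k - i) then (1:ℝ) else 0) =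
    if 2 ∣ k then ((k / 2 : ℕ) : ℝ) + 1 else 0 := by
  split_ifs with hk
  · obtain ⟨j, rfl⟩ := hk
    rw [Nat.mul_div_cancel_left _ (by norm_num), ← sum_even]
    apply sum_congr rfl
    intro i hi
    have : i ≤ 2 * j := by have := mem_range.1 hi; omega
    have e := Nat.even_sub this
    by_cases h : Even i <;> simp [h, e]
  · apply sum_eq_zero
    intro i hi
    have : i ≤ k := by have := mem_range.1 hi; omega
    have e := Nat.even_sub this
    have hk' : ¬ Even k := by rwa [even_iff_two_dvd]
    by_cases h : Even i <;> simp [h, hk', e]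

lemma rr_pp_a {ψ χ : ℕ →*₀ ℝ} (hχ : RC χ) {p : ℕ} (hp : p.Prime) (k : ℕ) (h1 : ψ p = 1) (h2 : χ p = -1) :
    rr ψ χ (p ^ k) = if 2 ∣ k then ((k / 2 : ℕ) : ℝ) + 1 else 0 := by
  rw [rr_pp ψ χ hp, ← sum_even2]
  apply sum_congr rfl
  intro i hi
  rw [(gg_pp_cases hχ hp _).2.2 h2, (gg_pp_cases hχ hp _).2.2 h2, h1]; simp

lemma rr_pp_b {ψ χ : ℕ →*₀ ℝ} (hχ : RC χ) {p : ℕ} (hp : p.Prime) (k : ℕ) (h1 : ψ p = -1) (h2 : χ p = -1) :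
    rr ψ χ (p ^ k) = if 2 ∣ k then ((k / 2 : ℕ) : ℝ) + 1 else 0 := by
  rw [rr_pp ψ χ hp, ← sum_even2]
  apply sum_congr rfl
  intro i hi
  rw [(gg_pp_cases hχ hp _).2.2 h2, (gg_pp_cases hχ hp _).2.2 h2, h1]
  by_cases h : Even (k - i)
  · simp [h]
  · simp [h]

lemma rr_pp_c {ψ χ : ℕ →*₀ ℝ} (hχ : RC χ) {p : ℕ} (hp : p.Prime) (k : ℕ) (h1 : ψ p = 1) (h2 : χ p = 1) :
    rr ψ χ (p ^ k) = (k + 1) * (k + 2) * (k + 3) / 6 := by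
  rw [rr_pp ψ χ hp, ← sum_pp]
  apply sum_congr rfl
  intro i hi
  rw [(gg_pp_cases hχ hp _).1 h2, (gg_pp_cases hχ hp _).1 h2, h1]; simp

lemma rr_pp_d {ψ χ : ℕ →*₀ ℝ} (hχ : RC χ) {p : ℕ} (hp : p.Prime) (k : ℕ) (h2 : χ p = 0) :
    rr ψ χ (p ^ k) = ∑ i ∈ range (k + 1), ψ p ^ i := by
  rw [rr_pp ψ χ hp, ← sum_range_reflect]
  apply sum_congr rfl
  intro i hi
  rw [(gg_pp_cases hχ hp _).2.1 h2, (gg_pp_cases hχ hp _).2.1 h2]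
  have : k - (k + 1 - 1 - i) = i := by have := mem_range.1 hi; omega
  rw [this]; ring

section cnt
variable (M : Type) [Field M] [NumberField M]

noncomputable def cA : ArithmeticFunction ℝ := ⟨fun n => if n = 0 then 0 else (cN M n : ℝ), by simp⟩

lemma cA_apply {n : ℕ} (hn : n ≠ 0) : cA M n = cN M n := by
  change (if n = 0 then 0 else (cN M n : ℝ)) = _
  rw [if_neg hn]

lemma cA_nonneg (n : ℕ) : 0 ≤ cA M n := by
  by_cases hn : n = 0
  · simp [hn]
  · rw [cA_apply M hn]; positivity

lemma cA_mult : (cA M).IsMultiplicative := by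
  rw [IsMultiplicative.iff_ne_zero]
  refine ⟨?_, ?_⟩
  · rw [cA_apply M one_ne_zero, cN_one]; simp
  · intro m n hm hn h
    rw [cA_apply M hm, cA_apply M hn, cA_apply M (mul_ne_zero hm hn), cN_mul M h hm hn]; push_cast; rfl

lemma cA_le_div (hg : ∀ p : ℕ, p.Prime → (SP M p).ncard ≤ 4) {n : ℕ} (hn : n ≠ 0) :
    cA M n ≤ (n.divisors.card : ℝ) ^ 4 := by
  rw [(cA_mult M).multiplicative_factorization _ hn, Nat.card_divisors hn, Nat.cast_prod, ← Finset.prod_pow]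
  apply Finset.prod_le_prod
  · intro p hp; exact cA_nonneg M _
  · intro p hp
    have hp' := Nat.prime_of_mem_primeFactors hp
    change cA M (p ^ _) ≤ _
    rw [cA_apply M (pow_ne_zero _ hp'.ne_zero)]
    exact_mod_cast cN_pp_le M hp' (hg p hp') _

lemma cA_pp (hM : Module.finrank ℚ M = 4) {c b : M} {d m : ℤ} (hd : d ≠ 0) (hm : Squarefree m) (hc : c ^ 2 = (d : M)) (hb : b ^ 2 = (m : M))
    (htop : IntermediateField.adjoin ℚ {b, c} = ⊤) {p : ℕ} (hp : p.Prime) (hpd : p.Coprime (2 * d.natAbs)) (k : ℕ) :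
    cA M (p ^ k) = rr (chi d.natAbs d) (chi d.natAbs m) (p ^ k) := by
  rw [cA_apply M (pow_ne_zero _ hp.ne_zero)]
  have hpd' : ¬ (p : ℤ) ∣ 2 * d := by
    intro h
    have h2 : p ∣ 2 * d.natAbs := by
      have := Int.natAbs_dvd_natAbs.2 h
      rwa [Int.natAbs_natCast, Int.natAbs_mul] at this
    exact (hp.coprime_iff_not_dvd.1 hpd) h2
  obtain ⟨f, g, hf, hN, hg, hcase⟩ := split_type M hM hd hm hc hb htop hp hpd'
  have hcn := cN_pp M hp hf hN hg k
  have hψ : chi d.natAbs d p = (jacobiSym d p : ℝ) := by rw [chi_apply, if_pos hpd]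
  have hχ : chi d.natAbs m p = (jacobiSym m p : ℝ) := by rw [chi_apply, if_pos hpd]
  have R1 := chi_RC d.natAbs d
  have R2 := chi_RC d.natAbs m
  rcases hcase with ⟨hu, hv, rfl, rfl⟩ | ⟨hu, hv, rfl, rfl⟩ | ⟨hu, hv, rfl, rfl⟩ | ⟨hu, hv, rfl, rfl⟩ | ⟨hu, hv, rfl, rfl⟩ | ⟨hu, hv, rfl, rfl⟩ <;>
    rw [hu] at hψ <;> rw [hv] at hχ <;> push_cast at hψ hχ
  · rw [rr_pp_c R2 hp k hψ hχ, hcn, ← mc4]; simp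
  · rw [rr_pp_d R2 hp k hχ, hcn, hψ]; simp [Nat.multichoose_two]
  · rw [rr_pp_d R2 hp k hχ, hcn, hψ, neg_one_geom_sum]
    by_cases h : Even k
    · have := even_iff_two_dvd.1 h
      simp [this, h, parity_simps]
    · have : ¬ 2 ∣ k := fun h' => h (even_iff_two_dvd.2 h')
      simp [this, h, parity_simps]
  · rw [rr_pp_a R2 hp k hψ hχ, hcn, Nat.multichoose_two]; push_cast; rfl
  · rw [rr_comm, rr_pp_a R1 hp k hχ hψ, hcn, Nat.multichoose_two]; push_cast; rfl
  · rw [rr_pp_b R2 hp k hψ hχ, hcn, Nat.multichoose_two]; push_cast; rfl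

lemma cA_eq_rr (hM : Module.finrank ℚ M = 4) {c b : M} {d m : ℤ} (hd : d ≠ 0) (hm : Squarefree m) (hc : c ^ 2 = (d : M)) (hb : b ^ 2 = (m : M))
    (htop : IntermediateField.adjoin ℚ {b, c} = ⊤) {n : ℕ} (hn : n ≠ 0) (hnd : n.Coprime (2 * d.natAbs)) :
    cA M n = rr (chi d.natAbs d) (chi d.natAbs m) n := by
  rw [(cA_mult M).multiplicative_factorization _ hn, (rr_mult _ _).multiplicative_factorization _ hn]
  apply Finset.prod_congr rfl
  intro p hp
  have hp' := Nat.prime_of_mem_primeFactors hp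
  exact cA_pp M hM hd hm hc hb htop hp' (Nat.Coprime.coprime_dvd_left (Nat.dvd_of_mem_primeFactors hp) hnd) _

end cnt

lemma rr_bad {a : ℕ} (m m' : ℤ) {n : ℕ} (hn : n ≠ 0) (h : ∀ p, p.Prime → p ∣ n → p ∣ 2 * a) :
    rr (chi a m) (chi a m') n = 1 := by
  rw [(rr_mult _ _).multiplicative_factorization _ hn]
  apply Finset.prod_eq_one
  intro p hp
  have hp' := Nat.prime_of_mem_primeFactors hp
  have h1 : ∀ m, chi a m p = 0 := by
    intro m
    rw [chi_apply, if_neg]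
    rw [hp'.coprime_iff_not_dvd, not_not]
    exact h p hp' (Nat.dvd_of_mem_primeFactors hp)
  change rr (chi a m) (chi a m') (p ^ _) = 1
  rw [rr_pp_d (chi_RC _ _) hp' _ (h1 _), h1, sum_range_succ']
  simp

/-- decompose n into a bad part and a coprime part. -/
lemma decompB {N : ℕ} (hN : N ≠ 0) (n : ℕ) (hn : n ≠ 0) :
    ∃ b g : ℕ, n = b * g ∧ b ≠ 0 ∧ g ≠ 0 ∧ (∀ p, p.Prime → p ∣ b → p ∣ N) ∧ g.Coprime N ∧ b.Coprime g := by
  have main : ∃ b g : ℕ, n = b * g ∧ b ≠ 0 ∧ g ≠ 0 ∧ (∀ p, p.Prime → p ∣ b → p ∣ N) ∧ g.Coprime N := by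
    induction n using induction_on_primes with
    | zero => exact absurd rfl hn
    | one => exact ⟨1, 1, rfl, one_ne_zero, one_ne_zero, fun p hp h => absurd (Nat.dvd_one.1 h) hp.ne_one, Nat.coprime_one_left _⟩
    | prime_mul p a hp ih =>
      obtain ⟨b, g, h1, h2, h3, h4, h5⟩ := ih (right_ne_zero_of_mul hn)
      by_cases hpN : p ∣ N
      · refine ⟨p * b, g, by rw [h1]; ring, mul_ne_zero hp.ne_zero h2, h3, ?_, h5⟩
        intro q hq hqd
        rcases (hq.dvd_mul).1 hqd with h | h
        · rwa [(Nat.prime_dvd_prime_iff_eq hq hp).1 h]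
        · exact h4 q hq h
      · refine ⟨b, p * g, by rw [h1]; ring, h2, mul_ne_zero hp.ne_zero h3, h4, ?_⟩
        exact Nat.Coprime.mul_left ((hp.coprime_iff_not_dvd).2 hpN) h5
  obtain ⟨b, g, h1, h2, h3, h4, h5⟩ := main
  refine ⟨b, g, h1, h2, h3, h4, h5, ?_⟩
  rw [Nat.coprime_iff_gcd_eq_one] 
  by_contra hne
  obtain ⟨p, hp, hpd⟩ := Nat.exists_prime_and_dvd hne
  have h6 := h4 p hp (hpd.trans (Nat.gcd_dvd_left _ _))
  exact Nat.not_coprime_of_dvd_of_dvd hp.one_lt (hpd.trans (Nat.gcd_dvd_right _ _)) h6 h5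

end BQ
end part_E4

section part_E5
set_option linter.unusedVariables false
open Finset Filter Topology
namespace BQ
open ArithmeticFunction
open scoped ArithmeticFunction.zeta
open NumberField UniqueFactorizationMonoid

open scoped Classical in
noncomputable def bad (N : ℕ) : ArithmeticFunction ℝ :=
  ⟨fun n => if n ≠ 0 ∧ ∀ p : ℕ, p.Prime → p ∣ n → p ∣ N then 1 else 0, by simp⟩

lemma bad_of {N n : ℕ} (hn : n ≠ 0) (h : ∀ p : ℕ, p.Prime → p ∣ n → p ∣ N) : bad N n = 1 :=
  if_pos ⟨hn, h⟩

lemma bad_not {N n : ℕ} (h : ¬ (n ≠ 0 ∧ ∀ p : ℕ, p.Prime → p ∣ n → p ∣ N)) : bad N n = 0 :=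
  if_neg h

lemma bad_nonneg (N n : ℕ) : 0 ≤ bad N n := by
  by_cases h : n ≠ 0 ∧ ∀ p : ℕ, p.Prime → p ∣ n → p ∣ N
  · rw [bad_of h.1 h.2]; exact zero_le_one
  · rw [bad_not h]

noncomputable def rpw (s : ℝ) (hs : s ≠ 0) : ℕ →*₀ ℝ where
  toFun n := (n : ℝ) ^ (-s)
  map_zero' := by
    rw [Nat.cast_zero, Real.zero_rpow]; simpa using hs
  map_one' := by simp
  map_mul' a b := by
    rw [Nat.cast_mul, Real.mul_rpow (Nat.cast_nonneg _) (Nat.cast_nonneg _)]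

lemma bad_sum {N : ℕ} (hN : N ≠ 0) {s : ℝ} (hs : 0 < s) : Summable (fun n => |twf s (bad N) n|) := by
  have h := (smi_sum (f := rpw s hs.ne') (fun p hp => by
    change |(p : ℝ) ^ (-s)| < 1
    rw [abs_of_nonneg (by positivity)]
    exact Real.rpow_lt_one_of_one_lt_of_neg (by exact_mod_cast hp.one_lt) (by linarith)) (N + 1)).1
  refine Summable.of_nonneg_of_le (fun n => abs_nonneg _) (fun n => ?_) h
  by_cases hn : n = 0
  · subst hn; simp
  rw [twf_apply _ _ hn]
  by_cases h : n ≠ 0 ∧ ∀ p : ℕ, p.Prime → p ∣ n → p ∣ N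
  · rw [bad_of h.1 h.2, mul_one, smi_apply, if_pos]
    · exact le_rfl
    · rw [Nat.mem_smoothNumbers]
      refine ⟨hn, fun p hp => ?_⟩
      have := Nat.le_of_dvd (Nat.pos_of_ne_zero hN) (h.2 p (Nat.prime_of_mem_primeFactorsList hp) (Nat.dvd_of_mem_primeFactorsList hp))
      omega
  · rw [bad_not h, mul_zero, abs_zero]; exact abs_nonneg _

lemma twf_nonneg (s : ℝ) {g : ArithmeticFunction ℝ} (h : ∀ n, 0 ≤ g n) (n : ℕ) : 0 ≤ twf s g n := by
  by_cases hn : n = 0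
  · subst hn; simp
  · rw [twf_apply _ _ hn]; exact mul_nonneg (by positivity) (h n)

lemma twf_le (s : ℝ) {f g : ArithmeticFunction ℝ} (h : ∀ n, f n ≤ g n) (n : ℕ) : twf s f n ≤ twf s g n := by
  by_cases hn : n = 0
  · subst hn; simp
  · rw [twf_apply _ _ hn, twf_apply _ _ hn]; exact mul_le_mul_of_nonneg_left (h n) (by positivity)

lemma char_summable {χ : ℕ →*₀ ℝ} (hc : RC χ) {s : ℝ} (hs : 1 < s) :
    Summable (fun n => |twf s (af χ) n|) := by
  refine Summable.of_nonneg_of_le (fun n => abs_nonneg _) (fun n => ?_)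
    (Real.summable_nat_rpow.2 (show -s < -1 by linarith))
  rw [twf_char, abs_mul, abs_of_nonneg (show 0 ≤ (n:ℝ) ^ (-s) by positivity)]
  exact mul_le_of_le_one_left (by positivity) (hc.abs_le n)

lemma range_Ioc (f : ℕ → ℝ) (h0 : f 0 = 0) (N : ℕ) : ∑ n ∈ range (N + 1), f n = ∑ n ∈ Ioc 0 N, f n := by
  rw [range_eq_Ico, sum_eq_sum_Ico_succ_bot (Nat.succ_pos N), h0, zero_add]
  rfl

lemma char_tsum {χ : ℕ →*₀ ℝ} (hc : RC χ) {B : ℝ} (h : PS χ B) {s : ℝ} (hs : 1 < s) :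
    ∑' n, twf s (af χ) n = Lv χ s := by
  have h1 := ((char_summable hc hs).of_abs.hasSum.tendsto_sum_nat).comp (tendsto_add_atTop_nat 1)
  refine tendsto_nhds_unique h1 ((h.tendsto (by linarith : 0 < s)).congr fun N => ?_)
  simp only [Function.comp]
  rw [range_Ioc _ (by simp)]
  exact sum_congr rfl fun n _ => (twf_char s χ n).symm

lemma rr_tsum {ψ χ : ℕ →*₀ ℝ} (hψ : RC ψ) (hχ : RC χ) {B : ℝ} (h1 : PS ψ B) (h2 : PS χ B)
    (h3 : PS (⇑(ψ * χ)) B) {s : ℝ} (hs : 1 < s) :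
    HasSum (fun n => twf s (rr ψ χ) n) (((∑' n : ℕ, 1 / (n : ℝ) ^ s) * Lv ψ s) * (Lv χ s * Lv (⇑(ψ * χ)) s)) := by
  have a0 := char_summable one1_RC hs
  have a1 := char_summable hψ hs
  have a2 := char_summable hχ hs
  have a3 := char_summable (hψ.mul hχ) hs
  have b1 := hasSum_conv _ _ a0 a1
  have b2 := hasSum_conv _ _ a2 a3
  have b3 := hasSum_conv _ _ (summable_conv _ _ a0 a1) (summable_conv _ _ a2 a3)
  rw [b1.tsum_eq, b2.tsum_eq, char_tsum hψ h1 hs, char_tsum hχ h2 hs, char_tsum (hψ.mul hχ) h3 hs] at b3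
  have e : ∑' n, twf s (af one1) n = ∑' n : ℕ, 1 / (n : ℝ) ^ s := by
    refine tsum_congr fun n => ?_
    rw [twf_char]
    by_cases hn : n = 0
    · subst hn; simp [Real.zero_rpow (show (0:ℝ) < s by linarith).ne']
    · rw [one1_apply hn, one_mul, Real.rpow_neg (by positivity), one_div]
  rw [e] at b3
  rw [rr, twf_mul, twf_mul, twf_mul]
  exact b3

lemma cA_bound (ε : ℝ) (hε : 0 < ε) : ∃ C : ℝ, 1 ≤ C ∧ ∀ (M : Type) [Field M] [NumberField M],
    (∀ p : ℕ, p.Prime → (SP M p).ncard ≤ 4) → ∀ n : ℕ, n ≠ 0 → cA M n ≤ C * (n : ℝ) ^ ε := by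
  obtain ⟨C, hC, h⟩ := div_bound (ε / 4) (by positivity)
  refine ⟨C ^ 4, one_le_pow₀ hC, fun M _ _ hg n hn => (cA_le_div M hg hn).trans ?_⟩
  calc (n.divisors.card : ℝ) ^ 4 ≤ (C * (n : ℝ) ^ (ε / 4)) ^ 4 := by
        gcongr; exact h n hn
    _ = _ := by
      rw [mul_pow, ← Real.rpow_natCast ((n:ℝ) ^ (ε / 4)), ← Real.rpow_mul (by positivity)]
      congr 2; push_cast; ring

lemma cA_summable (M : Type) [Field M] [NumberField M] (hg : ∀ p : ℕ, p.Prime → (SP M p).ncard ≤ 4)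
    {s : ℝ} (hs : 1 < s) : Summable (fun n => |twf s (cA M) n|) := by
  obtain ⟨C, hC, h⟩ := cA_bound ((s - 1) / 2) (by linarith)
  refine Summable.of_nonneg_of_le (fun n => abs_nonneg _) (fun n => ?_)
    ((Real.summable_nat_rpow.2 (show -((s + 1) / 2) < -1 by linarith)).mul_left C)
  by_cases hn : n = 0
  · subst hn; simp; positivity
  rw [abs_of_nonneg (twf_nonneg s (cA_nonneg M) n), twf_apply _ _ hn]
  have hn' : (0:ℝ) < n := by positivity
  calc (n:ℝ) ^ (-s) * cA M n ≤ (n:ℝ) ^ (-s) * (C * (n:ℝ) ^ ((s - 1) / 2)) := by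
        gcongr; exact h M hg n hn
    _ = C * ((n:ℝ) ^ (-s) * (n:ℝ) ^ ((s - 1) / 2)) := by ring
    _ = _ := by rw [← Real.rpow_add hn']; congr 2; ring

lemma zeta_eq (M : Type) [Field M] [NumberField M] (s : ℝ) :
    dedekindZeta M s = ((∑' n, twf s (cA M) n : ℝ) : ℂ) := by
  rw [dedekindZeta, LSeries, Complex.ofReal_tsum]
  refine tsum_congr fun n => ?_
  by_cases hn : n = 0
  · subst hn; simp
  rw [LSeries.term_of_ne_zero hn, twf_apply _ _ hn, cA_apply M hn, Real.rpow_neg (by positivity)]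
  push_cast
  rw [Complex.ofReal_cpow (by positivity), cN, div_eq_mul_inv, mul_comm]
  simp

lemma zeta_lim (M : Type) [Field M] [NumberField M] :
    Tendsto (fun s : ℝ => (s - 1) * ∑' n, twf s (cA M) n) (𝓝[>] 1) (𝓝 (dedekindZeta_residue M)) := by
  have h := tendsto_sub_one_mul_dedekindZeta_nhdsGT M
  have h2 := (Complex.continuous_re.tendsto _).comp h
  refine h2.congr fun s => ?_
  simp only [Function.comp]
  rw [zeta_eq, ← Complex.ofReal_one, ← Complex.ofReal_sub, ← Complex.ofReal_mul, Complex.ofReal_re]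

lemma lowerK (M : Type) [Field M] [NumberField M] (hg : ∀ p : ℕ, p.Prime → (SP M p).ncard ≤ 4)
    {ψ χ : ℕ →*₀ ℝ} (hψ : RC ψ) (hχ : RC χ) {B : ℝ} (h1 : PS ψ B) (h2 : PS χ B)
    (h3 : PS (⇑(ψ * χ)) B) {N : ℕ} (hN : N ≠ 0) (h : ∀ n, rr ψ χ n ≤ (bad N * cA M) n) :
    Lv ψ 1 * (Lv χ 1 * Lv (⇑(ψ * χ)) 1) ≤ (∑' n, twf 1 (bad N) n) * dedekindZeta_residue M := by
  have cont : ∀ (f : ℕ → ℝ), PS f B → Tendsto (Lv f) (𝓝[>] 1) (𝓝 (Lv f 1)) := fun f hf => by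
    have := (Lv_cont hf (a := 1/2) (b := 2) (by norm_num)).continuousAt (Icc_mem_nhds (by norm_num) (by norm_num : (1:ℝ) < 2))
    exact this.tendsto.mono_left nhdsWithin_le_nhds
  have t1 := tendsto_sub_mul_tsum_nat_rpow.mul ((cont _ h1).mul ((cont _ h2).mul (cont _ h3)))
  rw [one_mul] at t1
  have t2 := (zeta_lim M).const_mul (∑' n, twf 1 (bad N) n)
  refine le_of_tendsto_of_tendsto t1 t2 ?_
  filter_upwards [self_mem_nhdsWithin] with s hs
  have hs : (1:ℝ) < s := hs
  have e1 := rr_tsum hψ hχ h1 h2 h3 hs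
  have e2 := hasSum_conv _ _ (bad_sum hN (by linarith : 0 < s)) (cA_summable M hg hs)
  rw [← twf_mul] at e2
  have e3 := hasSum_le (fun n => twf_le s h n) e1 e2
  have e4 : ∑' n, twf s (bad N) n ≤ ∑' n, twf 1 (bad N) n := by
    refine (bad_sum hN (by linarith : 0 < s)).of_abs.tsum_le_tsum (fun n => ?_) (bad_sum hN one_pos).of_abs
    by_cases hn : n = 0
    · subst hn; simp
    rw [twf_apply _ _ hn, twf_apply _ _ hn]
    refine mul_le_mul_of_nonneg_right ?_ (bad_nonneg N n)
    exact Real.rpow_le_rpow_of_exponent_le (by exact_mod_cast Nat.one_le_iff_ne_zero.2 hn) (by linarith)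
  have e5 : 0 ≤ ∑' n, twf s (cA M) n := tsum_nonneg (twf_nonneg s (cA_nonneg M))
  have e6 := e3.trans (mul_le_mul_of_nonneg_right e4 e5)
  have := mul_le_mul_of_nonneg_left e6 (by linarith : 0 ≤ s - 1)
  calc _ = _ := ?_
    _ ≤ _ := this
    _ = _ := by ring
  ring
end BQ
end part_E5

section part_E6
set_option linter.unusedVariables false
open Finset Filter Topology
namespace BQ
open ArithmeticFunction
open scoped ArithmeticFunction.zeta
open NumberField UniqueFactorizationMonoid

lemma conv_ge {f g : ArithmeticFunction ℝ} (hf : ∀ n, 0 ≤ f n) (hg : ∀ n, 0 ≤ g n) {a b : ℕ} (ha : a ≠ 0) (hb : b ≠ 0) :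
    f a * g b ≤ (f * g) (a * b) := by
  rw [mul_apply]
  exact single_le_sum (f := fun x : ℕ × ℕ => f x.1 * g x.2) (fun x _ => mul_nonneg (hf _) (hg _))
    (Nat.mem_divisorsAntidiagonal.2 ⟨rfl, mul_ne_zero ha hb⟩ : (a, b) ∈ _)

lemma comp_rr (M : Type) [Field M] [NumberField M] (hM : Module.finrank ℚ M = 4) {c b : M} {d m : ℤ} (hd : d ≠ 0) (hm : Squarefree m) (hc : c ^ 2 = (d : M)) (hb : b ^ 2 = (m : M))
    (htop : IntermediateField.adjoin ℚ {b, c} = ⊤) (n : ℕ) :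
    rr (chi d.natAbs d) (chi d.natAbs m) n ≤ (bad (2 * d.natAbs) * cA M) n := by
  by_cases hn : n = 0
  · subst hn; simp
  obtain ⟨x, g, rfl, hx, hg, hxp, hgN, hxg⟩ := decompB (N := 2 * d.natAbs) (by simpa using hd) n hn
  rw [(rr_mult _ _).map_mul_of_coprime hxg, rr_bad _ _ hx hxp, ← cA_eq_rr M hM hd hm hc hb htop hg hgN,
    ← bad_of hx hxp]
  exact conv_ge (bad_nonneg _) (cA_nonneg M) hx hg

lemma comp_cA (M : Type) [Field M] [NumberField M] (hM : Module.finrank ℚ M = 4) {c b : M} {d m : ℤ} (hd : d ≠ 0) (hm : Squarefree m) (hc : c ^ 2 = (d : M)) (hb : b ^ 2 = (m : M))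
    (htop : IntermediateField.adjoin ℚ {b, c} = ⊤) (n : ℕ) :
    cA M n ≤ (rr (chi d.natAbs d) (chi d.natAbs m) * (bad (2 * d.natAbs)).pmul (cA M)) n := by
  by_cases hn : n = 0
  · subst hn; simp
  obtain ⟨x, g, rfl, hx, hg, hxp, hgN, hxg⟩ := decompB (N := 2 * d.natAbs) (by simpa using hd) n hn
  rw [(cA_mult M).map_mul_of_coprime hxg, cA_eq_rr M hM hd hm hc hb htop hg hgN, mul_comm (cA M x), mul_comm x]
  have e : cA M x = (bad (2 * d.natAbs)).pmul (cA M) x := by rw [pmul_apply, bad_of hx hxp, one_mul]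
  rw [e]
  exact conv_ge (rr_nonneg (chi_RC _ _) (chi_RC _ _)) (fun n => by
    rw [pmul_apply]; exact mul_nonneg (bad_nonneg _ _) (cA_nonneg M n)) hg hx

lemma sum_conv (f g : ArithmeticFunction ℝ) (N : ℕ) :
    ∑ n ∈ Ioc 0 N, (f * g) n = ∑ b ∈ Ioc 0 N, g b * ∑ a ∈ Ioc 0 (N / b), f a := by
  rw [hyperbola f g N N, Nat.div_eq_of_lt (Nat.lt_succ_self N)]
  simp

lemma count_eq (M : Type) [Field M] [NumberField M] {X : ℝ} (hX : 0 ≤ X) :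
    (Nat.card {I : Ideal (𝓞 M) // I ≠ ⊥ ∧ (Ideal.absNorm I : ℝ) ≤ X} : ℝ) = ∑ n ∈ Ioc 0 ⌊X⌋₊, cA M n := by
  have h := Finset.card_preimage_eq_sum_card_image_eq (f := fun I : Ideal (𝓞 M) => Ideal.absNorm I)
    (s := Ioc 0 ⌊X⌋₊) (fun k _ => fin_norm M k)
  have e : ∑ n ∈ Ioc 0 ⌊X⌋₊, cA M n = ((∑ n ∈ Ioc 0 ⌊X⌋₊, cN M n : ℕ) : ℝ) := by
    push_cast
    exact sum_congr rfl fun n hn => cA_apply M (by have := (mem_Ioc.1 hn).1; omega)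
  rw [e]
  congr 1
  refine Eq.trans ?_ h
  refine Nat.card_congr (Equiv.subtypeEquivRight fun I => ?_)
  simp only [Set.mem_preimage, Finset.coe_Ioc, Set.mem_Ioc, Nat.le_floor_iff hX]
  rw [Nat.pos_iff_ne_zero, Ne, Ne, Ideal.absNorm_eq_zero_iff]

end BQ
end part_E6

section part_E7
set_option linter.unusedVariables false
open Finset Filter Topology
namespace BQ
open ArithmeticFunction
open scoped ArithmeticFunction.zeta
open NumberField UniqueFactorizationMonoid

lemma ram_dvd (K : Type) [Field K] [NumberField K] {β : K} {m : ℤ} (hb : β ^ 2 = (m : K)) (hm : Squarefree m)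
    {p : ℕ} (hp : p.Prime) (hpm : (p : ℤ) ∣ m) : (p : ℤ) ∣ discr K := by
  by_contra hcon
  have hpi : Prime (p : ℤ) := Nat.prime_iff_prime_int.1 hp
  have h := (not_dvd_discr_iff_forall_mem K (𝓞 K) hpi).1 hcon
  have hmax : (Ideal.span {(p : ℤ)}).IsMaximal :=
      PrincipalIdealRing.isMaximal_of_irreducible hpi.irreducible
  have hprime := hmax.isPrime
  obtain ⟨P, hP⟩ : (SP K p).Nonempty := by
    obtain ⟨P, h⟩ := Ideal.nonempty_primesOver (S := 𝓞 K) (Ideal.span {(p : ℤ)})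
    exact ⟨P, h⟩
  have h1 : P.IsPrime := hP.1
  have h2 : P.LiesOver (Ideal.span {(p : ℤ)}) := hP.2
  have hu := h P h1 (by simpa using ((mem_SP K hp P).1 hP).2)
  have he := Ideal.ramificationIdx_eq_one (R := ℤ) P
  obtain ⟨y, -, hy⟩ := lift_int K hb
  have hpp := p_mem_sq K hp hP hy hm hpm
  have hne : Ideal.map (algebraMap ℤ (𝓞 K)) (Ideal.span {(p : ℤ)}) ≠ ⊥ :=
      Ideal.map_ne_bot_of_ne_bot (by simpa using hp.ne_zero)
  rw [Ideal.IsDedekindDomain.ramificationIdx_eq_multiplicity (Ideal.span {(p : ℤ)}) P hne] at he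
  have hd : P ^ 2 ∣ Ideal.map (algebraMap ℤ (𝓞 K)) (Ideal.span {(p : ℤ)}) := by
    rw [Ideal.dvd_iff_le, Ideal.map_span, Ideal.span_le]
    simpa using hpp
  have hfm : FiniteMultiplicity P (Ideal.map (algebraMap ℤ (𝓞 K)) (Ideal.span {(p : ℤ)})) :=
    FiniteMultiplicity.of_not_isUnit (Ideal.isUnit_iff.not.mpr h1.ne_top) hne
  have := hfm.le_multiplicity_of_pow_dvd hd
  omega

lemma m_le_discr (K : Type) [Field K] [NumberField K] {β : K} {m : ℤ} (hb : β ^ 2 = (m : K)) (hm : Squarefree m) :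
    (m.natAbs : ℝ) ≤ |(discr K : ℝ)| := by
  have h : m.natAbs ∣ (discr K).natAbs := by
    have h1 := Nat.prod_primeFactors_of_squarefree (Int.squarefree_natAbs.2 hm)
    rw [← h1]
    refine Finset.prod_primes_dvd _ (fun p hp => (Nat.prime_of_mem_primeFactors hp).prime) fun p hp => ?_
    have hp' := Nat.prime_of_mem_primeFactors hp
    exact Int.natCast_dvd.1 (ram_dvd K hb hm hp' (Int.natCast_dvd.2 (Nat.dvd_of_mem_primeFactors hp)))
  have h2 := Nat.le_of_dvd (Int.natAbs_pos.2 (discr_ne_zero K)) h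
  rw [← Int.cast_abs, Int.abs_eq_natAbs, Int.cast_natCast]
  exact Nat.cast_le.2 h2

lemma sqf_part (t : ℤ) (ht : t ≠ 0) : ∃ (m : ℤ) (s : ℤ), Squarefree m ∧ s ≠ 0 ∧ t = s ^ 2 * m := by
  obtain ⟨a, b, hab, ha⟩ := Nat.sq_mul_squarefree t.natAbs
  have hb : (b : ℤ) ≠ 0 := by
    rintro h
    have : b = 0 := by exact_mod_cast h
    subst this
    simp at hab; exact ht (by omega)
  have h : ((b:ℤ)) ^ 2 * a = |t| := by rw [Int.abs_eq_natAbs]; exact_mod_cast hab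
  rcases abs_choice t with h1 | h1
  · exact ⟨a, b, Int.squarefree_natCast.2 ha, hb, by rw [h, h1]⟩
  · exact ⟨-a, b, Int.squarefree_natAbs.1 (by simpa using ha), hb, by rw [mul_neg, h, h1, neg_neg]⟩

lemma quad_gen (M : Type) [Field M] [NumberField M] (K : IntermediateField ℚ M) (hK : Module.finrank ℚ K = 2) :
    ∃ (m : ℤ) (b : M), Squarefree m ∧ b ∈ K ∧ b ∉ (⊥ : IntermediateField ℚ M) ∧ b ^ 2 = (m : M) := by
  obtain ⟨α, hα, hα'⟩ : ∃ α ∈ K, α ∉ (⊥ : IntermediateField ℚ M) := by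
    by_contra! h
    have : K = ⊥ := le_bot_iff.1 h
    rw [this, IntermediateField.finrank_bot] at hK
    omega
  have hle : IntermediateField.adjoin ℚ {α} ≤ K := IntermediateField.adjoin_simple_le_iff.2 hα
  have hInt : IsIntegral ℚ α := Algebra.IsIntegral.isIntegral α
  have hdeg : (minpoly ℚ α).natDegree = 2 := by
    have h1 := IntermediateField.adjoin.finrank hInt
    have h2 : Module.finrank ℚ (IntermediateField.adjoin ℚ {α}) ≤ 2 := by
      rw [← hK]; exact Submodule.finrank_mono (s := Subalgebra.toSubmodule (IntermediateField.adjoin ℚ {α}).toSubalgebra) (t := Subalgebra.toSubmodule K.toSubalgebra) hle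
    have h3 : Module.finrank ℚ (IntermediateField.adjoin ℚ {α}) ≠ 1 := by
      rw [Ne, IntermediateField.finrank_adjoin_simple_eq_one_iff]; exact hα'
    have h4 : 0 < Module.finrank ℚ (IntermediateField.adjoin ℚ {α}) := Module.finrank_pos
    omega
  have hpoly : α ^ 2 + algebraMap ℚ M ((minpoly ℚ α).coeff 1) * α + algebraMap ℚ M ((minpoly ℚ α).coeff 0) = 0 := by
    have h := minpoly.aeval ℚ α
    have hlc : (minpoly ℚ α).coeff 2 = 1 := by
      have := (minpoly.monic hInt).coeff_natDegree; rwa [hdeg] at this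
    rw [Polynomial.aeval_eq_sum_range, hdeg, sum_range_succ, sum_range_succ, sum_range_one, hlc] at h
    simp only [Algebra.smul_def, pow_zero, pow_one, map_one, mul_one, one_mul] at h
    rw [← h]; ring
  set p := (minpoly ℚ α).coeff 1
  set q := (minpoly ℚ α).coeff 0
  set r : ℚ := p ^ 2 - 4 * q with hr
  set β0 : M := 2 * α + algebraMap ℚ M p with hβ0
  have e0 : β0 ^ 2 = algebraMap ℚ M r := by
    rw [hr, map_sub, map_mul, map_pow, map_ofNat]
    linear_combination 4 * hpoly
  have hbetaK : β0 ∈ K := K.add_mem (K.mul_mem (by simp) hα) (K.algebraMap_mem p)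
  have hbetaN : β0 ∉ (⊥ : IntermediateField ℚ M) := by
    intro h
    rw [IntermediateField.mem_bot] at h
    obtain ⟨z, hz⟩ := h
    apply hα'
    rw [IntermediateField.mem_bot]
    refine ⟨(z - p) / 2, ?_⟩
    rw [map_div₀, map_sub, hz, hβ0, map_ofNat]; ring
  have hr0 : r ≠ 0 := by
    intro h
    rw [h, _root_.map_zero] at e0
    rw [pow_eq_zero_iff (by norm_num)] at e0
    exact hbetaN (e0 ▸ zero_mem _)
  obtain ⟨m, s, hm, hs, hts⟩ := sqf_part (r.num * r.den) (mul_ne_zero (Rat.num_ne_zero.2 hr0) (by exact_mod_cast r.den_ne_zero))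
  have hsM : (s : M) ≠ 0 := by exact_mod_cast hs
  have hden : (r.den : M) ≠ 0 := by exact_mod_cast r.den_ne_zero
  refine ⟨m, β0 * ((r.den : M) / s), hm, K.mul_mem hbetaK (K.div_mem (K.natCast_mem _) (K.intCast_mem _)), ?_, ?_⟩
  · intro h
    apply hbetaN
    have h2 : β0 = β0 * ((r.den : M) / s) * ((s : M) / r.den) := by field_simp
    rw [h2]
    exact mul_mem h (div_mem (intCast_mem _ _) (natCast_mem _ _))
  · rw [mul_pow, e0, div_pow]
    have h3 : (r.num : M) * r.den = (s : M) ^ 2 * m := by exact_mod_cast congrArg (Int.cast : ℤ → M) hts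
    have h4 : algebraMap ℚ M r * (r.den : M) = r.num := by
      have := congrArg (algebraMap ℚ M) (Rat.mul_den_eq_num r)
      rwa [map_mul, map_natCast, map_intCast] at this
    field_simp
    linear_combination (r.den : M) * h4 + h3

lemma field_data (M : Type) [Field M] [NumberField M] (c : M) (K : IntermediateField ℚ M) {d : ℤ}
    (hc : c ^ 2 = (d : M)) (hK : Module.finrank ℚ K = 2) (hne : K ≠ IntermediateField.adjoin ℚ {c})
    (htop : K ⊔ IntermediateField.adjoin ℚ {c} = ⊤) :
    ∃ (m : ℤ) (b : M), Squarefree m ∧ m ≠ 1 ∧ m ≠ d ∧ b ^ 2 = (m : M) ∧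
      IntermediateField.adjoin ℚ {b, c} = ⊤ ∧ (m.natAbs : ℝ) ≤ |(discr K : ℝ)| := by
  obtain ⟨m, b, hm, hbK, hbn, hb⟩ := quad_gen M K hK
  have hle : IntermediateField.adjoin ℚ {b} ≤ K := IntermediateField.adjoin_simple_le_iff.2 hbK
  have hKb : IntermediateField.adjoin ℚ {b} = K := by
    apply IntermediateField.eq_of_le_of_finrank_le hle
    have h3 : Module.finrank ℚ (IntermediateField.adjoin ℚ {b}) ≠ 1 := by
      rw [Ne, IntermediateField.finrank_adjoin_simple_eq_one_iff]; exact hbn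
    have h4 : 0 < Module.finrank ℚ (IntermediateField.adjoin ℚ {b}) := Module.finrank_pos
    omega
  refine ⟨m, b, hm, ?_, ?_, hb, ?_, ?_⟩
  · rintro rfl
    rw [Int.cast_one, _root_.sq_eq_one_iff] at hb
    rcases hb with rfl | rfl
    · exact hbn (one_mem _)
    · exact hbn (neg_mem (one_mem _))
  · rintro rfl
    rw [← hc, sq_eq_sq_iff_eq_or_eq_neg] at hb
    apply hne
    rw [← hKb]
    rcases hb with rfl | rfl
    · rfl
    · apply le_antisymm
      · exact IntermediateField.adjoin_simple_le_iff.2 (neg_mem (IntermediateField.mem_adjoin_simple_self ℚ c))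
      · refine IntermediateField.adjoin_simple_le_iff.2 ?_
        have := neg_mem (IntermediateField.mem_adjoin_simple_self ℚ (-c))
        rwa [neg_neg] at this
  · rw [Set.insert_eq, IntermediateField.adjoin_union, hKb, htop]
  · exact m_le_discr K (β := ⟨b, hbK⟩) (Subtype.ext (by simpa using hb)) hm

end BQ
end part_E7

section part_E8
set_option linter.unusedVariables false
open Finset Filter Topology
namespace BQ
open ArithmeticFunction
open scoped ArithmeticFunction.zeta
open NumberField UniqueFactorizationMonoid

lemma PS.mono {χ : ℕ → ℝ} {B B' : ℝ} (hp : PS χ B) (hb : B ≤ B') : PS χ B' := fun N => (hp N).trans hb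

lemma chi_invol (d m : ℤ) : chi d.natAbs d * (chi d.natAbs d * chi d.natAbs m) = chi d.natAbs m := by
  rw [chi_mul, chi_mul]
  ext n
  rw [chi_apply, chi_apply]
  split_ifs with h
  · rw [show d * (d * m) = d ^ 2 * m by ring, jac_sq (Nat.Coprime.coprime_mul_left_right h)]
  · rfl

lemma nsq_of_sqf {m : ℤ} (hm : Squarefree m) (h1 : m ≠ 1) : ¬ IsSquare m := by
  have := not_sq_prod hm squarefree_one h1
  rwa [mul_one] at this

lemma trivial_step {a b k e : ℝ} (ha : 0 ≤ a) (hb : 0 ≤ b) (hk : 0 ≤ k) (he : 0 ≤ e) :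
    k * b ≤ (e + k) * (a + b) := by
  nlinarith [mul_nonneg hk ha, mul_nonneg he ha, mul_nonneg he hb]

lemma main_step {a b k e : ℝ} (ha : 0 ≤ a) (hb : 0 ≤ b) (hk : 0 ≤ k) (he : 0 ≤ e) :
    e * a ≤ (e + k) * (a + b) := by
  nlinarith [mul_nonneg hk ha, mul_nonneg he hb, mul_nonneg hk hb]

lemma main_sum {d : ℤ} (hsq : Squarefree d) (hd0 : d ≠ 0) (hd1 : d ≠ 1) {ε : ℝ} (hε : 0 < ε) (hε1 : ε ≤ 1) :
    ∃ C : ℝ, 0 < C ∧ ∀ m : ℤ, Squarefree m → m ≠ 1 → m ≠ d → ∀ N : ℕ, 1 ≤ N →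
      ∑ n ∈ Ioc 0 N, rr (chi d.natAbs d) (chi d.natAbs m) n ≤
        C * (N * (Lv (chi d.natAbs m) 1 * Lv (chi d.natAbs (d * m)) 1) +
          (N : ℝ) ^ (1 / 2 : ℝ) * (m.natAbs : ℝ) ^ (1 / 3 + ε)) := by
  have ha : d.natAbs ≠ 0 := by simpa using hd0
  have hdn := nsq_of_sqf hsq hd1
  set δ : ℝ := ε / 16 with hδ
  have hδ0 : 0 < δ := by positivity
  obtain ⟨C1, hC1, hPS⟩ := fam_PS ha (ε / 2) (by positivity)
  obtain ⟨c1, hc1, hS1⟩ := fam_siegel ha one_ne_zero (δ / 12) (by positivity)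
  obtain ⟨c2, hc2, hS2⟩ := fam_siegel ha hd0 (δ / 12) (by positivity)
  obtain ⟨C3, hC3, hrb⟩ := rr_bound (ε / 4) (by positivity)
  obtain ⟨C4, hC4, X0, hB⟩ := thmB (chi_RC d.natAbs d) (hPS d hdn) (fam_pos ha hdn).ne' δ hδ0 (by linarith)
  set C2 : ℝ := C1 * (d.natAbs : ℝ) ^ (1 / 2 + ε / 2) with hC2
  have hda : (1 : ℝ) ≤ d.natAbs := by exact_mod_cast Nat.one_le_iff_ne_zero.2 ha
  have hda' : 1 ≤ (d.natAbs : ℝ) ^ (1 / 2 + ε / 2) := Real.one_le_rpow hda (by positivity)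
  have hC2' : 1 ≤ C2 := one_le_mul_of_one_le_of_one_le hC1 hda'
  have hC12 : C1 ≤ C2 := le_mul_of_one_le_right (by linarith) hda'
  obtain ⟨T, hT1, hTC, hT2, hT3, hTX⟩ : ∃ T : ℝ, 1 ≤ T ∧ C2 ^ 2 ≤ T ∧ c1⁻¹ ^ (8 / δ) ≤ T ∧ c2⁻¹ ^ (8 / δ) ≤ T ∧ (X0 : ℝ) ≤ T := by
    refine ⟨1 + C2 ^ 2 + c1⁻¹ ^ (8 / δ) + c2⁻¹ ^ (8 / δ) + X0, ?_, ?_, ?_, ?_, ?_⟩ <;>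
    · have p1 : 0 ≤ c1⁻¹ ^ (8 / δ) := by positivity
      have p2 : 0 ≤ c2⁻¹ ^ (8 / δ) := by positivity
      have p3 : (0:ℝ) ≤ X0 := by positivity
      have p4 : 0 ≤ C2 ^ 2 := by positivity
      linarith
  refine ⟨C4 + C3 * T, by positivity, fun m hm hm1 hmd N hN => ?_⟩
  have hmn := nsq_of_sqf hm hm1
  have hdm : ¬ IsSquare (d * m) := not_sq_prod hsq hm hmd.symm
  have hL1 := fam_pos ha hmn
  have hL2 := fam_pos ha hdm
  set q : ℝ := (m.natAbs : ℝ) with hq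
  have hq1 : 1 ≤ q := by
    rw [hq]; exact_mod_cast Nat.one_le_iff_ne_zero.2 (natAbs_pos' hmn)
  have hq0 : 0 < q := by linarith
  have hN1 : (1:ℝ) ≤ N := by exact_mod_cast hN
  have hN0 : (0:ℝ) < N := by linarith
  have hq23 : 1 ≤ q ^ (2/3 + ε) := Real.one_le_rpow hq1 (by positivity)
  rcases le_or_gt (T * q ^ (2 / 3 + ε)) N with hcase | hcase
  · -- main range
    have hTN : T ≤ N := (le_mul_of_one_le_right (by linarith) hq23).trans hcase
    have key : ∀ e : ℝ, 0 ≤ e → T ^ e * q ^ ((2/3 + ε) * e) ≤ (N:ℝ) ^ e := fun e he => by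
      rw [Real.rpow_mul hq0.le, ← Real.mul_rpow (by positivity) (by positivity)]
      exact Real.rpow_le_rpow (by positivity) hcase he
    have hBN : C2 * q ^ (1 / 2 + ε / 2) ≤ (N:ℝ) ^ (3/4 - δ) := by
      refine le_trans (mul_le_mul ?_ ?_ (by positivity) (by positivity)) (key (3/4 - δ) (by linarith))
      · calc C2 = (C2 ^ 2) ^ (1/2 : ℝ) := by
              rw [← Real.sqrt_eq_rpow, Real.sqrt_sq (by linarith)]
          _ ≤ T ^ (1/2 : ℝ) := Real.rpow_le_rpow (by positivity) hTC (by norm_num)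
          _ ≤ T ^ (3/4 - δ) := Real.rpow_le_rpow_of_exponent_le hT1 (by linarith)
      · apply Real.rpow_le_rpow_of_exponent_le hq1
        rw [hδ]; nlinarith
    have hlow : ∀ c L : ℝ, 0 < c → c⁻¹ ^ (8/δ) ≤ T → c * q ^ (-(δ/12)) ≤ L → (N:ℝ) ^ (-(δ/8)) ≤ L := by
      intro c L hc hcT hL
      refine le_trans ?_ hL
      have h1 := key (δ/8) (by positivity)
      have h2 : c⁻¹ ≤ T ^ (δ/8) := by
        calc c⁻¹ = (c⁻¹ ^ (8/δ)) ^ (δ/8) := by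
              rw [← Real.rpow_mul (by positivity)]
              rw [show 8 / δ * (δ / 8) = 1 by field_simp, Real.rpow_one]
          _ ≤ _ := Real.rpow_le_rpow (by positivity) hcT (by positivity)
      have h3 : q ^ (δ/12) ≤ q ^ ((2/3 + ε) * (δ/8)) := by
        apply Real.rpow_le_rpow_of_exponent_le hq1; nlinarith
      have h4 : c⁻¹ * q ^ (δ/12) ≤ (N:ℝ) ^ (δ/8) :=
        (mul_le_mul h2 h3 (by positivity) (by positivity)).trans h1
      rw [Real.rpow_neg hN0.le, Real.rpow_neg hq0.le]
      calc ((N:ℝ) ^ (δ/8))⁻¹ ≤ (c⁻¹ * q ^ (δ/12))⁻¹ := inv_anti₀ (by positivity) h4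
        _ = _ := by rw [mul_inv, inv_inv]
    have hfun : (⇑(chi d.natAbs d) * ⇑(chi d.natAbs m)) = ⇑(chi d.natAbs (d * m)) := by
      rw [← chi_mul]; rfl
    have r := hB N (by exact_mod_cast hTX.trans hTN) (chi d.natAbs m) (C2 * q ^ (1/2 + ε/2)) (chi_RC _ _)
      (chi_invol d m) (one_le_mul_of_one_le_of_one_le hC2' (Real.one_le_rpow hq1 (by positivity))) hBN
      ((hPS m hmn).mono (by gcongr))
      (by
        rw [hfun]
        refine (hPS _ hdm).mono (le_of_eq ?_)
        rw [Int.natAbs_mul, Nat.cast_mul, Real.mul_rpow (by positivity) (by positivity), hC2, mul_assoc])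
      (hlow c1 _ hc1 hT2 (by have := hS1 m hm (by rwa [one_mul]); rwa [one_mul] at this))
      (by rw [hfun]; exact hlow c2 _ hc2 hT3 (hS2 m hm hdm))
    rw [hfun] at r
    refine r.trans ?_
    have z1 : 0 ≤ (N:ℝ) * (Lv (chi d.natAbs m) 1 * Lv (chi d.natAbs (d * m)) 1) := by positivity
    have z2 : 0 ≤ (N : ℝ) ^ (1 / 2 : ℝ) * q ^ (1 / 3 + ε) := by positivity
    have z3 : 0 ≤ C3 * T := by positivity
    exact main_step z1 z2 z3 hC4.le
  · -- trivial range
    have t1 : ∑ n ∈ Ioc 0 N, rr (chi d.natAbs d) (chi d.natAbs m) n ≤ N * (C3 * (N:ℝ) ^ (ε/4)) := by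
      calc _ ≤ ∑ n ∈ Ioc 0 N, C3 * (N:ℝ) ^ (ε/4) := sum_le_sum fun n hn =>
            hrb _ _ (chi_RC _ _) (chi_RC _ _) N n (by have := (mem_Ioc.1 hn).1; omega) (mem_Ioc.1 hn).2
        _ = _ := by simp
    have t2 : (N:ℝ) * (N:ℝ) ^ (ε/4) = (N:ℝ) ^ (1/2:ℝ) * (N:ℝ) ^ (1/2 + ε/4) := by
      rw [← Real.rpow_add hN0]
      nth_rewrite 1 [← Real.rpow_one (N:ℝ)]
      rw [← Real.rpow_add hN0]; congr 1; ring
    have t3 : (N:ℝ) ^ (1/2 + ε/4) ≤ T * q ^ (1/3 + ε) := by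
      calc (N:ℝ) ^ (1/2 + ε/4) ≤ (T * q ^ (2/3 + ε)) ^ (1/2 + ε/4) :=
            Real.rpow_le_rpow hN0.le hcase.le (by positivity)
        _ = T ^ (1/2 + ε/4) * q ^ ((2/3 + ε) * (1/2 + ε/4)) := by
            rw [Real.mul_rpow (by positivity) (by positivity), ← Real.rpow_mul hq0.le]
        _ ≤ T ^ (1:ℝ) * q ^ (1/3 + ε) := by
            exact mul_le_mul (Real.rpow_le_rpow_of_exponent_le hT1 (by linarith))
              (Real.rpow_le_rpow_of_exponent_le hq1 (by nlinarith)) (by positivity) (by positivity)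
        _ = _ := by rw [Real.rpow_one]
    have t4 : N * (C3 * (N:ℝ) ^ (ε/4)) ≤ C3 * T * ((N : ℝ) ^ (1 / 2 : ℝ) * q ^ (1 / 3 + ε)) := by
      calc N * (C3 * (N:ℝ) ^ (ε/4)) = C3 * ((N:ℝ) * (N:ℝ) ^ (ε/4)) := by ring
        _ = C3 * ((N:ℝ) ^ (1/2:ℝ) * (N:ℝ) ^ (1/2 + ε/4)) := by rw [t2]
        _ ≤ C3 * ((N:ℝ) ^ (1/2:ℝ) * (T * q ^ (1/3 + ε))) := by gcongr
        _ = _ := by ring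
    refine (t1.trans t4).trans ?_
    have z1 : 0 ≤ (N:ℝ) * (Lv (chi d.natAbs m) 1 * Lv (chi d.natAbs (d * m)) 1) := by positivity
    have z2 : 0 ≤ (N : ℝ) ^ (1 / 2 : ℝ) * q ^ (1 / 3 + ε) := by positivity
    have z3 : 0 ≤ C3 * T := by positivity
    exact trivial_step z1 z2 z3 hC4.le

lemma final_bound {d : ℤ} (hsq : Squarefree d) (hd0 : d ≠ 0) (hd1 : d ≠ 1) {ε : ℝ} (hε : 0 < ε) (hε1 : ε ≤ 1) :
    ∃ C : ℝ, 0 < C ∧ ∀ (M : Type) [Field M] [NumberField M] (c b : M) (m : ℤ),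
      Module.finrank ℚ M = 4 → c ^ 2 = (d : M) → b ^ 2 = (m : M) → IntermediateField.adjoin ℚ {b, c} = ⊤ →
      Squarefree m → m ≠ 1 → m ≠ d → ∀ X : ℝ, 1 ≤ X →
        (Nat.card {I : Ideal (𝓞 M) // I ≠ ⊥ ∧ (Ideal.absNorm I : ℝ) ≤ X} : ℝ) ≤
          C * (X * dedekindZeta_residue M + X ^ (1 / 2 : ℝ) * (m.natAbs : ℝ) ^ (1 / 3 + ε)) := by
  have ha : d.natAbs ≠ 0 := by simpa using hd0
  have hN : 2 * d.natAbs ≠ 0 := by simpa using hd0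
  have hdn := nsq_of_sqf hsq hd1
  obtain ⟨C1, hC1, hsum⟩ := main_sum hsq hd0 hd1 hε hε1
  obtain ⟨C2, hC2, hcA⟩ := cA_bound (1/4) (by norm_num)
  obtain ⟨C5, hC5, hPS⟩ := fam_PS ha 1 one_pos
  have hLψ := fam_pos ha hdn
  set Lp := Lv (chi d.natAbs d) 1
  set S1 := ∑' n, twf 1 (bad (2 * d.natAbs)) n with hS1
  set S4 := ∑' n, twf (1/4) (bad (2 * d.natAbs)) n with hS4
  have hS1' : 0 ≤ S1 := tsum_nonneg (twf_nonneg 1 (bad_nonneg _))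
  have hS4' : 0 ≤ S4 := tsum_nonneg (twf_nonneg _ (bad_nonneg _))
  refine ⟨C1 * C2 * (S4 + 1) * (1 + S1 / Lp), by positivity, fun M _ _ c b m hM hc hb htop hm hm1 hmd X hX => ?_⟩
  have hmn := nsq_of_sqf hm hm1
  have hdm : ¬ IsSquare (d * m) := not_sq_prod hsq hm hmd.symm
  have hL1 := fam_pos ha hmn
  have hL2 := fam_pos ha hdm
  have hm0 : m ≠ 0 := hm.ne_zero
  have hg : ∀ p : ℕ, p.Prime → (SP M p).ncard ≤ 4 := fun p hp => SP_le_four M hM hd0 hm0 hc hb htop hp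
  have hX0 : 0 < X := by linarith
  set LL := Lv (chi d.natAbs m) 1 * Lv (chi d.natAbs (d * m)) 1 with hLL
  have hLL0 : 0 ≤ LL := by positivity
  set q := (m.natAbs : ℝ) ^ (1 / 3 + ε) with hq
  have hq0 : 0 ≤ q := by positivity
  -- lower bound for the residue
  have hres : LL ≤ S1 / Lp * dedekindZeta_residue M := by
    have h1 := hPS d hdn
    have h2 := hPS m hmn
    have h3 := hPS _ hdm
    have h := lowerK M hg (chi_RC d.natAbs d) (chi_RC d.natAbs m)
      (h1.mono (le_add_of_nonneg_right (add_nonneg h2.nonneg h3.nonneg)))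
      (h2.mono (by have := h1.nonneg; have := h3.nonneg; linarith))
      (by rw [chi_mul]; exact h3.mono (by have := h1.nonneg; have := h2.nonneg; linarith))
      hN (comp_rr M hM hd0 hm hc hb htop)
    rw [chi_mul] at h
    rw [div_mul_eq_mul_div, le_div_iff₀ hLψ, mul_comm]
    exact h
  rw [count_eq M hX0.le]
  set N := ⌊X⌋₊ with hNX
  have hNle : (N:ℝ) ≤ X := Nat.floor_le hX0.le
  calc ∑ n ∈ Ioc 0 N, cA M n
      ≤ ∑ n ∈ Ioc 0 N, (rr (chi d.natAbs d) (chi d.natAbs m) * (bad (2 * d.natAbs)).pmul (cA M)) n :=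
        sum_le_sum fun n _ => comp_cA M hM hd0 hm hc hb htop n
    _ = ∑ x ∈ Ioc 0 N, ((bad (2 * d.natAbs)).pmul (cA M)) x * ∑ a ∈ Ioc 0 (N / x), rr (chi d.natAbs d) (chi d.natAbs m) a :=
        sum_conv _ _ _
    _ ≤ ∑ x ∈ Ioc 0 N, twf (1/4) (bad (2 * d.natAbs)) x * (C1 * C2 * (X * LL + X ^ (1 / 2 : ℝ) * q)) := by
        refine sum_le_sum fun x hx => ?_
        obtain ⟨hx0, hxN⟩ := mem_Ioc.1 hx
        have hx1 : (1:ℝ) ≤ x := by exact_mod_cast hx0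
        have hxp : (0:ℝ) < x := by linarith
        have h1 := hsum m hm hm1 hmd (N / x) ((Nat.one_le_div_iff hx0).2 hxN)
        have h2 : ((N / x : ℕ) : ℝ) ≤ X / x := Nat.cast_div_le.trans (by gcongr)
        have h3 : ∑ a ∈ Ioc 0 (N / x), rr (chi d.natAbs d) (chi d.natAbs m) a ≤
            C1 * ((x:ℝ) ^ (-(1/2) : ℝ) * (X * LL + X ^ (1 / 2 : ℝ) * q)) := by
          refine h1.trans ?_
          have h4 : ((N / x : ℕ) : ℝ) * LL ≤ (x:ℝ) ^ (-(1/2) : ℝ) * (X * LL) := by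
            calc ((N / x : ℕ) : ℝ) * LL ≤ X / x * LL := by gcongr
              _ = (x:ℝ) ^ (-1 : ℝ) * (X * LL) := by rw [Real.rpow_neg_one]; ring
              _ ≤ _ := by
                exact mul_le_mul_of_nonneg_right
                  (Real.rpow_le_rpow_of_exponent_le hx1 (by norm_num)) (by positivity)
          have h5 : ((N / x : ℕ) : ℝ) ^ (1/2:ℝ) * q ≤ (x:ℝ) ^ (-(1/2) : ℝ) * (X ^ (1/2:ℝ) * q) := by
            calc ((N / x : ℕ) : ℝ) ^ (1/2:ℝ) * q ≤ (X / x) ^ (1/2:ℝ) * q := by gcongr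
              _ = _ := by
                rw [Real.div_rpow hX0.le hxp.le, Real.rpow_neg hxp.le]; ring
          rw [mul_add (_ ^ _) (_) _]
          exact mul_le_mul_of_nonneg_left (add_le_add h4 h5) hC1.le
        have hbx := bad_nonneg (2 * d.natAbs) x
        rw [pmul_apply, twf_apply _ _ hx0.ne']
        calc bad (2 * d.natAbs) x * cA M x * ∑ a ∈ Ioc 0 (N / x), rr (chi d.natAbs d) (chi d.natAbs m) a
            ≤ bad (2 * d.natAbs) x * (C2 * (x:ℝ) ^ (1/4:ℝ)) * (C1 * ((x:ℝ) ^ (-(1/2) : ℝ) * (X * LL + X ^ (1 / 2 : ℝ) * q))) := by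
              refine mul_le_mul (mul_le_mul_of_nonneg_left (hcA M hg x hx0.ne') hbx) h3
                (sum_nonneg fun n _ => rr_nonneg (chi_RC _ _) (chi_RC _ _) n) (by positivity)
          _ = ((x:ℝ) ^ (1/4:ℝ) * (x:ℝ) ^ (-(1/2) : ℝ)) * bad (2 * d.natAbs) x * (C1 * C2 * (X * LL + X ^ (1 / 2 : ℝ) * q)) := by ring
          _ = _ := by rw [← Real.rpow_add hxp]; norm_num
    _ = (∑ x ∈ Ioc 0 N, twf (1/4) (bad (2 * d.natAbs)) x) * (C1 * C2 * (X * LL + X ^ (1 / 2 : ℝ) * q)) := by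
        rw [sum_mul]
    _ ≤ (S4 + 1) * (C1 * C2 * (X * LL + X ^ (1 / 2 : ℝ) * q)) := by
        gcongr
        refine le_trans ?_ (le_add_of_nonneg_right zero_le_one)
        exact (bad_sum hN (by norm_num)).of_abs.sum_le_tsum _ (fun n _ => twf_nonneg _ (bad_nonneg _) n)
    _ ≤ (S4 + 1) * (C1 * C2 * ((1 + S1 / Lp) * (X * dedekindZeta_residue M + X ^ (1 / 2 : ℝ) * q))) := by
        gcongr
        have z1 : 0 ≤ S1 / Lp := by positivity
        have z2 := dedekindZeta_residue_pos M
        have z3 : 0 ≤ X ^ (1 / 2 : ℝ) * q := by positivity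
        have z4 := mul_le_mul_of_nonneg_left hres hX0.le
        nlinarith [mul_nonneg z1 z3, mul_pos hX0 z2]
    _ = _ := by ring
end BQ
end part_E8

theorem statement_7 (d : ℤ) (hsq : Squarefree d) (hd0 : d ≠ 0) (hd1 : d ≠ 1)
    (ε : ℝ) (hε : 0 < ε) :
    ∃ C : ℝ, 0 < C ∧
      ∀ (M : Type) [Field M] [NumberField M] (c : M) (K : IntermediateField ℚ M),
        Module.finrank ℚ M = 4 → c ^ 2 = (d : M) →
        Module.finrank ℚ K = 2 → K ≠ IntermediateField.adjoin ℚ {c} →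
        K ⊔ IntermediateField.adjoin ℚ {c} = ⊤ →
        ∀ X : ℝ, 1 ≤ X →
          (Nat.card {𝔞 : Ideal (𝓞 M) // 𝔞 ≠ ⊥ ∧ (Ideal.absNorm 𝔞 : ℝ) ≤ X} : ℝ)
            ≤ C * (X * kappa M +
                X ^ ((1 : ℝ) / 2) * |(NumberField.discr K : ℝ)| ^ ((1 : ℝ) / 3 + ε)) := by
  obtain ⟨C, hC, h⟩ := BQ.final_bound hsq hd0 hd1 (ε := min ε 1) (lt_min hε one_pos) (min_le_right _ _)
  refine ⟨C, hC, fun M _ _ c K hM hc hK hne htop X hX => ?_⟩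
  obtain ⟨m, b, hm, hm1, hmd, hb, htop', hle⟩ := BQ.field_data M c K hc hK hne htop
  have hk : dedekindZeta_residue M = kappa M := by
    rw [dedekindZeta_residue_def]
    unfold kappa
    push_cast
    ring
  have hr := h M c b m hM hc hb htop' hm hm1 hmd X hX
  rw [hk] at hr
  refine hr.trans (mul_le_mul_of_nonneg_left ?_ hC.le)
  have hm0 : (1 : ℝ) ≤ (m.natAbs : ℝ) := by
    exact_mod_cast Nat.one_le_iff_ne_zero.2 (Int.natAbs_ne_zero.2 hm.ne_zero)
  have hD : (1 : ℝ) ≤ |(NumberField.discr K : ℝ)| := hm0.trans hle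
  have hmin : 0 < min ε 1 := lt_min hε one_pos
  have h1 : (m.natAbs : ℝ) ^ (1 / 3 + min ε 1) ≤ |(NumberField.discr K : ℝ)| ^ ((1 : ℝ) / 3 + ε) :=
    (Real.rpow_le_rpow (by positivity) hle (by positivity)).trans
      (Real.rpow_le_rpow_of_exponent_le hD (by linarith [min_le_left ε 1]))
  have hX0 : 0 ≤ X ^ ((1 : ℝ) / 2) := Real.rpow_nonneg (by linarith) _
  linarith [mul_le_mul_of_nonneg_left h1 hX0]
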